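/- Smooth single-soliton singularity formation at quantised rates: for every even integer ν ≥ 2 there exist constants T > 0 and δ > 0 and a function φ smooth on the open set Ω = {(t,x) ∈ ℝ × ℝ³ : 0 < t + |x| < T, t − |x| > −δ} — in particular smooth up to and across the light cone {|x| = t} — satisfying ∂_t²φ = Δ_x φ + φ⁵ pointwise on Ω, such that: (i) for every y ∈ ℝ³, t^{ν/2}·φ(t, t^ν·y) → W(y) as t → 0⁺, and (ii) ∫_{|x|<t} ( |∂_t(φ − S)(t,x)|² + |∇_x(φ − S)(t,x)|² ) dx → 0 as t → 0⁺, where S(t,x) = t^{−ν/2}·W(t^{−ν}·x). -/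

import Mathlib

open MeasureTheory Real Filter

noncomputable section

/-- ℝ³ as a Euclidean space. -/
abbrev E3 := EuclideanSpace ℝ (Fin 3)

/-- The ground state soliton `W(x) = √3 (1 + 3|x|²)^(-1/2)`. -/
def W (x : E3) : ℝ := Real.sqrt 3 * (1 + 3 * ‖x‖ ^ 2) ^ (-(1 / 2) : ℝ)

/-- The Euclidean Laplacian on ℝ³: sum of second partial derivatives. -/
def lap (f : E3 → ℝ) (x : E3) : ℝ :=
  ∑ i : Fin 3, fderiv ℝ (fun y => fderiv ℝ f y (EuclideanSpace.single i 1)) x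
    (EuclideanSpace.single i 1)

/-- The single-soliton profile `S(t,x) = t^{-ν/2} W(t^{-ν} x)`. -/
def singleSoliton (ν t : ℝ) (x : E3) : ℝ := t ^ (-ν / 2) * W (t ^ (-ν) • x)

namespace SW
open BoundedContinuousFunction Topology
open intervalIntegral (continuous_parametric_intervalIntegral_of_continuous')

local notation "ℝℝ" => ℝ × ℝ
local notation "CDOn" => ContDiffOn ℝ (⊤ : ℕ∞)
local notation "CDAt" => ContDiffAt ℝ (⊤ : ℕ∞)

section

structure KData (Y : Type) [TopologicalSpace Y] where
  W1 : Y → ℝ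
  W2 : Y → ℝ
  tri : Y → ℝ → ℝ → Y
  cW1 : Continuous W1
  cW2 : Continuous W2
  ctri : Continuous fun x : Y × ℝ × ℝ => tri x.1 x.2.1 x.2.2
  pW1 : ∀ y, 0 ≤ W1 y
  pW2 : ∀ y, 0 ≤ W2 y
  κ : ℝ
  bound : ∀ y, W1 y * ∫ β in (0:ℝ)..1, ∫ α in (0:ℝ)..1, max (α - β) 0 * W2 (tri y α β) ≤ κ

lemma cont_dbl {Y : Type} [TopologicalSpace Y] {f : Y → ℝ → ℝ → ℝ}
    (hf : Continuous fun x : Y × ℝ × ℝ => f x.1 x.2.1 x.2.2) :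
    Continuous fun y => ∫ β in (0:ℝ)..1, ∫ α in (0:ℝ)..1, f y α β := by
  apply continuous_parametric_intervalIntegral_of_continuous' (μ := volume)
    (f := fun y β => ∫ α in (0:ℝ)..1, f y α β)
  apply continuous_parametric_intervalIntegral_of_continuous' (μ := volume)
    (f := fun (x : Y × ℝ) α => f x.1 α x.2)
  exact hf.comp (by fun_prop : Continuous fun z : (Y × ℝ) × ℝ => (z.1.1, z.2, z.1.2))

lemma dbl_mono {f g : ℝ → ℝ → ℝ} (hf : Continuous fun x : ℝℝ => f x.1 x.2)
    (hg : Continuous fun x : ℝℝ => g x.1 x.2)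
    (h : ∀ α β, 0 ≤ α → α ≤ 1 → 0 ≤ β → β ≤ 1 → f α β ≤ g α β) :
    (∫ β in (0:ℝ)..1, ∫ α in (0:ℝ)..1, f α β) ≤ ∫ β in (0:ℝ)..1, ∫ α in (0:ℝ)..1, g α β := by
  have cin : ∀ {k : ℝ → ℝ → ℝ}, (Continuous fun x : ℝℝ => k x.1 x.2) →
      Continuous fun β => ∫ α in (0:ℝ)..1, k α β := by
    intro k hk
    apply continuous_parametric_intervalIntegral_of_continuous' (μ := volume)
      (f := fun β α => k α β)
    exact hk.comp (by fun_prop : Continuous fun z : ℝℝ => (z.2, z.1))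
  refine intervalIntegral.integral_mono_on zero_le_one ((cin hf).intervalIntegrable _ _)
    ((cin hg).intervalIntegrable _ _) ?_
  intro β hβ
  refine intervalIntegral.integral_mono_on zero_le_one ?_ ?_ ?_
  · exact (hf.comp (by fun_prop : Continuous fun α : ℝ => (α, β))).intervalIntegrable _ _
  · exact (hg.comp (by fun_prop : Continuous fun α : ℝ => (α, β))).intervalIntegrable _ _
  intro α hα
  exact h α β hα.1 hα.2 hβ.1 hβ.2

lemma dbl_const_mul (c : ℝ) (f : ℝ → ℝ → ℝ) :
    (∫ β in (0:ℝ)..1, ∫ α in (0:ℝ)..1, c * f α β) = c * ∫ β in (0:ℝ)..1, ∫ α in (0:ℝ)..1, f α β := by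
  simp [intervalIntegral.integral_const_mul]

lemma dbl_add {f g : ℝ → ℝ → ℝ} (hf : Continuous fun x : ℝℝ => f x.1 x.2)
    (hg : Continuous fun x : ℝℝ => g x.1 x.2) :
    (∫ β in (0:ℝ)..1, ∫ α in (0:ℝ)..1, (f α β + g α β)) =
      (∫ β in (0:ℝ)..1, ∫ α in (0:ℝ)..1, f α β) + ∫ β in (0:ℝ)..1, ∫ α in (0:ℝ)..1, g α β := by
  have cin : ∀ {k : ℝ → ℝ → ℝ}, (Continuous fun x : ℝℝ => k x.1 x.2) →
      Continuous fun β => ∫ α in (0:ℝ)..1, k α β := by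
    intro k hk
    apply continuous_parametric_intervalIntegral_of_continuous' (μ := volume)
      (f := fun β α => k α β)
    exact hk.comp (by fun_prop : Continuous fun z : ℝℝ => (z.2, z.1))
  rw [← intervalIntegral.integral_add ((cin hf).intervalIntegrable _ _)
    ((cin hg).intervalIntegrable _ _)]
  congr 1; ext β
  rw [← intervalIntegral.integral_add]
  · exact (hf.comp (by fun_prop : Continuous fun α : ℝ => (α, β))).intervalIntegrable _ _
  · exact (hg.comp (by fun_prop : Continuous fun α : ℝ => (α, β))).intervalIntegrable _ _

lemma dbl_abs_le {f g : ℝ → ℝ → ℝ} (hf : Continuous fun x : ℝℝ => f x.1 x.2)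
    (hg : Continuous fun x : ℝℝ => g x.1 x.2)
    (h : ∀ α β, 0 ≤ α → α ≤ 1 → 0 ≤ β → β ≤ 1 → |f α β| ≤ g α β) :
    |∫ β in (0:ℝ)..1, ∫ α in (0:ℝ)..1, f α β| ≤ ∫ β in (0:ℝ)..1, ∫ α in (0:ℝ)..1, g α β := by
  rw [abs_le]
  constructor
  · have := dbl_mono (f := fun α β => (-1) * g α β) (g := f) (by fun_prop) hf (by
      intro α β a b c d
      have := (abs_le.1 (h α β a b c d)).1
      linarith)
    rw [dbl_const_mul] at this
    linarith
  · exact dbl_mono hf hg fun α β a b c d => (abs_le.1 (h α β a b c d)).2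

namespace KData
variable {Y : Type} [TopologicalSpace Y] (k : KData Y)

def fn (g : Y → ℝ) (y : Y) : ℝ :=
  k.W1 y * ∫ β in (0:ℝ)..1, ∫ α in (0:ℝ)..1,
    max (α - β) 0 * (k.W2 (k.tri y α β) * g (k.tri y α β))

lemma cont_ker {g : Y → ℝ} (hg : Continuous g) :
    Continuous fun x : Y × ℝ × ℝ => max (x.2.1 - x.2.2) 0 *
      (k.W2 (k.tri x.1 x.2.1 x.2.2) * g (k.tri x.1 x.2.1 x.2.2)) := by
  have h1 := k.cW2.comp k.ctri
  have h2 := hg.comp k.ctri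
  have h3 : Continuous fun x : Y × ℝ × ℝ => max (x.2.1 - x.2.2) 0 := by fun_prop
  exact h3.mul (h1.mul h2)

lemma cont_fn {g : Y → ℝ} (hg : Continuous g) : Continuous (k.fn g) :=
  k.cW1.mul (cont_dbl (f := fun y α β => max (α - β) 0 * (k.W2 (k.tri y α β) * g (k.tri y α β)))
    (k.cont_ker hg))

lemma cont_ker' {g : Y → ℝ} (hg : Continuous g) (y : Y) :
    Continuous fun x : ℝℝ => max (x.1 - x.2) 0 *
      (k.W2 (k.tri y x.1 x.2) * g (k.tri y x.1 x.2)) :=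
  (k.cont_ker hg).comp (by fun_prop : Continuous fun x : ℝℝ => (y, x.1, x.2))

lemma abs_fn_le {g : Y → ℝ} (hg : Continuous g) {B : ℝ} (hB : ∀ y, |g y| ≤ B) (y : Y) :
    |k.fn g y| ≤ k.κ * B := by
  have hB0 : 0 ≤ B := le_trans (abs_nonneg _) (hB y)
  unfold fn
  rw [abs_mul, abs_of_nonneg (k.pW1 y)]
  have := dbl_abs_le (f := fun α β => max (α - β) 0 * (k.W2 (k.tri y α β) * g (k.tri y α β)))
    (k.cont_ker' hg y) (g := fun α β => B * (max (α - β) 0 * k.W2 (k.tri y α β))) ?_ ?_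
  · rw [dbl_const_mul] at this
    calc _ ≤ _ := mul_le_mul_of_nonneg_left this (k.pW1 y)
      _ = B * (k.W1 y * ∫ β in (0:ℝ)..1, ∫ α in (0:ℝ)..1, max (α - β) 0 * k.W2 (k.tri y α β)) := by
        ring
      _ ≤ B * k.κ := mul_le_mul_of_nonneg_left (k.bound y) hB0
      _ = _ := mul_comm _ _
  · have := k.cont_ker' (g := fun _ => 1) continuous_const y
    simp only [mul_one] at this
    exact continuous_const.mul this
  · intro α β _ _ _ _
    rw [abs_mul, abs_mul, abs_of_nonneg (le_max_right _ _), abs_of_nonneg (k.pW2 _)]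
    have h1 := hB (k.tri y α β)
    have h2 : 0 ≤ max (α - β) 0 * k.W2 (k.tri y α β) := mul_nonneg (le_max_right _ _) (k.pW2 _)
    nlinarith

def op : (Y →ᵇ ℝ) →L[ℝ] (Y →ᵇ ℝ) :=
  LinearMap.mkContinuous
    { toFun := fun g => BoundedContinuousFunction.ofNormedAddCommGroup (k.fn g)
        (k.cont_fn g.continuous) (k.κ * ‖g‖) (fun y => k.abs_fn_le g.continuous
          (fun y => g.norm_coe_le_norm y) y)
      map_add' := by
        intro f g
        ext y
        show k.fn (fun y => f y + g y) y = k.fn f y + k.fn g y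
        unfold fn
        rw [← mul_add, ← dbl_add
          (f := fun α β => max (α - β) 0 * (k.W2 (k.tri y α β) * f (k.tri y α β)))
          (g := fun α β => max (α - β) 0 * (k.W2 (k.tri y α β) * g (k.tri y α β)))
          (k.cont_ker' f.continuous y) (k.cont_ker' g.continuous y)]
        simp only [mul_add]
      map_smul' := by
        intro c g
        ext y
        show k.fn (fun y => c * g y) y = c * k.fn g y
        unfold fn
        have : ∀ α β : ℝ, max (α - β) 0 * (k.W2 (k.tri y α β) * (c * g (k.tri y α β))) =
          c * (max (α - β) 0 * (k.W2 (k.tri y α β) * g (k.tri y α β))) := fun α β => by ring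
        simp only [this, dbl_const_mul]
        ring }
    k.κ (by
      intro g
      have h0 : 0 ≤ k.κ * ‖g‖ := by
        by_cases hY : Nonempty Y
        · obtain ⟨y⟩ := hY
          exact le_trans (abs_nonneg _) (k.abs_fn_le g.continuous
            (fun y => g.norm_coe_le_norm y) y)
        · have : g = 0 := by ext y; exact absurd ⟨y⟩ hY
          simp [this]
      exact (BoundedContinuousFunction.norm_le h0).2 fun y => k.abs_fn_le g.continuous
          (fun y => g.norm_coe_le_norm y) y)

@[simp] lemma op_apply (g : Y →ᵇ ℝ) (y : Y) : k.op g y = k.fn g y := rfl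

lemma norm_op_le (h : 0 ≤ k.κ) : ‖k.op‖ ≤ k.κ := LinearMap.mkContinuous_norm_le _ h _

end KData

def Gw (Λ a d : ℝ) : ℝ := exp (-Λ * (a * (√(a ^ 2 + d ^ 2))⁻¹))

lemma sq_pos' {a : ℝ} (ha : 0 < a) (d : ℝ) : 0 < a ^ 2 + d ^ 2 := by positivity

lemma Gw_pos (Λ a d : ℝ) : 0 < Gw Λ a d := exp_pos _

lemma ratio_le_one {a : ℝ} (ha : 0 < a) (d : ℝ) : a * (√(a ^ 2 + d ^ 2))⁻¹ ≤ 1 := by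
  rw [← div_eq_mul_inv, div_le_one (sqrt_pos.2 (sq_pos' ha d))]
  exact le_sqrt_of_sq_le (by nlinarith [sq_nonneg d])

lemma Gw_le_one {Λ a : ℝ} (hΛ : 0 ≤ Λ) (ha : 0 < a) (d : ℝ) : Gw Λ a d ≤ 1 := by
  unfold Gw
  rw [exp_le_one_iff]
  have : 0 ≤ a * (√(a ^ 2 + d ^ 2))⁻¹ := by positivity
  nlinarith

lemma Gw_ge {Λ a : ℝ} (hΛ : 0 ≤ Λ) (ha : 0 < a) (d : ℝ) : exp (-Λ) ≤ Gw Λ a d := by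
  unfold Gw
  rw [exp_le_exp]
  nlinarith [ratio_le_one ha d]

lemma Gw_mono {Λ a b d e : ℝ} (hΛ : 0 ≤ Λ) (ha : 0 < a) (hab : a ≤ b) (he : 0 ≤ e) (hed : e ≤ d) :
    Gw Λ b e ≤ Gw Λ a d := by
  unfold Gw
  rw [exp_le_exp]
  have hb : 0 < b := ha.trans_le hab
  have : a * (√(a ^ 2 + d ^ 2))⁻¹ ≤ b * (√(b ^ 2 + e ^ 2))⁻¹ := by
    rw [← div_eq_mul_inv, ← div_eq_mul_inv, div_le_div_iff₀ (sqrt_pos.2 (sq_pos' ha d))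
      (sqrt_pos.2 (sq_pos' hb e))]
    have h1 : a * √(b ^ 2 + e ^ 2) = √(a ^ 2 * (b ^ 2 + e ^ 2)) := by
      rw [sqrt_mul (sq_nonneg a), sqrt_sq ha.le]
    have h2 : b * √(a ^ 2 + d ^ 2) = √(b ^ 2 * (a ^ 2 + d ^ 2)) := by
      rw [sqrt_mul (sq_nonneg b), sqrt_sq hb.le]
    rw [h1, h2]
    apply sqrt_le_sqrt
    have : a * e ≤ b * d := mul_le_mul hab hed he hb.le
    have h3 : 0 ≤ a * e := by positivity
    nlinarith
  nlinarith

lemma Gw_hasDeriv {Λ a : ℝ} (ha : 0 < a) (x : ℝ) :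
    HasDerivAt (fun x => Gw Λ a x) (Λ * x * (a * (√(a ^ 2 + x ^ 2))⁻¹ ^ 3 * Gw Λ a x)) x := by
  unfold Gw
  have h0 := sq_pos' ha x
  have h1 : HasDerivAt (fun x : ℝ => a ^ 2 + x ^ 2) (2 * x) x := by
    simpa using (hasDerivAt_pow 2 x).const_add (a ^ 2)
  have hs : √(a ^ 2 + x ^ 2) ≠ 0 := (sqrt_pos.2 h0).ne'
  have h2 := (h1.sqrt h0.ne').inv hs
  have h3 := ((h2.const_mul a).const_mul (-Λ)).exp
  refine h3.congr_deriv ?_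
  simp only [Pi.inv_apply]
  field_simp

lemma Gw_cont {Λ a : ℝ} (ha : 0 < a) : Continuous fun x => Gw Λ a x :=
  continuous_iff_continuousAt.2 fun x => (Gw_hasDeriv ha x).continuousAt

lemma kernel_bound {Λ a d β : ℝ} (hΛ : 0 < Λ) (ha : 0 < a) (hd : 0 ≤ d) (hβ : 0 ≤ β) (hβ1 : β ≤ 1) :
    d ^ 2 * ∫ α in (0:ℝ)..1, max (α - β) 0 *
      (a * (√(a ^ 2 + (d * (max (α - β) 0)) ^ 2))⁻¹ ^ 3 * Gw Λ a (d * max (α - β) 0)) ≤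
      Λ⁻¹ * Gw Λ a d := by
  have hc : Continuous fun α : ℝ => max (α - β) 0 *
      (a * (√(a ^ 2 + (d * (max (α - β) 0)) ^ 2))⁻¹ ^ 3 * Gw Λ a (d * max (α - β) 0)) := by
    have := Gw_cont (Λ := Λ) ha
    have h1 : Continuous fun α : ℝ => Gw Λ a (d * max (α - β) 0) := this.comp (by fun_prop)
    have h2 : Continuous fun α : ℝ => (√(a ^ 2 + (d * (max (α - β) 0)) ^ 2))⁻¹ :=
      Continuous.inv₀ (by fun_prop) fun α => (sqrt_pos.2 (sq_pos' ha _)).ne'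
    fun_prop
  rw [← intervalIntegral.integral_add_adjacent_intervals (hc.intervalIntegrable 0 β)
    (hc.intervalIntegrable β 1)]
  have e1 : (∫ α in (0:ℝ)..β, max (α - β) 0 *
      (a * (√(a ^ 2 + (d * (max (α - β) 0)) ^ 2))⁻¹ ^ 3 * Gw Λ a (d * max (α - β) 0))) = 0 := by
    rw [intervalIntegral.integral_congr (g := fun _ => (0:ℝ))]
    · simp
    · intro α hα
      rw [Set.uIcc_of_le hβ] at hα
      have : max (α - β) 0 = 0 := max_eq_right (by linarith [hα.2])
      simp [this]
  rw [e1, zero_add, ← intervalIntegral.integral_const_mul]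
  have key := intervalIntegral.integral_le_sub_of_hasDeriv_right_of_le
    (g := fun α => Λ⁻¹ * Gw Λ a (d * (α - β)))
    (g' := fun α => d ^ 2 * (max (α - β) 0 *
      (a * (√(a ^ 2 + (d * (max (α - β) 0)) ^ 2))⁻¹ ^ 3 * Gw Λ a (d * max (α - β) 0))))
    (φ := fun α => d ^ 2 * (max (α - β) 0 *
      (a * (√(a ^ 2 + (d * (max (α - β) 0)) ^ 2))⁻¹ ^ 3 * Gw Λ a (d * max (α - β) 0))))
    hβ1 ?_ ?_ ?_ ?_
  · refine key.trans ?_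
    have h1 : Gw Λ a (d * (1 - β)) ≤ Gw Λ a d := Gw_mono hΛ.le ha le_rfl
      (mul_nonneg hd (by linarith)) (by nlinarith)
    have h2 := Gw_pos Λ a (d * (β - β))
    have h3 : 0 < Λ⁻¹ := by positivity
    nlinarith
  · have : Continuous fun α : ℝ => Gw Λ a (d * (α - β)) := (Gw_cont ha).comp (by fun_prop)
    exact (continuous_const.mul this).continuousOn
  · intro α hα
    have hm : max (α - β) 0 = α - β := max_eq_left (by linarith [hα.1])
    have h := (Gw_hasDeriv (Λ := Λ) ha (d * (α - β))).comp α
      (((hasDerivAt_id α).sub_const β).const_mul d)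
    have h' := (h.const_mul Λ⁻¹).hasDerivWithinAt (s := Set.Ioi α)
    refine h'.congr_deriv ?_
    simp only [hm]
    field_simp
  · exact ((hc.const_mul _).continuousOn).integrableOn_Icc
  · intro α _; exact le_rfl

end

section

structure Adm (m : ℕ) (μ : ℝ → ℝ) : Prop where
  smooth : CDOn μ (Set.Ioi 0)
  b0 : ∀ t, 0 < t → |μ t - t ^ m| ≤ t ^ m / 4
  b1 : ∀ t, 0 < t → t * |deriv μ t| ≤ (m + 1) * t ^ m
  b2 : ∀ t, 0 < t → t ^ 2 * |deriv (deriv μ) t| ≤ ((m : ℝ) ^ 2 + 1) * t ^ m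

def MM (μ : ℝ → ℝ) (p q : ℝ) : ℝ := (μ p + μ q) / 2
def DD (μ : ℝ → ℝ) (p q : ℝ) : ℝ := MM μ p q ^ 4 + 3 / 4 * (p - q) ^ 2
def NN (μ : ℝ → ℝ) (p q : ℝ) : ℝ := (√(DD μ p q))⁻¹
def AA (μ : ℝ → ℝ) (p q : ℝ) : ℝ := √3 * MM μ p q * NN μ p q
def dd (μ : ℝ → ℝ) (p q : ℝ) : ℝ := ∫ l in (0:ℝ)..1, deriv (deriv μ) (q + l * (p - q))
def vv (μ : ℝ → ℝ) (p q : ℝ) : ℝ := deriv μ p * deriv μ q + MM μ p q * dd μ p q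
def ee (μ : ℝ → ℝ) (p q : ℝ) : ℝ :=
  2 * √3 * MM μ p q ^ 3 * (MM μ p q ^ 4 - 15 / 4 * (p - q) ^ 2) * NN μ p q ^ 5 * vv μ p q

def c01 (x : ℝ) : ℝ := max 0 (min x 1)
lemma c01_nonneg (x : ℝ) : 0 ≤ c01 x := le_max_left _ _
lemma c01_le (x : ℝ) : c01 x ≤ 1 := max_le zero_le_one (min_le_right _ _)
lemma c01_eq {x : ℝ} (h0 : 0 ≤ x) (h1 : x ≤ 1) : c01 x = x := by simp [c01, h0, h1]
@[fun_prop] lemma c01_cont : Continuous c01 := by unfold c01; fun_prop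
lemma c01_mono {x y : ℝ} (h : x ≤ y) : c01 x ≤ c01 y := max_le_max le_rfl (min_le_min h le_rfl)

lemma cont_int01 {Y : Type} [TopologicalSpace Y] {f : Y → ℝ → ℝ}
    (hf : Continuous fun x : Y × ℝ => f x.1 (c01 x.2)) :
    Continuous fun y => ∫ l in (0:ℝ)..1, f y l := by
  have := continuous_parametric_intervalIntegral_of_continuous' (μ := volume)
    (f := fun y l => f y (c01 l)) hf 0 1
  refine this.congr fun y => intervalIntegral.integral_congr fun l hl => ?_
  rw [Set.uIcc_of_le zero_le_one] at hl
  simp only [c01_eq hl.1 hl.2]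

section
variable {m : ℕ} {μ : ℝ → ℝ}

lemma Adm.cont (h : Adm m μ) : ContinuousOn μ (Set.Ioi 0) := h.smooth.continuousOn
lemma Adm.smooth1 (h : Adm m μ) : CDOn (deriv μ) (Set.Ioi 0) :=
  h.smooth.deriv_of_isOpen isOpen_Ioi (by simp)
lemma Adm.smooth2 (h : Adm m μ) : CDOn (deriv (deriv μ)) (Set.Ioi 0) :=
  h.smooth1.deriv_of_isOpen isOpen_Ioi (by simp)
lemma Adm.cont1 (h : Adm m μ) : ContinuousOn (deriv μ) (Set.Ioi 0) := h.smooth1.continuousOn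
lemma Adm.cont2 (h : Adm m μ) : ContinuousOn (deriv (deriv μ)) (Set.Ioi 0) := h.smooth2.continuousOn
lemma Adm.hasDeriv1 (h : Adm m μ) {t : ℝ} (ht : 0 < t) : HasDerivAt (deriv μ) (deriv (deriv μ) t) t :=
  ((h.smooth1.differentiableOn (by simp)).differentiableAt (Ioi_mem_nhds ht)).hasDerivAt
lemma Adm.hasDeriv (h : Adm m μ) {t : ℝ} (ht : 0 < t) : HasDerivAt μ (deriv μ t) t :=
  ((h.smooth.differentiableOn (by simp)).differentiableAt (Ioi_mem_nhds ht)).hasDerivAt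

lemma Adm.lo (h : Adm m μ) {t : ℝ} (ht : 0 < t) : 3 / 4 * t ^ m ≤ μ t := by
  have := (abs_le.1 (h.b0 t ht)).1; linarith
lemma Adm.hi (h : Adm m μ) {t : ℝ} (ht : 0 < t) : μ t ≤ 5 / 4 * t ^ m := by
  have := (abs_le.1 (h.b0 t ht)).2; linarith

variable {p q : ℝ}
lemma MM_lo (h : Adm m μ) (hq : 0 < q) (hqp : q ≤ p) : 3 / 4 * q ^ m ≤ MM μ p q := by
  have h1 := h.lo hq
  have h2 := h.lo (hq.trans_le hqp)
  have h3 : q ^ m ≤ p ^ m := pow_le_pow_left₀ hq.le hqp m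
  unfold MM; linarith
lemma MM_hi (h : Adm m μ) (hq : 0 < q) (hqp : q ≤ p) : MM μ p q ≤ 5 / 4 * p ^ m := by
  have h1 := h.hi hq
  have h2 := h.hi (hq.trans_le hqp)
  have h3 : q ^ m ≤ p ^ m := pow_le_pow_left₀ hq.le hqp m
  unfold MM; linarith
lemma MM_pos (h : Adm m μ) (hp : 0 < p) (hq : 0 < q) : 0 < MM μ p q := by
  have h1 := h.lo hq
  have h2 := h.lo hp
  have : 0 < q ^ m := by positivity
  have : 0 < p ^ m := by positivity
  unfold MM; linarith
lemma DD_pos (h : Adm m μ) (hp : 0 < p) (hq : 0 < q) : 0 < DD μ p q := by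
  have := MM_pos h hp hq
  unfold DD; positivity
lemma NN_pos (h : Adm m μ) (hp : 0 < p) (hq : 0 < q) : 0 < NN μ p q :=
  inv_pos.2 (sqrt_pos.2 (DD_pos h hp hq))
lemma AA_pos (h : Adm m μ) (hp : 0 < p) (hq : 0 < q) : 0 < AA μ p q := by
  have := MM_pos h hp hq
  have := NN_pos h hp hq
  unfold AA; positivity
lemma DD_NN (h : Adm m μ) (hp : 0 < p) (hq : 0 < q) : DD μ p q * NN μ p q ^ 2 = 1 := by
  have h0 := DD_pos h hp hq
  unfold NN
  rw [inv_pow, sq_sqrt h0.le]; field_simp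

lemma MM_symm : MM μ p q = MM μ q p := by unfold MM; ring
lemma DD_symm : DD μ p q = DD μ q p := by unfold DD; rw [MM_symm]; ring
lemma NN_symm : NN μ p q = NN μ q p := by unfold NN; rw [DD_symm]
lemma AA_symm : AA μ p q = AA μ q p := by unfold AA; rw [MM_symm, NN_symm]
lemma dd_symm : dd μ p q = dd μ q p := by
  unfold dd
  have := intervalIntegral.integral_comp_sub_left (a := 0) (b := 1)
    (fun l => deriv (deriv μ) (p + l * (q - p))) 1
  simp only [sub_self, sub_zero] at this
  rw [← this]
  congr 1; ext l; congr 1; ring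
lemma vv_symm : vv μ p q = vv μ q p := by unfold vv; rw [MM_symm, dd_symm]; ring
lemma ee_symm : ee μ p q = ee μ q p := by
  unfold ee; rw [MM_symm, NN_symm, vv_symm]; ring

lemma dd_eq (h : Adm m μ) (hp : 0 < p) (hq : 0 < q) : (p - q) * dd μ p q = deriv μ p - deriv μ q := by
  have hpos : ∀ l ∈ Set.uIcc (0:ℝ) 1, 0 < q + l * (p - q) := by
    intro l hl
    rw [Set.uIcc_of_le zero_le_one] at hl
    rcases eq_or_lt_of_le hl.2 with h1 | h1
    · rw [h1]; linarith
    · nlinarith [hl.1, mul_nonneg hl.1 hp.le, mul_pos (sub_pos.2 h1) hq]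
  have key := intervalIntegral.integral_eq_sub_of_hasDerivAt (a := 0) (b := 1)
    (f := fun l => deriv μ (q + l * (p - q)))
    (f' := fun l => (p - q) * deriv (deriv μ) (q + l * (p - q))) ?_ ?_
  · rw [intervalIntegral.integral_const_mul] at key
    unfold dd; rw [key]; simp
  · intro l hl
    have h1 : HasDerivAt (fun l : ℝ => q + l * (p - q)) (p - q) l := by
      simpa using ((hasDerivAt_id l).mul_const (p - q)).const_add q
    have := (h.hasDeriv1 (hpos l hl)).comp l h1
    simpa [mul_comm, Function.comp_def] using this
  · apply ContinuousOn.intervalIntegrable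
    apply continuousOn_const.mul
    exact h.cont2.comp (by fun_prop) hpos

lemma p_deriv_le (h : Adm m μ) (hm : 1 ≤ m) (hq : 0 < q) (hqp : q ≤ p) :
    p * |deriv μ q| ≤ (m + 1) * p ^ m := by
  obtain ⟨n, rfl⟩ : ∃ n, m = n + 1 := ⟨m - 1, by omega⟩
  have h1 := h.b1 q hq
  have h2 : |deriv μ q| ≤ ((n + 1 : ℕ) + 1) * q ^ n := by
    rw [pow_succ] at h1
    have : q * |deriv μ q| ≤ q * (((n + 1 : ℕ) + 1) * q ^ n) := by linarith
    exact le_of_mul_le_mul_left this hq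
  have h3 : q ^ n ≤ p ^ n := pow_le_pow_left₀ hq.le hqp n
  have hp := hq.trans_le hqp
  calc p * |deriv μ q| ≤ p * (((n + 1 : ℕ) + 1) * p ^ n) := by
        refine mul_le_mul_of_nonneg_left (h2.trans ?_) hp.le
        exact mul_le_mul_of_nonneg_left h3 (by positivity)
    _ = _ := by rw [pow_succ]; ring

lemma dd_le (h : Adm m μ) (hm : 1 ≤ m) (hq : 0 < q) (hqp : q ≤ p) :
    p ^ 2 * |dd μ p q| ≤ 4 * (m + 1) ^ 2 * p ^ m := by
  have hp := hq.trans_le hqp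
  have hpm : 0 < p ^ m := by positivity
  have hm0 : (0:ℝ) ≤ m := by positivity
  rcases le_or_gt p (2 * q) with hc | hc
  · have : |dd μ p q| ≤ 4 * (m + 1) ^ 2 * p ^ m / p ^ 2 := by
      unfold dd
      have := intervalIntegral.norm_integral_le_of_norm_le_const (a := 0) (b := 1)
        (f := fun l => deriv (deriv μ) (q + l * (p - q))) (C := 4 * (m + 1) ^ 2 * p ^ m / p ^ 2) ?_
      · simpa using this
      · intro l hl
        rw [Set.uIoc_of_le zero_le_one] at hl
        set t := q + l * (p - q) with ht
        have h1 : q ≤ t := by nlinarith [hl.1, hl.2]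
        have h2 : t ≤ p := by nlinarith [hl.1, hl.2]
        have ht0 : 0 < t := hq.trans_le h1
        have h3 := h.b2 t ht0
        have h4 : t ^ m ≤ p ^ m := pow_le_pow_left₀ ht0.le h2 m
        rw [le_div_iff₀ (by positivity), Real.norm_eq_abs]
        have h5 : p ^ 2 ≤ 4 * t ^ 2 := by nlinarith
        calc |deriv (deriv μ) t| * p ^ 2 ≤ |deriv (deriv μ) t| * (4 * t ^ 2) :=
              mul_le_mul_of_nonneg_left h5 (abs_nonneg _)
          _ = 4 * (t ^ 2 * |deriv (deriv μ) t|) := by ring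
          _ ≤ 4 * (((m:ℝ) ^ 2 + 1) * p ^ m) := by
              have : ((m:ℝ) ^ 2 + 1) * t ^ m ≤ ((m:ℝ) ^ 2 + 1) * p ^ m :=
                mul_le_mul_of_nonneg_left h4 (by positivity)
              linarith
          _ ≤ _ := by nlinarith [mul_nonneg hm0 hpm.le]
    rw [le_div_iff₀ (by positivity)] at this
    linarith
  · have hd : p / 2 ≤ p - q := by linarith
    have h1 := dd_eq h hp hq
    have h2 := p_deriv_le h hm hp le_rfl
    have h3 := p_deriv_le h hm hq hqp
    have h4 : p * ((p - q) * |dd μ p q|) ≤ 2 * ((m + 1) * p ^ m) := by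
      rw [← abs_of_nonneg (by linarith : 0 ≤ p - q), ← abs_mul, h1]
      have := abs_sub (deriv μ p) (deriv μ q)
      nlinarith
    have h5 : p ^ 2 * |dd μ p q| ≤ 2 * (p * ((p - q) * |dd μ p q|)) := by
      have := mul_nonneg hp.le (abs_nonneg (dd μ p q))
      nlinarith
    have h6 : 0 ≤ (m:ℝ) * p ^ m := by positivity
    have h7 : 0 ≤ (m:ℝ)^2 * p ^ m := by positivity
    nlinarith

lemma vv_le (h : Adm m μ) (hm : 1 ≤ m) (hq : 0 < q) (hqp : q ≤ p) :
    p ^ 2 * |vv μ p q| ≤ 6 * (m + 1) ^ 2 * (p ^ m) ^ 2 := by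
  have hp := hq.trans_le hqp
  have h1 := p_deriv_le h hm hp le_rfl
  have h2 := p_deriv_le h hm hq hqp
  have h3 := dd_le h hm hq hqp
  have h4 := MM_hi h hq hqp
  have h5 := MM_pos h hp hq
  unfold vv
  calc p ^ 2 * |deriv μ p * deriv μ q + MM μ p q * dd μ p q|
      ≤ p ^ 2 * (|deriv μ p * deriv μ q| + |MM μ p q * dd μ p q|) := by
        gcongr; exact abs_add_le _ _
    _ = (p * |deriv μ p|) * (p * |deriv μ q|) + MM μ p q * (p ^ 2 * |dd μ p q|) := by
        rw [abs_mul, abs_mul, abs_of_pos h5]; ring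
    _ ≤ ((m + 1) * p ^ m) * ((m + 1) * p ^ m) + (5 / 4 * p ^ m) * (4 * (m + 1) ^ 2 * p ^ m) := by
        gcongr
    _ = _ := by ring

def UU (m : ℕ) (p q : ℝ) : ℝ :=
  q ^ (2 * m) * (√((q ^ (2 * m)) ^ 2 + (p - q) ^ 2))⁻¹ ^ 3 + p⁻¹

lemma UU_pos (hq : 0 < q) (hqp : q ≤ p) : 0 < UU m p q := by
  have hp := hq.trans_le hqp
  unfold UU
  have : 0 ≤ q ^ (2 * m) * (√((q ^ (2 * m)) ^ 2 + (p - q) ^ 2))⁻¹ ^ 3 := by positivity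
  have : 0 < p⁻¹ := inv_pos.2 hp
  linarith

lemma NN_le (h : Adm m μ) (hm : 1 ≤ m) (hq : 0 < q) (hqp : q ≤ p) (hp1 : p ≤ 1) :
    (p ^ m) ^ 2 * NN μ p q ^ 3 ≤ 64 * 4 ^ m * UU m p q := by
  have hp := hq.trans_le hqp
  have hN := NN_pos h hp hq
  have hD := DD_pos h hp hq
  have h4m : (1:ℝ) ≤ 4 ^ m := one_le_pow₀ (by norm_num)
  rcases le_or_gt p (2 * q) with hc | hc
  · set R := (q ^ (2 * m)) ^ 2 + (p - q) ^ 2 with hR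
    have hR0 : 0 < R := by positivity
    have h1 : 81 / 256 * R ≤ DD μ p q := by
      have h2 := MM_lo h hq hqp
      have h3 : (3 / 4 * q ^ m) ^ 4 ≤ MM μ p q ^ 4 := pow_le_pow_left₀ (by positivity) h2 4
      have h4 : (3 / 4 * q ^ m) ^ 4 = 81 / 256 * (q ^ (2 * m)) ^ 2 := by
        rw [mul_pow, ← pow_mul, ← pow_mul]; norm_num; ring_nf
      unfold DD
      rw [hR]; nlinarith [sq_nonneg (p - q)]
    have h2 : 9 / 16 * √R ≤ √(DD μ p q) := by
      apply le_sqrt_of_sq_le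
      rw [mul_pow, sq_sqrt hR0.le]; linarith
    have hsR := sqrt_pos.2 hR0
    have h3 : NN μ p q ≤ 16 / 9 * (√R)⁻¹ := by
      unfold NN
      rw [show 16 / 9 * (√R)⁻¹ = (9 / 16 * √R)⁻¹ by rw [mul_inv]; norm_num]
      exact inv_anti₀ (by positivity) h2
    have h5 : (p ^ m) ^ 2 ≤ 4 ^ m * q ^ (2 * m) := by
      rw [← pow_mul, mul_comm m 2, pow_mul, pow_mul, ← mul_pow]
      exact pow_le_pow_left₀ (by positivity) (by nlinarith) m
    have hi : 0 < (√R)⁻¹ := inv_pos.2 hsR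
    calc (p ^ m) ^ 2 * NN μ p q ^ 3 ≤ (4 ^ m * q ^ (2 * m)) * (16 / 9 * (√R)⁻¹) ^ 3 := by
          gcongr
      _ = (16 / 9) ^ 3 * (4 ^ m * (q ^ (2 * m) * (√R)⁻¹ ^ 3)) := by ring
      _ ≤ 64 * (4 ^ m * (q ^ (2 * m) * (√R)⁻¹ ^ 3)) := by
          gcongr; norm_num
      _ ≤ 64 * 4 ^ m * UU m p q := by
          unfold UU
          have : 0 ≤ p⁻¹ := by positivity
          rw [mul_assoc]
          gcongr
          linarith
  · have h1 : NN μ p q ≤ 4 * p⁻¹ := by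
      unfold NN
      rw [show 4 * p⁻¹ = (p / 4)⁻¹ by rw [inv_div]; rfl]
      apply inv_anti₀ (by positivity)
      apply le_sqrt_of_sq_le
      unfold DD
      have : 0 < MM μ p q ^ 4 := by have := MM_pos h hp hq; positivity
      nlinarith
    have h2 : (p ^ m) ^ 2 ≤ p ^ 2 := by
      have : p ^ m ≤ p := by
        calc p ^ m ≤ p ^ 1 := pow_le_pow_of_le_one hp.le hp1 hm
          _ = p := pow_one p
      gcongr
    calc (p ^ m) ^ 2 * NN μ p q ^ 3 ≤ p ^ 2 * (4 * p⁻¹) ^ 3 := by gcongr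
      _ = 64 * p⁻¹ := by field_simp; norm_num
      _ ≤ 64 * 4 ^ m * p⁻¹ := by
          have : 0 < p⁻¹ := inv_pos.2 hp
          nlinarith
      _ ≤ _ := by
          unfold UU
          gcongr
          have : 0 ≤ q ^ (2 * m) * (√((q ^ (2 * m)) ^ 2 + (p - q) ^ 2))⁻¹ ^ 3 := by positivity
          linarith

lemma MN_le (h : Adm m μ) (hp : 0 < p) (hq : 0 < q) : MM μ p q ^ 2 * NN μ p q ≤ 1 := by
  have h1 := DD_NN h hp hq
  have hN := NN_pos h hp hq
  have hM := MM_pos h hp hq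
  have : (MM μ p q ^ 2 * NN μ p q) ^ 2 ≤ 1 := by
    rw [← h1]; unfold DD; nlinarith [mul_nonneg (sq_nonneg (p - q)) (sq_nonneg (NN μ p q))]
  exact (sq_le_one_iff₀ (by positivity)).1 this

lemma A4_le (h : Adm m μ) (hm : 1 ≤ m) (hq : 0 < q) (hqp : q ≤ p) (hp1 : p ≤ 1) :
    AA μ p q ^ 4 ≤ 1000 * 4 ^ m * UU m p q := by
  have hp := hq.trans_le hqp
  have h1 := MN_le h hp hq
  have hN := NN_pos h hp hq
  have hM := MM_pos h hp hq
  have h2 := NN_le h hm hq hqp hp1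
  have h3 := MM_hi h hq hqp
  have h4 : MM μ p q ^ 2 ≤ (5 / 4 * p ^ m) ^ 2 := by gcongr
  have hs : √3 ^ 4 = 9 := by
    rw [show √3 ^ 4 = (√3 ^ 2) ^ 2 by ring, sq_sqrt (by norm_num)]; norm_num
  calc AA μ p q ^ 4 = 9 * ((MM μ p q ^ 2 * NN μ p q) * (MM μ p q ^ 2 * NN μ p q ^ 3)) := by
        unfold AA; rw [mul_pow, mul_pow, hs]; ring
    _ ≤ 9 * (1 * ((5 / 4 * p ^ m) ^ 2 * NN μ p q ^ 3)) := by gcongr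
    _ = 225 / 16 * ((p ^ m) ^ 2 * NN μ p q ^ 3) := by ring
    _ ≤ 225 / 16 * (64 * 4 ^ m * UU m p q) := by gcongr
    _ ≤ _ := by
      have := mul_pos (show (0:ℝ) < 4 ^ m by positivity) (UU_pos (m := m) hq hqp)
      nlinarith

def Ce (m : ℕ) : ℝ := 240 * (m + 1) ^ 2 * (64 * 4 ^ m)

lemma e_le (h : Adm m μ) (hm : 1 ≤ m) (hq : 0 < q) (hqp : q ≤ p) (hp1 : p ≤ 1) :
    |ee μ p q| ≤ Ce m * p ^ (3 * m - 2) * UU m p q := by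
  have hp := hq.trans_le hqp
  have hN := NN_pos h hp hq
  have hM := MM_pos h hp hq
  have hDN := DD_NN h hp hq
  have hDp := DD_pos h hp hq
  have h2 := NN_le h hm hq hqp hp1
  have h3 := MM_hi h hq hqp
  have h4 := vv_le h hm hq hqp
  have h5 : |MM μ p q ^ 4 - 15 / 4 * (p - q) ^ 2| ≤ 5 * DD μ p q := by
    unfold DD
    rw [abs_le]; constructor <;> nlinarith [pow_pos hM 4, sq_nonneg (p - q)]
  have hs : √3 ≤ 2 := sqrt_le_iff.2 ⟨by norm_num, by norm_num⟩
  have hpk : p ^ (3 * m) = p ^ 2 * p ^ (3 * m - 2) := by rw [← pow_add]; congr 1; omega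
  have key : p ^ 2 * |ee μ p q| ≤ p ^ 2 * (Ce m * p ^ (3 * m - 2) * UU m p q) := by
    calc p ^ 2 * |ee μ p q| = 2 * √3 * MM μ p q ^ 3 * |MM μ p q ^ 4 - 15 / 4 * (p - q) ^ 2| *
          NN μ p q ^ 5 * (p ^ 2 * |vv μ p q|) := by
          unfold ee
          rw [abs_mul, abs_mul, abs_mul, abs_mul, abs_mul, abs_of_pos (pow_pos hM 3),
            abs_of_pos (pow_pos hN 5), abs_of_nonneg (sqrt_nonneg 3), abs_two]; ring
      _ ≤ 2 * 2 * (5 / 4 * p ^ m) ^ 3 * (5 * DD μ p q) * NN μ p q ^ 5 *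
          (6 * (m + 1) ^ 2 * (p ^ m) ^ 2) := by gcongr
      _ = 1875 / 8 * (m + 1) ^ 2 * p ^ (3 * m) * (DD μ p q * NN μ p q ^ 2) *
          ((p ^ m) ^ 2 * NN μ p q ^ 3) := by
          rw [show p ^ (3 * m) = (p ^ m) ^ 3 by rw [← pow_mul, mul_comm]]; ring
      _ ≤ 240 * (m + 1) ^ 2 * p ^ (3 * m) * 1 * (64 * 4 ^ m * UU m p q) := by
          rw [hDN]; gcongr; norm_num
      _ = _ := by rw [hpk]; unfold Ce; ring
  exact le_of_mul_le_mul_left key (by positivity)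

end

section
variable {m : ℕ} {μ : ℝ → ℝ} {Y : Type} [TopologicalSpace Y] {P Q : Y → ℝ}

lemma cont_MM (h : Adm m μ) (hP : Continuous P) (hQ : Continuous Q) (hP0 : ∀ y, 0 < P y)
    (hQ0 : ∀ y, 0 < Q y) : Continuous fun y => MM μ (P y) (Q y) := by
  have h1 : Continuous fun y => μ (P y) := h.cont.comp_continuous hP hP0
  have h2 : Continuous fun y => μ (Q y) := h.cont.comp_continuous hQ hQ0
  unfold MM; exact (h1.add h2).div_const 2

lemma cont_NN (h : Adm m μ) (hP : Continuous P) (hQ : Continuous Q) (hP0 : ∀ y, 0 < P y)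
    (hQ0 : ∀ y, 0 < Q y) : Continuous fun y => NN μ (P y) (Q y) := by
  have h1 := cont_MM h hP hQ hP0 hQ0
  unfold NN
  refine Continuous.inv₀ ?_ fun y => (sqrt_pos.2 (DD_pos h (hP0 y) (hQ0 y))).ne'
  unfold DD; fun_prop

lemma cont_AA (h : Adm m μ) (hP : Continuous P) (hQ : Continuous Q) (hP0 : ∀ y, 0 < P y)
    (hQ0 : ∀ y, 0 < Q y) : Continuous fun y => AA μ (P y) (Q y) := by
  have h1 := cont_MM h hP hQ hP0 hQ0
  have h2 := cont_NN h hP hQ hP0 hQ0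
  unfold AA; fun_prop

lemma seg_pos {p q l : ℝ} (hp : 0 < p) (hq : 0 < q) (h0 : 0 ≤ l) (h1 : l ≤ 1) :
    0 < q + l * (p - q) := by
  rcases eq_or_lt_of_le h1 with h1 | h1
  · rw [h1]; linarith
  · nlinarith [mul_nonneg h0 hp.le, mul_pos (sub_pos.2 h1) hq]

lemma cont_dd (h : Adm m μ) (hP : Continuous P) (hQ : Continuous Q) (hP0 : ∀ y, 0 < P y)
    (hQ0 : ∀ y, 0 < Q y) : Continuous fun y => dd μ (P y) (Q y) := by
  unfold dd
  apply cont_int01 (f := fun y l => deriv (deriv μ) (Q y + l * (P y - Q y)))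
  exact h.cont2.comp_continuous (by fun_prop)
    fun x => seg_pos (hP0 x.1) (hQ0 x.1) (c01_nonneg _) (c01_le _)

lemma cont_ee (h : Adm m μ) (hP : Continuous P) (hQ : Continuous Q) (hP0 : ∀ y, 0 < P y)
    (hQ0 : ∀ y, 0 < Q y) : Continuous fun y => ee μ (P y) (Q y) := by
  have h1 := cont_MM h hP hQ hP0 hQ0
  have h2 := cont_NN h hP hQ hP0 hQ0
  have h3 := cont_dd h hP hQ hP0 hQ0
  have h4 : Continuous fun y => deriv μ (P y) := h.cont1.comp_continuous hP hP0
  have h5 : Continuous fun y => deriv μ (Q y) := h.cont1.comp_continuous hQ hQ0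
  unfold ee vv; fun_prop

end

end

section

lemma pow5_lip {a b B : ℝ} (ha : |a| ≤ B) (hb : |b| ≤ B) : |a ^ 5 - b ^ 5| ≤ 5 * B ^ 4 * |a - b| := by
  have hB : 0 ≤ B := (abs_nonneg a).trans ha
  have : a ^ 5 - b ^ 5 = (a ^ 4 + a ^ 3 * b + a ^ 2 * b ^ 2 + a * b ^ 3 + b ^ 4) * (a - b) := by ring
  rw [this, abs_mul]
  refine mul_le_mul_of_nonneg_right ?_ (abs_nonneg _)
  have t : ∀ i j : ℕ, |a ^ i * b ^ j| ≤ B ^ i * B ^ j := by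
    intro i j
    rw [abs_mul, abs_pow, abs_pow]; gcongr
  have t1 := t 4 0
  have t2 := t 3 1
  have t3 := t 2 2
  have t4 := t 1 3
  have t5 := t 0 4
  simp only [pow_zero, mul_one, one_mul, pow_one] at t1 t2 t3 t4 t5
  calc _ ≤ |a ^ 4| + |a ^ 3 * b| + |a ^ 2 * b ^ 2| + |a * b ^ 3| + |b ^ 4| := by
        refine (abs_add_le _ _).trans ?_
        gcongr
        refine (abs_add_le _ _).trans ?_
        gcongr
        refine (abs_add_le _ _).trans ?_
        gcongr
        exact abs_add_le _ _
    _ ≤ B ^ 4 + B ^ 3 * B + B ^ 2 * B ^ 2 + B * B ^ 3 + B ^ 4 := by gcongr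
    _ = _ := by ring

def clip (z : ℝ) : ℝ := max (-1) (min z 1)
lemma clip_abs (z : ℝ) : |clip z| ≤ 1 :=
  abs_le.2 ⟨le_max_left _ _, max_le (by norm_num) (min_le_right _ _)⟩
lemma clip_lip (z w : ℝ) : |clip z - clip w| ≤ |z - w| := by
  unfold clip
  refine (abs_max_sub_max_le_max _ _ _ _).trans ?_
  simp only [sub_self, abs_zero]
  refine max_le (abs_nonneg _) ((abs_min_sub_min_le_max _ _ _ _).trans ?_)
  simp
lemma clip_eq {z : ℝ} (h : |z| ≤ 1) : clip z = z := by
  have := abs_le.1 h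
  simp [clip, this.1, this.2]
@[fun_prop] lemma clip_cont : Continuous clip := by unfold clip; fun_prop

def NL (A z : ℝ) : ℝ := (A + clip z) ^ 5 - A ^ 5
lemma NL_lip {A z w : ℝ} (hA : 0 ≤ A) : |NL A z - NL A w| ≤ 5 * (A + 1) ^ 4 * |z - w| := by
  unfold NL
  have h : ∀ z, |A + clip z| ≤ A + 1 := fun z =>
    (abs_add_le _ _).trans (by rw [abs_of_nonneg hA]; linarith [clip_abs z])
  have h1 := pow5_lip (h z) (h w)
  have h2 : (A + clip z) - (A + clip w) = clip z - clip w := by ring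
  rw [h2] at h1
  calc _ = |(A + clip z) ^ 5 - (A + clip w) ^ 5| := by congr 1; ring
    _ ≤ _ := h1
    _ ≤ _ := mul_le_mul_of_nonneg_left (clip_lip z w) (by positivity)

def YT (T : ℝ) : Type := {y : ℝℝ // 0 < y.2 ∧ y.2 ≤ y.1 ∧ y.1 < T}
instance (T : ℝ) : TopologicalSpace (YT T) := inferInstanceAs (TopologicalSpace {y : ℝℝ // _})

section
variable {T : ℝ}
def YT.p (y : YT T) : ℝ := y.1.1
def YT.q (y : YT T) : ℝ := y.1.2
@[fun_prop] lemma YT.cp : Continuous (YT.p : YT T → ℝ) := continuous_fst.comp continuous_subtype_val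
@[fun_prop] lemma YT.cq : Continuous (YT.q : YT T → ℝ) := continuous_snd.comp continuous_subtype_val
lemma YT.q0 (y : YT T) : 0 < y.q := y.2.1
lemma YT.qp (y : YT T) : y.q ≤ y.p := y.2.2.1
lemma YT.pT (y : YT T) : y.p < T := y.2.2.2
lemma YT.p0 (y : YT T) : 0 < y.p := y.q0.trans_le y.qp

def YT.tri (y : YT T) (α β : ℝ) : YT T :=
  ⟨(y.q + (y.p - y.q) * c01 (max α β), y.q + (y.p - y.q) * c01 β), by
    have h1 := y.q0
    have h2 := y.qp
    have h3 := y.pT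
    have h4 := c01_mono (le_max_right α β)
    have h5 := c01_nonneg β
    have h6 := c01_le (max α β)
    refine ⟨?_, ?_, ?_⟩
    · show 0 < y.q + (y.p - y.q) * c01 β
      nlinarith
    · show y.q + (y.p - y.q) * c01 β ≤ y.q + (y.p - y.q) * c01 (max α β)
      nlinarith
    · show y.q + (y.p - y.q) * c01 (max α β) < T
      nlinarith⟩
@[simp] lemma YT.tri_p (y : YT T) (α β : ℝ) :
  (y.tri α β).p = y.q + (y.p - y.q) * c01 (max α β) := rfl
@[simp] lemma YT.tri_q (y : YT T) (α β : ℝ) : (y.tri α β).q = y.q + (y.p - y.q) * c01 β := rfl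

def YT.w (m : ℕ) (Λ : ℝ) (y : YT T) : ℝ := y.p ^ (3 * m - 2) * Gw Λ (y.q ^ (2 * m)) (y.p - y.q)
def YT.U (m : ℕ) (y : YT T) : ℝ := UU m y.p y.q
lemma YT.w_pos (m : ℕ) (Λ : ℝ) (y : YT T) : 0 < y.w m Λ :=
  mul_pos (pow_pos y.p0 _) (Gw_pos _ _ _)
lemma YT.U_pos (m : ℕ) (y : YT T) : 0 < y.U m := UU_pos y.q0 y.qp

lemma YT.cw (m : ℕ) (Λ : ℝ) : Continuous (YT.w m Λ : YT T → ℝ) := by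
  unfold YT.w Gw
  have : Continuous fun y : YT T => (√((y.q ^ (2 * m)) ^ 2 + (y.p - y.q) ^ 2))⁻¹ :=
    Continuous.inv₀ (by fun_prop) fun y => (sqrt_pos.2 (sq_pos' (pow_pos y.q0 _) _)).ne'
  fun_prop
lemma YT.cU (m : ℕ) : Continuous (YT.U m : YT T → ℝ) := by
  unfold YT.U UU
  have : Continuous fun y : YT T => (√((y.q ^ (2 * m)) ^ 2 + (y.p - y.q) ^ 2))⁻¹ :=
    Continuous.inv₀ (by fun_prop) fun y => (sqrt_pos.2 (sq_pos' (pow_pos y.q0 _) _)).ne'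
  have h2 : Continuous fun y : YT T => (y.p)⁻¹ := YT.cp.inv₀ fun y => y.p0.ne'
  fun_prop

lemma YT.ctri : Continuous fun x : YT T × ℝ × ℝ => x.1.tri x.2.1 x.2.2 := by
  apply Continuous.subtype_mk
  fun_prop

lemma bound_aux {d D B g Pi Pk pk T : ℝ} (hd : 0 ≤ d) (hD : 0 ≤ D) (hB : 0 ≤ B) (hg : 0 ≤ g)
    (hg1 : g ≤ 1) (hPi : 0 ≤ Pi) (s2 : d * D * Pi ≤ 1) (hdT : d ≤ T) (hPk0 : 0 ≤ Pk) (hPk : Pk ≤ pk) :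
    d ^ 2 * (D * ((B + Pi) * (Pk * g))) ≤ pk * d ^ 2 * (D * (B * g)) + T * pk := by
  have hT : 0 ≤ T := hd.trans hdT
  have hpk : 0 ≤ pk := hPk0.trans hPk
  have h1 : d ^ 2 * (D * (B * g)) * Pk ≤ d ^ 2 * (D * (B * g)) * pk :=
    mul_le_mul_of_nonneg_left hPk (by positivity)
  have h2 : d * (d * D * Pi) * (Pk * g) ≤ T * 1 * (pk * 1) := by
    apply mul_le_mul (mul_le_mul hdT s2 (by positivity) hT) (mul_le_mul hPk hg1 hg hpk)
      (by positivity) (by positivity)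
  calc _ = d ^ 2 * (D * (B * g)) * Pk + d * (d * D * Pi) * (Pk * g) := by ring
    _ ≤ d ^ 2 * (D * (B * g)) * pk + T * 1 * (pk * 1) := add_le_add h1 h2
    _ = _ := by ring

lemma YT.bound {m : ℕ} (hm : 1 ≤ m) {Λ : ℝ} (hΛ : 0 < Λ) (y : YT T) :
    (y.p - y.q) ^ 2 / (4 * y.w m Λ) * ∫ β in (0:ℝ)..1, ∫ α in (0:ℝ)..1,
      max (α - β) 0 * ((y.tri α β).U m * (y.tri α β).w m Λ) ≤ 4⁻¹ * (Λ⁻¹ + T * exp Λ) := by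
  set d := y.p - y.q with hd
  have hd0 : 0 ≤ d := by have := y.qp; rw [hd]; linarith
  have hq := y.q0
  have hp := y.p0
  have hT : 0 < T := hp.trans y.pT
  set k := 3 * m - 2 with hk
  have hk1 : 1 ≤ k := by omega
  set a0 := y.q ^ (2 * m) with ha0
  have ha00 : 0 < a0 := pow_pos hq _
  set G0 := Gw Λ a0 d with hG0
  have hG00 : 0 < G0 := Gw_pos _ _ _
  have hker : Continuous fun x : ℝℝ =>
      max (x.1 - x.2) 0 * ((y.tri x.1 x.2).U m * (y.tri x.1 x.2).w m Λ) := by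
    have h1 : Continuous fun x : ℝℝ => y.tri x.1 x.2 :=
      YT.ctri.comp (by fun_prop : Continuous fun x : ℝℝ => (y, x.1, x.2))
    have h2 := (YT.cU (T := T) m).comp h1
    have h3 := (YT.cw (T := T) m Λ).comp h1
    exact (by fun_prop : Continuous fun x : ℝℝ => max (x.1 - x.2) 0).mul (h2.mul h3)
  have inner : ∀ β ∈ Set.Icc (0:ℝ) 1, d ^ 2 * (∫ α in (0:ℝ)..1,
      max (α - β) 0 * ((y.tri α β).U m * (y.tri α β).w m Λ)) ≤
      y.p ^ k * (Λ⁻¹ * G0 + T) := by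
    intro β hβ
    set a := (y.q + d * β) ^ (2 * m) with ha
    have hqb : y.q ≤ y.q + d * β := by nlinarith [hβ.1]
    have ha1 : a0 ≤ a := pow_le_pow_left₀ hq.le hqb _
    have ha2 : 0 < a := ha00.trans_le ha1
    have kb := kernel_bound hΛ ha2 hd0 hβ.1 hβ.2
    have kG : Gw Λ a d ≤ G0 := Gw_mono hΛ.le ha00 ha1 hd0 le_rfl
    have hc : Continuous fun α : ℝ => max (α - β) 0 *
      (a * (√(a ^ 2 + (d * (max (α - β) 0)) ^ 2))⁻¹ ^ 3 * Gw Λ a (d * max (α - β) 0)) := by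
      have h1 : Continuous fun α : ℝ => Gw Λ a (d * max (α - β) 0) :=
        (Gw_cont (Λ := Λ) ha2).comp (by fun_prop)
      have h2 : Continuous fun α : ℝ => (√(a ^ 2 + (d * (max (α - β) 0)) ^ 2))⁻¹ :=
        Continuous.inv₀ (by fun_prop) fun α => (sqrt_pos.2 (sq_pos' ha2 _)).ne'
      fun_prop
    have hc0 : Continuous fun α : ℝ =>
        max (α - β) 0 * ((y.tri α β).U m * (y.tri α β).w m Λ) :=
      hker.comp (by fun_prop : Continuous fun α : ℝ => (α, β))
    rw [← intervalIntegral.integral_const_mul]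
    calc _ ≤ ∫ α in (0:ℝ)..1, (y.p ^ k * d ^ 2 * (max (α - β) 0 *
      (a * (√(a ^ 2 + (d * (max (α - β) 0)) ^ 2))⁻¹ ^ 3 * Gw Λ a (d * max (α - β) 0))) +
        T * y.p ^ k) := by
          refine intervalIntegral.integral_mono_on zero_le_one
            ((continuous_const.mul hc0).intervalIntegrable _ _)
            (((continuous_const.mul hc).add continuous_const).intervalIntegrable _ _) ?_
          intro α hα
          rcases le_or_gt α β with hab | hab
          · have : max (α - β) 0 = 0 := max_eq_right (by linarith)
            rw [this]
            have : 0 ≤ T * y.p ^ k := by positivity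
            simpa using this
          · have hm1 : max (α - β) 0 = α - β := max_eq_left (by linarith)
            have hm2 : max α β = α := max_eq_left hab.le
            have e1 : (y.tri α β).p = y.q + d * α := by
              rw [YT.tri_p, hm2, c01_eq hα.1 hα.2]
            have e2 : (y.tri α β).q = y.q + d * β := by
              rw [YT.tri_q, c01_eq hβ.1 hβ.2]
            rw [hm1]
            unfold YT.U YT.w UU
            rw [e1, e2, ← ha]
            have e3 : y.q + d * α - (y.q + d * β) = d * (α - β) := by ring
            rw [e3, ← hk]
            set P := y.q + d * α with hP
            have hP0 : 0 < P := by nlinarith [hα.1]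
            have hPp : P ≤ y.p := by rw [hP, hd]; nlinarith [hα.2]
            have hPk : P ^ k ≤ y.p ^ k := pow_le_pow_left₀ hP0.le hPp k
            set g := Gw Λ a (d * (α - β)) with hg
            have hg0 : 0 < g := Gw_pos _ _ _
            have hg1 : g ≤ 1 := Gw_le_one hΛ.le ha2 _
            set B := a * (√(a ^ 2 + (d * (α - β)) ^ 2))⁻¹ ^ 3 with hB
            have hB0 : 0 ≤ B := by positivity
            have hab0 : 0 ≤ α - β := by linarith
            have s2 : d * (α - β) * P⁻¹ ≤ 1 := by
              rw [← div_eq_mul_inv, div_le_one hP0, hP]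
              nlinarith [hβ.1]
            have s3 : d ≤ T := by have := y.pT; rw [hd]; linarith
            exact bound_aux hd0 hab0 hB0 hg0.le hg1 (by positivity) s2 s3 (by positivity) hPk
      _ = y.p ^ k * (d ^ 2 * ∫ α in (0:ℝ)..1, (max (α - β) 0 *
      (a * (√(a ^ 2 + (d * (max (α - β) 0)) ^ 2))⁻¹ ^ 3 * Gw Λ a (d * max (α - β) 0)))) +
        T * y.p ^ k := by
          rw [intervalIntegral.integral_add ((hc.const_mul (y.p ^ k * d ^ 2)).intervalIntegrable _ _)
            (continuous_const.intervalIntegrable _ _), intervalIntegral.integral_const_mul]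
          simp; ring
      _ ≤ y.p ^ k * (Λ⁻¹ * G0) + T * y.p ^ k := by
          have h9 := kb.trans (mul_le_mul_of_nonneg_left kG (inv_nonneg.2 hΛ.le))
          have h10 := mul_le_mul_of_nonneg_left h9 (pow_nonneg hp.le k)
          linarith
      _ = _ := by ring
  have cin : Continuous fun β : ℝ => ∫ α in (0:ℝ)..1,
      max (α - β) 0 * ((y.tri α β).U m * (y.tri α β).w m Λ) := by
    apply continuous_parametric_intervalIntegral_of_continuous' (μ := volume)
      (f := fun β α => max (α - β) 0 * ((y.tri α β).U m * (y.tri α β).w m Λ))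
    exact hker.comp (by fun_prop : Continuous fun z : ℝℝ => (z.2, z.1))
  have outer : d ^ 2 * (∫ β in (0:ℝ)..1, ∫ α in (0:ℝ)..1,
      max (α - β) 0 * ((y.tri α β).U m * (y.tri α β).w m Λ)) ≤ y.p ^ k * (Λ⁻¹ * G0 + T) := by
    rw [← intervalIntegral.integral_const_mul]
    calc _ ≤ ∫ β in (0:ℝ)..1, y.p ^ k * (Λ⁻¹ * G0 + T) :=
          intervalIntegral.integral_mono_on zero_le_one
            ((continuous_const.mul cin).intervalIntegrable _ _)
            (continuous_const.intervalIntegrable _ _) inner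
      _ = _ := by simp
  have hw : y.w m Λ = y.p ^ k * G0 := rfl
  rw [hw, div_mul_eq_mul_div, div_le_iff₀ (by positivity)]
  refine outer.trans ?_
  have hGe : exp (-Λ) ≤ G0 := Gw_ge hΛ.le ha00 d
  have : 1 ≤ exp Λ * G0 := by
    calc (1:ℝ) = exp Λ * exp (-Λ) := by rw [← exp_add]; simp
      _ ≤ _ := by gcongr
  have hpk : 0 < y.p ^ k := by positivity
  calc y.p ^ k * (Λ⁻¹ * G0 + T) = y.p ^ k * (Λ⁻¹ * G0) + y.p ^ k * T * 1 := by ring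
    _ ≤ y.p ^ k * (Λ⁻¹ * G0) + y.p ^ k * T * (exp Λ * G0) := by gcongr
    _ = _ := by ring

def YT.K {m : ℕ} (hm : 1 ≤ m) {Λ : ℝ} (hΛ : 0 < Λ) (T : ℝ) : KData (YT T) where
  W1 y := (y.p - y.q) ^ 2 / (4 * y.w m Λ)
  W2 y := y.U m * y.w m Λ
  tri y α β := y.tri α β
  cW1 := by
    refine Continuous.div (by fun_prop) (continuous_const.mul (YT.cw m Λ)) fun y => ?_
    have := y.w_pos m Λ
    positivity
  cW2 := (YT.cU m).mul (YT.cw m Λ)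
  ctri := YT.ctri
  pW1 y := by have := y.w_pos m Λ; positivity
  pW2 y := (mul_pos (y.U_pos m) (y.w_pos m Λ)).le
  κ := 4⁻¹ * (Λ⁻¹ + T * exp Λ)
  bound y := YT.bound hm hΛ y

end

def CL (m : ℕ) : ℝ := 40040 * 4 ^ m
def RR (m : ℕ) : ℝ := 2 * Ce m * exp (CL m)
def TT (m : ℕ) : ℝ := min (1 / 4) (min (exp (-CL m) / CL m) (1 / RR m))
lemma CL_pos (m : ℕ) : 0 < CL m := by unfold CL; positivity
lemma Ce_pos (m : ℕ) : 0 < Ce m := by unfold Ce; positivity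
lemma RR_pos (m : ℕ) : 0 < RR m := by have := Ce_pos m; unfold RR; positivity
lemma TT_pos (m : ℕ) : 0 < TT m := by
  have := CL_pos m
  have := RR_pos m
  unfold TT; positivity
lemma TT_le (m : ℕ) : TT m ≤ 1 / 4 := min_le_left _ _

section
variable {m : ℕ} {μ : ℝ → ℝ}

lemma L_le (h : Adm m μ) (hm : 1 ≤ m) {p q : ℝ} (hq : 0 < q) (hqp : q ≤ p) (hp1 : p ≤ 1) :
    5 * (AA μ p q + 1) ^ 4 ≤ CL m * UU m p q := by
  have hp := hq.trans_le hqp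
  have h1 := A4_le h hm hq hqp hp1
  have h2 := AA_pos h hp hq
  have h3 : 1 ≤ UU m p q := by
    unfold UU
    have : 1 ≤ p⁻¹ := (one_le_inv₀ hp).2 hp1
    have : 0 ≤ q ^ (2 * m) * (√((q ^ (2 * m)) ^ 2 + (p - q) ^ 2))⁻¹ ^ 3 := by positivity
    linarith
  have h4m : (1:ℝ) ≤ 4 ^ m := one_le_pow₀ (by norm_num)
  set A := AA μ p q
  have h4 : (A + 1) ^ 4 ≤ 8 * (A ^ 4 + 1) := by
    have e1 : (A + 1) ^ 2 ≤ 2 * (A ^ 2 + 1) := by nlinarith [sq_nonneg (A - 1)]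
    have e2 : (A + 1) ^ 4 ≤ (2 * (A ^ 2 + 1)) ^ 2 := by
      calc (A + 1) ^ 4 = ((A + 1) ^ 2) ^ 2 := by ring
        _ ≤ _ := by gcongr
    nlinarith [sq_nonneg (A ^ 2 - 1)]
  have h5 : 1 ≤ 4 ^ m * UU m p q := by nlinarith
  unfold CL
  nlinarith

def Nfun (μ : ℝ → ℝ) (m : ℕ) (Λ : ℝ) {T : ℝ} (x : YT T → ℝ) (y : YT T) : ℝ :=
  (ee μ y.p y.q - NL (AA μ y.p y.q) (y.w m Λ * x y)) / (y.U m * y.w m Λ)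

lemma Nfun_cont (h : Adm m μ) (Λ : ℝ) {T : ℝ} {x : YT T → ℝ} (hx : Continuous x) :
    Continuous (Nfun μ m Λ x) := by
  unfold Nfun NL
  have h1 := cont_AA h (YT.cp (T := T)) YT.cq YT.p0 YT.q0
  have h2 := cont_ee h (YT.cp (T := T)) YT.cq YT.p0 YT.q0
  have h3 := YT.cw (T := T) m Λ
  have h4 := YT.cU (T := T) m
  refine Continuous.div (by fun_prop) (h4.mul h3) fun y => ?_
  exact (mul_pos (y.U_pos m) (y.w_pos m Λ)).ne'

lemma Nfun_lip (h : Adm m μ) (hm : 1 ≤ m) (Λ : ℝ) {T : ℝ} (hT : T ≤ 1) (x x' : YT T → ℝ) (y : YT T) :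
    |Nfun μ m Λ x y - Nfun μ m Λ x' y| ≤ CL m * |x y - x' y| := by
  have hU := y.U_pos m
  have hw := y.w_pos m Λ
  have h1 := L_le h hm y.q0 y.qp (y.pT.le.trans hT)
  have h2 := NL_lip (z := y.w m Λ * x' y) (w := y.w m Λ * x y) (AA_pos h y.p0 y.q0).le
  unfold Nfun
  rw [← sub_div, abs_div, abs_of_pos (mul_pos hU hw), div_le_iff₀ (mul_pos hU hw)]
  calc _ = |NL (AA μ y.p y.q) (y.w m Λ * x' y) - NL (AA μ y.p y.q) (y.w m Λ * x y)| := by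
        congr 1; ring
    _ ≤ _ := h2
    _ = 5 * (AA μ y.p y.q + 1) ^ 4 * (y.w m Λ * |x y - x' y|) := by
        rw [← mul_sub, abs_mul, abs_of_pos hw, abs_sub_comm]
    _ ≤ CL m * UU m y.p y.q * (y.w m Λ * |x y - x' y|) := by gcongr
    _ = _ := by unfold YT.U; ring

lemma Nfun_zero (h : Adm m μ) (hm : 1 ≤ m) {Λ : ℝ} (hΛ : 0 ≤ Λ) {T : ℝ} (hT : T ≤ 1) (y : YT T) :
    |Nfun μ m Λ (fun _ => 0) y| ≤ Ce m * exp Λ := by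
  have hU := y.U_pos m
  have hw := y.w_pos m Λ
  have h1 := e_le h hm y.q0 y.qp (y.pT.le.trans hT)
  have h2 : NL (AA μ y.p y.q) (y.w m Λ * 0) = 0 := by simp [NL, clip]
  have h3 := Gw_ge hΛ (pow_pos y.q0 (2 * m)) (y.p - y.q)
  have hp := y.p0
  have hC := Ce_pos m
  unfold Nfun
  rw [h2, sub_zero, abs_div, abs_of_pos (mul_pos hU hw), div_le_iff₀ (mul_pos hU hw)]
  refine h1.trans ?_
  have : 1 ≤ exp Λ * Gw Λ (y.q ^ (2 * m)) (y.p - y.q) := by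
    calc (1:ℝ) = exp Λ * exp (-Λ) := by rw [← exp_add]; simp
      _ ≤ _ := by gcongr
  calc Ce m * y.p ^ (3 * m - 2) * UU m y.p y.q = Ce m * y.p ^ (3 * m - 2) * y.U m * 1 := by
        rw [mul_one]; rfl
    _ ≤ Ce m * y.p ^ (3 * m - 2) * y.U m * (exp Λ * Gw Λ (y.q ^ (2 * m)) (y.p - y.q)) := by
        gcongr
    _ = _ := by unfold YT.w; ring

def Nbcf (h : Adm m μ) (hm : 1 ≤ m) {Λ : ℝ} (hΛ : 0 ≤ Λ) {T : ℝ} (hT : T ≤ 1) (x : YT T →ᵇ ℝ) :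
    YT T →ᵇ ℝ :=
  BoundedContinuousFunction.ofNormedAddCommGroup (Nfun μ m Λ x) (Nfun_cont h Λ x.continuous)
    (Ce m * exp Λ + CL m * ‖x‖) (by
      intro y
      have h1 := Nfun_zero h hm hΛ hT y
      have h2 := Nfun_lip h hm Λ hT x (fun _ => 0) y
      have h3 : |x y| ≤ ‖x‖ := x.norm_coe_le_norm y
      have hC := CL_pos m
      rw [Real.norm_eq_abs]
      have h4 := abs_add_le (Nfun μ m Λ x y - Nfun μ m Λ (fun _ => 0) y) (Nfun μ m Λ (fun _ => 0) y)
      rw [sub_add_cancel] at h4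
      simp only [sub_zero] at h2
      have := mul_le_mul_of_nonneg_left h3 hC.le
      linarith)

lemma exists_fix (h : Adm m μ) (hm : 1 ≤ m) :
    ∃ x : YT (TT m) →ᵇ ℝ, ‖x‖ ≤ RR m ∧
      ∀ y, x y = (YT.K hm (CL_pos m) (TT m)).fn (Nfun μ m (CL m) x) y := by
  have hC := CL_pos m
  have hT1 : TT m ≤ 1 := (TT_le m).trans (by norm_num)
  have hT0 := TT_pos m
  set k := YT.K hm hC (TT m) with hk
  have hκ : k.κ ≤ (2 * CL m)⁻¹ := by
    show 4⁻¹ * ((CL m)⁻¹ + TT m * exp (CL m)) ≤ _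
    have : TT m ≤ exp (-CL m) / CL m := (min_le_right _ _).trans (min_le_left _ _)
    have h2 : TT m * exp (CL m) ≤ (CL m)⁻¹ := by
      calc TT m * exp (CL m) ≤ exp (-CL m) / CL m * exp (CL m) := by gcongr
        _ = (CL m)⁻¹ := by rw [exp_neg]; field_simp
    rw [mul_inv]; linarith
  have hκ0 : 0 ≤ k.κ := by
    show 0 ≤ 4⁻¹ * ((CL m)⁻¹ + TT m * exp (CL m))
    positivity
  set Ψ : (YT (TT m) →ᵇ ℝ) → (YT (TT m) →ᵇ ℝ) := fun x => k.op (Nbcf h hm hC.le hT1 x) with hΨ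
  have hlip : LipschitzWith (1 / 2 : NNReal) Ψ := by
    refine LipschitzWith.of_dist_le_mul fun x x' => ?_
    rw [dist_eq_norm, dist_eq_norm, hΨ]
    simp only
    rw [← map_sub]
    refine (k.op.le_opNorm _).trans ?_
    have h1 : ‖Nbcf h hm hC.le hT1 x - Nbcf h hm hC.le hT1 x'‖ ≤ CL m * ‖x - x'‖ := by
      refine (BoundedContinuousFunction.norm_le (by positivity)).2 fun y => ?_
      refine (Nfun_lip h hm (CL m) hT1 x x' y).trans ?_
      gcongr
      exact (x - x').norm_coe_le_norm y
    have h2 := k.norm_op_le hκ0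
    calc _ ≤ (2 * CL m)⁻¹ * (CL m * ‖x - x'‖) := by
          gcongr
          exact h2.trans hκ
      _ = _ := by push_cast; field_simp
  have hcw : ContractingWith (1 / 2 : NNReal) Ψ := ⟨by
    rw [← NNReal.coe_lt_coe]; norm_num, hlip⟩
  set x := ContractingWith.fixedPoint Ψ hcw with hx
  have hfix : Ψ x = x := hcw.fixedPoint_isFixedPt
  refine ⟨x, ?_, fun y => ?_⟩
  · have h1 : ‖Ψ 0‖ ≤ Ce m * exp (CL m) := by
      have hn : ‖Nbcf h hm hC.le hT1 0‖ ≤ Ce m * exp (CL m) := by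
        refine (BoundedContinuousFunction.norm_le (by have := Ce_pos m; positivity)).2 fun y => ?_
        exact Nfun_zero h hm hC.le hT1 y
      have hC1 : (2 * CL m)⁻¹ ≤ 1 := by
        apply inv_le_one_of_one_le₀
        unfold CL
        have : (1:ℝ) ≤ 4 ^ m := one_le_pow₀ (by norm_num)
        linarith
      refine (k.op.le_opNorm _).trans ?_
      calc _ ≤ 1 * (Ce m * exp (CL m)) := by
            gcongr
            exact (k.norm_op_le hκ0).trans (hκ.trans hC1)
        _ = _ := one_mul _
    have h2 : dist (Ψ x) (Ψ 0) ≤ (1 / 2 : NNReal) * dist x 0 := hlip.dist_le_mul x 0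
    rw [hfix, dist_zero_right, dist_eq_norm] at h2
    push_cast at h2
    have h3 := norm_sub_norm_le x (Ψ 0)
    unfold RR
    linarith
  · conv_lhs => rw [← hfix]
    rfl

def gg (μ : ℝ → ℝ) (z : ℝ → ℝ → ℝ) (p q : ℝ) : ℝ :=
  ee μ p q - ((AA μ p q + z p q) ^ 5 - AA μ p q ^ 5)

structure IsSol (m : ℕ) (μ : ℝ → ℝ) (z : ℝ → ℝ → ℝ) : Prop where
  symm : ∀ p q, z p q = z q p
  cont : ContinuousOn (fun x : ℝℝ => z x.1 x.2) (Set.Ioo 0 (TT m) ×ˢ Set.Ioo 0 (TT m))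
  bd : ∀ p q, 0 < q → q ≤ p → p < TT m → |z p q| ≤ RR m * p ^ (3 * m - 2)
  eq : ∀ p q, 0 < p → p < TT m → 0 < q → q < TT m →
    z p q = (p - q) ^ 2 / 4 * ∫ β in (0:ℝ)..1, ∫ α in (0:ℝ)..1,
      max (α - β) 0 * gg μ z (q + (p - q) * α) (q + (p - q) * β)

lemma tri_flip {H : ℝ → ℝ → ℝ}
    (hH : ContinuousOn (fun x : ℝℝ => H x.1 x.2) (Set.Icc 0 1 ×ˢ Set.Icc 0 1)) :
    (∫ β in (0:ℝ)..1, ∫ α in (0:ℝ)..1, max (α - β) 0 * H α β) =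
      ∫ β in (0:ℝ)..1, ∫ α in (0:ℝ)..1, max (α - β) 0 * H (1 - β) (1 - α) := by
  have e1 : ∀ β : ℝ, (∫ α in (0:ℝ)..1, max (α - β) 0 * H (1 - β) (1 - α)) =
      ∫ α in (0:ℝ)..1, max (1 - β - α) 0 * H (1 - β) α := by
    intro β
    have := intervalIntegral.integral_comp_sub_left (a := 0) (b := 1)
      (fun α => max (1 - β - α) 0 * H (1 - β) α) 1
    simp only [sub_self, sub_zero] at this
    rw [← this]
    congr 1; ext α; congr 2; ring
  have e2 := intervalIntegral.integral_comp_sub_left (a := 0) (b := 1)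
      (fun β => ∫ α in (0:ℝ)..1, max (β - α) 0 * H β α) 1
  simp only [sub_self, sub_zero] at e2
  simp only [e1]
  rw [e2]
  have hc : ContinuousOn (fun x : ℝℝ => max (x.2 - x.1) 0 * H x.2 x.1)
      (Set.Icc 0 1 ×ˢ Set.Icc 0 1) := by
    refine ContinuousOn.mul (by fun_prop) ?_
    exact hH.comp (by fun_prop : ContinuousOn (fun x : ℝℝ => (x.2, x.1)) _)
      (fun x hx => ⟨hx.2, hx.1⟩)
  have hi : IntegrableOn (fun x : ℝℝ => max (x.2 - x.1) 0 * H x.2 x.1)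
      (Set.Icc 0 1 ×ˢ Set.Icc 0 1) (volume.prod volume) := by
    exact hc.integrableOn_compact (isCompact_Icc.prod isCompact_Icc)
  have hi2 := hi.mono_set (Set.prod_mono (Set.Ioc_subset_Icc_self (a := (0:ℝ)) (b := 1))
    (Set.Ioc_subset_Icc_self (a := (0:ℝ)) (b := 1)))
  simp only [intervalIntegral.integral_of_le (zero_le_one' ℝ)]
  apply MeasureTheory.integral_integral_swap
    (f := fun β α => max (α - β) 0 * H α β)
  rw [MeasureTheory.Measure.prod_restrict]
  exact hi2

lemma tri_seg {p q α : ℝ} {T : ℝ} (hp : 0 < p) (hpT : p < T) (hq : 0 < q) (hqT : q < T)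
    (h0 : 0 ≤ α) (h1 : α ≤ 1) : q + (p - q) * α ∈ Set.Ioo 0 T := by
  constructor
  · rcases h0.lt_or_eq with h | h
    · nlinarith [mul_pos hp h, mul_nonneg hq.le (sub_nonneg.2 h1)]
    · rw [← h]; simpa using hq
  · rcases h0.lt_or_eq with h | h
    · nlinarith [mul_pos (sub_pos.2 hpT) h, mul_nonneg (sub_pos.2 hqT).le (sub_nonneg.2 h1)]
    · rw [← h]; simpa using hqT

lemma cont_gg (h : Adm m μ) {z : ℝ → ℝ → ℝ} {T : ℝ}
    (hz : ContinuousOn (fun x : ℝℝ => z x.1 x.2) (Set.Ioo 0 T ×ˢ Set.Ioo 0 T)) :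
    ContinuousOn (fun x : ℝℝ => gg μ z x.1 x.2) (Set.Ioo 0 T ×ˢ Set.Ioo 0 T) := by
  rw [continuousOn_iff_continuous_domRestrict] at hz ⊢
  have h1 : Continuous fun x : (Set.Ioo (0:ℝ) T ×ˢ Set.Ioo (0:ℝ) T : Set (ℝℝ)) => x.1.1 := by
    fun_prop
  have h2 : Continuous fun x : (Set.Ioo (0:ℝ) T ×ˢ Set.Ioo (0:ℝ) T : Set (ℝℝ)) => x.1.2 := by
    fun_prop
  have h3 := cont_AA h h1 h2 (fun y => y.2.1.1) (fun y => y.2.2.1)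
  have h4 := cont_ee h h1 h2 (fun y => y.2.1.1) (fun y => y.2.2.1)
  have h5 : Continuous fun x : (Set.Ioo (0:ℝ) T ×ˢ Set.Ioo (0:ℝ) T : Set (ℝℝ)) => z x.1.1 x.1.2 := hz
  show Continuous fun x : (Set.Ioo (0:ℝ) T ×ˢ Set.Ioo (0:ℝ) T : Set (ℝℝ)) =>
    ee μ x.1.1 x.1.2 - ((AA μ x.1.1 x.1.2 + z x.1.1 x.1.2) ^ 5 - AA μ x.1.1 x.1.2 ^ 5)
  exact h4.sub (((h3.add h5).pow 5).sub (h3.pow 5))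

theorem exists_sol (h : Adm m μ) (hm : 1 ≤ m) : ∃ z, IsSol m μ z := by
  obtain ⟨x, hxn, hx⟩ := exists_fix h hm
  have hT0 := TT_pos m
  have hT1 : TT m ≤ 1 := (TT_le m).trans (by norm_num)
  have hTR : TT m ≤ 1 / RR m := (min_le_right _ _).trans (min_le_right _ _)
  have hR := RR_pos m
  classical
  set z0 : YT (TT m) → ℝ := fun y => y.w m (CL m) * x y with hz0
  have hz0c : Continuous z0 := (YT.cw m (CL m)).mul x.continuous
  set z : ℝ → ℝ → ℝ := fun p q =>
    if hh : 0 < min p q ∧ min p q ≤ max p q ∧ max p q < TT m then z0 ⟨(max p q, min p q), hh⟩ else 0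
    with hz
  have hzle : ∀ p q (hq : 0 < q) (hqp : q ≤ p) (hp : p < TT m), z p q = z0 ⟨(p, q), hq, hqp, hp⟩ := by
    intro p q hq hqp hp
    have e1 : min p q = q := min_eq_right hqp
    have e2 : max p q = p := max_eq_left hqp
    have hh : 0 < min p q ∧ min p q ≤ max p q ∧ max p q < TT m := by rw [e1, e2]; exact ⟨hq, hqp, hp⟩
    simp only [hz]
    rw [dif_pos hh]
    congr 2; rw [e1, e2]
  have hsymm : ∀ p q, z p q = z q p := by
    intro p q
    simp only [hz, max_comm p q, min_comm p q]
  have hbd : ∀ p q, 0 < q → q ≤ p → p < TT m → |z p q| ≤ RR m * p ^ (3 * m - 2) := by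
    intro p q hq hqp hp
    have hp0 := hq.trans_le hqp
    rw [hzle p q hq hqp hp]
    set y : YT (TT m) := ⟨(p, q), hq, hqp, hp⟩
    have h1 : |x y| ≤ RR m := (x.norm_coe_le_norm y).trans hxn
    have h2 : y.w m (CL m) ≤ p ^ (3 * m - 2) := by
      have := Gw_le_one (CL_pos m).le (pow_pos hq (2 * m)) (p - q)
      calc y.w m (CL m) ≤ p ^ (3 * m - 2) * 1 := mul_le_mul_of_nonneg_left this (by positivity)
        _ = _ := mul_one _
    have h3 := y.w_pos m (CL m)
    simp only [hz0]
    rw [abs_mul, abs_of_pos h3, mul_comm]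
    exact mul_le_mul h1 h2 h3.le hR.le
  have hcont : ContinuousOn (fun x : ℝℝ => z x.1 x.2)
      (Set.Ioo 0 (TT m) ×ˢ Set.Ioo 0 (TT m)) := by
    rw [continuousOn_iff_continuous_domRestrict]
    have hmem : ∀ x : (Set.Ioo 0 (TT m) ×ˢ Set.Ioo 0 (TT m) : Set (ℝℝ)),
      0 < min x.1.1 x.1.2 ∧ min x.1.1 x.1.2 ≤ max x.1.1 x.1.2 ∧ max x.1.1 x.1.2 < TT m :=
      fun x => ⟨lt_min x.2.1.1 x.2.2.1, min_le_max, max_lt x.2.1.2 x.2.2.2⟩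
    have : Set.domRestrict (Set.Ioo 0 (TT m) ×ˢ Set.Ioo 0 (TT m)) (fun x : ℝℝ => z x.1 x.2) =
        fun x => z0 ⟨(max x.1.1 x.1.2, min x.1.1 x.1.2), hmem x⟩ := by
      ext x
      show z x.1.1 x.1.2 = _
      simp only [hz]
      rw [dif_pos (hmem x)]
    rw [this]
    refine hz0c.comp ?_
    apply Continuous.subtype_mk
    fun_prop
  have hle1 : ∀ p q, 0 < q → q ≤ p → p < TT m → |z p q| ≤ 1 := by
    intro p q hq hqp hp
    have hp0 := hq.trans_le hqp
    refine (hbd p q hq hqp hp).trans ?_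
    have hk : 3 * m - 2 ≠ 0 := by omega
    have : p ^ (3 * m - 2) ≤ p := pow_le_of_le_one hp0.le (hp.le.trans hT1) hk
    calc RR m * p ^ (3 * m - 2) ≤ RR m * (1 / RR m) := by
          gcongr
          exact this.trans (hp.le.trans hTR)
      _ = 1 := by field_simp
  have heq1 : ∀ p q, 0 < q → q ≤ p → p < TT m → z p q = (p - q) ^ 2 / 4 *
      ∫ β in (0:ℝ)..1, ∫ α in (0:ℝ)..1,
      max (α - β) 0 * gg μ z (q + (p - q) * α) (q + (p - q) * β) := by
    intro p q hq hqp hp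
    rw [hzle p q hq hqp hp]
    set y : YT (TT m) := ⟨(p, q), hq, hqp, hp⟩ with hy
    have hw := y.w_pos m (CL m)
    simp only [hz0]
    rw [hx y]
    show y.w m (CL m) * ((p - q) ^ 2 / (4 * y.w m (CL m)) * _) = _
    have e0 : ∀ J : ℝ, y.w m (CL m) * ((p - q) ^ 2 / (4 * y.w m (CL m)) * J) = (p - q) ^ 2 / 4 * J := by
      intro J; field_simp
    rw [e0]
    congr 1
    refine intervalIntegral.integral_congr fun β hβ => ?_
    refine intervalIntegral.integral_congr fun α hα => ?_
    rw [Set.uIcc_of_le zero_le_one] at hα hβ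
    show max (α - β) 0 * ((y.tri α β).U m * (y.tri α β).w m (CL m) *
      Nfun μ m (CL m) x (y.tri α β)) = max (α - β) 0 * gg μ z _ _
    rcases le_or_gt α β with hab | hab
    · have : max (α - β) 0 = 0 := max_eq_right (by linarith)
      rw [this]; simp
    · congr 1
      set y' := y.tri α β with hy'
      have hU' := y'.U_pos m
      have hw' := y'.w_pos m (CL m)
      have ep : y'.p = q + (p - q) * α := by
        rw [hy', YT.tri_p, max_eq_left hab.le, c01_eq hα.1 hα.2]; rfl
      have eq' : y'.q = q + (p - q) * β := by
        rw [hy', YT.tri_q, c01_eq hβ.1 hβ.2]; rfl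
      have ez : z y'.p y'.q = y'.w m (CL m) * x y' := hzle y'.p y'.q y'.q0 y'.qp y'.pT
      have e1 := hle1 y'.p y'.q y'.q0 y'.qp y'.pT
      unfold Nfun gg NL
      rw [← ez, clip_eq e1, ← ep, ← eq']
      field_simp
  refine ⟨z, hsymm, hcont, hbd, ?_⟩
  intro p q hp hpT hq hqT
  rcases le_or_gt q p with hqp | hqp
  · exact heq1 p q hq hqp hpT
  · rw [hsymm, heq1 q p hp hqp.le hqT]
    have e1 : (q - p) ^ 2 / 4 = (p - q) ^ 2 / 4 := by ring
    rw [e1]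
    congr 1
    rw [tri_flip (H := fun α β => gg μ z (p + (q - p) * α) (p + (q - p) * β))]
    · refine intervalIntegral.integral_congr fun β _ => ?_
      refine intervalIntegral.integral_congr fun α _ => ?_
      congr 1
      have e2 : p + (q - p) * (1 - β) = q + (p - q) * β := by ring
      have e3 : p + (q - p) * (1 - α) = q + (p - q) * α := by ring
      rw [e2, e3]
      unfold gg
      rw [hsymm, ee_symm, AA_symm]
    · refine (cont_gg h hcont).comp (f := fun x : ℝℝ => (p + (q - p) * x.1, p + (q - p) * x.2))
        (by fun_prop) ?_
      intro x hx
      exact ⟨tri_seg hq hqT hp hpT hx.1.1 hx.1.2, tri_seg hq hqT hp hpT hx.2.1 hx.2.2⟩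

end

end

section

def clampR (a b x : ℝ) : ℝ := max a (min x b)
lemma clampR_mem {a b : ℝ} (hab : a ≤ b) (x : ℝ) : clampR a b x ∈ Set.Icc a b :=
  ⟨le_max_left _ _, max_le hab (min_le_right _ _)⟩
lemma clampR_eq {a b x : ℝ} (h : x ∈ Set.Icc a b) : clampR a b x = x := by
  simp [clampR, h.1, h.2]
lemma clampR_cont {a b : ℝ} : Continuous (clampR a b) := by unfold clampR; fun_prop

structure NemData (Y : Type) [TopologicalSpace Y] (a b : ℝ) where
  hab : a ≤ b
  G : ℕ → Y → ℝ → ℝ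
  cont : ∀ j, ContinuousOn (fun x : Y × ℝ => G j x.1 x.2) (Set.univ ×ˢ Set.Icc a b)
  der : ∀ j y τ, τ ∈ Set.Icc a b → HasDerivAt (G j y) (G (j + 1) y τ) τ
  C : ℕ → ℝ
  bd : ∀ j y τ, τ ∈ Set.Icc a b → |G j y τ| ≤ C j

lemma mulL_contDiffOn {B : Type} [NormedCommRing B] [NormedAlgebra ℝ B] {f : B → B} {s : Set B} {n : WithTop ℕ∞}
    (hf : ContDiffOn ℝ n f s) : ContDiffOn ℝ n (fun u => ContinuousLinearMap.mul ℝ B (f u)) s :=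
  (ContinuousLinearMap.mul ℝ B).contDiff.comp_contDiffOn hf

namespace NemData
variable {Y : Type} [TopologicalSpace Y] {a b : ℝ} (N : NemData Y a b)

def map (j : ℕ) (u : Y →ᵇ ℝ) : Y →ᵇ ℝ :=
  BoundedContinuousFunction.ofNormedAddCommGroup (fun y => N.G j y (clampR a b (u y)))
    (by
      have h := N.cont j
      have := h.comp_continuous (f := fun y => (y, clampR a b (u y)))
        (continuous_id.prodMk (clampR_cont.comp u.continuous))
        (fun y => ⟨trivial, clampR_mem N.hab _⟩)
      exact this)
    (N.C j) (fun y => N.bd j y _ (clampR_mem N.hab _))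

lemma map_apply (j : ℕ) {u : Y →ᵇ ℝ} {y : Y} (h : u y ∈ Set.Icc a b) : N.map j u y = N.G j y (u y) := by
  show N.G j y (clampR a b (u y)) = _
  rw [clampR_eq h]

lemma taylor1 (j : ℕ) (y : Y) {s t : ℝ} (hs : s ∈ Set.Icc a b) (ht : t ∈ Set.Icc a b) :
    |N.G j y t - N.G j y s| ≤ N.C (j + 1) * |t - s| := by
  have := (convex_Icc a b).norm_image_sub_le_of_norm_hasDerivWithin_le (f := N.G j y)
    (f' := N.G (j + 1) y) (C := N.C (j + 1))
    (fun x hx => (N.der j y x hx).hasDerivWithinAt) (fun x hx => N.bd (j + 1) y x hx) hs ht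
  exact this

lemma taylor2 (j : ℕ) (y : Y) {s t : ℝ} (hs : s ∈ Set.Icc a b) (ht : t ∈ Set.Icc a b) :
    |N.G j y t - N.G j y s - N.G (j + 1) y s * (t - s)| ≤ N.C (j + 2) * |t - s| * |t - s| := by
  have hC : 0 ≤ N.C (j + 2) := (abs_nonneg _).trans (N.bd (j + 2) y s hs)
  have hsub : Set.uIcc s t ⊆ Set.Icc a b := Set.uIcc_subset_Icc hs ht
  have := (convex_uIcc s t).norm_image_sub_le_of_norm_hasDerivWithin_le
    (f := fun x => N.G j y x - N.G (j + 1) y s * x)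
    (f' := fun x => N.G (j + 1) y x - N.G (j + 1) y s) (C := N.C (j + 2) * |t - s|)
    (fun x hx => by
      have h1 := N.der j y x (hsub hx)
      have h2 := (hasDerivAt_id x).const_mul (N.G (j + 1) y s)
      have h3 := (h1.sub h2).hasDerivWithinAt (s := Set.uIcc s t)
      rw [mul_one] at h3
      exact h3)
    (fun x hx => by
      refine (N.taylor1 (j + 1) y hs (hsub hx)).trans ?_
      refine mul_le_mul_of_nonneg_left ?_ hC
      exact Set.abs_sub_left_of_mem_uIcc hx)
    Set.left_mem_uIcc Set.right_mem_uIcc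
  refine le_trans (le_of_eq ?_) this
  rw [Real.norm_eq_abs]; congr 1; ring

def dom (a b : ℝ) : Set (Y →ᵇ ℝ) := {u | ∃ ε > 0, ∀ y, u y ∈ Set.Icc (a + ε) (b - ε)}

lemma dom_open : IsOpen (dom a b : Set (Y →ᵇ ℝ)) := by
  rw [Metric.isOpen_iff]
  rintro u ⟨ε, hε, h⟩
  refine ⟨ε / 2, by positivity, fun v hv => ⟨ε / 2, by positivity, fun y => ?_⟩⟩
  have h1 : dist (v y) (u y) ≤ dist v u := BoundedContinuousFunction.dist_coe_le_dist y
  have h2 : dist v u < ε / 2 := hv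
  rw [Real.dist_eq] at h1
  have h3 := abs_le.1 (h1.trans h2.le)
  have := h y
  constructor <;> [linarith [this.1]; linarith [this.2]]

lemma dom_mem {u : Y →ᵇ ℝ} (h : u ∈ (dom a b : Set (Y →ᵇ ℝ))) (y : Y) : u y ∈ Set.Icc a b := by
  obtain ⟨ε, hε, h⟩ := h
  have := h y
  constructor <;> [linarith [this.1]; linarith [this.2]]

lemma hasFDeriv (j : ℕ) {u : Y →ᵇ ℝ} (hu : u ∈ (dom a b : Set (Y →ᵇ ℝ))) :
    HasFDerivAt (N.map j) (ContinuousLinearMap.mul ℝ (Y →ᵇ ℝ) (N.map (j + 1) u)) u := by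
  rw [hasFDerivAt_iff_isLittleO_nhds_zero]
  have hO : (fun h : Y →ᵇ ℝ => N.map j (u + h) - N.map j u -
      (ContinuousLinearMap.mul ℝ (Y →ᵇ ℝ) (N.map (j + 1) u)) h) =O[𝓝 0] fun h => ‖h‖ ^ 2 := by
    have hev : ∀ᶠ h in 𝓝 (0 : Y →ᵇ ℝ), u + h ∈ (dom a b : Set (Y →ᵇ ℝ)) := by
      have : ContinuousAt (fun h : Y →ᵇ ℝ => u + h) 0 := by fun_prop
      exact this.eventually (by show _ ∈ 𝓝 (u + 0); rw [add_zero]; exact dom_open.mem_nhds hu)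
    refine Asymptotics.IsBigO.of_bound (|N.C (j + 2)|) ?_
    filter_upwards [hev] with h hh
    refine (BoundedContinuousFunction.norm_le (by positivity)).2 fun y => ?_
    have m1 := dom_mem hu y
    have m2 := dom_mem hh y
    have t := N.taylor2 j y m1 m2
    have e : (N.map j (u + h) - N.map j u -
      (ContinuousLinearMap.mul ℝ (Y →ᵇ ℝ) (N.map (j + 1) u)) h) y =
      N.G j y ((u + h) y) - N.G j y (u y) - N.G (j + 1) y (u y) * ((u + h) y - u y) := by
      have e1 := N.map_apply j m1
      have e2 := N.map_apply j m2
      have e3 := N.map_apply (j + 1) m1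
      rw [← e1, ← e2, ← e3]
      simp [ContinuousLinearMap.mul_apply']
    rw [e]
    refine t.trans ?_
    have e4 : (u + h) y - u y = h y := by simp
    rw [e4]
    have h5 : |h y| ≤ ‖h‖ := h.norm_coe_le_norm y
    rw [norm_pow, norm_norm, mul_assoc, ← sq]
    have h6 : |h y| ^ 2 ≤ ‖h‖ ^ 2 := by gcongr
    exact mul_le_mul (le_abs_self _) h6 (by positivity) (abs_nonneg _)
  refine hO.trans_isLittleO ?_
  exact (Asymptotics.isLittleO_norm_pow_id one_lt_two)

lemma contDiffOn_nat (n : ℕ) : ∀ j, ContDiffOn ℝ n (N.map j) (dom a b) := by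
  induction n with
  | zero =>
    intro j
    rw [Nat.cast_zero, contDiffOn_zero]
    exact fun u hu => (N.hasFDeriv j hu).continuousAt.continuousWithinAt
  | succ n ih =>
    intro j
    push_cast
    rw [contDiffOn_succ_iff_fderiv_of_isOpen dom_open]
    refine ⟨fun u hu => (N.hasFDeriv j hu).differentiableAt.differentiableWithinAt, ?_, ?_⟩
    · intro h; exact absurd h (by simp)
    · have : ContDiffOn ℝ n (fun u => ContinuousLinearMap.mul ℝ (Y →ᵇ ℝ) (N.map (j + 1) u)) (dom a b) :=
        mulL_contDiffOn (ih (j + 1))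
      exact this.congr fun u hu => (N.hasFDeriv j hu).fderiv

lemma contDiffAt (j : ℕ) {u : Y →ᵇ ℝ} (hu : u ∈ (dom a b : Set (Y →ᵇ ℝ))) :
    CDAt (N.map j) u := by
  rw [contDiffAt_infty]
  exact fun n => (N.contDiffOn_nat n j).contDiffAt (dom_open.mem_nhds hu)

def ofSmooth (Y : Type) [TopologicalSpace Y] {f : ℝ → ℝ} {O : Set ℝ} (hO : IsOpen O)
    (hf : CDOn f O) {a b : ℝ} (hab : a ≤ b) (hI : Set.Icc a b ⊆ O) : NemData Y a b :=
  have hc : ∀ j, CDOn (iteratedDeriv j f) O := by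
    intro j
    induction j with
    | zero => simpa using hf
    | succ j ih =>
      rw [iteratedDeriv_succ]
      exact ih.deriv_of_isOpen hO (by simp)
  have hb : ∀ j, ∃ C, ∀ τ ∈ Set.Icc a b, |iteratedDeriv j f τ| ≤ C := fun j =>
    isCompact_Icc.exists_bound_of_continuousOn ((hc j).continuousOn.mono hI)
  { hab := hab
    G := fun j _ => iteratedDeriv j f
    cont := fun j => ((hc j).continuousOn.mono hI).comp continuousOn_snd (fun x hx => hx.2)
    der := fun j y τ hτ => by
      rw [iteratedDeriv_succ]
      have := ((hc j).contDiffAt (hO.mem_nhds (hI hτ))).differentiableAt (by simp)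
      exact this.hasDerivAt
    C := fun j => (hb j).choose
    bd := fun j y τ hτ => (hb j).choose_spec τ hτ }

end NemData

section
variable {B : Type} [NormedCommRing B] [NormedAlgebra ℝ B]

def H4 (a b : B) : B := a ^ 4 + a ^ 3 * b + a ^ 2 * b ^ 2 + a * b ^ 3 + b ^ 4

lemma H4_diff (A l x y : B) : x * H4 (A + l * x) A - y * H4 (A + l * y) A =
    (x - y) * H4 (A + l * x) (A + l * y) := by unfold H4; ring

def FF (kap lam : B) (c A : B) (K : B →L[ℝ] B) (x : B) : B :=
  x - K (c - kap * (x * H4 (A + lam * x) A))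

lemma ift_abs [CompleteSpace B] {E : Type} [NormedAddCommGroup E] [NormedSpace ℝ E] [CompleteSpace E]
    {kap lam : B} {c A : E → B} {K : E → B →L[ℝ] B} {e0 : E} {x0 : B}
    (hc : CDAt c e0) (hA : CDAt A e0)
    (hK : CDAt K e0)
    (h0 : FF kap lam (c e0) (A e0) (K e0) x0 = 0)
    (hs : ‖K e0‖ * ‖kap * (5 * (A e0 + lam * x0) ^ 4)‖ < 1) :
    ∃ X : E → B, CDAt X e0 ∧ X e0 = x0 ∧
      ∀ᶠ e in 𝓝 e0, FF kap lam (c e) (A e) (K e) (X e) = 0 := by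
  set f : E × B → B := fun u => FF kap lam (c u.1) (A u.1) (K u.1) u.2 with hf
  have cdf : CDAt f (e0, x0) := by
    have c1 : CDAt (fun u : E × B => c u.1) (e0, x0) := hc.comp (e0, x0) contDiffAt_fst
    have c2 : CDAt (fun u : E × B => A u.1) (e0, x0) := hA.comp (e0, x0) contDiffAt_fst
    have c3 : CDAt (fun u : E × B => K u.1) (e0, x0) := hK.comp (e0, x0) contDiffAt_fst
    have c4 : CDAt (fun u : E × B => u.2) (e0, x0) := contDiffAt_snd
    unfold f FF H4
    refine c4.sub (c3.clm_apply (c1.sub ?_))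
    fun_prop
  have hx : HasFDerivAt (fun x => f (e0, x)) (ContinuousLinearMap.id ℝ B -
      (K e0).comp (-(ContinuousLinearMap.mul ℝ B (kap * (5 * (A e0 + lam * x0) ^ 4))))) x0 := by
    unfold f FF
    refine (hasFDerivAt_id x0).sub ((K e0).hasFDerivAt.comp x0 ?_)
    have h1 : HasFDerivAt (fun x : B => A e0 + lam * x) (lam • ContinuousLinearMap.id ℝ B) x0 :=
      ((hasFDerivAt_id x0).const_mul lam).const_add (A e0)
    have h2 : HasFDerivAt (fun x : B => c e0 - kap * (x * H4 (A e0 + lam * x) (A e0))) _ x0 :=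
      ((HasFDerivAt.mul (hasFDerivAt_id x0) (((((h1.pow 4).add ((h1.pow 3).mul_const (A e0))).add
        ((h1.pow 2).mul_const (A e0 ^ 2))).add (h1.mul_const (A e0 ^ 3))).add_const
          (A e0 ^ 4))).const_mul kap).const_sub (c e0)
    refine h2.congr_fderiv ?_
    ext v
    simp [H4]
    ring
  have if2 : (fderiv ℝ f (e0, x0) ∘L .inr ℝ E B).IsInvertible := by
    have h1 : fderiv ℝ f (e0, x0) ∘L .inr ℝ E B = ContinuousLinearMap.id ℝ B -
      (K e0).comp (-(ContinuousLinearMap.mul ℝ B (kap * (5 * (A e0 + lam * x0) ^ 4)))) := by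
      have h2 : HasFDerivAt (fun x : B => f (e0, x)) (fderiv ℝ f (e0, x0) ∘L .inr ℝ E B) x0 := by
        have hd : HasFDerivAt f (fderiv ℝ f (e0, x0)) (e0, x0) :=
          (cdf.differentiableAt (by simp)).hasFDerivAt
        exact hd.comp x0 (hasFDerivAt_prodMk_right e0 x0)
      exact h2.unique hx
    rw [h1]
    have hn : ‖(K e0).comp (-(ContinuousLinearMap.mul ℝ B (kap * (5 * (A e0 + lam * x0) ^ 4))))‖ < 1 := by
      refine lt_of_le_of_lt ((ContinuousLinearMap.opNorm_comp_le _ _).trans ?_) hs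
      rw [norm_neg]
      gcongr
      exact ContinuousLinearMap.opNorm_mul_apply_le _ _ _
    have hu := (Units.oneSub _ hn).isUnit
    rw [Units.val_oneSub] at hu
    obtain ⟨w, hw⟩ := hu
    exact ⟨ContinuousLinearEquiv.unitsEquiv ℝ B w, hw⟩
  have pn : ((⊤ : ℕ∞) : WithTop ℕ∞) ≠ 0 := by simp
  refine ⟨cdf.implicitFunction pn if2, cdf.contDiffAt_implicitFunction pn if2,
    cdf.implicitFunction_apply_self pn if2, ?_⟩
  have := cdf.eventually_apply_implicitFunction pn if2
  filter_upwards [this] with e he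
  exact he.trans h0

lemma ff_unique {kap lam c A : B} {K : B →L[ℝ] B} {x y : B}
    (hx : FF kap lam c A K x = 0) (hy : FF kap lam c A K y = 0)
    (h : ‖K‖ * ‖kap * H4 (A + lam * x) (A + lam * y)‖ < 1) : x = y := by
  have h1 : x - y = K (-(kap * H4 (A + lam * x) (A + lam * y) * (x - y))) := by
    unfold FF at hx hy
    rw [sub_eq_zero] at hx hy
    conv_lhs => rw [hx, hy]
    rw [← map_sub]
    congr 1
    linear_combination (-kap) * H4_diff A lam x y
  by_contra hne
  have hpos : 0 < ‖x - y‖ := norm_pos_iff.2 (sub_ne_zero.2 hne)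
  have h2 : ‖x - y‖ ≤ ‖K‖ * ‖kap * H4 (A + lam * x) (A + lam * y)‖ * ‖x - y‖ := by
    conv_lhs => rw [h1]
    refine (K.le_opNorm _).trans ?_
    rw [norm_neg, mul_assoc ‖K‖]
    exact mul_le_mul_of_nonneg_left (norm_mul_le (kap * H4 (A + lam * x) (A + lam * y)) (x - y))
      (norm_nonneg K)
  nlinarith
end

end

section

def Y2 (S : Set ℝ) : Type :=
  {y : ℝ × ℝ × ℝ // y.1 ∈ S ∧ 0 < y.1 ∧ y.1 ≤ 1 ∧ -1 ≤ y.2.2 ∧ y.2.2 ≤ y.2.1 ∧ y.2.1 ≤ 1}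
instance (S : Set ℝ) : TopologicalSpace (Y2 S) := inferInstanceAs (TopologicalSpace {y : ℝ × ℝ × ℝ // _})

namespace Y2
variable {S : Set ℝ}
def s (y : Y2 S) : ℝ := y.1.1
def u (y : Y2 S) : ℝ := y.1.2.1
def v (y : Y2 S) : ℝ := y.1.2.2
@[fun_prop] lemma cs : Continuous (s : Y2 S → ℝ) := continuous_fst.comp continuous_subtype_val
@[fun_prop] lemma cu : Continuous (u : Y2 S → ℝ) :=
  continuous_fst.comp (continuous_snd.comp continuous_subtype_val)
@[fun_prop] lemma cv : Continuous (v : Y2 S → ℝ) :=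
  continuous_snd.comp (continuous_snd.comp continuous_subtype_val)
lemma sS (y : Y2 S) : y.s ∈ S := y.2.1
lemma s0 (y : Y2 S) : 0 < y.s := y.2.2.1
lemma s1 (y : Y2 S) : y.s ≤ 1 := y.2.2.2.1
lemma v1 (y : Y2 S) : -1 ≤ y.v := y.2.2.2.2.1
lemma vu (y : Y2 S) : y.v ≤ y.u := y.2.2.2.2.2.1
lemma u1 (y : Y2 S) : y.u ≤ 1 := y.2.2.2.2.2.2

def tri (y : Y2 S) (α β : ℝ) : Y2 S :=
  ⟨(y.s, y.v + (y.u - y.v) * c01 (max α β), y.v + (y.u - y.v) * c01 β), by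
    have h1 := y.v1
    have h2 := y.vu
    have h3 := y.u1
    have h4 := c01_mono (le_max_right α β)
    have h5 := c01_nonneg β
    have h6 := c01_le (max α β)
    refine ⟨y.sS, y.s0, y.s1, ?_, ?_, ?_⟩
    · show -1 ≤ y.v + (y.u - y.v) * c01 β
      nlinarith
    · show y.v + (y.u - y.v) * c01 β ≤ y.v + (y.u - y.v) * c01 (max α β)
      nlinarith
    · show y.v + (y.u - y.v) * c01 (max α β) ≤ 1
      nlinarith⟩
@[simp] lemma tri_s (y : Y2 S) (α β : ℝ) : (y.tri α β).s = y.s := rfl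
@[simp] lemma tri_u (y : Y2 S) (α β : ℝ) : (y.tri α β).u = y.v + (y.u - y.v) * c01 (max α β) := rfl
@[simp] lemma tri_v (y : Y2 S) (α β : ℝ) : (y.tri α β).v = y.v + (y.u - y.v) * c01 β := rfl
lemma ctri : Continuous fun x : Y2 S × ℝ × ℝ => x.1.tri x.2.1 x.2.2 := by
  apply Continuous.subtype_mk
  fun_prop

def a (m : ℕ) (y : Y2 S) : ℝ := y.s ^ (2 * m)
def d (y : Y2 S) : ℝ := y.s * (y.u - y.v)
def D (m : ℕ) (y : Y2 S) : ℝ := y.a m ^ 2 + y.d ^ 2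
def R (m : ℕ) (y : Y2 S) : ℝ := (√(y.D m))⁻¹
def w (m : ℕ) (Λ : ℝ) (y : Y2 S) : ℝ := y.s ^ (3 * m - 2) * Gw Λ (y.a m) y.d
def U (m : ℕ) (y : Y2 S) : ℝ := y.a m * y.R m ^ 3

lemma a_pos (m : ℕ) (y : Y2 S) : 0 < y.a m := pow_pos y.s0 _
lemma a_le (m : ℕ) (y : Y2 S) : y.a m ≤ 1 := pow_le_one₀ y.s0.le y.s1
lemma d_nonneg (y : Y2 S) : 0 ≤ y.d := mul_nonneg y.s0.le (by linarith [y.vu])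
lemma d_le (y : Y2 S) : y.d ≤ 2 := by
  have h1 := y.s0; have h2 := y.s1; have h3 := y.vu; have h4 := y.v1; have h5 := y.u1
  unfold d; nlinarith
lemma D_pos (m : ℕ) (y : Y2 S) : 0 < y.D m := sq_pos' (y.a_pos m) _
lemma R_pos (m : ℕ) (y : Y2 S) : 0 < y.R m := inv_pos.2 (sqrt_pos.2 (y.D_pos m))
lemma w_pos (m : ℕ) (Λ : ℝ) (y : Y2 S) : 0 < y.w m Λ := mul_pos (pow_pos y.s0 _) (Gw_pos _ _ _)
lemma U_pos (m : ℕ) (y : Y2 S) : 0 < y.U m := mul_pos (y.a_pos m) (pow_pos (y.R_pos m) _)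
lemma R_sq (m : ℕ) (y : Y2 S) : y.R m ^ 2 * y.D m = 1 := by
  have h0 := y.D_pos m
  unfold R
  rw [inv_pow, sq_sqrt h0.le]; field_simp

@[fun_prop] lemma ca (m : ℕ) : Continuous (a m : Y2 S → ℝ) := by unfold a; fun_prop
@[fun_prop] lemma cd : Continuous (d : Y2 S → ℝ) := by unfold d; fun_prop
@[fun_prop] lemma cD (m : ℕ) : Continuous (D m : Y2 S → ℝ) := by unfold D; fun_prop
@[fun_prop] lemma cR (m : ℕ) : Continuous (R m : Y2 S → ℝ) :=
  Continuous.inv₀ (by fun_prop) fun y => (sqrt_pos.2 (y.D_pos m)).ne'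
lemma G_eq (m : ℕ) (Λ : ℝ) (y : Y2 S) : Gw Λ (y.a m) y.d = exp (-Λ * (y.a m * y.R m)) := rfl
@[fun_prop] lemma cG (m : ℕ) (Λ : ℝ) : Continuous (fun y : Y2 S => Gw Λ (y.a m) y.d) := by
  simp only [G_eq]; fun_prop
@[fun_prop] lemma cw (m : ℕ) (Λ : ℝ) : Continuous (w m Λ : Y2 S → ℝ) := by unfold w; fun_prop
@[fun_prop] lemma cU (m : ℕ) : Continuous (U m : Y2 S → ℝ) := by unfold U; fun_prop

lemma bound (m : ℕ) {Λ : ℝ} (hΛ : 0 < Λ) (y : Y2 S) :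
    y.d ^ 2 / (4 * y.w m Λ) * ∫ β in (0:ℝ)..1, ∫ α in (0:ℝ)..1,
      max (α - β) 0 * ((y.tri α β).U m * (y.tri α β).w m Λ) ≤ 4⁻¹ * Λ⁻¹ := by
  have hker : Continuous fun x : ℝℝ =>
      max (x.1 - x.2) 0 * ((y.tri x.1 x.2).U m * (y.tri x.1 x.2).w m Λ) := by
    have h1 : Continuous fun x : ℝℝ => y.tri x.1 x.2 :=
      ctri.comp (by fun_prop : Continuous fun x : ℝℝ => (y, x.1, x.2))
    have h2 := (cU (S := S) m).comp h1
    have h3 := (cw (S := S) m Λ).comp h1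
    exact (by fun_prop : Continuous fun x : ℝℝ => max (x.1 - x.2) 0).mul (h2.mul h3)
  have inner : ∀ β ∈ Set.Icc (0:ℝ) 1, y.d ^ 2 * (∫ α in (0:ℝ)..1,
      max (α - β) 0 * ((y.tri α β).U m * (y.tri α β).w m Λ)) ≤ Λ⁻¹ * y.w m Λ := by
    intro β hβ
    have hk := kernel_bound (Λ := Λ) (a := y.a m) (d := y.d) (β := β) hΛ (y.a_pos m) y.d_nonneg hβ.1 hβ.2
    have e1 : (∫ α in (0:ℝ)..1, max (α - β) 0 * ((y.tri α β).U m * (y.tri α β).w m Λ)) =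
        ∫ α in (0:ℝ)..1, y.s ^ (3 * m - 2) * (max (α - β) 0 *
      (y.a m * (√(y.a m ^ 2 + (y.d * (max (α - β) 0)) ^ 2))⁻¹ ^ 3 *
        Gw Λ (y.a m) (y.d * max (α - β) 0))) := by
      apply intervalIntegral.integral_congr
      intro α hα
      rw [Set.uIcc_of_le zero_le_one] at hα
      have hd : (y.tri α β).d = y.d * max (α - β) 0 := by
        show y.s * ((y.v + (y.u - y.v) * c01 (max α β)) - (y.v + (y.u - y.v) * c01 β)) =
          y.s * (y.u - y.v) * max (α - β) 0
        rw [c01_eq hβ.1 hβ.2, c01_eq (hβ.1.trans (le_max_right _ _)) (max_le hα.2 hβ.2)]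
        rw [show max α β = max (α - β) 0 + β by rw [← max_add_add_right]; simp]
        ring
      have ha : (y.tri α β).a m = y.a m := rfl
      simp only [U, w, R, D, hd, ha, tri_s]
      ring
    rw [e1, intervalIntegral.integral_const_mul]
    have h0 : 0 < y.s ^ (3 * m - 2) := pow_pos y.s0 _
    calc _ = y.s ^ (3 * m - 2) * (y.d ^ 2 * _) := by ring
      _ ≤ y.s ^ (3 * m - 2) * (Λ⁻¹ * Gw Λ (y.a m) y.d) := mul_le_mul_of_nonneg_left hk h0.le
      _ = _ := by unfold w; ring
  have hin : Continuous fun β : ℝ => ∫ α in (0:ℝ)..1,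
      max (α - β) 0 * ((y.tri α β).U m * (y.tri α β).w m Λ) := by
    apply continuous_parametric_intervalIntegral_of_continuous' (μ := volume)
      (f := fun β α => max (α - β) 0 * ((y.tri α β).U m * (y.tri α β).w m Λ))
    exact hker.comp (by fun_prop : Continuous fun z : ℝℝ => (z.2, z.1))
  have h2 : y.d ^ 2 * (∫ β in (0:ℝ)..1, ∫ α in (0:ℝ)..1,
      max (α - β) 0 * ((y.tri α β).U m * (y.tri α β).w m Λ)) ≤ Λ⁻¹ * y.w m Λ := by
    rw [← intervalIntegral.integral_const_mul]
    have := intervalIntegral.integral_mono_on (a := (0:ℝ)) (b := 1) zero_le_one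
      ((continuous_const.mul hin).intervalIntegrable (μ := volume) _ _)
      (intervalIntegrable_const (c := Λ⁻¹ * y.w m Λ)) inner
    simpa using this
  have hw := y.w_pos m Λ
  calc _ = (y.d ^ 2 * (∫ β in (0:ℝ)..1, ∫ α in (0:ℝ)..1,
      max (α - β) 0 * ((y.tri α β).U m * (y.tri α β).w m Λ))) * (4⁻¹ * (y.w m Λ)⁻¹) := by
        field_simp
    _ ≤ (Λ⁻¹ * y.w m Λ) * (4⁻¹ * (y.w m Λ)⁻¹) := mul_le_mul_of_nonneg_right h2 (by positivity)
    _ = _ := by field_simp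

def K (S : Set ℝ) (m : ℕ) {Λ : ℝ} (hΛ : 0 < Λ) : KData (Y2 S) where
  W1 y := y.d ^ 2 / (4 * y.w m Λ)
  W2 y := y.U m * y.w m Λ
  tri y α β := y.tri α β
  cW1 := by
    refine Continuous.div (by fun_prop) (continuous_const.mul (cw m Λ)) fun y => ?_
    have := y.w_pos m Λ
    positivity
  cW2 := (cU m).mul (cw m Λ)
  ctri := ctri
  pW1 y := by have := y.w_pos m Λ; positivity
  pW2 y := (mul_pos (y.U_pos m) (y.w_pos m Λ)).le
  κ := 4⁻¹ * Λ⁻¹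
  bound y := bound m hΛ y

lemma K_norm (S : Set ℝ) (m : ℕ) {Λ : ℝ} (hΛ : 0 < Λ) : ‖(K S m hΛ).op‖ ≤ 4⁻¹ * Λ⁻¹ :=
  (K S m hΛ).norm_op_le (by show (0:ℝ) ≤ 4⁻¹ * Λ⁻¹; positivity)

def inc {S : Set ℝ} (s : ℝ) (hs : s ∈ S) : C(Y2 {s}, Y2 S) where
  toFun y := ⟨y.1, by
    have h : y.1.1 = s := y.2.1
    exact ⟨by rw [h]; exact hs, y.2.2⟩⟩
  continuous_toFun := by
    apply Continuous.subtype_mk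
    exact continuous_subtype_val

end Y2

def mkB {Y : Type} [TopologicalSpace Y] (f : Y → ℝ) (hf : Continuous f) (C : ℝ) (h : ∀ y, |f y| ≤ C) :
    Y →ᵇ ℝ := BoundedContinuousFunction.ofNormedAddCommGroup f hf C h
@[simp] lemma mkB_apply {Y : Type} [TopologicalSpace Y] (f : Y → ℝ) (hf : Continuous f) (C : ℝ)
    (h : ∀ y, |f y| ≤ C) (y : Y) : mkB f hf C h y = f y := rfl

namespace Y2
variable {S : Set ℝ}
lemma aR_le (m : ℕ) (y : Y2 S) : y.a m * y.R m ≤ 1 := ratio_le_one (y.a_pos m) _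
lemma aR_nonneg (m : ℕ) (y : Y2 S) : 0 ≤ y.a m * y.R m := (mul_pos (y.a_pos m) (y.R_pos m)).le

def bu (S : Set ℝ) : Y2 S →ᵇ ℝ := mkB u cu 1 fun y => abs_le.2 ⟨y.v1.trans y.vu, y.u1⟩
def bv (S : Set ℝ) : Y2 S →ᵇ ℝ := mkB v cv 1 fun y => abs_le.2 ⟨y.v1, y.vu.trans y.u1⟩
def bk (S : Set ℝ) (m : ℕ) : Y2 S →ᵇ ℝ := mkB (fun y => y.a m * y.R m) (by fun_prop) 1 fun y => by
  rw [abs_of_nonneg (y.aR_nonneg m)]; exact y.aR_le m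
def bα (S : Set ℝ) (m : ℕ) : Y2 S →ᵇ ℝ := mkB (fun y => (y.a m * y.R m) ^ 2) (by fun_prop) 1 fun y => by
  rw [abs_of_nonneg (by positivity)]; exact pow_le_one₀ (y.aR_nonneg m) (y.aR_le m)
lemma dR_sq (m : ℕ) (y : Y2 S) : (y.a m * y.R m) ^ 2 + (y.d * y.R m) ^ 2 = 1 := by
  have := y.R_sq m; unfold D at this; linear_combination this
def bβ (S : Set ℝ) (m : ℕ) : Y2 S →ᵇ ℝ := mkB (fun y => (y.d * y.R m) ^ 2) (by fun_prop) 1 fun y => by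
  rw [abs_of_nonneg (by positivity)]; nlinarith [y.dR_sq m, sq_nonneg (y.a m * y.R m)]
lemma D_le (m : ℕ) (y : Y2 S) : y.D m ≤ 9 := by
  have h1 := y.a_pos m; have h2 := y.a_le m; have h3 := y.d_nonneg; have h4 := y.d_le
  unfold D; nlinarith
def bl (S : Set ℝ) (m : ℕ) (Λ : ℝ) (hΛ : 0 < Λ) : Y2 S →ᵇ ℝ :=
  mkB (fun y => y.s ^ (2 * m - 2) * Gw Λ (y.a m) y.d * √(y.D m)) (by fun_prop) 3 fun y => by
    have h1 : y.s ^ (2 * m - 2) ≤ 1 := pow_le_one₀ y.s0.le y.s1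
    have h2 := Gw_le_one hΛ.le (y.a_pos m) y.d
    have h3 := (Gw_pos Λ (y.a m) y.d).le
    have h4 : √(y.D m) ≤ 3 := by
      rw [show (3:ℝ) = √9 by rw [show (9:ℝ) = 3 ^ 2 by norm_num]; simp]
      exact sqrt_le_sqrt (y.D_le m)
    have h0 := y.s0.le
    rw [abs_of_nonneg (by positivity)]
    calc _ ≤ 1 * 1 * (3:ℝ) := by gcongr
      _ = 3 := by norm_num
def bG (S : Set ℝ) (m : ℕ) (Λ : ℝ) (hΛ : 0 < Λ) : Y2 S →ᵇ ℝ :=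
  mkB (fun y => (Gw Λ (y.a m) y.d)⁻¹) ((cG m Λ).inv₀ fun y => (Gw_pos _ _ _).ne') (exp Λ) fun y => by
    rw [abs_of_pos (inv_pos.2 (Gw_pos _ _ _)), ← inv_inv (exp Λ), ← Real.exp_neg]
    exact inv_anti₀ (exp_pos _) (Gw_ge hΛ.le (y.a_pos m) _)
end Y2

end

section

structure Sym (n : ℝ) (f : ℝ → ℝ) : Prop where
  smooth : CDOn f (Set.Ioi 0)
  bd : ∀ j : ℕ, ∃ C, ∀ t, 0 < t → t ≤ 1 → |iteratedDeriv j f t| ≤ C * t ^ (n - j)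

lemma iter_smooth {f : ℝ → ℝ} {O : Set ℝ} (hO : IsOpen O) (hf : CDOn f O) (j : ℕ) :
    CDOn (iteratedDeriv j f) O := by
  induction j with
  | zero => simpa using hf
  | succ j ih =>
    rw [iteratedDeriv_succ]
    exact ih.deriv_of_isOpen hO (by simp)

lemma iter_hasDeriv {f : ℝ → ℝ} {O : Set ℝ} (hO : IsOpen O) (hf : CDOn f O) (j : ℕ)
    {t : ℝ} (ht : t ∈ O) : HasDerivAt (iteratedDeriv j f) (iteratedDeriv (j + 1) f t) t := by
  rw [iteratedDeriv_succ]
  exact (((iter_smooth hO hf j).contDiffAt (hO.mem_nhds ht)).differentiableAt (by simp)).hasDerivAt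

section
variable {Y : Type} [TopologicalSpace Y]

def symNem {n : ℝ} {f : ℝ → ℝ} (h : Sym n f) (i : ℕ) {sf : Y → ℝ} (hc : Continuous sf)
    (h0 : ∀ y, 0 < sf y) {a b : ℝ} (ha : 0 < a) (hab : a ≤ b) (h1 : ∀ y, sf y * b ≤ 1) : NemData Y a b :=
  have hex : ∀ j : ℕ, ∃ C, ∀ y, ∀ τ ∈ Set.Icc a b,
      |sf y ^ (((j + i : ℕ) : ℝ) - n) * iteratedDeriv (j + i) f (sf y * τ)| ≤ C := by
    intro j
    obtain ⟨C, hC⟩ := h.bd (j + i)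
    obtain ⟨C', hC'⟩ := isCompact_Icc.exists_bound_of_continuousOn
      (f := fun τ : ℝ => τ ^ (n - ((j + i : ℕ) : ℝ))) (s := Set.Icc a b)
      (fun τ hτ => (Real.continuousAt_rpow_const _ _ (Or.inl (ha.trans_le hτ.1).ne')).continuousWithinAt)
    refine ⟨|C| * C', fun y τ hτ => ?_⟩
    have hs := h0 y
    have hτ0 : 0 < τ := ha.trans_le hτ.1
    have hb := hC (sf y * τ) (by positivity) ((mul_le_mul_of_nonneg_left hτ.2 hs.le).trans (h1 y))
    have e1 : 0 ≤ sf y ^ (((j + i : ℕ) : ℝ) - n) := by positivity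
    rw [abs_mul, abs_of_nonneg e1]
    have h3 := hC' τ hτ
    rw [Real.norm_eq_abs, abs_of_nonneg (by positivity)] at h3
    calc _ ≤ sf y ^ (((j + i : ℕ) : ℝ) - n) * (|C| * (sf y * τ) ^ (n - ((j + i : ℕ) : ℝ))) := by
          refine mul_le_mul_of_nonneg_left (hb.trans ?_) e1
          exact mul_le_mul_of_nonneg_right (le_abs_self C) (by positivity)
      _ = |C| * (sf y ^ ((((j + i : ℕ) : ℝ) - n) + (n - ((j + i : ℕ) : ℝ))) *
            τ ^ (n - ((j + i : ℕ) : ℝ))) := by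
          rw [Real.mul_rpow hs.le hτ0.le, rpow_add hs]; ring
      _ = |C| * τ ^ (n - ((j + i : ℕ) : ℝ)) := by
          rw [show (((j + i : ℕ) : ℝ) - n) + (n - ((j + i : ℕ) : ℝ)) = 0 by ring]; simp
      _ ≤ _ := by gcongr
  { hab := hab
    G := fun j y τ => sf y ^ (((j + i : ℕ) : ℝ) - n) * iteratedDeriv (j + i) f (sf y * τ)
    cont := fun j => by
      have c1 : Continuous fun y => sf y ^ (((j + i : ℕ) : ℝ) - n) :=
        hc.rpow_const fun y => Or.inl (h0 y).ne'
      refine (c1.comp continuous_fst).continuousOn.mul ?_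
      refine (iter_smooth isOpen_Ioi h.smooth (j + i)).continuousOn.comp
        ((hc.comp continuous_fst).mul continuous_snd).continuousOn ?_
      rintro ⟨y, τ⟩ hx
      exact mul_pos (h0 y) (ha.trans_le hx.2.1)
    der := fun j y τ hτ => by
      have hp : sf y * τ ∈ Set.Ioi (0:ℝ) := mul_pos (h0 y) (ha.trans_le hτ.1)
      have h2 := iter_hasDeriv isOpen_Ioi h.smooth (j + i) hp
      have h3 : HasDerivAt (fun τ : ℝ => sf y * τ) (sf y) τ := by
        simpa using (hasDerivAt_id τ).const_mul (sf y)
      have h4 := (h2.comp τ h3).const_mul (sf y ^ (((j + i : ℕ) : ℝ) - n))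
      refine h4.congr_deriv ?_
      have e : sf y ^ (((j + 1 + i : ℕ) : ℝ) - n) = sf y ^ (((j + i : ℕ) : ℝ) - n) * sf y := by
        rw [show ((j + 1 + i : ℕ) : ℝ) - n = (((j + i : ℕ) : ℝ) - n) + 1 by push_cast; ring,
          rpow_add (h0 y), rpow_one]
      rw [e, show j + 1 + i = j + i + 1 by ring]
      ring
    C := fun j => (hex j).choose
    bd := fun j y τ hτ => (hex j).choose_spec y τ hτ }

abbrev PE := ℝ × ℝ × ℝ

def aff (ζ : Y →ᵇ ℝ) (e : PE) : Y →ᵇ ℝ := e.1 • (1 : Y →ᵇ ℝ) + e.2.1 • ζ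
lemma aff_apply (ζ : Y →ᵇ ℝ) (e : PE) (y : Y) : aff ζ e y = e.1 + e.2.1 * ζ y := by simp [aff]
lemma aff_smooth (ζ : Y →ᵇ ℝ) : ContDiff ℝ (⊤ : ℕ∞) (aff ζ) := by
  unfold aff; fun_prop
lemma aff_range {ζ : Y →ᵇ ℝ} (hζ : ∀ y, |ζ y| ≤ 1) (e : PE) (y : Y) :
    e.1 - |e.2.1| ≤ aff ζ e y ∧ aff ζ e y ≤ e.1 + |e.2.1| := by
  rw [aff_apply]
  have h : |e.2.1 * ζ y| ≤ |e.2.1| := by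
    rw [abs_mul]; exact mul_le_of_le_one_right (abs_nonneg _) (hζ y)
  have := abs_le.1 h
  constructor <;> linarith
lemma aff_dom {ζ : Y →ᵇ ℝ} (hζ : ∀ y, |ζ y| ≤ 1) {e : PE} {a b : ℝ} (h1 : a < e.1 - |e.2.1|)
    (h2 : e.1 + |e.2.1| < b) : aff ζ e ∈ (NemData.dom a b : Set (Y →ᵇ ℝ)) := by
  refine ⟨min (e.1 - |e.2.1| - a) (b - (e.1 + |e.2.1|)), lt_min (by linarith) (by linarith), fun y => ?_⟩
  have := aff_range hζ e y
  constructor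
  · linarith [min_le_left (e.1 - |e.2.1| - a) (b - (e.1 + |e.2.1|))]
  · linarith [min_le_right (e.1 - |e.2.1| - a) (b - (e.1 + |e.2.1|))]

def avgL (Y : Type) [TopologicalSpace Y] : ((Y × Set.Icc (0:ℝ) 1) →ᵇ ℝ) →L[ℝ] (Y →ᵇ ℝ) :=
  have hcont : ∀ g : (Y × Set.Icc (0:ℝ) 1) →ᵇ ℝ, Continuous fun x : Y × ℝ =>
      g (x.1, Set.projIcc 0 1 zero_le_one x.2) := fun g =>
    g.continuous.comp (continuous_fst.prodMk (continuous_projIcc.comp continuous_snd))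
  have hi : ∀ (g : (Y × Set.Icc (0:ℝ) 1) →ᵇ ℝ) (y : Y), IntervalIntegrable
      (fun l => g (y, Set.projIcc 0 1 zero_le_one l)) volume 0 1 := fun g y =>
    ((hcont g).comp (by fun_prop : Continuous fun l : ℝ => (y, l))).intervalIntegrable _ _
  have hb : ∀ (g : (Y × Set.Icc (0:ℝ) 1) →ᵇ ℝ) (y : Y),
      |∫ l in (0:ℝ)..1, g (y, Set.projIcc 0 1 zero_le_one l)| ≤ ‖g‖ := fun g y => by
    have := intervalIntegral.norm_integral_le_of_norm_le_const (a := (0:ℝ)) (b := 1) (C := ‖g‖)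
      (f := fun l => g (y, Set.projIcc 0 1 zero_le_one l)) (fun l _ => g.norm_coe_le_norm _)
    simpa using this
  LinearMap.mkContinuous
    { toFun := fun g => mkB (fun y => ∫ l in (0:ℝ)..1, g (y, Set.projIcc 0 1 zero_le_one l))
        (continuous_parametric_intervalIntegral_of_continuous' (μ := volume)
          (f := fun y l => g (y, Set.projIcc 0 1 zero_le_one l)) (hcont g) 0 1) ‖g‖ (hb g)
      map_add' := fun g h => by
        ext y
        exact intervalIntegral.integral_add (hi g y) (hi h y)
      map_smul' := fun c g => by
        ext y
        exact intervalIntegral.integral_smul c _ } 1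
    (fun g => by
      rw [one_mul]
      exact (BoundedContinuousFunction.norm_le (norm_nonneg g)).2 fun y => hb g y)

lemma avgL_apply (g : (Y × Set.Icc (0:ℝ) 1) →ᵇ ℝ) (y : Y) :
    avgL Y g y = ∫ l in (0:ℝ)..1, g (y, Set.projIcc 0 1 zero_le_one l) := rfl

lemma piece_smooth {a b : ℝ} (N : NemData Y a b) (j : ℕ) {ζ : Y →ᵇ ℝ} (hζ : ∀ y, |ζ y| ≤ 1) {e : PE}
    (h1 : a < e.1 - |e.2.1|) (h2 : e.1 + |e.2.1| < b) :
    CDAt (fun e => N.map j (aff ζ e)) e :=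
  (N.contDiffAt j (aff_dom hζ h1 h2)).comp e (aff_smooth ζ).contDiffAt

lemma piece_eval {a b : ℝ} (N : NemData Y a b) (j : ℕ) {ζ : Y →ᵇ ℝ} (hζ : ∀ y, |ζ y| ≤ 1) {e : PE}
    (h1 : a < e.1 - |e.2.1|) (h2 : e.1 + |e.2.1| < b) (y : Y) :
    N.map j (aff ζ e) y = N.G j y (e.1 + e.2.1 * ζ y) := by
  rw [N.map_apply j, aff_apply]
  have := aff_range hζ e y
  constructor <;> linarith
end

lemma sym_pieces {n : ℝ} {f : ℝ → ℝ} (h : Sym n f) {S : Set ℝ} {a b : ℝ} (ha : 0 < a) (hab : a ≤ b)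
    (hb : ∀ s ∈ S, s * b ≤ 1) :
    ∃ (P : ℕ → (Y2 S →ᵇ ℝ) → PE → Y2 S →ᵇ ℝ) (Q : PE → Y2 S →ᵇ ℝ),
      (∀ e : PE, a < e.1 - |e.2.1| → e.1 + |e.2.1| < b → CDAt Q e ∧ ∀ i ζ,
        (∀ y, |ζ y| ≤ 1) → CDAt (P i ζ) e) ∧
      ∀ e : PE, a < e.1 - |e.2.1| → e.1 + |e.2.1| < b → ∀ y : Y2 S,
        (Q e y = ∫ l in (0:ℝ)..1, y.s ^ ((2:ℝ) - n) * iteratedDeriv 2 f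
          (y.s * (e.1 + e.2.1 * (y.v + l * (y.u - y.v))))) ∧
        ∀ (i : ℕ) ζ, (∀ y, |ζ y| ≤ 1) → P i ζ e y = y.s ^ ((i:ℝ) - n) * iteratedDeriv i f
          (y.s * (e.1 + e.2.1 * ζ y)) := by
  let ζ' : (Y2 S × Set.Icc (0:ℝ) 1) →ᵇ ℝ := mkB (fun x => x.1.v + x.2.1 * (x.1.u - x.1.v))
    (by fun_prop) 1 (by
      rintro ⟨y, l⟩
      have h1 := y.v1; have h2 := y.vu; have h3 := y.u1; have h4 := l.2.1; have h5 := l.2.2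
      rw [abs_le]; constructor <;> simp only <;> nlinarith)
  have hζ' : ∀ x, |ζ' x| ≤ 1 := by
      rintro ⟨y, l⟩
      have h1 := y.v1; have h2 := y.vu; have h3 := y.u1; have h4 := l.2.1; have h5 := l.2.2
      simp only [ζ', mkB_apply]
      rw [abs_le]; constructor <;> nlinarith
  let N1 := fun i => symNem (Y := Y2 S) h i Y2.cs Y2.s0 ha hab (fun y => hb _ y.sS)
  let N2 := symNem (Y := Y2 S × Set.Icc (0:ℝ) 1) h 2 (sf := fun x => x.1.s)
    (Y2.cs.comp continuous_fst) (fun x => x.1.s0) ha hab (fun x => hb _ x.1.sS)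
  refine ⟨fun i ζ e => (N1 i).map 0 (aff ζ e), fun e => avgL _ (N2.map 0 (aff ζ' e)), ?_, ?_⟩
  · intro e h1 h2
    refine ⟨?_, fun i ζ hζ => piece_smooth _ 0 hζ h1 h2⟩
    exact (avgL (Y2 S)).contDiff.contDiffAt.comp e (piece_smooth N2 0 hζ' h1 h2)
  · intro e h1 h2 y
    constructor
    · rw [avgL_apply]
      apply intervalIntegral.integral_congr
      intro l hl
      rw [Set.uIcc_of_le zero_le_one] at hl
      simp only
      rw [piece_eval N2 0 hζ' h1 h2, Set.projIcc_of_mem _ hl]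
      simp [N2, symNem, ζ']
    · intro i ζ hζ
      simp only
      rw [piece_eval (N1 i) 0 hζ h1 h2]
      simp [N1, symNem]

end

section

section
variable {B : Type} [NormedCommRing B] [NormedAlgebra ℝ B]
lemma cd_hatM {P1 P2 Q1 Q2 : PE → B} {e : PE} (h1 : CDAt P1 e)
    (h2 : CDAt P2 e) (h3 : CDAt Q1 e) (h4 : CDAt Q2 e) :
    CDAt (fun e => (1 / 2 : ℝ) • (P1 e + P2 e + e.2.2 • (Q1 e + Q2 e))) e := by
  fun_prop
lemma cd_hatV {P1 Q1 : PE → B} {e : PE} (h1 : CDAt P1 e)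
    (h3 : CDAt Q1 e) :
    CDAt (fun e => P1 e + e.2.2 • Q1 e) e := by
  fun_prop
lemma cd_hatD {M : PE → B} {e : PE} (al be : B) (h1 : CDAt M e) :
    CDAt (fun e => al * M e ^ 4 + (3 / 4 * e.2.1 ^ 2) • be) e := by
  fun_prop
lemma cd_hatA {M N : PE → B} {e : PE} (h1 : CDAt M e) (h2 : CDAt N e) :
    CDAt (fun e => √3 • (M e * N e)) e := by
  fun_prop
lemma cd_hatc {M N V1 V2 Q : PE → B} {e : PE} (g al be : B) (h1 : CDAt M e)
    (h2 : CDAt N e) (h3 : CDAt V1 e) (h4 : CDAt V2 e)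
    (h5 : CDAt Q e) :
    CDAt (fun e => (2 * √3) • (g * M e ^ 3 *
      (al * M e ^ 4 - (15 / 4 * e.2.1 ^ 2) • be) * N e ^ 5 * (V1 e * V2 e + M e * Q e))) e := by
  fun_prop
lemma cd_smulK {K : B →L[ℝ] B} {e : PE} :
    CDAt (fun e : PE => (e.2.1 ^ 2) • K) e := by
  fun_prop
end

lemma seg_pos' {p q l : ℝ} (hp : 0 < p) (hq : 0 < q) (h0 : 0 ≤ l) (h1 : l ≤ 1) : 0 < q + l * (p - q) := by
  rcases eq_or_lt_of_le h1 with h | h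
  · rw [h]; linarith
  · nlinarith [mul_nonneg h0 hp.le, mul_pos (sub_pos.2 h) hq]

lemma deriv_comb {f g : ℝ → ℝ} (hf : CDOn f (Set.Ioi 0))
    (hg : CDOn g (Set.Ioi 0)) (c : ℝ) {t : ℝ} (ht : 0 < t) :
    deriv (fun t => f t + c * g t) t = deriv f t + c * deriv g t := by
  have h1 : DifferentiableAt ℝ f t := (hf.contDiffAt (Ioi_mem_nhds ht)).differentiableAt (by simp)
  have h2 : DifferentiableAt ℝ g t := (hg.contDiffAt (Ioi_mem_nhds ht)).differentiableAt (by simp)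
  exact (h1.hasDerivAt.add (h2.hasDerivAt.const_mul c)).deriv

lemma deriv2_comb {f g : ℝ → ℝ} (hf : CDOn f (Set.Ioi 0))
    (hg : CDOn g (Set.Ioi 0)) (c : ℝ) {t : ℝ} (ht : 0 < t) :
    deriv (deriv (fun t => f t + c * g t)) t = deriv (deriv f) t + c * deriv (deriv g) t := by
  have h : deriv (fun t => f t + c * g t) =ᶠ[𝓝 t] fun t => deriv f t + c * deriv g t := by
    filter_upwards [Ioi_mem_nhds ht] with x hx
    exact deriv_comb hf hg c hx
  rw [h.deriv_eq]
  exact deriv_comb (hf.deriv_of_isOpen isOpen_Ioi (by simp)) (hg.deriv_of_isOpen isOpen_Ioi (by simp)) c ht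

def Y2.pos {S : Set ℝ} (e : PE) (y : Y2 S) (x : ℝ) : ℝ := y.s * (e.1 + e.2.1 * x)

lemma Y2.pos_pos {S : Set ℝ} {e : PE} (he : |e.2.1| < e.1) (y : Y2 S) {x : ℝ} (hx : |x| ≤ 1) :
    0 < y.pos e x := by
  have h : |e.2.1 * x| ≤ |e.2.1| := by
    rw [abs_mul]; exact mul_le_of_le_one_right (abs_nonneg _) hx
  have := abs_le.1 h
  exact mul_pos y.s0 (by linarith)
lemma Y2.pos_lt {S : Set ℝ} {e : PE} {b : ℝ} (he : e.1 + |e.2.1| < b) (y : Y2 S) {x : ℝ} (hx : |x| ≤ 1) :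
    y.pos e x < y.s * b := by
  have h : |e.2.1 * x| ≤ |e.2.1| := by
    rw [abs_mul]; exact mul_le_of_le_one_right (abs_nonneg _) hx
  have := abs_le.1 h
  exact mul_lt_mul_of_pos_left (by linarith) y.s0
lemma Y2.abs_u {S : Set ℝ} (y : Y2 S) : |y.u| ≤ 1 := abs_le.2 ⟨y.v1.trans y.vu, y.u1⟩
lemma Y2.abs_v {S : Set ℝ} (y : Y2 S) : |y.v| ≤ 1 := abs_le.2 ⟨y.v1, y.vu.trans y.u1⟩

def muT (m : ℕ) (n : ℝ) (μ δ : ℝ → ℝ) (η s : ℝ) : ℝ → ℝ := fun t => μ t + (η * s ^ ((m:ℝ) - n)) * δ t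

lemma rpow_nat_sub {s : ℝ} (hs : 0 < s) (m : ℕ) (i : ℝ) : s ^ m * s ^ (i - (m:ℝ)) = s ^ i := by
  rw [← rpow_natCast s m, ← rpow_add hs]; congr 1; ring
lemma rpow_nat_sub2 {s : ℝ} (hs : 0 < s) (m : ℕ) (i n : ℝ) :
    s ^ m * s ^ (i - n) = s ^ ((m:ℝ) - n) * s ^ i := by
  rw [← rpow_natCast s m, ← rpow_add hs, ← rpow_add hs]; congr 1; ring

theorem pieces {m : ℕ} (hm : 1 ≤ m) {n : ℝ} {μ δ : ℝ → ℝ} (hA : Adm m μ) (hμ : Sym m μ) (hδ : Sym n δ) {S : Set ℝ} {b : ℝ}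
    (hb : ∀ s ∈ S, s * b ≤ 1) {Λ : ℝ} (hΛ : 0 < Λ) {θ1 θ2 : ℝ} (h1 : |θ2| < θ1) (h2 : θ1 + |θ2| < b)
    (hnd : θ2 ≠ 0 ∨ ∃ c > 0, ∀ y : Y2 S, c ≤ (y.a m * y.R m) ^ 2) :
    ∃ M A c : PE → Y2 S →ᵇ ℝ, CDAt M (θ1, θ2, 0) ∧
      CDAt A (θ1, θ2, 0) ∧ CDAt c (θ1, θ2, 0) ∧
      ∀ᶠ e : PE in 𝓝 (θ1, θ2, 0), |e.2.1| < e.1 ∧ e.1 + |e.2.1| < b ∧ ∀ y : Y2 S,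
        MM (muT m n μ δ e.2.2 y.s) (y.pos e y.u) (y.pos e y.v) = y.s ^ m * M e y ∧
        AA (muT m n μ δ e.2.2 y.s) (y.pos e y.u) (y.pos e y.v) = y.s ^ m * y.R m * A e y ∧
        ee (muT m n μ δ e.2.2 y.s) (y.pos e y.u) (y.pos e y.v) = y.U m * y.w m Λ * c e y := by
  set a := (θ1 - |θ2|) / 2 with ha_def
  have ha : 0 < a := by rw [ha_def]; linarith
  have hab : a ≤ b := by rw [ha_def]; linarith [abs_nonneg θ2]
  have ha1 : a < θ1 - |θ2| := by rw [ha_def]; linarith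
  obtain ⟨P, Q, cdP, evP⟩ := sym_pieces hμ (S := S) ha hab hb
  obtain ⟨P', Q', cdP', evP'⟩ := sym_pieces hδ (S := S) ha hab hb
  set e0 : PE := (θ1, θ2, 0) with he0
  have hbu : ∀ y, |Y2.bu S y| ≤ 1 := fun y => y.abs_u
  have hbv : ∀ y, |Y2.bv S y| ≤ 1 := fun y => y.abs_v
  obtain ⟨cQ, cP⟩ := cdP e0 ha1 h2
  obtain ⟨cQ', cP'⟩ := cdP' e0 ha1 h2
  let M : PE → Y2 S →ᵇ ℝ := fun e => (1 / 2 : ℝ) •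
    (P 0 (Y2.bu S) e + P 0 (Y2.bv S) e + e.2.2 • (P' 0 (Y2.bu S) e + P' 0 (Y2.bv S) e))
  let V1 : PE → Y2 S →ᵇ ℝ := fun e => P 1 (Y2.bu S) e + e.2.2 • P' 1 (Y2.bu S) e
  let V2 : PE → Y2 S →ᵇ ℝ := fun e => P 1 (Y2.bv S) e + e.2.2 • P' 1 (Y2.bv S) e
  let WW : PE → Y2 S →ᵇ ℝ := fun e => Q e + e.2.2 • Q' e
  let D : PE → Y2 S →ᵇ ℝ := fun e => Y2.bα S m * M e ^ 4 + (3 / 4 * e.2.1 ^ 2) • Y2.bβ S m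
  have cM : CDAt M e0 :=
    cd_hatM (cP 0 _ hbu) (cP 0 _ hbv) (cP' 0 _ hbu) (cP' 0 _ hbv)
  have cV1 : CDAt V1 e0 := cd_hatV (cP 1 _ hbu) (cP' 1 _ hbu)
  have cV2 : CDAt V2 e0 := cd_hatV (cP 1 _ hbv) (cP' 1 _ hbv)
  have cW : CDAt WW e0 := cd_hatV cQ cQ'
  have cD : CDAt D e0 := cd_hatD _ _ cM
  have evM : ∀ e : PE, a < e.1 - |e.2.1| → e.1 + |e.2.1| < b → ∀ y : Y2 S,
      MM (muT m n μ δ e.2.2 y.s) (y.pos e y.u) (y.pos e y.v) = y.s ^ m * M e y := by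
    intro e g1 g2 y
    have k1 := (evP e g1 g2 y).2 0 _ hbu
    have k2 := (evP e g1 g2 y).2 0 _ hbv
    have k3 := (evP' e g1 g2 y).2 0 _ hbu
    have k4 := (evP' e g1 g2 y).2 0 _ hbv
    have r1 := rpow_nat_sub y.s0 m 0
    have r2 := rpow_nat_sub2 y.s0 m 0 n
    simp only [rpow_zero, mul_one] at r1 r2
    have : M e y = 1 / 2 * (P 0 (Y2.bu S) e y + P 0 (Y2.bv S) e y + e.2.2 *
      (P' 0 (Y2.bu S) e y + P' 0 (Y2.bv S) e y)) := by simp [M]; try ring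
    rw [this, k1, k2, k3, k4]
    simp only [MM, muT, Y2.pos, iteratedDeriv_zero, Y2.bu, Y2.bv, mkB_apply, Nat.cast_zero]
    linear_combination (-(1 / 2) * (μ (y.s * (e.1 + e.2.1 * y.u)) + μ (y.s * (e.1 + e.2.1 * y.v)))) * r1 -
      (1 / 2 * e.2.2 * (δ (y.s * (e.1 + e.2.1 * y.u)) + δ (y.s * (e.1 + e.2.1 * y.v)))) * r2
  have Mlo : ∀ y, 3 / 4 * (θ1 - |θ2|) ^ m ≤ M e0 y := by
    intro y
    have k := evM e0 ha1 h2 y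
    have hpu := y.pos_pos (e := e0) h1 y.abs_u
    have hpv := y.pos_pos (e := e0) h1 y.abs_v
    have l1 := hA.lo hpu
    have l2 := hA.lo hpv
    have rg : ∀ x, |x| ≤ 1 → y.s ^ m * (θ1 - |θ2|) ^ m ≤ (y.pos e0 x) ^ m := by
      intro x hx
      rw [← mul_pow]
      have h : |θ2 * x| ≤ |θ2| := by
        rw [abs_mul]; exact mul_le_of_le_one_right (abs_nonneg _) hx
      have := abs_le.1 h
      have hs := y.s0
      refine pow_le_pow_left₀ (mul_nonneg hs.le (by linarith)) ?_ m
      exact mul_le_mul_of_nonneg_left (by show θ1 - |θ2| ≤ θ1 + θ2 * x; linarith) hs.le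
    have r1 := rg _ y.abs_u
    have r2 := rg _ y.abs_v
    simp only [MM, muT, he0, zero_mul, add_zero] at k
    have hsm : 0 < y.s ^ m := pow_pos y.s0 m
    refine le_of_mul_le_mul_left ?_ hsm
    rw [← k]
    linarith
  obtain ⟨c0, hc0, Dlo⟩ : ∃ c0 > 0, ∀ y, c0 ≤ D e0 y := by
    have hDy : ∀ y, D e0 y = (y.a m * y.R m) ^ 2 * M e0 y ^ 4 + 3 / 4 * θ2 ^ 2 * (y.d * y.R m) ^ 2 := by
      intro y; simp [D, Y2.bα, Y2.bβ, he0]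
    set c1 := 3 / 4 * (θ1 - |θ2|) ^ m with hc1
    have hc1p : 0 < c1 := by have : 0 < θ1 - |θ2| := by linarith
                             positivity
    have hM4 : ∀ y, c1 ^ 4 ≤ M e0 y ^ 4 := fun y => pow_le_pow_left₀ hc1p.le (Mlo y) 4
    rcases hnd with h | ⟨c, hc, hcy⟩
    · refine ⟨min (c1 ^ 4) (3 / 4 * θ2 ^ 2), lt_min (by positivity) (by positivity), fun y => ?_⟩
      rw [hDy]
      have k1 := min_le_left (c1 ^ 4) (3 / 4 * θ2 ^ 2)
      have k2 := min_le_right (c1 ^ 4) (3 / 4 * θ2 ^ 2)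
      have k3 := y.dR_sq m
      have k4 := sq_nonneg (y.a m * y.R m)
      have k5 := sq_nonneg (y.d * y.R m)
      have k6 := hM4 y
      nlinarith [mul_le_mul_of_nonneg_left (k1.trans k6) k4, mul_le_mul_of_nonneg_left k2 k5]
    · refine ⟨c * c1 ^ 4, by positivity, fun y => ?_⟩
      rw [hDy]
      have := mul_le_mul (hcy y) (hM4 y) (by positivity) (by positivity)
      have : 0 ≤ 3 / 4 * θ2 ^ 2 * (y.d * y.R m) ^ 2 := by positivity
      linarith
  set b0 := ‖D e0‖ + c0 + 1 with hb0
  have hcb : c0 / 2 ≤ b0 := by rw [hb0]; have := norm_nonneg (D e0); linarith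
  have hsq : CDOn (fun τ : ℝ => (√τ)⁻¹) (Set.Ioi 0) := by
    intro τ hτ
    have hτ' : (0:ℝ) < τ := hτ
    exact ((Real.contDiffAt_sqrt hτ'.ne').inv (sqrt_pos.2 hτ').ne').contDiffWithinAt
  let Nm := NemData.ofSmooth (Y2 S) isOpen_Ioi hsq hcb (fun x hx => lt_of_lt_of_le (by positivity) hx.1)
  have hdom : D e0 ∈ (NemData.dom (c0 / 2) b0 : Set (Y2 S →ᵇ ℝ)) := by
    refine ⟨min (c0 / 2) 1, by positivity, fun y => ?_⟩
    have k1 := Dlo y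
    have k2 := (le_abs_self _).trans ((D e0).norm_coe_le_norm y)
    have k3 := min_le_left (c0 / 2) 1
    have k4 := min_le_right (c0 / 2) 1
    constructor <;> linarith
  let N : PE → Y2 S →ᵇ ℝ := fun e => Nm.map 0 (D e)
  have cN : CDAt N e0 := (Nm.contDiffAt 0 hdom).comp e0 cD
  refine ⟨M, fun e => √3 • (M e * N e), fun e => (2 * √3) • (Y2.bG S m Λ hΛ * M e ^ 3 *
      (Y2.bα S m * M e ^ 4 - (15 / 4 * e.2.1 ^ 2) • Y2.bβ S m) * N e ^ 5 * (V1 e * V2 e + M e * WW e)),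
    cM, cd_hatA cM cN, cd_hatc _ _ _ cM cN cV1 cV2 cW, ?_⟩
  have ev1 : ∀ᶠ e : PE in 𝓝 e0, D e ∈ (NemData.dom (c0 / 2) b0 : Set (Y2 S →ᵇ ℝ)) :=
    cD.continuousAt.eventually (NemData.dom_open.mem_nhds hdom)
  have ev2 : ∀ᶠ e : PE in 𝓝 e0, a < e.1 - |e.2.1| := by
    have : ContinuousAt (fun e : PE => e.1 - |e.2.1|) e0 := by fun_prop
    exact this.eventually (lt_mem_nhds ha1)
  have ev3 : ∀ᶠ e : PE in 𝓝 e0, e.1 + |e.2.1| < b := by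
    have : ContinuousAt (fun e : PE => e.1 + |e.2.1|) e0 := by fun_prop
    exact this.eventually (gt_mem_nhds h2)
  filter_upwards [ev1, ev2, ev3] with e g0 g1 g2
  refine ⟨by linarith, g2, fun y => ?_⟩
  have g3 : |e.2.1| < e.1 := by linarith
  have hs := y.s0
  have kM := evM e g1 g2 y
  set nu := muT m n μ δ e.2.2 y.s with hnu
  set p := y.pos e y.u with hp
  set q := y.pos e y.v with hq
  have hp0 : 0 < p := y.pos_pos g3 y.abs_u
  have hq0 : 0 < q := y.pos_pos g3 y.abs_v
  have hpq : p - q = e.2.1 * y.d := by simp only [hp, hq, Y2.pos, Y2.d]; ring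
  have hRD := y.R_sq m
  have hR := y.R_pos m
  have hDs := y.D_pos m
  have eD : D e y = (y.a m * y.R m) ^ 2 * M e y ^ 4 + 3 / 4 * e.2.1 ^ 2 * (y.d * y.R m) ^ 2 := by
    simp [D, Y2.bα, Y2.bβ]
  have ea : y.a m = y.s ^ m * y.s ^ m := by unfold Y2.a; rw [two_mul, pow_add]
  have kD : DD nu p q = y.D m * D e y := by
    have : DD nu p q = (y.s ^ m * M e y) ^ 4 + 3 / 4 * (e.2.1 * y.d) ^ 2 := by
      unfold DD; rw [kM, hpq]
    rw [this, eD, ea]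
    linear_combination (-((y.s ^ m * M e y) ^ 4 + 3 / 4 * (e.2.1 * y.d) ^ 2)) * hRD
  have eN : N e y = (√(D e y))⁻¹ := by
    show Nm.map 0 (D e) y = _
    rw [Nm.map_apply 0 (NemData.dom_mem g0 y)]
    simp [Nm, NemData.ofSmooth]
  have kN : NN nu p q = y.R m * N e y := by
    unfold NN Y2.R
    rw [kD, sqrt_mul hDs.le, mul_inv, eN]
  refine ⟨kM, ?_, ?_⟩
  · unfold AA
    rw [kM, kN]
    simp; ring
  · have d1 : ∀ t, 0 < t → deriv nu t = deriv μ t + (e.2.2 * y.s ^ ((m:ℝ) - n)) * deriv δ t :=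
      fun t ht => deriv_comb hμ.smooth hδ.smooth _ ht
    have d2 : ∀ t, 0 < t → deriv (deriv nu) t =
        deriv (deriv μ) t + (e.2.2 * y.s ^ ((m:ℝ) - n)) * deriv (deriv δ) t :=
      fun t ht => deriv2_comb hμ.smooth hδ.smooth _ ht
    have r1 := rpow_nat_sub hs m 1
    have r2 := rpow_nat_sub2 hs m 1 n
    have r3 := rpow_nat_sub hs m 2
    have r4 := rpow_nat_sub2 hs m 2 n
    simp only [rpow_one] at r1 r2
    have kV1 : y.s * deriv nu p = y.s ^ m * V1 e y := by
      have k1 := (evP e g1 g2 y).2 1 _ hbu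
      have k3 := (evP' e g1 g2 y).2 1 _ hbu
      simp only [iteratedDeriv_one, Nat.cast_one] at k1 k3
      have : V1 e y = P 1 (Y2.bu S) e y + e.2.2 * P' 1 (Y2.bu S) e y := by simp [V1]
      rw [this, k1, k3, d1 p hp0]
      simp only [hp, Y2.pos, Y2.bu, mkB_apply]
      linear_combination (-deriv μ (y.s * (e.1 + e.2.1 * y.u))) * r1 -
        e.2.2 * deriv δ (y.s * (e.1 + e.2.1 * y.u)) * r2
    have kV2 : y.s * deriv nu q = y.s ^ m * V2 e y := by
      have k1 := (evP e g1 g2 y).2 1 _ hbv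
      have k3 := (evP' e g1 g2 y).2 1 _ hbv
      simp only [iteratedDeriv_one, Nat.cast_one] at k1 k3
      have : V2 e y = P 1 (Y2.bv S) e y + e.2.2 * P' 1 (Y2.bv S) e y := by simp [V2]
      rw [this, k1, k3, d1 q hq0]
      simp only [hq, Y2.pos, Y2.bv, mkB_apply]
      linear_combination (-deriv μ (y.s * (e.1 + e.2.1 * y.v))) * r1 -
        e.2.2 * deriv δ (y.s * (e.1 + e.2.1 * y.v)) * r2
    have kW : y.s ^ 2 * dd nu p q = y.s ^ m * WW e y := by
      have k1 := (evP e g1 g2 y).1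
      have k3 := (evP' e g1 g2 y).1
      have e2 : ∀ f : ℝ → ℝ, iteratedDeriv 2 f = deriv (deriv f) := fun f => by
        rw [iteratedDeriv_succ, iteratedDeriv_one]
      simp only [e2] at k1 k3
      have hW : WW e y = Q e y + e.2.2 * Q' e y := by simp [WW]
      have hseg : ∀ l ∈ Set.uIcc (0:ℝ) 1, 0 < q + l * (p - q) := by
        intro l hl
        rw [Set.uIcc_of_le zero_le_one] at hl
        exact seg_pos' hp0 hq0 hl.1 hl.2
      have hl' : ∀ l, y.s * (e.1 + e.2.1 * (y.v + l * (y.u - y.v))) = q + l * (p - q) := by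
        intro l; simp only [hp, hq, Y2.pos]; ring
      simp only [hl'] at k1 k3
      have i1 : ∀ f : ℝ → ℝ, CDOn f (Set.Ioi 0) → IntervalIntegrable
          (fun l => deriv (deriv f) (q + l * (p - q))) volume 0 1 := by
        intro f hf
        apply ContinuousOn.intervalIntegrable
        have j1 := hf.deriv_of_isOpen (m := (⊤ : ℕ∞)) isOpen_Ioi (by simp)
        have j2 := j1.deriv_of_isOpen (m := (⊤ : ℕ∞)) isOpen_Ioi (by simp)
        exact j2.continuousOn.comp (by fun_prop) hseg
      have hdd : dd nu p q = (∫ l in (0:ℝ)..1, deriv (deriv μ) (q + l * (p - q))) +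
          (e.2.2 * y.s ^ ((m:ℝ) - n)) * ∫ l in (0:ℝ)..1, deriv (deriv δ) (q + l * (p - q)) := by
        unfold dd
        rw [← intervalIntegral.integral_const_mul, ← intervalIntegral.integral_add (i1 μ hμ.smooth)
          ((i1 δ hδ.smooth).const_mul _)]
        exact intervalIntegral.integral_congr fun l hl => d2 _ (hseg l hl)
      rw [hW, k1, k3, hdd, intervalIntegral.integral_const_mul, intervalIntegral.integral_const_mul]
      have r5 : y.s ^ (2:ℝ) = y.s ^ 2 := by exact_mod_cast rpow_natCast y.s 2
      rw [r5] at r3 r4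
      linear_combination (-∫ l in (0:ℝ)..1, deriv (deriv μ) (q + l * (p - q))) * r3 -
        e.2.2 * (∫ l in (0:ℝ)..1, deriv (deriv δ) (q + l * (p - q))) * r4
    have kvv : y.s ^ 2 * vv nu p q = y.s ^ m * y.s ^ m * (V1 e y * V2 e y + M e y * WW e y) := by
      unfold vv
      rw [kM]
      linear_combination (y.s * deriv nu q) * kV1 + y.s ^ m * V1 e y * kV2 + y.s ^ m * M e y * kW
    have hG := (Gw_pos Λ (y.a m) y.d).ne'
    have e3 : y.s ^ (3 * m - 2) * y.s ^ 2 = y.s ^ m * y.s ^ m * y.s ^ m := by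
      rw [← pow_add, ← pow_add, ← pow_add]; congr 1; omega
    have hs2 : y.s ^ 2 ≠ 0 := (pow_pos hs 2).ne'
    apply mul_left_cancel₀ hs2
    unfold ee
    rw [kM, kN, hpq]
    have ec : ((2 * √3) • (Y2.bG S m Λ hΛ * M e ^ 3 *
      (Y2.bα S m * M e ^ 4 - (15 / 4 * e.2.1 ^ 2) • Y2.bβ S m) * N e ^ 5 *
        (V1 e * V2 e + M e * WW e))) y = 2 * √3 * ((Gw Λ (y.a m) y.d)⁻¹ * M e y ^ 3 *
        ((y.a m * y.R m) ^ 2 * M e y ^ 4 - 15 / 4 * e.2.1 ^ 2 * (y.d * y.R m) ^ 2) * N e y ^ 5 *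
        (V1 e y * V2 e y + M e y * WW e y)) := by
      simp [Y2.bα, Y2.bβ, Y2.bG]
    rw [ec]
    have hGG : Gw Λ (y.a m) y.d * (Gw Λ (y.a m) y.d)⁻¹ = 1 := mul_inv_cancel₀ hG
    unfold Y2.U Y2.w
    have lhs : y.s ^ 2 * (2 * √3 * (y.s ^ m * M e y) ^ 3 * ((y.s ^ m * M e y) ^ 4 - 15 / 4 * (e.2.1 * y.d) ^ 2) *
        (y.R m * N e y) ^ 5 * vv nu p q) = 2 * √3 * (y.s ^ m * M e y) ^ 3 *
        ((y.s ^ m * M e y) ^ 4 - 15 / 4 * (e.2.1 * y.d) ^ 2) *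
        (y.R m * N e y) ^ 5 * (y.s ^ m * y.s ^ m * (V1 e y * V2 e y + M e y * WW e y)) := by
      rw [← kvv]; ring
    rw [lhs]
    set G := Gw Λ (y.a m) y.d
    set X := V1 e y * V2 e y + M e y * WW e y
    have rhs : y.s ^ 2 * (y.a m * y.R m ^ 3 * (y.s ^ (3 * m - 2) * G) * (2 * √3 * (G⁻¹ * M e y ^ 3 *
        ((y.a m * y.R m) ^ 2 * M e y ^ 4 - 15 / 4 * e.2.1 ^ 2 * (y.d * y.R m) ^ 2) * N e y ^ 5 * X))) =
        (y.s ^ m * y.s ^ m * y.s ^ m) * (G * G⁻¹) * (y.a m * y.R m ^ 3 * (2 * √3 * (M e y ^ 3 *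
        ((y.a m * y.R m) ^ 2 * M e y ^ 4 - 15 / 4 * e.2.1 ^ 2 * (y.d * y.R m) ^ 2) * N e y ^ 5 * X))) := by
      rw [← e3]; ring
    rw [rhs, hGG, ea]
    ring

end

lemma Y2.lam_eq {S : Set ℝ} {m : ℕ} (hm : 1 ≤ m) {Λ : ℝ} (hΛ : 0 < Λ) (y : Y2 S) :
    y.s ^ m * y.R m * Y2.bl S m Λ hΛ y = y.w m Λ := by
  have h1 : √(y.D m) ≠ 0 := (sqrt_pos.2 (y.D_pos m)).ne'
  have e : y.s ^ m * y.s ^ (2 * m - 2) = y.s ^ (3 * m - 2) := by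
    rw [← pow_add]; congr 1; omega
  simp only [Y2.bl, mkB_apply, Y2.w, Y2.R]
  rw [← e]; field_simp

lemma Y2.U_kap {S : Set ℝ} {m : ℕ} (y : Y2 S) :
    y.U m * Y2.bk S m y = (y.s ^ m * y.R m) ^ 4 := by
  simp only [Y2.bk, mkB_apply, Y2.U, Y2.a]
  have : y.s ^ (2 * m) = y.s ^ m * y.s ^ m := by rw [two_mul, pow_add]
  rw [this]; ring

lemma sol_eq {m : ℕ} (hm : 1 ≤ m) {μ : ℝ → ℝ} {z : ℝ → ℝ → ℝ} (hz : IsSol m μ z) {S : Set ℝ} {b Λ : ℝ}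
    (hΛ : 0 < Λ) (hb : ∀ s ∈ S, s * b ≤ TT m) {e : PE} (h1 : |e.2.1| < e.1) (h2 : e.1 + |e.2.1| < b)
    {A c x : Y2 S →ᵇ ℝ}
    (hA : ∀ y, AA μ (y.pos e y.u) (y.pos e y.v) = y.s ^ m * y.R m * A y)
    (hc : ∀ y, ee μ (y.pos e y.u) (y.pos e y.v) = y.U m * y.w m Λ * c y)
    (hx : ∀ y, z (y.pos e y.u) (y.pos e y.v) = y.w m Λ * x y) :
    FF (Y2.bk S m) (Y2.bl S m Λ hΛ) c A ((e.2.1 ^ 2) • (Y2.K S m hΛ).op) x = 0 := by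
  ext y
  have key : ∀ y : Y2 S, y.U m * y.w m Λ *
      ((c - Y2.bk S m * (x * H4 (A + Y2.bl S m Λ hΛ * x) A)) y) =
      gg μ z (y.pos e y.u) (y.pos e y.v) := by
    intro y
    have l := y.lam_eq hm hΛ
    have k := y.U_kap (m := m)
    unfold gg
    rw [hA, hc, hx]
    simp only [H4, BoundedContinuousFunction.coe_sub, BoundedContinuousFunction.coe_mul,
      BoundedContinuousFunction.coe_add, BoundedContinuousFunction.coe_pow, Pi.sub_apply, Pi.mul_apply,
      Pi.add_apply, Pi.pow_apply]
    rw [← l]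
    linear_combination (-(y.s ^ m * y.R m * (Y2.bl S m Λ hΛ) y * x y *
      ((A y + (Y2.bl S m Λ hΛ) y * x y) ^ 4 + (A y + (Y2.bl S m Λ hΛ) y * x y) ^ 3 * A y +
        (A y + (Y2.bl S m Λ hΛ) y * x y) ^ 2 * A y ^ 2 + (A y + (Y2.bl S m Λ hΛ) y * x y) * A y ^ 3 + A y ^ 4))) * k
  set g := c - Y2.bk S m * (x * H4 (A + Y2.bl S m Λ hΛ * x) A) with hg
  have hpu := y.pos_pos h1 y.abs_u
  have hpv := y.pos_pos h1 y.abs_v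
  have hqu := (y.pos_lt h2 y.abs_u).trans_le (hb _ y.sS)
  have hqv := (y.pos_lt h2 y.abs_v).trans_le (hb _ y.sS)
  have E := hz.eq _ _ hpu hqu hpv hqv
  have hpq : y.pos e y.u - y.pos e y.v = e.2.1 * y.d := by simp only [Y2.pos, Y2.d]; ring
  have I : (Y2.K S m hΛ).op g y = y.d ^ 2 / (4 * y.w m Λ) * ∫ β in (0:ℝ)..1, ∫ α in (0:ℝ)..1,
      max (α - β) 0 * gg μ z (y.pos e y.v + (y.pos e y.u - y.pos e y.v) * α)
        (y.pos e y.v + (y.pos e y.u - y.pos e y.v) * β) := by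
    show y.d ^ 2 / (4 * y.w m Λ) * (∫ β in (0:ℝ)..1, ∫ α in (0:ℝ)..1,
      max (α - β) 0 * ((y.tri α β).U m * (y.tri α β).w m Λ * g (y.tri α β))) = _
    congr 1
    refine intervalIntegral.integral_congr fun β hβ => ?_
    refine intervalIntegral.integral_congr fun α hα => ?_
    rw [Set.uIcc_of_le zero_le_one] at hα hβ
    show max (α - β) 0 * ((y.tri α β).U m * (y.tri α β).w m Λ * g (y.tri α β)) = max (α - β) 0 * _
    rcases le_total α β with h | h
    · rw [max_eq_right (by linarith)]; simp
    · rw [key, Y2.tri_u, Y2.tri_v, max_eq_left h, c01_eq hα.1 hα.2, c01_eq hβ.1 hβ.2]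
      have e1 : ∀ t, (y.tri α β).pos e (y.v + (y.u - y.v) * t) =
          y.pos e y.v + (y.pos e y.u - y.pos e y.v) * t := by
        intro t; simp only [Y2.pos, Y2.tri_s]; ring
      rw [e1, e1]
  have hw := y.w_pos m Λ
  show x y - e.2.1 ^ 2 * (Y2.K S m hΛ).op g y = 0
  rw [I]
  rw [hx] at E
  set J := ∫ β in (0:ℝ)..1, ∫ α in (0:ℝ)..1, max (α - β) 0 *
    gg μ z (y.pos e y.v + (y.pos e y.u - y.pos e y.v) * α) (y.pos e y.v + (y.pos e y.u - y.pos e y.v) * β)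
  rw [hpq] at E
  field_simp
  linear_combination 4 * E

lemma exists_x {m : ℕ} {μ : ℝ → ℝ} {z : ℝ → ℝ → ℝ} (hz : IsSol m μ z) {S : Set ℝ} {b Λ : ℝ}
    (hΛ : 0 < Λ) (hb : ∀ s ∈ S, s * b ≤ TT m) {e : PE} (h1 : |e.2.1| < e.1) (h2 : e.1 + |e.2.1| < b) :
    ∃ x : Y2 S →ᵇ ℝ, ∀ y, z (y.pos e y.u) (y.pos e y.v) = y.w m Λ * x y := by
  have hzb : ∀ y : Y2 S, |z (y.pos e y.u) (y.pos e y.v)| ≤ RR m * (y.s * b) ^ (3 * m - 2) := by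
    intro y
    have hpu := y.pos_pos h1 y.abs_u
    have hpv := y.pos_pos h1 y.abs_v
    have hlu := y.pos_lt h2 y.abs_u
    have hlv := y.pos_lt h2 y.abs_v
    have hR := (RR_pos m).le
    rcases le_total (y.pos e y.v) (y.pos e y.u) with h | h
    · exact (hz.bd _ _ hpv h (hlu.trans_le (hb _ y.sS))).trans (by gcongr)
    · rw [hz.symm]
      exact (hz.bd _ _ hpu h (hlv.trans_le (hb _ y.sS))).trans (by gcongr)
  have hcont : Continuous fun y : Y2 S => z (y.pos e y.u) (y.pos e y.v) := by
    refine hz.cont.comp_continuous (f := fun y : Y2 S => (y.pos e y.u, y.pos e y.v)) ?_ ?_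
    · unfold Y2.pos; fun_prop
    · intro y
      exact ⟨⟨y.pos_pos h1 y.abs_u, (y.pos_lt h2 y.abs_u).trans_le (hb _ y.sS)⟩,
        ⟨y.pos_pos h1 y.abs_v, (y.pos_lt h2 y.abs_v).trans_le (hb _ y.sS)⟩⟩
  refine ⟨mkB (fun y => z (y.pos e y.u) (y.pos e y.v) / y.w m Λ)
    (hcont.div (Y2.cw m Λ) fun y => (y.w_pos m Λ).ne') (RR m * b ^ (3 * m - 2) * exp Λ) fun y => ?_, fun y => ?_⟩
  · have hw := y.w_pos m Λ
    rw [abs_div, abs_of_pos hw, div_le_iff₀ hw]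
    refine (hzb y).trans ?_
    have hb0 : 0 < b := by linarith [abs_nonneg e.2.1]
    have hG := Gw_ge hΛ.le (y.a_pos m) y.d
    have hR := RR_pos m
    have hs := y.s0
    have h3 : 1 ≤ exp Λ * Gw Λ (y.a m) y.d := by
      calc 1 = exp Λ * exp (-Λ) := by rw [← Real.exp_add]; simp
        _ ≤ _ := by gcongr
    unfold Y2.w
    rw [mul_pow]
    calc _ = RR m * b ^ (3 * m - 2) * y.s ^ (3 * m - 2) * 1 := by ring
      _ ≤ RR m * b ^ (3 * m - 2) * y.s ^ (3 * m - 2) * (exp Λ * Gw Λ (y.a m) y.d) := by gcongr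
      _ = _ := by ring
  · rw [mkB_apply]; field_simp [(y.w_pos m Λ).ne']

lemma lamx_le {m : ℕ} (hm : 1 ≤ m) {μ : ℝ → ℝ} {z : ℝ → ℝ → ℝ} (hz : IsSol m μ z) {S : Set ℝ} {b Λ : ℝ}
    (hΛ : 0 < Λ) (hb : ∀ s ∈ S, s * b ≤ TT m) {e : PE} (h1 : |e.2.1| < e.1) (h2 : e.1 + |e.2.1| < b)
    {x : Y2 S →ᵇ ℝ} (hx : ∀ y, z (y.pos e y.u) (y.pos e y.v) = y.w m Λ * x y) :
    ‖Y2.bl S m Λ hΛ * x‖ ≤ 3 * RR m * b ^ (3 * m - 2) := by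
  have hb0 : 0 < b := by linarith [abs_nonneg e.2.1]
  have hR := RR_pos m
  refine (norm_le (by positivity)).2 fun y => ?_
  have hpu := y.pos_pos h1 y.abs_u
  have hpv := y.pos_pos h1 y.abs_v
  have hlu := y.pos_lt h2 y.abs_u
  have hlv := y.pos_lt h2 y.abs_v
  have hzb : |z (y.pos e y.u) (y.pos e y.v)| ≤ RR m * (y.s * b) ^ (3 * m - 2) := by
    rcases le_total (y.pos e y.v) (y.pos e y.u) with h | h
    · exact (hz.bd _ _ hpv h (hlu.trans_le (hb _ y.sS))).trans (by gcongr)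
    · rw [hz.symm]
      exact (hz.bd _ _ hpu h (hlv.trans_le (hb _ y.sS))).trans (by gcongr)
  rw [hx, ← y.lam_eq hm hΛ, mul_assoc, abs_mul, mul_pow] at hzb
  have hs := y.s0
  have hRp := y.R_pos m
  rw [abs_of_pos (by positivity)] at hzb
  have e : y.s ^ m * y.s ^ (2 * m - 2) = y.s ^ (3 * m - 2) := by
    rw [← pow_add]; congr 1; omega
  have h3 : y.s ^ (2 * m - 2) ≤ 1 := pow_le_one₀ hs.le y.s1
  have h4 : √(y.D m) ≤ 3 := by
    rw [show (3:ℝ) = √9 by rw [show (9:ℝ) = 3 ^ 2 by norm_num]; simp]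
    exact sqrt_le_sqrt (y.D_le m)
  have h5 : 1 ≤ 3 * y.R m := by
    have h6 : 0 < √(y.D m) := sqrt_pos.2 (y.D_pos m)
    unfold Y2.R
    rw [← div_eq_mul_inv, le_div_iff₀ h6]; linarith
  have hsm : 0 < y.s ^ m := pow_pos hs m
  show |Y2.bl S m Λ hΛ y * x y| ≤ _
  refine le_of_mul_le_mul_left ?_ (mul_pos hsm hRp)
  refine hzb.trans ?_
  rw [← e]
  calc RR m * (y.s ^ m * y.s ^ (2 * m - 2) * b ^ (3 * m - 2))
      ≤ RR m * (y.s ^ m * 1 * b ^ (3 * m - 2)) := by gcongr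
    _ = y.s ^ m * (RR m * b ^ (3 * m - 2)) * 1 := by ring
    _ ≤ y.s ^ m * (RR m * b ^ (3 * m - 2)) * (3 * y.R m) := by gcongr
    _ = _ := by ring

lemma H4_bound {S : Set ℝ} {m : ℕ} {a b : Y2 S →ᵇ ℝ} {B : ℝ} (ha : ‖a‖ ≤ B) (hb : ‖b‖ ≤ B) :
    ‖Y2.bk S m * H4 a b‖ ≤ 5 * B ^ 4 := by
  have hB : 0 ≤ B := (norm_nonneg _).trans ha
  refine (norm_le (by positivity)).2 fun y => ?_
  have h1 : |a y| ≤ B := (a.norm_coe_le_norm y).trans ha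
  have h2 : |b y| ≤ B := (b.norm_coe_le_norm y).trans hb
  have h3 : |Y2.bk S m y| ≤ 1 := by
    show |y.a m * y.R m| ≤ 1
    rw [abs_of_nonneg (y.aR_nonneg m)]; exact y.aR_le m
  show |Y2.bk S m y * (a y ^ 4 + a y ^ 3 * b y + a y ^ 2 * b y ^ 2 + a y * b y ^ 3 + b y ^ 4)| ≤ _
  rw [abs_mul]
  have h4 : |a y ^ 4 + a y ^ 3 * b y + a y ^ 2 * b y ^ 2 + a y * b y ^ 3 + b y ^ 4| ≤ 5 * B ^ 4 := by
    have e1 : |a y ^ 4| ≤ B ^ 4 := by rw [abs_pow]; gcongr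
    have e2 : |a y ^ 3 * b y| ≤ B ^ 3 * B := by rw [abs_mul, abs_pow]; gcongr
    have e3 : |a y ^ 2 * b y ^ 2| ≤ B ^ 2 * B ^ 2 := by rw [abs_mul, abs_pow, abs_pow]; gcongr
    have e4 : |a y * b y ^ 3| ≤ B * B ^ 3 := by rw [abs_mul, abs_pow]; gcongr
    have e5 : |b y ^ 4| ≤ B ^ 4 := by rw [abs_pow]; gcongr
    rw [abs_le] at *
    constructor <;> nlinarith
  calc _ ≤ 1 * (5 * B ^ 4) := by gcongr
    _ = _ := one_mul _

lemma FF_inc {S : Set ℝ} {m : ℕ} {Λ : ℝ} (hΛ : 0 < Λ) {s : ℝ} (hs : s ∈ S) (c A x : Y2 S →ᵇ ℝ) (r : ℝ)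
    (h : FF (Y2.bk S m) (Y2.bl S m Λ hΛ) c A (r • (Y2.K S m hΛ).op) x = 0) :
    FF (Y2.bk {s} m) (Y2.bl {s} m Λ hΛ) (c.compContinuous (Y2.inc s hs)) (A.compContinuous (Y2.inc s hs))
      (r • (Y2.K {s} m hΛ).op) (x.compContinuous (Y2.inc s hs)) = 0 := by
  ext y
  have h1 := congrArg (fun f : Y2 S →ᵇ ℝ => f (Y2.inc s hs y)) h
  exact h1

lemma comp_norm_le {S : Set ℝ} {s : ℝ} (hs : s ∈ S) (a : Y2 S →ᵇ ℝ) :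
    ‖a.compContinuous (Y2.inc s hs)‖ ≤ ‖a‖ :=
  (norm_le (norm_nonneg _)).2 fun y => a.norm_coe_le_norm _

lemma smulK_norm {B : Type} [NormedCommRing B] [NormedAlgebra ℝ B] (K : B →L[ℝ] B) {r ρ k : ℝ} (h0 : 0 ≤ r)
    (h : r ≤ ρ) (hk : ‖K‖ ≤ k) : ‖r • K‖ ≤ ρ * k := by
  rw [norm_smul, Real.norm_eq_abs, abs_of_nonneg h0]
  exact mul_le_mul h hk (norm_nonneg _) (h0.trans h)

lemma five_H4 {B : Type} [NormedCommRing B] [NormedAlgebra ℝ B] (k a : B) : k * (5 * a ^ 4) = k * H4 a a := by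
  unfold H4; ring

lemma FFK_norm {S : Set ℝ} {m : ℕ} {Λ : ℝ} (hΛ : 0 < Λ) {r ρ B : ℝ} (hr0 : 0 ≤ r) (hr : r ≤ ρ) (hB : 1 ≤ B)
    (hL : Λ = ρ * (5 * B ^ 4)) {a b : Y2 S →ᵇ ℝ} (ha : ‖a‖ ≤ B) (hb : ‖b‖ ≤ B) :
    ‖r • (Y2.K S m hΛ).op‖ * ‖Y2.bk S m * H4 a b‖ < 1 := by
  have h1 := H4_bound (m := m) ha hb
  have h2 := Y2.K_norm S m hΛ
  have h3 : ‖r • (Y2.K S m hΛ).op‖ ≤ ρ * (4⁻¹ * Λ⁻¹) := smulK_norm _ hr0 hr h2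
  have h4 : 0 ≤ ρ * (4⁻¹ * Λ⁻¹) := mul_nonneg (hr0.trans hr) (by positivity)
  calc _ ≤ ρ * (4⁻¹ * Λ⁻¹) * (5 * B ^ 4) := mul_le_mul h3 h1 (norm_nonneg _) h4
    _ = 4⁻¹ * (Λ * Λ⁻¹) := by rw [hL]; ring
    _ < 1 := by rw [mul_inv_cancel₀ hΛ.ne']; norm_num

lemma muT_zero (m : ℕ) (n : ℝ) (μ δ : ℝ → ℝ) (s : ℝ) : muT m n μ δ 0 s = μ := by
  funext t; simp [muT]
lemma muT_full {m : ℕ} (n : ℝ) (μ δ : ℝ → ℝ) {s : ℝ} (hs : 0 < s) :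
    muT m n μ δ (s ^ (n - m)) s = fun t => μ t + δ t := by
  funext t
  have : s ^ (n - (m:ℝ)) * s ^ ((m:ℝ) - n) = 1 := by rw [← rpow_add hs]; simp
  simp [muT, this]

theorem slice_smooth {m : ℕ} (hm : 1 ≤ m) {n : ℝ} {μ δ : ℝ → ℝ} (hA : Adm m μ) (hμ : Sym m μ) (hδ : Sym n δ)
    {S : Set ℝ} {b : ℝ} (hb : ∀ s ∈ S, s * b ≤ TT m) {θ1 θ2 : ℝ} (h1 : |θ2| < θ1) (h2 : θ1 + |θ2| < b)
    (hnd : θ2 ≠ 0 ∨ ∃ c > 0, ∀ y : Y2 S, c ≤ (y.a m * y.R m) ^ 2) :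
    ∃ Λ : ℝ, ∃ hΛ : 0 < Λ, ∃ M X : PE → Y2 S →ᵇ ℝ, CDAt M (θ1, θ2, 0) ∧
      CDAt X (θ1, θ2, 0) ∧
      ∀ᶠ e : PE in 𝓝 (θ1, θ2, 0), |e.2.1| < e.1 ∧ e.1 + |e.2.1| < b ∧ ∀ y : Y2 S,
        MM (muT m n μ δ e.2.2 y.s) (y.pos e y.u) (y.pos e y.v) = y.s ^ m * M e y ∧
        ∀ z, IsSol m (muT m n μ δ e.2.2 y.s) z → z (y.pos e y.u) (y.pos e y.v) = y.w m Λ * X e y := by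
  have hT1 : TT m ≤ 1 := (TT_le m).trans (by norm_num)
  have hb1 : ∀ s ∈ S, s * b ≤ 1 := fun s hs => (hb s hs).trans hT1
  set e0 : PE := (θ1, θ2, 0) with he0
  obtain ⟨M1, A1, c1, -, -, -, ev1⟩ := pieces hm hA hμ hδ hb1 one_pos h1 h2 hnd
  set ρ := 3 * RR m * b ^ (3 * m - 2) with hρ
  have hb0 : 0 < b := by linarith [abs_nonneg θ2]
  have hRR := RR_pos m
  have hρ0 : 0 ≤ ρ := by positivity
  set B := ‖A1 e0‖ + ρ + 1 with hB
  have hB1 : 1 ≤ B := by have := norm_nonneg (A1 e0); linarith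
  set Λ := (θ2 ^ 2 + 1) * (5 * B ^ 4) with hLdef
  have hΛ : 0 < Λ := by positivity
  obtain ⟨M, A, c, cM, cA, cc, ev⟩ := pieces hm hA hμ hδ hb1 hΛ h1 h2 hnd
  have hA1 : A e0 = A1 e0 := by
    ext y
    have k1 := (ev1.self_of_nhds.2.2 y).2.1
    have k2 := (ev.self_of_nhds.2.2 y).2.1
    have hs := y.s0
    have hR := y.R_pos m
    rw [k1] at k2
    exact (mul_left_cancel₀ (by positivity) k2).symm
  obtain ⟨z, hz⟩ := exists_sol hA hm
  obtain ⟨x0, hx0⟩ := exists_x hz hΛ hb (e := e0) h1 h2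
  have hmu0 : ∀ s, muT m n μ δ e0.2.2 s = μ := fun s => muT_zero m n μ δ s
  have F0 : FF (Y2.bk S m) (Y2.bl S m Λ hΛ) (c e0) (A e0) ((e0.2.1 ^ 2) • (Y2.K S m hΛ).op) x0 = 0 := by
    refine sol_eq hm hz hΛ hb h1 h2 (fun y => ?_) (fun y => ?_) hx0
    · have := (ev.self_of_nhds.2.2 y).2.1; rw [hmu0] at this; exact this
    · have := (ev.self_of_nhds.2.2 y).2.2; rw [hmu0] at this; exact this
  have hl0 := lamx_le hm hz hΛ hb (e := e0) h1 h2 hx0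
  have hn0 : ‖A e0 + Y2.bl S m Λ hΛ * x0‖ < B := by
    refine (norm_add_le _ _).trans_lt ?_
    rw [hA1]; linarith
  obtain ⟨X, cX, hX0, evX⟩ := ift_abs cc cA (cd_smulK (K := (Y2.K S m hΛ).op)) F0 (by
    have := FFK_norm (m := m) hΛ (sq_nonneg θ2) (by linarith : θ2 ^ 2 ≤ θ2 ^ 2 + 1) hB1 rfl hn0.le hn0.le
    rw [five_H4]
    exact this)
  refine ⟨Λ, hΛ, M, X, cM, cX, ?_⟩
  have ev2 : ∀ᶠ e in 𝓝 e0, ‖A e‖ < ‖A1 e0‖ + 1 := by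
    have : ContinuousAt (fun e => ‖A e‖) e0 := cA.continuousAt.norm
    refine this.eventually (gt_mem_nhds ?_)
    show ‖A e0‖ < _
    rw [hA1]; linarith
  have ev3 : ∀ᶠ e in 𝓝 e0, ‖A e + Y2.bl S m Λ hΛ * X e‖ < B := by
    have : ContinuousAt (fun e => ‖A e + Y2.bl S m Λ hΛ * X e‖) e0 :=
      (cA.continuousAt.add (continuousAt_const.mul cX.continuousAt)).norm
    refine this.eventually (gt_mem_nhds ?_)
    show ‖A e0 + Y2.bl S m Λ hΛ * X e0‖ < B
    rw [show X e0 = x0 from hX0]; exact hn0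
  have ev4 : ∀ᶠ e : PE in 𝓝 e0, e.2.1 ^ 2 < θ2 ^ 2 + 1 := by
    have : ContinuousAt (fun e : PE => e.2.1 ^ 2) e0 := by fun_prop
    refine this.eventually (gt_mem_nhds ?_)
    show θ2 ^ 2 < θ2 ^ 2 + 1
    linarith
  filter_upwards [ev, evX, ev2, ev3, ev4] with e g1 g2 g3 g4 g5
  refine ⟨g1.1, g1.2.1, fun y => ⟨(g1.2.2 y).1, fun z' hz' => ?_⟩⟩
  set s := y.s with hs
  have hsS : s ∈ S := y.sS
  have hbs : ∀ s' ∈ ({s} : Set ℝ), s' * b ≤ TT m := by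
    intro s' hs'; rw [Set.mem_singleton_iff.1 hs']; exact hb _ hsS
  obtain ⟨x', hx'⟩ := exists_x hz' hΛ hbs (e := e) g1.1 g1.2.1
  have ys : ∀ y' : Y2 {s}, y'.s = s := fun y' => y'.sS
  have F1 : FF (Y2.bk {s} m) (Y2.bl {s} m Λ hΛ) ((c e).compContinuous (Y2.inc s hsS))
      ((A e).compContinuous (Y2.inc s hsS)) ((e.2.1 ^ 2) • (Y2.K {s} m hΛ).op) x' = 0 := by
    refine sol_eq hm hz' hΛ hbs g1.1 g1.2.1 (fun y' => ?_) (fun y' => ?_) hx'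
    · have := (g1.2.2 (Y2.inc s hsS y')).2.1
      rw [show (Y2.inc s hsS y').s = s from ys y'] at this
      rw [ys y']
      exact this
    · have := (g1.2.2 (Y2.inc s hsS y')).2.2
      rw [show (Y2.inc s hsS y').s = s from ys y'] at this
      exact this
  have F2 := FF_inc hΛ hsS (c e) (A e) (X e) _ g2
  have hl := lamx_le hm hz' hΛ hbs (e := e) g1.1 g1.2.1 hx'
  have hU := ff_unique F2 F1 (by
    refine FFK_norm hΛ (sq_nonneg _) g5.le hB1 rfl ?_ ?_
    · refine le_trans ?_ g4.le
      exact comp_norm_le hsS (A e + Y2.bl S m Λ hΛ * X e)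
    · refine (norm_add_le _ _).trans ?_
      have := comp_norm_le hsS (A e)
      linarith)
  let y' : Y2 {s} := ⟨y.1, rfl, y.2.2⟩
  have k := hx' y'
  rw [← hU] at k
  exact k

lemma sym_zero (n : ℝ) : Sym n (fun _ => (0:ℝ)) where
  smooth := contDiffOn_const
  bd j := ⟨0, fun t _ _ => by
    have : iteratedDeriv j (fun _ : ℝ => (0:ℝ)) t = 0 := by
      rw [iteratedDeriv_const]; split_ifs <;> rfl
    rw [this]; simp⟩

def Y2.cor {S : Set ℝ} (s : ℝ) (h : s ∈ S) (h0 : 0 < s) (h1 : s ≤ 1) : Y2 S :=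
  ⟨(s, 1, -1), h, h0, h1, le_rfl, by norm_num, le_rfl⟩

theorem z_smooth {m : ℕ} (hm : 1 ≤ m) {μ : ℝ → ℝ} (hA : Adm m μ) (hμ : Sym m μ) {z : ℝ → ℝ → ℝ}
    (hz : IsSol m μ z) :
    CDOn (fun x : ℝℝ => z x.1 x.2) (Set.Ioo 0 (TT m) ×ˢ Set.Ioo 0 (TT m)) := by
  rintro ⟨p, q⟩ ⟨⟨hp0, hpT⟩, ⟨hq0, hqT⟩⟩
  simp only at hp0 hpT hq0 hqT
  apply ContDiffAt.contDiffWithinAt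
  have h1 : |(p - q) / 2| < (p + q) / 2 := by rw [abs_lt]; constructor <;> linarith
  have h2 : (p + q) / 2 + |(p - q) / 2| < TT m := by
    have : |(p - q) / 2| < TT m - (p + q) / 2 := by rw [abs_lt]; constructor <;> linarith
    linarith
  obtain ⟨Λ, hΛ, M, X, -, cX, ev⟩ := slice_smooth hm hA hμ (sym_zero m) (S := {1}) (b := TT m)
    (by intro s hs; rw [Set.mem_singleton_iff.1 hs, one_mul]) h1 h2
    (Or.inr ⟨1 / 9, by norm_num, fun y => by
      have k1 := y.R_sq m
      have k2 := y.D_le m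
      have k3 : y.a m = 1 := by
        unfold Y2.a; rw [show y.s = 1 from y.sS]; simp
      rw [k3, one_mul]
      nlinarith [sq_nonneg (y.R m)]⟩)
  let y : Y2 {1} := Y2.cor 1 rfl one_pos le_rfl
  let ef : ℝℝ → PE := fun x => ((x.1 + x.2) / 2, (x.1 - x.2) / 2, 0)
  have cef : ContDiff ℝ (⊤ : ℕ∞) ef := by
    show ContDiff ℝ (⊤ : ℕ∞) (fun x : ℝℝ => (((x.1 + x.2) / 2, (x.1 - x.2) / 2, (0:ℝ)) : ℝ × ℝ × ℝ))
    fun_prop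
  have c1 : CDAt (fun x => X (ef x)) (p, q) :=
    ContDiffAt.comp (p, q) (g := X) (f := ef) cX cef.contDiffAt
  have hev : ContDiff ℝ (⊤ : ℕ∞) (fun f : Y2 {1} →ᵇ ℝ => f y) :=
    let L : (Y2 {1} →ᵇ ℝ) →L[ℝ] ℝ := BoundedContinuousFunction.evalCLM ℝ y
    L.contDiff
  have c2 : CDAt (fun x => y.w m Λ * X (ef x) y) (p, q) :=
    contDiffAt_const.mul
      (ContDiffAt.comp (p, q) (g := fun f : Y2 {1} →ᵇ ℝ => f y) (f := fun x => X (ef x))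
        hev.contDiffAt c1)
  refine c2.congr_of_eventuallyEq ?_
  have hcont : Tendsto ef (𝓝 (p, q)) (𝓝 ((p + q) / 2, (p - q) / 2, 0)) := cef.continuous.continuousAt
  filter_upwards [hcont.eventually ev] with x hx
  have k := (hx.2.2 y).2 z (by rw [show (ef x).2.2 = 0 from rfl, muT_zero]; exact hz)
  rw [← k]
  show z x.1 x.2 = z (1 * ((x.1 + x.2) / 2 + (x.1 - x.2) / 2 * 1)) (1 * ((x.1 + x.2) / 2 + (x.1 - x.2) / 2 * (-1)))
  congr 1 <;> ring

def PS (μ : ℝ → ℝ) (z : ℝ → ℝ → ℝ) (p q : ℝ) : ℝ := (p - q) / 2 * (AA μ p q + z p q)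

def kq (w : ℝ) : ℝ := -(√(1 + w) * (1 + √(1 + w)))⁻¹
lemma kq_eq {w : ℝ} (hw : -1 < w) : (√(1 + w))⁻¹ - 1 = w * kq w := by
  have h : 0 < √(1 + w) := sqrt_pos.2 (by linarith)
  have h2 : √(1 + w) ^ 2 = 1 + w := sq_sqrt (by linarith)
  unfold kq
  field_simp
  linear_combination -h2
lemma kq_smooth : CDOn kq (Set.Ioi (-1)) := by
  intro w hw
  have hw' : (-1:ℝ) < w := hw
  have h : 0 < √(1 + w) := sqrt_pos.2 (by linarith)
  have c : CDAt (fun w : ℝ => √(1 + w)) w :=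
    ContDiffAt.sqrt (by fun_prop) (by linarith)
  exact ((c.mul (contDiffAt_const.add c)).inv (by positivity)).neg.contDiffWithinAt

lemma corner_id {m : ℕ} (hm : 1 ≤ m) {μ : ℝ → ℝ} {z : ℝ → ℝ → ℝ} {p q s θ M Wt G X : ℝ} (hs : 0 < s) (hθ : 0 < θ)
    (hpq : p - q = 2 * (s * θ)) (hM : MM μ p q = s ^ m * M)
    (hW : Wt = (3 * θ ^ 2)⁻¹ * (s ^ (4 * m - 2) * M ^ 4))
    (hz : z p q = s ^ (3 * m - 2) * G * X) :
    PS μ z p q - MM μ p q = s ^ (m + 1) * ((3 * θ ^ 2)⁻¹ * (s ^ (4 * m - 3) * M ^ 5 * kq Wt) +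
      θ * (s ^ (2 * m - 2) * G * X)) := by
  have hW0 : 0 ≤ Wt := by rw [hW]; positivity
  have hr : 0 < s * θ := mul_pos hs hθ
  have e1 : s ^ (4 * m - 2) * s ^ 2 = (s ^ m) ^ 4 := by
    rw [← pow_add, ← pow_mul]; congr 1; omega
  have e2 : s ^ (4 * m - 3) * s ^ (m + 1) = s ^ (4 * m - 2) * s ^ m := by
    rw [← pow_add, ← pow_add]; congr 1; omega
  have e3 : s * s ^ (3 * m - 2) = s ^ (m + 1) * s ^ (2 * m - 2) := by
    rw [← pow_succ', ← pow_add]; congr 1; omega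
  have eD : DD μ p q = (√3 * (s * θ)) ^ 2 * (1 + Wt) := by
    unfold DD
    rw [hM, hpq, hW, mul_pow (√3), sq_sqrt (by norm_num : (0:ℝ) ≤ 3)]
    field_simp
    linear_combination -(4 * M ^ 4) * e1
  have eN : NN μ p q = (√3 * (s * θ))⁻¹ * (√(1 + Wt))⁻¹ := by
    unfold NN
    rw [eD, sqrt_mul (by positivity), sqrt_sq (by positivity), mul_inv]
  have h3 : √3 ≠ 0 := by positivity
  have eA : (p - q) / 2 * AA μ p q = s ^ m * M * (√(1 + Wt))⁻¹ := by
    unfold AA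
    rw [hM, eN, hpq]
    have : √(1 + Wt) ≠ 0 := (sqrt_pos.2 (by linarith)).ne'
    field_simp
  have hk := kq_eq (w := Wt) (by linarith)
  have : PS μ z p q - MM μ p q = s ^ m * M * (Wt * kq Wt) + s * θ * (s ^ (3 * m - 2) * G * X) := by
    unfold PS
    rw [mul_add, eA, hM, hz, hpq]
    linear_combination s ^ m * M * hk
  rw [this]
  nth_rewrite 1 [hW]
  linear_combination (-((3 * θ ^ 2)⁻¹ * M ^ 5 * kq Wt)) * e2 + θ * G * X * e3

lemma cd_corner {B : Type} [NormedCommRing B] [NormedAlgebra ℝ B] {M X Kq : PE → B} {e : PE} (b1 b2 : B)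
    (he : e.2.1 ≠ 0)
    (h1 : CDAt M e) (h2 : CDAt X e) (h3 : CDAt Kq e) :
    CDAt (fun e => (3 * e.2.1 ^ 2)⁻¹ • (b1 * M e ^ 5 * Kq e) + e.2.1 • (b2 * X e)) e := by
  have : CDAt (fun e : PE => (3 * e.2.1 ^ 2)⁻¹) e :=
    ContDiffAt.inv (by fun_prop) (by positivity)
  fun_prop
lemma cd_cornerW {B : Type} [NormedCommRing B] [NormedAlgebra ℝ B] {M : PE → B} {e : PE} (b1 : B)
    (he : e.2.1 ≠ 0) (h1 : CDAt M e) :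
    CDAt (fun e => (3 * e.2.1 ^ 2)⁻¹ • (b1 * M e ^ 4)) e := by
  have : CDAt (fun e : PE => (3 * e.2.1 ^ 2)⁻¹) e :=
    ContDiffAt.inv (by fun_prop) (by positivity)
  fun_prop

def Y2.bs (S : Set ℝ) (i : ℕ) : Y2 S →ᵇ ℝ := mkB (fun y => y.s ^ i) (by fun_prop) 1 fun y => by
  rw [abs_of_nonneg (pow_nonneg y.s0.le _)]; exact pow_le_one₀ y.s0.le y.s1
def Y2.bg (S : Set ℝ) (m : ℕ) (Λ : ℝ) (hΛ : 0 < Λ) : Y2 S →ᵇ ℝ :=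
  mkB (fun y => Gw Λ (y.a m) y.d) (by fun_prop) 1 fun y => by
    rw [abs_of_pos (Gw_pos _ _ _)]; exact Gw_le_one hΛ.le (y.a_pos m) _

theorem corner_fun {m : ℕ} (hm : 1 ≤ m) {n : ℝ} {μ δ : ℝ → ℝ} (hA : Adm m μ) (hμ : Sym m μ) (hδ : Sym n δ) :
    ∃ (Y : Type) (_ : TopologicalSpace Y) (G : ℝℝ → (Y →ᵇ ℝ)) (c : ∀ s : ℝ, 0 < s → s < TT m / 3 → Y),
      CDAt G (0, 0) ∧ ∀ᶠ x : ℝℝ in 𝓝 (0, 0), ∀ s (h0 : 0 < s) (h1 : s < TT m / 3), ∀ z,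
        IsSol m (muT m n μ δ x.2 s) z → PS (muT m n μ δ x.2 s) z (2 * s) (s + s * x.1) -
          MM (muT m n μ δ x.2 s) (2 * s) (s + s * x.1) = s ^ (m + 1) * G x (c s h0 h1) := by
  set S : Set ℝ := Set.Iio (TT m / 3) with hS
  have hT4 := TT_le m
  obtain ⟨Λ, hΛ, M, X, cM, cX, ev⟩ := slice_smooth hm hA hμ hδ (S := S) (b := 3)
    (fun s hs => by have : s < TT m / 3 := hs; linarith) (θ1 := 3 / 2) (θ2 := 1 / 2)
    (by rw [abs_of_pos (by norm_num)]; norm_num) (by rw [abs_of_pos (by norm_num)]; norm_num)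
    (Or.inl (by norm_num))
  set e0 : PE := (3 / 2, 1 / 2, 0) with he0
  have he1 : e0.2.1 ≠ 0 := by rw [he0]; norm_num
  let Wf : PE → Y2 S →ᵇ ℝ := fun e => (3 * e.2.1 ^ 2)⁻¹ • (Y2.bs S (4 * m - 2) * M e ^ 4)
  have cW : CDAt Wf e0 := cd_cornerW _ he1 cM
  have eW : ∀ e y, Wf e y = (3 * e.2.1 ^ 2)⁻¹ * (y.s ^ (4 * m - 2) * M e y ^ 4) := by
    intro e y; simp [Wf, Y2.bs]
  set b0 := ‖Wf e0‖ + 1 with hb0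
  have hcb : (-1 / 2 : ℝ) ≤ b0 := by rw [hb0]; have := norm_nonneg (Wf e0); linarith
  let Nm := NemData.ofSmooth (Y2 S) isOpen_Ioi kq_smooth hcb
    (fun x hx => lt_of_lt_of_le (by norm_num) hx.1)
  have hdom : Wf e0 ∈ (NemData.dom (-1 / 2) b0 : Set (Y2 S →ᵇ ℝ)) := by
    refine ⟨1 / 2, by norm_num, fun y => ?_⟩
    have k1 : 0 ≤ Wf e0 y := by
      rw [eW]; have := y.s0; positivity
    have k2 := (le_abs_self _).trans ((Wf e0).norm_coe_le_norm y)
    constructor <;> linarith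
  let Kq : PE → Y2 S →ᵇ ℝ := fun e => Nm.map 0 (Wf e)
  have cK : CDAt Kq e0 := (Nm.contDiffAt 0 hdom).comp e0 cW
  let Ψ : PE → Y2 S →ᵇ ℝ := fun e => (3 * e.2.1 ^ 2)⁻¹ • (Y2.bs S (4 * m - 3) * M e ^ 5 * Kq e) +
    e.2.1 • ((Y2.bs S (2 * m - 2) * Y2.bg S m Λ hΛ) * X e)
  have cΨ : CDAt Ψ e0 := cd_corner _ _ he1 cM cX cK
  let ef : ℝℝ → PE := fun x => ((3 + x.1) / 2, (1 - x.1) / 2, x.2)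
  have cef : ContDiff ℝ (⊤ : ℕ∞) ef := by
    show ContDiff ℝ (⊤ : ℕ∞) (fun x : ℝℝ => (((3 + x.1) / 2, (1 - x.1) / 2, x.2) : ℝ × ℝ × ℝ))
    fun_prop
  have hef0 : ef (0, 0) = e0 := by simp [ef, he0]
  refine ⟨Y2 S, inferInstance, fun x => Ψ (ef x), fun s h0 h1 => Y2.cor s h1 h0 (by linarith),
    ContDiffAt.comp (0, 0) (g := Ψ) (f := ef) (by rw [hef0]; exact cΨ) cef.contDiffAt, ?_⟩
  have hcont : Tendsto ef (𝓝 (0, 0)) (𝓝 e0) := by rw [← hef0]; exact cef.continuous.continuousAt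
  have ev1 : ∀ᶠ e : PE in 𝓝 e0, Wf e ∈ (NemData.dom (-1 / 2) b0 : Set (Y2 S →ᵇ ℝ)) :=
    cW.continuousAt.eventually (NemData.dom_open.mem_nhds hdom)
  have ev2 : ∀ᶠ e : PE in 𝓝 e0, 0 < e.2.1 := by
    have : ContinuousAt (fun e : PE => e.2.1) e0 := by fun_prop
    exact this.eventually (lt_mem_nhds (by rw [he0]; norm_num))
  filter_upwards [hcont.eventually ev, hcont.eventually ev1, hcont.eventually ev2] with x g1 g2 g3 s h0 h1 z hz
  let y : Y2 S := Y2.cor s h1 h0 (by linarith)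
  have g := g1.2.2 y
  have ys : y.s = s := rfl
  have pu : y.pos (ef x) y.u = 2 * s := by
    show s * ((3 + x.1) / 2 + (1 - x.1) / 2 * 1) = 2 * s
    ring
  have pv : y.pos (ef x) y.v = s + s * x.1 := by
    show s * ((3 + x.1) / 2 + (1 - x.1) / 2 * (-1)) = s + s * x.1
    ring
  rw [pu, pv, ys] at g
  have k := g.2 z hz
  have := corner_id hm (μ := muT m n μ δ x.2 s) (z := z) (p := 2 * s) (q := s + s * x.1) (s := s)
    (θ := (ef x).2.1) (M := M (ef x) y) (Wt := Wf (ef x) y) (G := Gw Λ (y.a m) y.d) (X := X (ef x) y)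
    h0 g3 (by show 2 * s - (s + s * x.1) = 2 * (s * ((1 - x.1) / 2)); ring) g.1 (by rw [eW, ys]) k
  rw [this]
  congr 1
  have hk : Kq (ef x) y = kq (Wf (ef x) y) := by
    show Nm.map 0 (Wf (ef x)) y = _
    rw [Nm.map_apply 0 (NemData.dom_mem g2 y)]
    simp [Nm, NemData.ofSmooth]
  show _ = (3 * (ef x).2.1 ^ 2)⁻¹ * (s ^ (4 * m - 3) * M (ef x) y ^ 5 * Kq (ef x) y) +
    (ef x).2.1 * (s ^ (2 * m - 2) * Gw Λ (y.a m) y.d * X (ef x) y)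
  rw [hk]

lemma iter_scale (F : ℝ → ℝ) (s : ℝ) (j : ℕ) :
    iteratedDeriv j (fun τ => F (s + s * τ)) = fun τ => s ^ j * iteratedDeriv j F (s + s * τ) := by
  induction j with
  | zero => simp
  | succ j ih =>
    rw [iteratedDeriv_succ, ih]
    funext τ
    rw [deriv_const_mul_field]
    have h := deriv_comp_mul_left s (fun u => iteratedDeriv j F (s + u)) τ
    simp only [smul_eq_mul] at h
    rw [h, deriv_comp_const_add, iteratedDeriv_succ, pow_succ]
    ring

lemma par_deriv {V : Type*} [NormedAddCommGroup V] [NormedSpace ℝ V] {G : ℝℝ → V}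
    (hG : CDAt G (0, 0)) (j : ℕ) :
    ∃ D : ℝℝ → V, CDAt D (0, 0) ∧ ∀ᶠ x : ℝℝ in 𝓝 (0, 0), ∀ L : V →L[ℝ] ℝ,
      iteratedDeriv j (fun τ => L (G (τ, x.2))) x.1 = L (D x) := by
  induction j with
  | zero => exact ⟨G, hG, Eventually.of_forall fun x L => by simp⟩
  | succ j ih =>
    obtain ⟨D, hD, ev⟩ := ih
    refine ⟨fun x => fderiv ℝ D x (1, 0), (hD.fderiv_right (m := (⊤ : ℕ∞)) le_rfl).clm_apply contDiffAt_const, ?_⟩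
    have e1 : ∀ᶠ x : ℝℝ in 𝓝 (0, 0), ContDiffAt ℝ 1 D x :=
      (hD.of_le (by exact_mod_cast le_top)).eventually (by simp)
    filter_upwards [ev.eventually_nhds, e1] with x hx h1 L
    rw [iteratedDeriv_succ]
    have hc : ContinuousAt (fun τ : ℝ => (τ, x.2)) x.1 := by fun_prop
    have h2 : (iteratedDeriv j fun τ => L (G (τ, x.2))) =ᶠ[𝓝 x.1] fun τ => L (D (τ, x.2)) := by
      filter_upwards [hc.eventually (show ∀ᶠ y in 𝓝 (x.1, x.2), _ from hx)] with τ hτ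
      exact hτ L
    rw [h2.deriv_eq]
    have h3 : HasFDerivAt D (fderiv ℝ D x) (x.1, x.2) := (h1.differentiableAt (by simp)).hasFDerivAt
    have h4 : HasDerivAt (fun τ : ℝ => (τ, x.2)) ((1:ℝ), (0:ℝ)) x.1 :=
      (hasDerivAt_id x.1).prodMk (hasDerivAt_const x.1 x.2)
    have h5 : HasDerivAt (fun τ : ℝ => D (τ, x.2)) (fderiv ℝ D x (1, 0)) x.1 := h3.comp_hasDerivAt x.1 h4
    exact (L.hasFDerivAt.comp_hasDerivAt x.1 h5).deriv

theorem corner {m : ℕ} (hm : 1 ≤ m) {n : ℝ} (hn : m < n) {μ δ : ℝ → ℝ} (hA : Adm m μ) (hμ : Sym m μ)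
    (hδ : Sym n δ) {z z' : ℝ → ℝ → ℝ} (hz : IsSol m μ z) (hz' : IsSol m (fun t => μ t + δ t) z') (j : ℕ) :
    ∃ C ε, 0 < ε ∧ ∀ s, 0 < s → s < ε →
      |iteratedDeriv j (fun q => PS μ z (2 * s) q - MM μ (2 * s) q) s| ≤ C * s ^ ((m:ℝ) + 1 - j) ∧
      |iteratedDeriv j (fun q => PS (fun t => μ t + δ t) z' (2 * s) q - MM (fun t => μ t + δ t) (2 * s) q) s
        - iteratedDeriv j (fun q => PS μ z (2 * s) q - MM μ (2 * s) q) s| ≤ C * s ^ (n + 1 - j) := by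
  obtain ⟨Y, _, G, c, cG, ev⟩ := corner_fun hm (n := n) hA hμ hδ
  obtain ⟨D, cD, evD⟩ := par_deriv cG j
  obtain ⟨K, u, hu, hK⟩ := (cD.of_le (m := 1) (by exact_mod_cast le_top)).exists_lipschitzOnWith
  obtain ⟨ε, hε, hB⟩ := Metric.eventually_nhds_iff_ball.1 ((ev.eventually_nhds.and evD).and hu)
  have key : ∀ η s, |η| < ε → ∀ (h0 : 0 < s) (h1 : s < TT m / 3), ∀ z, IsSol m (muT m n μ δ η s) z →
      iteratedDeriv j (fun q => PS (muT m n μ δ η s) z (2 * s) q - MM (muT m n μ δ η s) (2 * s) q) s =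
        s ^ ((m:ℝ) + 1 - j) * D (0, η) (c s h0 h1) := by
    intro η s hη h0 h1 z hz
    have hx : ((0:ℝ), η) ∈ Metric.ball ((0:ℝ), (0:ℝ)) ε := by
      rw [Metric.mem_ball, Prod.dist_eq]; simp [Real.dist_eq, hη, hε]
    obtain ⟨⟨h2, h3⟩, -⟩ := hB _ hx
    let L : (Y →ᵇ ℝ) →L[ℝ] ℝ := BoundedContinuousFunction.evalCLM ℝ (c s h0 h1)
    have h4 := h3 L
    have hc : ContinuousAt (fun τ : ℝ => (τ, η)) 0 := by fun_prop
    set F := fun q => PS (muT m n μ δ η s) z (2 * s) q - MM (muT m n μ δ η s) (2 * s) q with hF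
    have h5 : (fun τ => F (s + s * τ)) =ᶠ[𝓝 0] fun τ => s ^ (m + 1) * L (G (τ, η)) := by
      filter_upwards [hc.eventually h2] with τ hτ
      exact hτ s h0 h1 z hz
    have h6 := h5.iteratedDeriv_eq j
    rw [iter_scale, iteratedDeriv_const_mul_field, h4] at h6
    simp only [mul_zero, add_zero] at h6
    have h7 : s ^ (m + 1) = s ^ j * s ^ ((m:ℝ) + 1 - j) := by
      rw [← rpow_natCast s j, ← rpow_add h0, ← rpow_natCast s (m + 1)]
      congr 1; push_cast; ring
    rw [h7, mul_assoc] at h6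
    exact mul_left_cancel₀ (by positivity) h6
  have hpos : 0 < n - m := sub_pos.2 hn
  have hlim : Tendsto (fun s : ℝ => s ^ (n - (m:ℝ))) (𝓝 0) (𝓝 0) := by
    have := (Real.continuousAt_rpow_const 0 (n - (m:ℝ)) (Or.inr hpos.le)).tendsto
    rwa [Real.zero_rpow hpos.ne'] at this
  obtain ⟨ε', hε', hB'⟩ := Metric.eventually_nhds_iff_ball.1 (hlim.eventually (Metric.ball_mem_nhds 0 hε))
  refine ⟨‖D (0, 0)‖ + K, min ε' (TT m / 3), lt_min hε' (by have := TT_pos m; linarith), fun s h0 hs => ?_⟩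
  have h1 : s < TT m / 3 := hs.trans_le (min_le_right _ _)
  have hη : |s ^ (n - (m:ℝ))| < ε := by
    have := hB' s (by rw [Metric.mem_ball, Real.dist_eq, sub_zero, abs_of_pos h0]; exact hs.trans_le (min_le_left _ _))
    simpa using this
  have k1 := key 0 s (by simpa using hε) h0 h1 z (by rw [muT_zero]; exact hz)
  have k2 := key _ s hη h0 h1 z' (by rw [muT_full n μ δ h0]; exact hz')
  rw [muT_zero] at k1
  rw [muT_full n μ δ h0] at k2
  rw [k1, k2]
  have hK0 : (0:ℝ) ≤ K := K.2
  have hpw := rpow_pos_of_pos h0 ((m:ℝ) + 1 - j)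
  constructor
  · rw [abs_mul, abs_of_pos hpw, mul_comm]
    gcongr
    have := (D (0, 0)).norm_coe_le_norm (c s h0 h1)
    rw [Real.norm_eq_abs] at this
    linarith
  · rw [← mul_sub, abs_mul, abs_of_pos hpw]
    have hx : ((0:ℝ), s ^ (n - (m:ℝ))) ∈ Metric.ball ((0:ℝ), (0:ℝ)) ε := by
      rw [Metric.mem_ball, Prod.dist_eq]; simp only [Real.dist_eq, sub_zero, abs_zero]
      exact max_lt hε hη
    have h3 := hK.dist_le_mul _ (hB _ hx).2 _ (hB _ (Metric.mem_ball_self hε)).2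
    have h4 : dist ((0:ℝ), s ^ (n - (m:ℝ))) ((0:ℝ), (0:ℝ)) = s ^ (n - (m:ℝ)) := by
      rw [Prod.dist_eq]; simp only [Real.dist_eq, sub_zero, abs_zero]
      rw [abs_of_pos (rpow_pos_of_pos h0 _), max_eq_right (rpow_pos_of_pos h0 _).le]
    rw [h4, dist_eq_norm] at h3
    have h5 := (D (0, s ^ (n - (m:ℝ))) - D (0, 0)).norm_coe_le_norm (c s h0 h1)
    rw [Real.norm_eq_abs] at h5
    have h6 : s ^ (n + 1 - j) = s ^ ((m:ℝ) + 1 - j) * s ^ (n - (m:ℝ)) := by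
      rw [← rpow_add h0]; congr 1; ring
    rw [h6]
    have h7 : |D (0, s ^ (n - (m:ℝ))) (c s h0 h1) - D (0, 0) (c s h0 h1)| ≤ K * s ^ (n - (m:ℝ)) := by
      refine le_trans (le_of_eq ?_) (h5.trans h3)
      simp
    calc _ ≤ s ^ ((m:ℝ) + 1 - j) * (K * s ^ (n - (m:ℝ))) := by gcongr
      _ ≤ s ^ ((m:ℝ) + 1 - j) * ((‖D (0, 0)‖ + K) * s ^ (n - (m:ℝ))) := by
        gcongr; linarith [norm_nonneg (D (0, 0))]
      _ = _ := by ring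

section

def DQ (j : ℕ) (f : ℝℝ → ℝ) (x : ℝℝ) : ℝ := iteratedDeriv j (fun q => f (x.1, q)) x.2
def DP (f : ℝℝ → ℝ) (x : ℝℝ) : ℝ := deriv (fun p => f (p, x.2)) x.1

@[simp] lemma DQ_zero (f : ℝℝ → ℝ) : DQ 0 f = f := by funext x; simp [DQ]
lemma DQ_succ (j : ℕ) (f : ℝℝ → ℝ) : DQ (j + 1) f = DQ 1 (DQ j f) := by
  funext x; simp [DQ, iteratedDeriv_succ]
lemma DQ_succ' (j : ℕ) (f : ℝℝ → ℝ) : DQ (j + 1) f = DQ j (DQ 1 f) := by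
  funext x; simp [DQ, iteratedDeriv_succ']

section
variable {Ω : Set (ℝℝ)} (hΩ : IsOpen Ω)
include hΩ

lemma slice_q {x : ℝℝ} (hx : x ∈ Ω) : ∀ᶠ q in 𝓝 x.2, (x.1, q) ∈ Ω := by
  have hc : ContinuousAt (fun q : ℝ => (x.1, q)) x.2 := by fun_prop
  exact hc.eventually (show ∀ᶠ y in 𝓝 (x.1, x.2), y ∈ Ω from hΩ.mem_nhds hx)

lemma DQ_congr {f g : ℝℝ → ℝ} (h : ∀ x ∈ Ω, f x = g x) (j : ℕ) : ∀ x ∈ Ω, DQ j f x = DQ j g x := by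
  intro x hx
  refine Filter.EventuallyEq.iteratedDeriv_eq j ?_
  filter_upwards [slice_q hΩ hx] with q hq using h _ hq

lemma has_q {f : ℝℝ → ℝ} (hf : CDOn f Ω) {x : ℝℝ} (hx : x ∈ Ω) :
    HasDerivAt (fun q => f (x.1, q)) (fderiv ℝ f x (0, 1)) x.2 := by
  have h1 : HasFDerivAt f (fderiv ℝ f x) (x.1, x.2) :=
    ((hf.contDiffAt (hΩ.mem_nhds hx)).differentiableAt (by simp)).hasFDerivAt
  have h4 : HasDerivAt (fun q : ℝ => (x.1, q)) ((0:ℝ), (1:ℝ)) x.2 :=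
    (hasDerivAt_const x.2 x.1).prodMk (hasDerivAt_id x.2)
  exact h1.comp_hasDerivAt x.2 h4

lemma has_p {f : ℝℝ → ℝ} (hf : CDOn f Ω) {x : ℝℝ} (hx : x ∈ Ω) :
    HasDerivAt (fun p => f (p, x.2)) (fderiv ℝ f x (1, 0)) x.1 := by
  have h1 : HasFDerivAt f (fderiv ℝ f x) (x.1, x.2) :=
    ((hf.contDiffAt (hΩ.mem_nhds hx)).differentiableAt (by simp)).hasFDerivAt
  have h4 : HasDerivAt (fun p : ℝ => (p, x.2)) ((1:ℝ), (0:ℝ)) x.1 :=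
    (hasDerivAt_id x.1).prodMk (hasDerivAt_const x.1 x.2)
  exact h1.comp_hasDerivAt x.1 h4

lemma DQ_one_eq {f : ℝℝ → ℝ} (hf : CDOn f Ω) {x : ℝℝ} (hx : x ∈ Ω) :
    DQ 1 f x = fderiv ℝ f x (0, 1) := by
  simp only [DQ, iteratedDeriv_one]; exact (has_q hΩ hf hx).deriv

lemma DP_eq {f : ℝℝ → ℝ} (hf : CDOn f Ω) {x : ℝℝ} (hx : x ∈ Ω) :
    DP f x = fderiv ℝ f x (1, 0) := (has_p hΩ hf hx).deriv

lemma fd_smooth {f : ℝℝ → ℝ} (hf : CDOn f Ω) (v : ℝℝ) :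
    CDOn (fun x => fderiv ℝ f x v) Ω :=
  (hf.fderiv_of_isOpen hΩ (m := (⊤ : ℕ∞)) le_rfl).clm_apply contDiffOn_const

lemma DQ_smooth {f : ℝℝ → ℝ} (hf : CDOn f Ω) (j : ℕ) :
    CDOn (DQ j f) Ω := by
  induction j with
  | zero => simpa using hf
  | succ j ih =>
    rw [DQ_succ]
    exact (fd_smooth hΩ ih (0, 1)).congr fun x hx => DQ_one_eq hΩ ih hx

lemma DP_smooth {f : ℝℝ → ℝ} (hf : CDOn f Ω) :
    CDOn (DP f) Ω :=
  (fd_smooth hΩ hf (1, 0)).congr fun x hx => DP_eq hΩ hf hx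

lemma comm1 {f : ℝℝ → ℝ} (hf : CDOn f Ω) {x : ℝℝ} (hx : x ∈ Ω) :
    DP (DQ 1 f) x = DQ 1 (DP f) x := by
  rw [DP_eq hΩ (DQ_smooth hΩ hf 1) hx, DQ_one_eq hΩ (DP_smooth hΩ hf) hx]
  have hd : DifferentiableAt ℝ (fderiv ℝ f) x :=
    ((hf.fderiv_of_isOpen hΩ (m := (⊤ : ℕ∞)) le_rfl).contDiffAt (hΩ.mem_nhds hx)).differentiableAt (by simp)
  have e1 : DQ 1 f =ᶠ[𝓝 x] fun y => fderiv ℝ f y (0, 1) := by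
    filter_upwards [hΩ.mem_nhds hx] with y hy using DQ_one_eq hΩ hf hy
  have e2 : DP f =ᶠ[𝓝 x] fun y => fderiv ℝ f y (1, 0) := by
    filter_upwards [hΩ.mem_nhds hx] with y hy using DP_eq hΩ hf hy
  rw [e1.fderiv_eq, e2.fderiv_eq]
  have a1 : fderiv ℝ (fun y => fderiv ℝ f y (0, 1)) x (1, 0) = fderiv ℝ (fderiv ℝ f) x (1, 0) (0, 1) := by
    rw [(hd.hasFDerivAt.clm_apply (hasFDerivAt_const ((0:ℝ), (1:ℝ)) x)).fderiv]; simp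
  have a2 : fderiv ℝ (fun y => fderiv ℝ f y (1, 0)) x (0, 1) = fderiv ℝ (fderiv ℝ f) x (0, 1) (1, 0) := by
    rw [(hd.hasFDerivAt.clm_apply (hasFDerivAt_const ((1:ℝ), (0:ℝ)) x)).fderiv]; simp
  rw [a1, a2]
  exact ((hf.contDiffAt (hΩ.mem_nhds hx)).isSymmSndFDerivAt (by simpa using (show ((2:ℕ∞) : WithTop ℕ∞) ≤ ((⊤ : ℕ∞) : WithTop ℕ∞) from by exact_mod_cast le_top))) _ _

lemma comm_j {f : ℝℝ → ℝ} (hf : CDOn f Ω) (j : ℕ) {x : ℝℝ} (hx : x ∈ Ω) :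
    DP (DQ j f) x = DQ j (DP f) x := by
  induction j generalizing x with
  | zero => simp
  | succ j ih =>
    rw [DQ_succ j f, comm1 hΩ (DQ_smooth hΩ hf j) hx, DQ_succ j (DP f)]
    exact DQ_congr hΩ (fun y hy => ih hy) 1 x hx

lemma has_DQ_q {f : ℝℝ → ℝ} (hf : CDOn f Ω) (j : ℕ) {x : ℝℝ} (hx : x ∈ Ω) :
    HasDerivAt (fun q => DQ j f (x.1, q)) (DQ (j + 1) f x) x.2 := by
  rw [DQ_succ, DQ_one_eq hΩ (DQ_smooth hΩ hf j) hx]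
  exact has_q hΩ (DQ_smooth hΩ hf j) hx

lemma has_DQ_p {f : ℝℝ → ℝ} (hf : CDOn f Ω) (j : ℕ) {x : ℝℝ} (hx : x ∈ Ω) :
    HasDerivAt (fun p => DQ j f (p, x.2)) (DQ j (DP f) x) x.1 := by
  rw [← comm_j hΩ hf j hx, DP_eq hΩ (DQ_smooth hΩ hf j) hx]
  exact has_p hΩ (DQ_smooth hΩ hf j) hx

lemma slice_cd {f : ℝℝ → ℝ} (hf : CDOn f Ω) {x : ℝℝ} (hx : x ∈ Ω) (j : ℕ) :
    ContDiffAt ℝ j (fun q => f (x.1, q)) x.2 := by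
  have h := (hf.contDiffAt (hΩ.mem_nhds hx)).of_le (m := (j : WithTop ℕ∞)) (by exact_mod_cast le_top)
  exact ContDiffAt.comp x.2 (g := f) (f := fun q : ℝ => (x.1, q)) h (by fun_prop)

lemma DQ_add {f g : ℝℝ → ℝ} (hf : CDOn f Ω) (hg : CDOn g Ω) (j : ℕ)
    {x : ℝℝ} (hx : x ∈ Ω) : DQ j (fun y => f y + g y) x = DQ j f x + DQ j g x :=
  iteratedDeriv_add (slice_cd hΩ hf hx j) (slice_cd hΩ hg hx j)

lemma DQ_sub {f g : ℝℝ → ℝ} (hf : CDOn f Ω) (hg : CDOn g Ω) (j : ℕ)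
    {x : ℝℝ} (hx : x ∈ Ω) : DQ j (fun y => f y - g y) x = DQ j f x - DQ j g x :=
  iteratedDeriv_sub (slice_cd hΩ hf hx j) (slice_cd hΩ hg hx j)

def Bd (R : Set (ℝℝ)) (c : ℕ → ℝℝ → ℝ) (J : ℕ) (f : ℝℝ → ℝ) : Prop :=
  ∀ j ≤ J, ∃ C, 0 ≤ C ∧ ∀ x ∈ R, |DQ j f x| ≤ C * c j x

lemma Bd.mul {R : Set (ℝℝ)} (hR : R ⊆ Ω) {c d e : ℕ → ℝℝ → ℝ} {J : ℕ} {f g : ℝℝ → ℝ}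
    (hf : CDOn f Ω) (hg : CDOn g Ω)
    (bf : Bd R c J f) (bg : Bd R d J g) (B : ℝ) (hB0 : 0 ≤ B) (hc : ∀ i, ∀ x ∈ R, 0 ≤ c i x)
    (hB : ∀ i j, ∀ x ∈ R, c i x * d j x ≤ B * e (i + j) x) : Bd R e J (fun y => f y * g y) := by
  intro j hj
  choose! Cf hCf0 hCf using bf
  choose! Cg hCg0 hCg using bg
  refine ⟨∑ i ∈ Finset.range (j + 1), (j.choose i : ℝ) * (Cf i * Cg (j - i) * B), ?_, ?_⟩
  · refine Finset.sum_nonneg fun i hi => ?_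
    have hi' : i ≤ j := Nat.lt_succ_iff.1 (Finset.mem_range.1 hi)
    have := hCf0 i (hi'.trans hj); have := hCg0 (j - i) (by omega)
    positivity
  · intro x hx
    have h := iteratedDeriv_mul (slice_cd hΩ hf (hR hx) j) (slice_cd hΩ hg (hR hx) j)
    have h' : DQ j (fun y => f y * g y) x =
      ∑ i ∈ Finset.range (j + 1), (j.choose i : ℝ) * DQ i f x * DQ (j - i) g x := h
    rw [h', Finset.sum_mul]
    refine (Finset.abs_sum_le_sum_abs _ _).trans (Finset.sum_le_sum fun i hi => ?_)
    have hi' : i ≤ j := Nat.lt_succ_iff.1 (Finset.mem_range.1 hi)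
    have a1 := hCf i (hi'.trans hj) x hx
    have a2 := hCg (j - i) (by omega) x hx
    have a3 := hB i (j - i) x hx
    rw [Nat.add_sub_cancel' hi'] at a3
    have a4 := hCf0 i (hi'.trans hj); have a5 := hCg0 (j - i) (by omega)
    rw [abs_mul, abs_mul, Nat.abs_cast, mul_assoc, mul_assoc]
    refine mul_le_mul_of_nonneg_left ?_ (Nat.cast_nonneg _)
    calc |DQ i f x| * |DQ (j - i) g x| ≤ (Cf i * c i x) * (Cg (j - i) * d (j - i) x) :=
          mul_le_mul a1 a2 (abs_nonneg _) (mul_nonneg a4 (hc i x hx))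
      _ = (Cf i * Cg (j - i)) * (c i x * d (j - i) x) := by ring
      _ ≤ (Cf i * Cg (j - i)) * (B * e j x) := mul_le_mul_of_nonneg_left a3 (mul_nonneg a4 a5)
      _ = _ := by ring

lemma Bd.add {R : Set (ℝℝ)} (hR : R ⊆ Ω) {c : ℕ → ℝℝ → ℝ} {J : ℕ} {f g : ℝℝ → ℝ}
    (hf : CDOn f Ω) (hg : CDOn g Ω)
    (bf : Bd R c J f) (bg : Bd R c J g) : Bd R c J (fun y => f y + g y) := by
  intro j hj
  obtain ⟨C1, h1, k1⟩ := bf j hj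
  obtain ⟨C2, h2, k2⟩ := bg j hj
  refine ⟨C1 + C2, add_nonneg h1 h2, fun x hx => ?_⟩
  rw [DQ_add hΩ hf hg j (hR hx), add_mul]
  exact (abs_add_le _ _).trans (add_le_add (k1 x hx) (k2 x hx))

lemma Bd.congr {R : Set (ℝℝ)} (hR : R ⊆ Ω) {c : ℕ → ℝℝ → ℝ} {J : ℕ} {f g : ℝℝ → ℝ}
    (h : ∀ x ∈ Ω, f x = g x) (bf : Bd R c J f) : Bd R c J g := by
  intro j hj
  obtain ⟨C1, h1, k1⟩ := bf j hj
  exact ⟨C1, h1, fun x hx => by rw [← DQ_congr hΩ h j x (hR hx)]; exact k1 x hx⟩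

end

lemma Bd.mono_w {R : Set (ℝℝ)} {c d : ℕ → ℝℝ → ℝ} {J : ℕ} {f : ℝℝ → ℝ} (bf : Bd R c J f) {B : ℝ}
    (hB : 0 ≤ B) (h : ∀ j, ∀ x ∈ R, c j x ≤ B * d j x) : Bd R d J f := by
  intro j hj
  obtain ⟨C1, h1, k1⟩ := bf j hj
  refine ⟨C1 * B, mul_nonneg h1 hB, fun x hx => (k1 x hx).trans ?_⟩
  rw [mul_assoc]; exact mul_le_mul_of_nonneg_left (h j x hx) h1

end

section

def Om (T : ℝ) : Set (ℝℝ) := {x | 0 < x.2 ∧ x.2 < x.1 ∧ x.1 < T}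
lemma Om_open (T : ℝ) : IsOpen (Om T) := by
  have h1 : IsOpen {x : ℝℝ | 0 < x.2} := isOpen_lt continuous_const continuous_snd
  have h2 : IsOpen {x : ℝℝ | x.2 < x.1} := isOpen_lt continuous_snd continuous_fst
  have h3 : IsOpen {x : ℝℝ | x.1 < T} := isOpen_lt continuous_fst continuous_const
  exact h1.inter (h2.inter h3)
def Rg (p0 : ℝ) : Set (ℝℝ) := {x | 0 < x.2 ∧ 2 * x.2 ≤ x.1 ∧ x.1 ≤ p0}
lemma Rg_sub {p0 T : ℝ} (h : p0 < T) : Rg p0 ⊆ Om T := by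
  rintro x ⟨h1, h2, h3⟩; exact ⟨h1, by linarith, by linarith⟩

structure WaveSol (T C1 : ℝ) (ψ : ℝℝ → ℝ) : Prop where
  smooth : CDOn ψ (Om T)
  eq : ∀ x ∈ Om T, DP (DQ 1 ψ) x = 4 * ψ x ^ 5 * ((x.1 - x.2)⁻¹) ^ 4
  bd : ∀ x ∈ Om T, |ψ x| ≤ C1 * x.1

def cw (n : ℝ) (j : ℕ) (x : ℝℝ) : ℝ := (x.1⁻¹) ^ j + x.1⁻¹ * (x.2 ^ n * (x.2⁻¹) ^ j)
def pcw (n : ℝ) (j : ℕ) (x : ℝℝ) : ℝ := x.1 * cw n j x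
def dw (n : ℝ) (j : ℕ) (x : ℝℝ) : ℝ := x.1 ^ n * (x.1⁻¹) ^ j + x.2 ^ n * (x.2⁻¹) ^ j

lemma Rg_facts {p0 n : ℝ} (hp : p0 ≤ 1) (hn : 1 ≤ n) {x : ℝℝ} (hx : x ∈ Rg p0) :
    0 < x.1 ∧ 0 < x.2 ∧ 1 ≤ x.1⁻¹ ∧ x.1⁻¹ ≤ x.2⁻¹ ∧ 0 < x.2 ^ n ∧ x.2 ^ n ≤ x.1 ^ n ∧ x.1⁻¹ * x.1 ^ n ≤ 1 ∧
      x.1⁻¹ * x.2 ^ n ≤ 1 ∧ x.1 ≤ 1 ∧ x.1⁻¹ * x.1 = 1 := by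
  obtain ⟨h1, h2, h3⟩ := hx
  have hx1 : 0 < x.1 := by linarith
  have a1 : x.2 ^ n ≤ x.1 ^ n := rpow_le_rpow h1.le (by linarith) (by linarith)
  have a2 : x.1 ^ n ≤ x.1 := by
    have := rpow_le_rpow_of_exponent_ge hx1 (h3.trans hp) hn
    rwa [rpow_one] at this
  have a3 : x.1⁻¹ * x.1 = 1 := inv_mul_cancel₀ hx1.ne'
  have a4 : x.1⁻¹ * x.1 ^ n ≤ 1 := by
    rw [← a3]; exact mul_le_mul_of_nonneg_left a2 (by positivity)
  refine ⟨hx1, h1, (one_le_inv₀ hx1).2 (h3.trans hp), inv_anti₀ h1 (by linarith), rpow_pos_of_pos h1 n, a1, a4,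
    le_trans (mul_le_mul_of_nonneg_left a1 (by positivity)) a4, h3.trans hp, a3⟩

lemma w_alg1 {a b y : ℝ} (ha : 0 ≤ a) (hab : a ≤ b) (hy : 0 ≤ y) (hay : a * y ≤ 1) (i l : ℕ) :
    (a ^ i + a * (y * b ^ i)) * (a ^ l + a * (y * b ^ l)) ≤ 3 * (a ^ (i + l) + a * (y * b ^ (i + l))) := by
  have hb : 0 ≤ b := ha.trans hab
  have e1 : a ^ i * b ^ l ≤ b ^ (i + l) := by
    rw [pow_add]; exact mul_le_mul_of_nonneg_right (pow_le_pow_left₀ ha hab i) (by positivity)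
  have e2 : b ^ i * a ^ l ≤ b ^ (i + l) := by
    rw [pow_add]; exact mul_le_mul_of_nonneg_left (pow_le_pow_left₀ ha hab l) (by positivity)
  have h0 : 0 ≤ a * y := mul_nonneg ha hy
  have e3 := mul_le_mul_of_nonneg_left e1 h0
  have e4 := mul_le_mul_of_nonneg_left e2 h0
  have e5 : (a * y) * (a * y) * b ^ (i + l) ≤ 1 * (a * y) * b ^ (i + l) := by gcongr
  have e6 : 0 ≤ a ^ (i + l) := by positivity
  calc _ = a ^ (i + l) + (a * y * (a ^ i * b ^ l) + a * y * (b ^ i * a ^ l)) + (a * y) * (a * y) * b ^ (i + l) := by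
        ring
    _ ≤ _ := by nlinarith

lemma w_alg2 {a b y X : ℝ} (ha : 0 ≤ a) (hab : a ≤ b) (hy : 0 ≤ y) (hay : a * y ≤ 1) (hX : 0 ≤ X) (haX : a * X ≤ 1)
    (i l : ℕ) :
    (a ^ i + a * (y * b ^ i)) * (X * a ^ l + y * b ^ l) ≤ 3 * (X * a ^ (i + l) + y * b ^ (i + l)) := by
  have hb : 0 ≤ b := ha.trans hab
  have e1 : a ^ i * b ^ l ≤ b ^ (i + l) := by
    rw [pow_add]; exact mul_le_mul_of_nonneg_right (pow_le_pow_left₀ ha hab i) (by positivity)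
  have e2 : b ^ i * a ^ l ≤ b ^ (i + l) := by
    rw [pow_add]; exact mul_le_mul_of_nonneg_left (pow_le_pow_left₀ ha hab l) (by positivity)
  have e3 := mul_le_mul_of_nonneg_left e1 hy
  have e4 := mul_le_mul_of_nonneg_left e2 hy
  have e4' : (a * X) * (y * (b ^ i * a ^ l)) ≤ 1 * (y * (b ^ i * a ^ l)) := by gcongr
  have e5 : (a * y) * (y * b ^ (i + l)) ≤ 1 * (y * b ^ (i + l)) := by gcongr
  have e6 : 0 ≤ X * a ^ (i + l) := by positivity
  calc _ = X * a ^ (i + l) + y * (a ^ i * b ^ l) + (a * X) * (y * (b ^ i * a ^ l)) + (a * y) * (y * b ^ (i + l)) := by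
        ring
    _ ≤ _ := by nlinarith

lemma DQ_inv {T : ℝ} (j : ℕ) : ∀ x ∈ Om T, DQ j (fun x => (x.1 - x.2)⁻¹) x = j.factorial * ((x.1 - x.2)⁻¹) ^ (j + 1) := by
  induction j with
  | zero => intro x _; simp
  | succ j ih =>
    intro x hx
    rw [DQ_succ, DQ_congr (Om_open T) ih 1 x hx]
    simp only [DQ, iteratedDeriv_one]
    have h0 : x.1 - x.2 ≠ 0 := by have := hx.2.1; linarith
    have h1 : HasDerivAt (fun q => (x.1 - q)⁻¹) (((x.1 - x.2)⁻¹) ^ 2) x.2 := by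
      have := ((hasDerivAt_id x.2).const_sub x.1).inv h0
      refine this.congr_deriv ?_
      simp [div_eq_mul_inv]
    have h2 := ((h1.pow (j + 1)).const_mul (j.factorial : ℝ)).deriv
    refine Eq.trans h2 ?_
    rw [Nat.factorial_succ]
    push_cast
    ring

lemma inv_smooth (T : ℝ) : CDOn (fun x : ℝℝ => (x.1 - x.2)⁻¹) (Om T) := by
  refine ContDiffOn.inv (by fun_prop) fun x hx => ?_
  have := hx.2.1
  linarith

section
variable {T p0 n C1 : ℝ} (hpT : p0 < T) (hp1 : p0 ≤ 1) (hn : 1 ≤ n)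
include hpT hp1 hn

lemma bd_quot {J : ℕ} {f : ℝℝ → ℝ} (hf : CDOn f (Om T)) (bf : Bd (Rg p0) (pcw n) J f) :
    Bd (Rg p0) (cw n) J (fun x => f x * (x.1 - x.2)⁻¹) := by
  have bi : Bd (Rg p0) (fun j x => (x.1⁻¹) ^ (j + 1)) J (fun x => (x.1 - x.2)⁻¹) := by
    intro j _
    refine ⟨j.factorial * 2 ^ (j + 1), by positivity, fun x hx => ?_⟩
    rw [DQ_inv j x (Rg_sub hpT hx)]
    obtain ⟨h1, h2, h3⟩ := hx
    have h4 : 0 < x.1 := by linarith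
    have h5 : (x.1 - x.2)⁻¹ ≤ 2 * x.1⁻¹ := by
      rw [inv_le_comm₀ (by linarith) (by positivity), mul_inv, inv_inv]; linarith
    have h6 : 0 < (x.1 - x.2)⁻¹ := inv_pos.2 (by linarith)
    rw [abs_of_nonneg (by positivity), mul_assoc, ← mul_pow]
    gcongr
  refine bf.mul (Om_open T) (Rg_sub hpT) hf (inv_smooth T) bi 1 zero_le_one ?_ ?_
  · intro i x hx
    obtain ⟨h1, h2, h3, h4, h5, h6, h7, h8, h9, h10⟩ := Rg_facts hp1 hn hx
    unfold pcw cw; positivity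
  · intro i l x hx
    obtain ⟨h1, h2, h3, h4, h5, h6, h7, h8, h9, h10⟩ := Rg_facts hp1 hn hx
    unfold pcw cw
    have ha : 0 ≤ x.1⁻¹ := by positivity
    have e1 : (x.2⁻¹) ^ i * (x.1⁻¹) ^ l ≤ (x.2⁻¹) ^ (i + l) := by
      rw [pow_add]; exact mul_le_mul_of_nonneg_left (pow_le_pow_left₀ ha h4 l) (by positivity)
    have e2 : x.1⁻¹ * x.2 ^ n * ((x.2⁻¹) ^ i * (x.1⁻¹) ^ l) ≤ x.1⁻¹ * x.2 ^ n * (x.2⁻¹) ^ (i + l) := by gcongr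
    calc _ = (x.1⁻¹ * x.1) * ((x.1⁻¹) ^ (i + l) + x.1⁻¹ * x.2 ^ n * ((x.2⁻¹) ^ i * (x.1⁻¹) ^ l)) := by ring
      _ ≤ _ := by rw [h10]; linarith

lemma bd_cc {J : ℕ} {f g : ℝℝ → ℝ} (hf : CDOn f (Om T)) (hg : CDOn g (Om T))
    (bf : Bd (Rg p0) (cw n) J f) (bg : Bd (Rg p0) (cw n) J g) : Bd (Rg p0) (cw n) J (fun x => f x * g x) := by
  refine bf.mul (Om_open T) (Rg_sub hpT) hf hg bg 3 (by norm_num) ?_ ?_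
  · intro i x hx
    obtain ⟨h1, h2, h3, h4, h5, h6, h7, h8, h9, h10⟩ := Rg_facts hp1 hn hx
    unfold cw; positivity
  · intro i l x hx
    obtain ⟨h1, h2, h3, h4, h5, h6, h7, h8, h9, h10⟩ := Rg_facts hp1 hn hx
    exact w_alg1 (by positivity) h4 h5.le h8 i l

lemma bd_cpc {J : ℕ} {f g : ℝℝ → ℝ} (hf : CDOn f (Om T)) (hg : CDOn g (Om T))
    (bf : Bd (Rg p0) (cw n) J f) (bg : Bd (Rg p0) (pcw n) J g) : Bd (Rg p0) (pcw n) J (fun x => f x * g x) := by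
  refine bf.mul (Om_open T) (Rg_sub hpT) hf hg bg 3 (by norm_num) ?_ ?_
  · intro i x hx
    obtain ⟨h1, h2, h3, h4, h5, h6, h7, h8, h9, h10⟩ := Rg_facts hp1 hn hx
    unfold cw; positivity
  · intro i l x hx
    obtain ⟨h1, h2, h3, h4, h5, h6, h7, h8, h9, h10⟩ := Rg_facts hp1 hn hx
    have := mul_le_mul_of_nonneg_left (w_alg1 (by positivity) h4 h5.le h8 i l) h1.le
    unfold pcw cw
    linarith

lemma bd_cd {J : ℕ} {f g : ℝℝ → ℝ} (hf : CDOn f (Om T)) (hg : CDOn g (Om T))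
    (bf : Bd (Rg p0) (cw n) J f) (bg : Bd (Rg p0) (dw n) J g) : Bd (Rg p0) (dw n) J (fun x => f x * g x) := by
  refine bf.mul (Om_open T) (Rg_sub hpT) hf hg bg 3 (by norm_num) ?_ ?_
  · intro i x hx
    obtain ⟨h1, h2, h3, h4, h5, h6, h7, h8, h9, h10⟩ := Rg_facts hp1 hn hx
    unfold cw; positivity
  · intro i l x hx
    obtain ⟨h1, h2, h3, h4, h5, h6, h7, h8, h9, h10⟩ := Rg_facts hp1 hn hx
    exact w_alg2 (by positivity) h4 h5.le h8 (h5.le.trans h6) h7 i l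

end

lemma mvt {f f' : ℝ → ℝ} {a b B : ℝ} (hab : a ≤ b) (h : ∀ p, a ≤ p → p ≤ b → HasDerivAt f (f' p) p)
    (hB : ∀ p, a ≤ p → p ≤ b → |f' p| ≤ B) : |f b - f a| ≤ B * (b - a) := by
  have := Convex.norm_image_sub_le_of_norm_hasDerivWithin_le (f := f) (f' := f') (s := Set.Icc a b) (C := B)
    (fun p hp => (h p hp.1 hp.2).hasDerivWithinAt) (fun p hp => hB p hp.1 hp.2) (convex_Icc a b)
    (Set.left_mem_Icc.2 hab) (Set.right_mem_Icc.2 hab)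
  simpa [abs_of_nonneg (sub_nonneg.2 hab)] using this

lemma mvt_p {T : ℝ} {g : ℝℝ → ℝ} (hg : CDOn g (Om T)) (j : ℕ) {q a b B : ℝ} (hq : 0 < q)
    (hqa : q < a) (hab : a ≤ b) (hb : b < T) (hB : ∀ p, a ≤ p → p ≤ b → |DQ j (DP (DQ 1 g)) (p, q)| ≤ B) :
    |DQ (j + 1) g (b, q) - DQ (j + 1) g (a, q)| ≤ B * (b - a) := by
  rw [DQ_succ']
  refine mvt (f := fun p => DQ j (DQ 1 g) (p, q)) (f' := fun p => DQ j (DP (DQ 1 g)) (p, q)) hab ?_ hB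
  intro p h1 h2
  exact has_DQ_p (Om_open T) (DQ_smooth (Om_open T) hg 1) j (x := (p, q)) ⟨hq, by simp; linarith, by simp; linarith⟩

end

section

lemma DP_congr {Ω : Set (ℝℝ)} (hΩ : IsOpen Ω) {f g : ℝℝ → ℝ} (h : ∀ x ∈ Ω, f x = g x) :
    ∀ x ∈ Ω, DP f x = DP g x := by
  intro x hx
  refine Filter.EventuallyEq.deriv_eq ?_
  have hc : ContinuousAt (fun p : ℝ => (p, x.2)) x.1 := by fun_prop
  filter_upwards [hc.eventually (show ∀ᶠ y in 𝓝 (x.1, x.2), y ∈ Ω from hΩ.mem_nhds hx)] with q hq using h _ hq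

lemma DP_sub {Ω : Set (ℝℝ)} (hΩ : IsOpen Ω) {f g : ℝℝ → ℝ} (hf : CDOn f Ω)
    (hg : CDOn g Ω) : ∀ x ∈ Ω, DP (fun y => f y - g y) x = DP f x - DP g x := by
  intro x hx
  rw [DP_eq hΩ hf hx, DP_eq hΩ hg hx]
  exact ((has_p hΩ hf hx).sub (has_p hΩ hg hx)).deriv

lemma DPQ_sub {Ω : Set (ℝℝ)} (hΩ : IsOpen Ω) {f g : ℝℝ → ℝ} (hf : CDOn f Ω)
    (hg : CDOn g Ω) :
    ∀ x ∈ Ω, DP (DQ 1 (fun y => f y - g y)) x = DP (DQ 1 f) x - DP (DQ 1 g) x := by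
  intro x hx
  rw [← DP_sub hΩ (DQ_smooth hΩ hf 1) (DQ_smooth hΩ hg 1) x hx]
  exact DP_congr hΩ (fun y hy => DQ_sub hΩ hf hg 1 hy) x hx

lemma DQ_const_mul (j : ℕ) (k : ℝ) (f : ℝℝ → ℝ) (x : ℝℝ) :
    DQ j (fun y => k * f y) x = k * DQ j f x := iteratedDeriv_const_mul_field _ _

lemma Bd.const_mul {R : Set (ℝℝ)} {c : ℕ → ℝℝ → ℝ} {J : ℕ} {f : ℝℝ → ℝ} (bf : Bd R c J f) (k : ℝ) :
    Bd R c J (fun y => k * f y) := by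
  intro j hj
  obtain ⟨C, h0, h⟩ := bf j hj
  refine ⟨|k| * C, by positivity, fun x hx => ?_⟩
  rw [DQ_const_mul, abs_mul, mul_assoc]
  exact mul_le_mul_of_nonneg_left (h x hx) (abs_nonneg k)

section
variable {T p0 n C1 : ℝ} (hpT : p0 < T) (hp1 : p0 ≤ 1) (hn : 1 ≤ n)
include hpT hp1 hn

lemma bdF {J : ℕ} {ψ : ℝℝ → ℝ} (hψ : WaveSol T C1 ψ) (b : Bd (Rg p0) (pcw n) J ψ) :
    Bd (Rg p0) (pcw n) J (DP (DQ 1 ψ)) := by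
  have hi := inv_smooth T
  have sw : CDOn (fun x => ψ x * (x.1 - x.2)⁻¹) (Om T) := hψ.smooth.mul hi
  have bw := bd_quot hpT hp1 hn hψ.smooth b
  have b2 := bd_cc hpT hp1 hn sw sw bw bw
  have b4 := bd_cc hpT hp1 hn (sw.mul sw) (sw.mul sw) b2 b2
  have b5 := bd_cpc hpT hp1 hn ((sw.mul sw).mul (sw.mul sw)) hψ.smooth b4 b
  refine (b5.const_mul 4).congr (Om_open T) (Rg_sub hpT) fun x hx => ?_
  rw [hψ.eq x hx]; ring

lemma bdV {J : ℕ} {ψ ψ' : ℝℝ → ℝ} (hψ : WaveSol T C1 ψ) (hψ' : WaveSol T C1 ψ')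
    (b : Bd (Rg p0) (pcw n) J ψ) (b' : Bd (Rg p0) (pcw n) J ψ')
    (bΔ : Bd (Rg p0) (dw n) J (fun x => ψ' x - ψ x)) :
    Bd (Rg p0) (dw n) J (DP (DQ 1 (fun x => ψ' x - ψ x))) := by
  have hi := inv_smooth T
  have sw : CDOn (fun x => ψ x * (x.1 - x.2)⁻¹) (Om T) := hψ.smooth.mul hi
  have sw' : CDOn (fun x => ψ' x * (x.1 - x.2)⁻¹) (Om T) := hψ'.smooth.mul hi
  have bw := bd_quot hpT hp1 hn hψ.smooth b
  have bw' := bd_quot hpT hp1 hn hψ'.smooth b'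
  have s00 := sw.mul sw
  have s01 := sw'.mul sw
  have s11 := sw'.mul sw'
  have b00 := bd_cc hpT hp1 hn sw sw bw bw
  have b01 := bd_cc hpT hp1 hn sw' sw bw' bw
  have b11 := bd_cc hpT hp1 hn sw' sw' bw' bw'
  have t1 := bd_cc hpT hp1 hn s00 s00 b00 b00
  have t2 := bd_cc hpT hp1 hn s01 s00 b01 b00
  have t3 := bd_cc hpT hp1 hn s11 s00 b11 b00
  have t4 := bd_cc hpT hp1 hn s11 s01 b11 b01
  have t5 := bd_cc hpT hp1 hn s11 s11 b11 b11
  have u1 := Bd.add (Om_open T) (Rg_sub hpT) (s00.mul s00) (s01.mul s00) t1 t2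
  have u2 := Bd.add (Om_open T) (Rg_sub hpT) ((s00.mul s00).add (s01.mul s00)) (s11.mul s00) u1 t3
  have u3 := Bd.add (Om_open T) (Rg_sub hpT) (((s00.mul s00).add (s01.mul s00)).add (s11.mul s00)) (s11.mul s01) u2 t4
  have u4 := Bd.add (Om_open T) (Rg_sub hpT) ((((s00.mul s00).add (s01.mul s00)).add (s11.mul s00)).add (s11.mul s01))
    (s11.mul s11) u3 t5
  have u5 := bd_cd hpT hp1 hn (((((s00.mul s00).add (s01.mul s00)).add (s11.mul s00)).add (s11.mul s01)).add
    (s11.mul s11)) (hψ'.smooth.sub hψ.smooth) u4 bΔ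
  refine (u5.const_mul 4).congr (Om_open T) (Rg_sub hpT) fun x hx => ?_
  rw [DPQ_sub (Om_open T) hψ'.smooth hψ.smooth x hx, hψ.eq x hx, hψ'.eq x hx]; ring

theorem claimA (hC1 : 0 ≤ C1) {ψ : ℝℝ → ℝ} (hψ : WaveSol T C1 ψ)
    (hh : ∀ j, ∃ C, ∀ q, 0 < q → 2 * q ≤ p0 → |DQ j ψ (p0, q)| ≤ C * (1 + q ^ n * (q⁻¹) ^ j)) (J : ℕ) :
    Bd (Rg p0) (pcw n) J ψ := by
  induction J with
  | zero =>
    intro j hj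
    obtain rfl : j = 0 := by omega
    refine ⟨C1, hC1, fun x hx => ?_⟩
    obtain ⟨h1, h2, h3, h4, h5, h6, h7, h8, h9, h10⟩ := Rg_facts hp1 hn hx
    rw [DQ_zero]
    refine (hψ.bd x (Rg_sub hpT hx)).trans (mul_le_mul_of_nonneg_left ?_ hC1)
    unfold pcw cw
    have : 0 ≤ x.1⁻¹ * x.2 ^ n := by positivity
    simp only [pow_zero, mul_one]
    nlinarith
  | succ J ih =>
    intro j hj
    rcases Nat.lt_or_ge j (J + 1) with h | h
    · exact ih j (by omega)
    obtain rfl : j = J + 1 := by omega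
    obtain ⟨C, hC0, hC⟩ := bdF hpT hp1 hn hψ ih J le_rfl
    obtain ⟨K, hK⟩ := hh (J + 1)
    refine ⟨|K| + C, by positivity, ?_⟩
    rintro ⟨p, q⟩ hx
    obtain ⟨h1, h2, h3, h4, h5, h6, h7, h8, h9, h10⟩ := Rg_facts hp1 hn hx
    obtain ⟨k1, k2, k3⟩ := hx
    simp only at h1 h2 h3 h4 h5 h6 h7 h8 h9 h10 k1 k2 k3
    have hb1 : 1 ≤ q⁻¹ := h3.trans h4
    have e0 : pcw n (J + 1) (p, q) = (p⁻¹) ^ J + q ^ n * (q⁻¹) ^ (J + 1) := by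
      unfold pcw cw; simp only; rw [pow_succ]
      calc _ = (p⁻¹ * p) * ((p⁻¹) ^ J + q ^ n * (q⁻¹) ^ (J + 1)) := by ring
        _ = _ := by rw [h10, one_mul, pow_succ]
    have e1 : |DQ (J + 1) ψ (p0, q)| ≤ |K| * pcw n (J + 1) (p, q) := by
      refine (hK q k1 (by linarith)).trans ?_
      have : 0 ≤ 1 + q ^ n * (q⁻¹) ^ (J + 1) := by positivity
      refine (mul_le_mul_of_nonneg_right (le_abs_self K) this).trans ?_
      rw [e0]
      refine mul_le_mul_of_nonneg_left ?_ (abs_nonneg K)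
      have := one_le_pow₀ h3 (n := J)
      linarith
    have e2 := mvt_p hψ.smooth J (q := q) (a := p) (b := p0) (B := C * pcw n (J + 1) (p, q)) k1 (by linarith) k3 hpT (by
      intro p' hp hp'
      have hx' : (p', q) ∈ Rg p0 := ⟨k1, by simp; linarith, hp'⟩
      refine (hC (p', q) hx').trans (mul_le_mul_of_nonneg_left ?_ hC0)
      obtain ⟨g1, g2, g3, g4, g5, g6, g7, g8, g9, g10⟩ := Rg_facts hp1 hn hx'
      simp only at g1 g2 g3 g4 g5 g6 g7 g8 g9 g10
      rw [e0]
      unfold pcw cw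
      simp only
      have i1 : (p'⁻¹) ^ J ≤ (p⁻¹) ^ J := pow_le_pow_left₀ (by positivity) (inv_anti₀ h1 hp) J
      have i2 : (q⁻¹) ^ J ≤ (q⁻¹) ^ (J + 1) := pow_le_pow_right₀ hb1 (Nat.le_succ J)
      calc _ = p' * (p'⁻¹) ^ J + (p'⁻¹ * p') * (q ^ n * (q⁻¹) ^ J) := by ring
        _ ≤ 1 * (p⁻¹) ^ J + q ^ n * (q⁻¹) ^ (J + 1) := by rw [g10, one_mul]; gcongr
        _ = _ := by ring)
    have e3 : C * pcw n (J + 1) (p, q) * (p0 - p) ≤ C * pcw n (J + 1) (p, q) := by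
      refine mul_le_of_le_one_right (mul_nonneg hC0 ?_) (by linarith)
      rw [e0]; positivity
    have e4 : |DQ (J + 1) ψ (p, q)| ≤ |DQ (J + 1) ψ (p0, q)| + |DQ (J + 1) ψ (p0, q) - DQ (J + 1) ψ (p, q)| := by
      have := abs_sub_abs_le_abs_sub (DQ (J + 1) ψ (p, q)) (DQ (J + 1) ψ (p0, q))
      rw [abs_sub_comm] at this
      linarith
    rw [add_mul]
    linarith

end

lemma pow5_sub {a b K : ℝ} (ha : |a| ≤ K) (hb : |b| ≤ K) : |a ^ 5 - b ^ 5| ≤ 5 * K ^ 4 * |a - b| := by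
  have hK : 0 ≤ K := (abs_nonneg a).trans ha
  have e : a ^ 5 - b ^ 5 = (a ^ 4 + a ^ 3 * b + a ^ 2 * b ^ 2 + a * b ^ 3 + b ^ 4) * (a - b) := by ring
  have h : |a ^ 4 + a ^ 3 * b + a ^ 2 * b ^ 2 + a * b ^ 3 + b ^ 4| ≤ 5 * K ^ 4 := by
    have t : ∀ i j : ℕ, i + j = 4 → |a ^ i * b ^ j| ≤ K ^ 4 := by
      intro i j hij
      rw [abs_mul, abs_pow, abs_pow, ← hij, pow_add]
      gcongr
    have t1 := t 4 0 rfl; have t2 := t 3 1 rfl; have t3 := t 2 2 rfl; have t4 := t 1 3 rfl; have t5 := t 0 4 rfl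
    simp only [pow_zero, mul_one, one_mul, pow_one] at t1 t2 t4 t5
    rw [abs_le] at *
    constructor <;> linarith [t1.1, t2.1, t3.1, t4.1, t5.1, t1.2, t2.2, t3.2, t4.2, t5.2]
  rw [e, abs_mul]
  exact mul_le_mul_of_nonneg_right h (abs_nonneg _)

end

section

section
variable {T p0 n C1 : ℝ} (hpT : p0 < T) (hp1 : p0 ≤ 1) (hn : 1 ≤ n)
include hpT hp1 hn

lemma claimB0 (hC1 : 0 ≤ C1) (hs : 320 * C1 ^ 4 * p0 ^ 2 ≤ 1 / 2) {ψ ψ' : ℝℝ → ℝ} (hψ : WaveSol T C1 ψ)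
    (hψ' : WaveSol T C1 ψ') {K : ℝ} (hK : 0 ≤ K)
    (c0 : ∀ q, 0 < q → 2 * q ≤ p0 → |ψ' (2 * q, q) - ψ (2 * q, q)| ≤ K * q ^ n)
    (c1 : ∀ q, 0 < q → 2 * q ≤ p0 → |DQ 1 (fun x => ψ' x - ψ x) (2 * q, q)| ≤ K * (q ^ n * q⁻¹)) :
    ∀ x ∈ Rg p0, |ψ' x - ψ x| ≤ 4 * K * x.1 ^ n := by
  intro y hy
  set Δ : ℝℝ → ℝ := fun x => ψ' x - ψ x with hΔ
  have sΔ : CDOn Δ (Om T) := hψ'.smooth.sub hψ.smooth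
  set Ks : Set (ℝℝ) := {x | y.2 ≤ x.2 ∧ 2 * x.2 ≤ x.1 ∧ x.1 ≤ p0} with hKs
  have hsub : Ks ⊆ Rg p0 := fun x hx => ⟨hy.1.trans_le hx.1, hx.2⟩
  have hcl : IsClosed Ks :=
    (isClosed_le continuous_const continuous_snd).inter
      ((isClosed_le (continuous_const.mul continuous_snd) continuous_fst).inter
        (isClosed_le continuous_fst continuous_const))
  have hcp : IsCompact Ks := by
    refine IsCompact.of_isClosed_subset (isCompact_Icc.prod isCompact_Icc :
      IsCompact (Set.Icc 0 p0 ×ˢ Set.Icc 0 p0)) hcl fun x hx => ?_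
    have h1 := hy.1
    obtain ⟨h2, h3, h4⟩ := hx
    exact ⟨⟨by linarith, h4⟩, ⟨by linarith, by linarith⟩⟩
  have hpos : ∀ x ∈ Ks, 0 < x.1 := fun x hx => (Rg_facts hp1 hn (hsub hx)).1
  have hco : ContinuousOn (fun x => |Δ x| / x.1 ^ n) Ks := by
    refine ContinuousOn.div ((sΔ.continuousOn.mono (hsub.trans (Rg_sub hpT))).abs) ?_ fun x hx =>
      (rpow_pos_of_pos (hpos x hx) n).ne'
    exact continuousOn_fst.rpow_const fun x hx => Or.inl (hpos x hx).ne'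
  have hyK : y ∈ Ks := ⟨le_rfl, hy.2⟩
  obtain ⟨x, hxK, hmax⟩ := hcp.exists_isMaxOn ⟨y, hyK⟩ hco
  set S := |Δ x| / x.1 ^ n with hS
  have hSb : ∀ w ∈ Ks, |Δ w| ≤ S * w.1 ^ n := fun w hw => by
    rw [← div_le_iff₀ (rpow_pos_of_pos (hpos w hw) n)]; exact hmax hw
  have hS0 : 0 ≤ S := by rw [hS]; have := hpos x hxK; positivity
  have hV : ∀ w ∈ Ks, |DP (DQ 1 Δ) w| ≤ 320 * C1 ^ 4 * (S * w.1 ^ n) := by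
    intro w hw
    have hwO := Rg_sub hpT (hsub hw)
    rw [hΔ, DPQ_sub (Om_open T) hψ'.smooth hψ.smooth w hwO, hψ.eq w hwO, hψ'.eq w hwO]
    have h1 := pow5_sub (hψ'.bd w hwO) (hψ.bd w hwO)
    obtain ⟨g1, g2, g3⟩ := hsub hw
    have hw1 := hpos w hw
    have h6 : 0 < (w.1 - w.2)⁻¹ := inv_pos.2 (by linarith)
    have h5 : (w.1 - w.2)⁻¹ * w.1 ≤ 2 := by
      rw [inv_mul_le_iff₀ (by linarith)]; linarith
    have h7 : ((w.1 - w.2)⁻¹ * w.1) ^ 4 ≤ 2 ^ 4 := pow_le_pow_left₀ (by positivity) h5 4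
    have e : 4 * ψ' w ^ 5 * ((w.1 - w.2)⁻¹) ^ 4 - 4 * ψ w ^ 5 * ((w.1 - w.2)⁻¹) ^ 4 =
      (4 * ((w.1 - w.2)⁻¹) ^ 4) * (ψ' w ^ 5 - ψ w ^ 5) := by ring
    rw [e, abs_mul, abs_of_pos (by positivity)]
    have h8 := hSb w hw
    calc 4 * ((w.1 - w.2)⁻¹) ^ 4 * |ψ' w ^ 5 - ψ w ^ 5|
        ≤ 4 * ((w.1 - w.2)⁻¹) ^ 4 * (5 * (C1 * w.1) ^ 4 * |ψ' w - ψ w|) := by gcongr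
      _ = 20 * C1 ^ 4 * ((w.1 - w.2)⁻¹ * w.1) ^ 4 * |Δ w| := by rw [hΔ]; ring
      _ ≤ 20 * C1 ^ 4 * 2 ^ 4 * (S * w.1 ^ n) := by gcongr
      _ = _ := by ring
  obtain ⟨p, q⟩ := x
  obtain ⟨k1, k2, k3⟩ := hxK
  simp only at k1 k2 k3
  have hq0 : 0 < q := hy.1.trans_le k1
  have hp0 : 0 < p := by linarith
  have hpn : 0 < p ^ n := rpow_pos_of_pos hp0 n
  have hD : ∀ q', q ≤ q' → q' ≤ p / 2 → |DQ 1 Δ (p, q')| ≤ K * (p ^ n * p⁻¹) + 320 * C1 ^ 4 * (S * p ^ n) * p := by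
    intro q' h1 h2
    have hq' : 0 < q' := hq0.trans_le h1
    have m1 := mvt_p sΔ 0 (q := q') (a := 2 * q') (b := p) (B := 320 * C1 ^ 4 * (S * p ^ n)) hq' (by linarith)
      (by linarith) (by linarith) (by
        intro p' g1 g2
        rw [DQ_zero]
        have hw : (p', q') ∈ Ks := ⟨k1.trans h1, g1, g2.trans k3⟩
        refine (hV _ hw).trans ?_
        have : p' ^ n ≤ p ^ n := rpow_le_rpow (by linarith) g2 (by linarith)
        gcongr)
    have m2 := c1 q' hq' (by linarith)
    have m3 : q' ^ n * q'⁻¹ ≤ p ^ n * p⁻¹ := by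
      rw [← rpow_neg_one q', ← rpow_neg_one p, ← rpow_add hq', ← rpow_add hp0]
      exact rpow_le_rpow hq'.le (by linarith) (by linarith)
    have m4 : K * (q' ^ n * q'⁻¹) ≤ K * (p ^ n * p⁻¹) := by gcongr
    have m5 : 320 * C1 ^ 4 * (S * p ^ n) * (p - 2 * q') ≤ 320 * C1 ^ 4 * (S * p ^ n) * p := by
      refine mul_le_mul_of_nonneg_left (by linarith) (by positivity)
    rw [zero_add] at m1
    have m6 := abs_sub_abs_le_abs_sub (DQ 1 Δ (p, q')) (DQ 1 Δ (2 * q', q'))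
    linarith
  have hM := mvt (f := fun q' => Δ (p, q')) (f' := fun q' => DQ 1 Δ (p, q')) (a := q) (b := p / 2)
    (by linarith) (fun q' h1 h2 => by
      have hx' : (p, q') ∈ Om T := ⟨hq0.trans_le h1, by simp only; linarith, by simp only; linarith⟩
      simpa using has_DQ_q (Om_open T) sΔ 0 hx') hD
  have hE := c0 (p / 2) (by linarith) (by linarith)
  rw [show 2 * (p / 2) = p by ring] at hE
  have hE2 : (p / 2) ^ n ≤ p ^ n := rpow_le_rpow (by linarith) (by linarith) (by linarith)
  have hE3 : K * (p / 2) ^ n ≤ K * p ^ n := by gcongr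
  have hF : |Δ (p, q)| ≤ |Δ (p, p / 2)| + |Δ (p, p / 2) - Δ (p, q)| := by
    have := abs_sub_abs_le_abs_sub (Δ (p, q)) (Δ (p, p / 2))
    have e := abs_sub_comm (Δ (p, q)) (Δ (p, p / 2))
    linarith
  have hG : (K * (p ^ n * p⁻¹) + 320 * C1 ^ 4 * (S * p ^ n) * p) * (p / 2 - q) ≤ K * p ^ n + S * p ^ n / 2 := by
    have g1 : (K * (p ^ n * p⁻¹) + 320 * C1 ^ 4 * (S * p ^ n) * p) * (p / 2 - q) ≤
        (K * (p ^ n * p⁻¹) + 320 * C1 ^ 4 * (S * p ^ n) * p) * p :=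
      mul_le_mul_of_nonneg_left (by linarith) (by positivity)
    have g2 : (K * (p ^ n * p⁻¹) + 320 * C1 ^ 4 * (S * p ^ n) * p) * p =
        K * p ^ n * (p⁻¹ * p) + (320 * C1 ^ 4 * p ^ 2) * (S * p ^ n) := by ring
    have g3 : 320 * C1 ^ 4 * p ^ 2 ≤ 1 / 2 := le_trans (by gcongr) hs
    have g4 := mul_le_mul_of_nonneg_right g3 (mul_nonneg hS0 hpn.le)
    rw [inv_mul_cancel₀ hp0.ne'] at g2
    linarith
  have hSx : |Δ (p, q)| = S * p ^ n := by rw [hS]; simp only; field_simp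
  have hfin : S ≤ 4 * K := by
    have : S * p ^ n ≤ (4 * K) * p ^ n := by
      have e : |Δ (p, p / 2)| ≤ K * (p / 2) ^ n := hE
      linarith
    exact le_of_mul_le_mul_right this hpn
  exact (hSb y hyK).trans (mul_le_mul_of_nonneg_right hfin (rpow_nonneg (hpos y hyK).le n))

lemma dw_mono {J : ℕ} {p p' q : ℝ} (hq : 0 < q) (h1 : 2 * q ≤ p') (h2 : p' ≤ p) :
    dw n J (p', q) ≤ p ^ n * (p⁻¹) ^ J + 2 * (q ^ n * (q⁻¹) ^ J) := by
  have e : ∀ t : ℝ, 0 < t → t ^ n * (t⁻¹) ^ J = t ^ (n - J) := by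
    intro t ht
    rw [inv_pow, ← rpow_natCast, ← rpow_neg ht.le, ← rpow_add ht]; rfl
  unfold dw
  simp only
  rw [e p' (by linarith), e q hq, e p (by linarith)]
  have k1 := rpow_pos_of_pos hq (n - J)
  have k2 := rpow_pos_of_pos (show 0 < p by linarith) (n - J)
  rcases le_total 0 (n - J) with h | h
  · have := rpow_le_rpow (show 0 ≤ p' by linarith) h2 h; linarith
  · have := rpow_le_rpow_of_nonpos hq (show q ≤ p' by linarith) h; linarith

lemma dw_pcw (j : ℕ) : ∀ x ∈ Rg p0, dw n j x ≤ 1 * pcw n j x := by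
  intro x hx
  obtain ⟨h1, h2, h3, h4, h5, h6, h7, h8, h9, h10⟩ := Rg_facts hp1 hn hx
  unfold dw pcw cw
  have e : x.1 ^ n ≤ x.1 := by
    have := mul_le_mul_of_nonneg_left h7 h1.le
    rwa [← mul_assoc, mul_comm x.1, h10, one_mul, mul_one] at this
  calc _ ≤ x.1 * (x.1⁻¹) ^ j + (x.1⁻¹ * x.1) * (x.2 ^ n * (x.2⁻¹) ^ j) := by
        rw [h10, one_mul]; gcongr
    _ = _ := by ring

theorem claimB (hC1 : 0 ≤ C1) (hs : 320 * C1 ^ 4 * p0 ^ 2 ≤ 1 / 2) {ψ ψ' : ℝℝ → ℝ} (hψ : WaveSol T C1 ψ)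
    (hψ' : WaveSol T C1 ψ') (hA : ∀ J, Bd (Rg p0) (pcw n) J ψ)
    (hc : ∀ j, ∃ K, ∀ q, 0 < q → 2 * q ≤ p0 → |DQ j (fun x => ψ' x - ψ x) (2 * q, q)| ≤ K * (q ^ n * (q⁻¹) ^ j)) (J : ℕ) :
    Bd (Rg p0) (dw n) J (fun x => ψ' x - ψ x) ∧ Bd (Rg p0) (dw n) J (DP (DQ 1 (fun x => ψ' x - ψ x))) := by
  have sΔ : CDOn (fun x => ψ' x - ψ x) (Om T) := hψ'.smooth.sub hψ.smooth
  have step : ∀ J, Bd (Rg p0) (dw n) J (fun x => ψ' x - ψ x) →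
      Bd (Rg p0) (dw n) J (DP (DQ 1 (fun x => ψ' x - ψ x))) := by
    intro J b
    refine bdV hpT hp1 hn hψ hψ' (hA J) ?_ b
    refine (Bd.add (Om_open T) (Rg_sub hpT) sΔ hψ.smooth (b.mono_w zero_le_one (dw_pcw hpT hp1 hn)) (hA J)).congr
      (Om_open T) (Rg_sub hpT) fun x _ => ?_
    ring
  suffices main : ∀ J, Bd (Rg p0) (dw n) J (fun x => ψ' x - ψ x) from ⟨main J, step J (main J)⟩
  · clear J
    intro J
    induction J with
    | zero =>
      obtain ⟨K0, h0⟩ := hc 0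
      obtain ⟨K1, h1⟩ := hc 1
      intro j hj
      obtain rfl : j = 0 := by omega
      refine ⟨4 * (|K0| + |K1|), by positivity, fun x hx => ?_⟩
      have := claimB0 hpT hp1 hn hC1 hs hψ hψ' (K := |K0| + |K1|) (by positivity)
        (fun q g1 g2 => by
          have := h0 q g1 g2
          simp only [DQ_zero, pow_zero, mul_one] at this
          refine this.trans (mul_le_mul_of_nonneg_right ?_ (rpow_nonneg g1.le n))
          linarith [le_abs_self K0, abs_nonneg K1])
        (fun q g1 g2 => by
          have := h1 q g1 g2
          rw [pow_one] at this
          refine this.trans (mul_le_mul_of_nonneg_right ?_ (by positivity))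
          linarith [le_abs_self K1, abs_nonneg K0]) x hx
      rw [DQ_zero]
      refine this.trans (mul_le_mul_of_nonneg_left ?_ (by positivity))
      obtain ⟨h1, h2, h3, h4, h5, h6, h7, h8, h9, h10⟩ := Rg_facts hp1 hn hx
      unfold dw; simp only [pow_zero, mul_one]; linarith
    | succ J ih =>
      intro j hj
      rcases Nat.lt_or_ge j (J + 1) with h | h
      · exact ih j (by omega)
      obtain rfl : j = J + 1 := by omega
      obtain ⟨C, hC0, hC⟩ := step J ih J le_rfl
      obtain ⟨K, hK⟩ := hc (J + 1)
      refine ⟨|K| + 2 * C, by positivity, ?_⟩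
      rintro ⟨p, q⟩ hx
      obtain ⟨h1, h2, h3, h4, h5, h6, h7, h8, h9, h10⟩ := Rg_facts hp1 hn hx
      obtain ⟨k1, k2, k3⟩ := hx
      simp only at h1 h2 h3 h4 h5 h6 h7 h8 h9 h10 k1 k2 k3
      have hb1 : 1 ≤ q⁻¹ := h3.trans h4
      have hpn : 0 < p ^ n := rpow_pos_of_pos h1 n
      have e0 : p ^ n * (p⁻¹) ^ J + 2 * (q ^ n * (q⁻¹) ^ J) ≤ 2 * dw n (J + 1) (p, q) := by
        unfold dw; simp only
        have i1 : (p⁻¹) ^ J ≤ (p⁻¹) ^ (J + 1) := pow_le_pow_right₀ h3 (Nat.le_succ J)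
        have i2 : (q⁻¹) ^ J ≤ (q⁻¹) ^ (J + 1) := pow_le_pow_right₀ hb1 (Nat.le_succ J)
        have i3 := mul_le_mul_of_nonneg_left i1 hpn.le
        have i4 := mul_le_mul_of_nonneg_left i2 h5.le
        have i5 : 0 ≤ p ^ n * (p⁻¹) ^ (J + 1) := by positivity
        linarith
      have e2 := mvt_p sΔ J (q := q) (a := 2 * q) (b := p) (B := C * (2 * dw n (J + 1) (p, q))) k1 (by linarith) k2
        (by linarith) (by
          intro p' g1 g2
          have hx' : (p', q) ∈ Rg p0 := ⟨k1, g1, g2.trans k3⟩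
          exact (hC (p', q) hx').trans (mul_le_mul_of_nonneg_left ((dw_mono hpT hp1 hn k1 g1 g2).trans e0) hC0))
      have e3 : C * (2 * dw n (J + 1) (p, q)) * (p - 2 * q) ≤ C * (2 * dw n (J + 1) (p, q)) := by
        refine mul_le_of_le_one_right (mul_nonneg hC0 ?_) (by linarith)
        unfold dw; simp only; positivity
      have e4 := abs_sub_abs_le_abs_sub (DQ (J + 1) (fun x => ψ' x - ψ x) (p, q))
        (DQ (J + 1) (fun x => ψ' x - ψ x) (2 * q, q))
      have e5 : |DQ (J + 1) (fun x => ψ' x - ψ x) (2 * q, q)| ≤ |K| * dw n (J + 1) (p, q) := by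
        refine (hK q k1 (by linarith)).trans ?_
        refine (mul_le_mul_of_nonneg_right (le_abs_self K) (by positivity)).trans ?_
        refine mul_le_mul_of_nonneg_left ?_ (abs_nonneg K)
        unfold dw; simp only
        have : 0 ≤ p ^ n * (p⁻¹) ^ (J + 1) := by positivity
        linarith
      rw [add_mul]
      linarith

theorem claimC (hp00 : 0 < p0) (hC1 : 0 ≤ C1) (hs : 320 * C1 ^ 4 * p0 ^ 2 ≤ 1 / 2) {ψ ψ' : ℝℝ → ℝ} (hψ : WaveSol T C1 ψ)
    (hψ' : WaveSol T C1 ψ')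
    (hh : ∀ j, ∃ C, ∀ q, 0 < q → 2 * q ≤ p0 → |DQ j ψ (p0, q)| ≤ C * (1 + q ^ n * (q⁻¹) ^ j))
    (dl : ℕ → ℝ → ℝ) (hdl : ∀ j, ∃ C, ∀ q, 0 < q → 2 * q ≤ p0 → |dl j q| ≤ C * (q ^ n * (q⁻¹) ^ j))
    (hc0 : ∃ K, ∀ q, 0 < q → 2 * q ≤ p0 → |ψ' (2 * q, q) - ψ (2 * q, q)| ≤ K * q ^ n)
    (hc : ∀ j, ∃ K, ∀ q, 0 < q → 2 * q ≤ p0 →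
      |DQ (j + 1) (fun x => ψ' x - ψ x) (2 * q, q) - dl (j + 1) q| ≤ K * (q ^ n * (q⁻¹) ^ j)) (j : ℕ) :
    ∃ C, ∀ q, 0 < q → 2 * q ≤ p0 →
      |DQ j (fun x => ψ' x - ψ x) (p0, q) - dl j q| ≤ C * (1 + q ^ (n + 1) * (q⁻¹) ^ j) := by
  have sΔ : CDOn (fun x => ψ' x - ψ x) (Om T) := hψ'.smooth.sub hψ.smooth
  have hA := claimA hpT hp1 hn hC1 hψ hh
  have hc' : ∀ j, ∃ K, ∀ q, 0 < q → 2 * q ≤ p0 →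
      |DQ j (fun x => ψ' x - ψ x) (2 * q, q)| ≤ K * (q ^ n * (q⁻¹) ^ j) := by
    intro j
    rcases j with _ | j
    · obtain ⟨K, hK⟩ := hc0
      exact ⟨K, fun q h1 h2 => by simpa using hK q h1 h2⟩
    · obtain ⟨K, hK⟩ := hc j
      obtain ⟨C, hC⟩ := hdl (j + 1)
      refine ⟨|K| + C, fun q h1 h2 => ?_⟩
      have a1 := hK q h1 h2
      have a2 := hC q h1 h2
      have a3 := abs_sub_abs_le_abs_sub (DQ (j + 1) (fun x => ψ' x - ψ x) (2 * q, q)) (dl (j + 1) q)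
      have a4 : K * (q ^ n * (q⁻¹) ^ j) ≤ |K| * (q ^ n * (q⁻¹) ^ (j + 1)) := by
        refine (mul_le_mul_of_nonneg_right (le_abs_self K) (by positivity)).trans ?_
        have i2 : (q⁻¹) ^ j ≤ (q⁻¹) ^ (j + 1) := pow_le_pow_right₀ ((one_le_inv₀ h1).2 (by linarith)) (Nat.le_succ j)
        gcongr
      rw [add_mul]; linarith
  rcases j with _ | j
  · obtain ⟨C, hC0, hC⟩ := (claimB hpT hp1 hn hC1 hs hψ hψ' hA hc' 0).1 0 le_rfl
    obtain ⟨K, hK⟩ := hdl 0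
    refine ⟨2 * C + |K|, fun q h1 h2 => ?_⟩
    have hx : (p0, q) ∈ Rg p0 := ⟨h1, h2, le_rfl⟩
    have a1 := hC _ hx
    have a2 := hK q h1 h2
    obtain ⟨g1, g2, g3, g4, g5, g6, g7, g8, g9, g10⟩ := Rg_facts hp1 hn hx
    simp only [dw, pow_zero, mul_one] at a1 a2 g1 g2 g3 g4 g5 g6 g7 g8 g9 g10 ⊢
    have i1 : p0 ^ n ≤ 1 := rpow_le_one hp00.le hp1 (by linarith)
    have i2 : q ^ n ≤ 1 := g6.trans i1
    have i3 : C * (p0 ^ n + q ^ n) ≤ C * 2 := mul_le_mul_of_nonneg_left (by linarith) hC0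
    have i4 : K * q ^ n ≤ |K| * 1 := mul_le_mul (le_abs_self K) i2 g5.le (abs_nonneg K)
    have i5 := abs_sub (DQ 0 (fun x => ψ' x - ψ x) (p0, q)) (dl 0 q)
    have i6 : 0 ≤ (2 * C + |K|) * q ^ (n + 1) := by positivity
    rw [mul_add]
    linarith
  · obtain ⟨C, hC0, hC⟩ := (claimB hpT hp1 hn hC1 hs hψ hψ' hA hc' j).2 j le_rfl
    obtain ⟨K, hK⟩ := hc j
    refine ⟨|K| + (p0⁻¹ ^ j + 2) * C, fun q h1 h2 => ?_⟩
    have hx : (p0, q) ∈ Rg p0 := ⟨h1, h2, le_rfl⟩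
    obtain ⟨g1, g2, g3, g4, g5, g6, g7, g8, g9, g10⟩ := Rg_facts hp1 hn hx
    simp only at g1 g2 g3 g4 g5 g6 g7 g8 g9 g10
    have i1 : p0 ^ n ≤ 1 := rpow_le_one hp00.le hp1 (by linarith)
    have ee : q ^ (n + 1) * (q⁻¹) ^ (j + 1) = q ^ n * (q⁻¹) ^ j := by
      rw [rpow_add h1, rpow_one, pow_succ]; field_simp
    rw [ee]
    set X := q ^ n * (q⁻¹) ^ j with hX
    have hX0 : 0 < X := by positivity
    set B := C * (p0⁻¹ ^ j + 2 * X) with hB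
    have e2 := mvt_p sΔ j (q := q) (a := 2 * q) (b := p0) (B := B) h1 (by linarith) h2 hpT (by
        intro p' k1 k2
        have hx' : (p', q) ∈ Rg p0 := ⟨h1, k1, k2⟩
        refine (hC (p', q) hx').trans (mul_le_mul_of_nonneg_left ((dw_mono hpT hp1 hn h1 k1 k2).trans ?_) hC0)
        have : p0 ^ n * p0⁻¹ ^ j ≤ 1 * p0⁻¹ ^ j := by gcongr
        linarith)
    have e3 : B * (p0 - 2 * q) ≤ B := mul_le_of_le_one_right (by positivity) (by linarith)
    have e4 := hK q h1 h2
    have e5 := abs_sub_le (DQ (j + 1) (fun x => ψ' x - ψ x) (p0, q)) (DQ (j + 1) (fun x => ψ' x - ψ x) (2 * q, q))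
      (dl (j + 1) q)
    have e6 : K * X ≤ |K| * X := mul_le_mul_of_nonneg_right (le_abs_self K) hX0.le
    have e7 : B ≤ (p0⁻¹ ^ j + 2) * C * (1 + X) := by
      rw [hB]
      have : 0 ≤ p0⁻¹ ^ j := by positivity
      nlinarith [mul_nonneg hC0 hX0.le, mul_nonneg this (mul_nonneg hC0 hX0.le)]
    have e8 : |K| * X ≤ |K| * (1 + X) := mul_le_mul_of_nonneg_left (by linarith) (abs_nonneg K)
    rw [add_mul]
    linarith

end

end

section

lemma f_alg {M N d a b w : ℝ} (h1 : (M ^ 4 + 3 / 4 * d ^ 2) * N ^ 2 = 1) (h2 : d * w = a - b) :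
    -(1 / 2 * a * N + M * (-(1 / 2) * N ^ 3 * (2 * M ^ 3 * a + 3 / 2 * d)))
      + ((1 / 2 * b) * N + d * (1 / 2 * b) * (-(1 / 2) * N ^ 3 * (2 * M ^ 3 * a + 3 / 2 * d)))
      - 1 / 2 * ((2 * M ^ 3 * b - 3 / 2 * d) * (M * N ^ 3)
        + d * (3 * M ^ 2 * a * b - 3 / 2) * (M * N ^ 3)
        + d * (2 * M ^ 3 * b - 3 / 2 * d) * (1 / 2 * a * N ^ 3 + M * (3 * N ^ 2 *
          (-(1 / 2) * N ^ 3 * (2 * M ^ 3 * a + 3 / 2 * d))))) =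
    1 / 4 * d * (9 * M ^ 5 * N ^ 5) + 1 / 4 * d * (2 * M ^ 3 * (M ^ 4 - 15 / 4 * d ^ 2) * N ^ 5 * (a * b + M * w)) := by
  linear_combination (-((-(1 / 2) * a + 1 / 2 * b) * N * ((M ^ 4 + 3 / 4 * d ^ 2) * N ^ 2 + 1)
    + (M ^ 4 * a + 3 / 4 * M * d - 1 / 2 * d * b * M ^ 3 * a - 3 / 8 * d ^ 2 * b - 1 / 2 * (2 * M ^ 3 * b - 3 / 2 * d) * M
      - 1 / 2 * d * (3 * M ^ 2 * a * b - 3 / 2) * M - 1 / 4 * d * (2 * M ^ 3 * b - 3 / 2 * d) * a) * N ^ 3)) * h1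
    - (1 / 2 * M ^ 4 * (M ^ 4 - 15 / 4 * d ^ 2) * N ^ 5) * h2

section
variable {m : ℕ} {μ : ℝ → ℝ}

lemma AA_smooth (h : Adm m μ) (T : ℝ) :
    CDOn (fun x : ℝℝ => AA μ x.1 x.2) (Set.Ioo 0 T ×ˢ Set.Ioo 0 T) := by
  have h1 : CDOn (fun x : ℝℝ => μ x.1) (Set.Ioo 0 T ×ˢ Set.Ioo 0 T) :=
    h.smooth.comp contDiff_fst.contDiffOn (fun x hx => hx.1.1)
  have h2 : CDOn (fun x : ℝℝ => μ x.2) (Set.Ioo 0 T ×ˢ Set.Ioo 0 T) :=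
    h.smooth.comp contDiff_snd.contDiffOn (fun x hx => hx.2.1)
  have h3 : CDOn (fun x : ℝℝ => MM μ x.1 x.2) (Set.Ioo 0 T ×ˢ Set.Ioo 0 T) := by
    unfold MM; exact (h1.add h2).div_const 2
  have h4 : CDOn (fun x : ℝℝ => DD μ x.1 x.2) (Set.Ioo 0 T ×ˢ Set.Ioo 0 T) := by
    unfold DD
    exact (h3.pow 4).add (contDiff_const.mul ((contDiff_fst.sub contDiff_snd).pow 2)).contDiffOn
  have h5 : CDOn (fun x : ℝℝ => NN μ x.1 x.2) (Set.Ioo 0 T ×ˢ Set.Ioo 0 T) := by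
    unfold NN
    exact (h4.sqrt fun x hx => (DD_pos h hx.1.1 hx.2.1).ne').inv
      fun x hx => (sqrt_pos.2 (DD_pos h hx.1.1 hx.2.1)).ne'
  unfold AA
  exact (contDiffOn_const.mul h3).mul h5

lemma NN_has {D : ℝ → ℝ} {D' t : ℝ} (hD : HasDerivAt D D' t) (h0 : 0 < D t) :
    HasDerivAt (fun s => (√(D s))⁻¹) (-(1 / 2) * (√(D t))⁻¹ ^ 3 * D') t := by
  have h1 := (hD.sqrt h0.ne').inv (sqrt_pos.2 h0).ne'
  refine h1.congr_deriv ?_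
  have := sqrt_pos.2 h0
  field_simp

def fq (μ : ℝ → ℝ) (p q : ℝ) : ℝ :=
  √3 / 2 * (-(MM μ p q * NN μ p q) + (p - q) * (1 / 2 * deriv μ q) * NN μ p q
    - 1 / 2 * ((p - q) * (2 * MM μ p q ^ 3 * deriv μ q - 3 / 2 * (p - q)) * (MM μ p q * NN μ p q ^ 3)))

lemma MM_has_q (h : Adm m μ) {p q : ℝ} (hq : 0 < q) :
    HasDerivAt (fun q => MM μ p q) (1 / 2 * deriv μ q) q := by
  have := ((h.hasDeriv hq).const_add (μ p)).div_const 2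
  refine this.congr_deriv (by ring)
lemma MM_has_p (h : Adm m μ) {p q : ℝ} (hp : 0 < p) :
    HasDerivAt (fun p => MM μ p q) (1 / 2 * deriv μ p) p := by
  have := ((h.hasDeriv hp).add_const (μ q)).div_const 2
  refine this.congr_deriv (by ring)

lemma NN_has_q (h : Adm m μ) {p q : ℝ} (hp : 0 < p) (hq : 0 < q) :
    HasDerivAt (fun q => NN μ p q)
      (-(1 / 2) * NN μ p q ^ 3 * (2 * MM μ p q ^ 3 * deriv μ q - 3 / 2 * (p - q))) q := by
  have h1 : HasDerivAt (fun q => DD μ p q) (2 * MM μ p q ^ 3 * deriv μ q - 3 / 2 * (p - q)) q := by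
    have := ((MM_has_q h (p := p) hq).fun_pow 4).add ((((hasDerivAt_id q).const_sub p).fun_pow 2).const_mul (3 / 4))
    refine this.congr_deriv ?_
    simp; ring
  exact NN_has h1 (DD_pos h hp hq)

lemma NN_has_p (h : Adm m μ) {p q : ℝ} (hp : 0 < p) (hq : 0 < q) :
    HasDerivAt (fun p => NN μ p q)
      (-(1 / 2) * NN μ p q ^ 3 * (2 * MM μ p q ^ 3 * deriv μ p + 3 / 2 * (p - q))) p := by
  have h1 : HasDerivAt (fun p => DD μ p q) (2 * MM μ p q ^ 3 * deriv μ p + 3 / 2 * (p - q)) p := by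
    have := ((MM_has_p h (q := q) hp).fun_pow 4).add ((((hasDerivAt_id p).sub_const q).fun_pow 2).const_mul (3 / 4))
    refine this.congr_deriv ?_
    simp; ring
  exact NN_has h1 (DD_pos h hp hq)

lemma f_has_q (h : Adm m μ) {p q : ℝ} (hp : 0 < p) (hq : 0 < q) :
    HasDerivAt (fun q => (p - q) / 2 * AA μ p q) (fq μ p q) q := by
  have h1 := ((((hasDerivAt_id q).const_sub p).div_const 2).mul
    (((MM_has_q h (p := p) hq).const_mul √3).mul (NN_has_q h hp hq)))
  refine h1.congr_deriv ?_
  simp only [fq, Pi.mul_apply, id]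
  ring

lemma f_has_p (h : Adm m μ) {p q : ℝ} (hp : 0 < p) (hq : 0 < q) :
    HasDerivAt (fun p => fq μ p q) ((p - q) / 8 * (AA μ p q ^ 5 + ee μ p q)) p := by
  have hM := MM_has_p h (q := q) hp
  have hN := NN_has_p h hp hq
  have hd := (hasDerivAt_id p).sub_const q
  have h1 := (((hM.mul hN).neg.add ((hd.mul_const (1 / 2 * deriv μ q)).mul hN)).sub
    (((hd.mul ((((hM.fun_pow 3).const_mul 2).mul_const (deriv μ q)).sub (hd.const_mul (3 / 2)))).mul
      (hM.mul (hN.fun_pow 3))).const_mul (1 / 2))).const_mul (√3 / 2)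
  refine h1.congr_deriv ?_
  have h3 : √3 ^ 5 = 9 * √3 := by
    have : √3 ^ 2 = 3 := sq_sqrt (by norm_num)
    calc √3 ^ 5 = (√3 ^ 2) ^ 2 * √3 := by ring
      _ = _ := by rw [this]; ring
  have h2 := f_alg (DD_NN h hp hq) (dd_eq h hp hq)
  have h5 : AA μ p q ^ 5 = 9 * √3 * (MM μ p q ^ 5 * NN μ p q ^ 5) := by
    unfold AA; rw [mul_pow, mul_pow, h3]; ring
  rw [h5]
  unfold ee vv
  simp only [Pi.mul_apply, Pi.sub_apply, id]
  norm_num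
  linear_combination (√3 / 2) * h2
end

section
variable {m : ℕ} {μ : ℝ → ℝ} {z : ℝ → ℝ → ℝ}

def JJ (μ : ℝ → ℝ) (z : ℝ → ℝ → ℝ) (p q : ℝ) : ℝ := ∫ p' in q..p, (p' - q) * gg μ z p' q

lemma gg_symm (hz : IsSol m μ z) (p q : ℝ) : gg μ z p q = gg μ z q p := by
  unfold gg; rw [ee_symm, AA_symm, hz.symm]

lemma uIcc_Ioo {T a b x : ℝ} (ha : a ∈ Set.Ioo 0 T) (hb : b ∈ Set.Ioo 0 T) (hx : x ∈ Set.uIcc a b) : x ∈ Set.Ioo 0 T :=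
  (Set.ordConnected_Ioo.uIcc_subset ha hb) hx

lemma JJ_has_p (h : Adm m μ) (hz : IsSol m μ z) {p q : ℝ} (hp : p ∈ Set.Ioo 0 (TT m)) (hq : q ∈ Set.Ioo 0 (TT m)) :
    HasDerivAt (fun p => JJ μ z p q) ((p - q) * gg μ z p q) p := by
  have hg := cont_gg h hz.cont
  have hc : ContinuousOn (fun p' => (p' - q) * gg μ z p' q) (Set.Ioo 0 (TT m)) :=
    ContinuousOn.mul (by fun_prop) (hg.comp (f := fun p' : ℝ => (p', q)) (by fun_prop) fun x hx => ⟨hx, hq⟩)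
  exact intervalIntegral.integral_hasDerivAt_right
    (hc.mono fun x hx => uIcc_Ioo hq hp hx).intervalIntegrable
    (hc.stronglyMeasurableAtFilter isOpen_Ioo p hp) (hc.continuousAt (isOpen_Ioo.mem_nhds hp))

lemma JJ_cont (h : Adm m μ) (hz : IsSol m μ z) {p : ℝ} (hp : p ∈ Set.Ioo 0 (TT m)) :
    ContinuousOn (fun q => JJ μ z p q) (Set.Ioo 0 (TT m)) := by
  have hg := cont_gg h hz.cont
  rw [continuousOn_iff_continuous_domRestrict]
  have e : ∀ q : Set.Ioo (0:ℝ) (TT m), JJ μ z p q.1 =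
      (p - q.1) ^ 2 * ∫ α in (0:ℝ)..1, α * gg μ z (q.1 + (p - q.1) * α) q.1 := by
    intro q
    have := intervalIntegral.smul_integral_comp_add_mul (fun p' => (p' - q.1) * gg μ z p' q.1) (p - q.1) q.1
      (a := 0) (b := 1)
    simp only [mul_zero, add_zero, mul_one, add_sub_cancel, smul_eq_mul] at this
    unfold JJ
    rw [← this, pow_two, mul_assoc]
    congr 1
    rw [← intervalIntegral.integral_const_mul (p - q.1)]
    congr 1; funext α; ring
  have e2 : (Set.Ioo (0:ℝ) (TT m)).domRestrict (fun q => JJ μ z p q) = fun q : Set.Ioo (0:ℝ) (TT m) =>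
      (p - q.1) ^ 2 * ∫ α in (0:ℝ)..1, α * gg μ z (q.1 + (p - q.1) * α) q.1 := by
    funext q; exact e q
  rw [e2]
  refine Continuous.mul (by fun_prop) (cont_int01 (f := fun (q : Set.Ioo (0:ℝ) (TT m)) α =>
    α * gg μ z (q.1 + (p - q.1) * α) q.1) ?_)
  refine Continuous.mul (by fun_prop) ?_
  exact hg.comp_continuous (f := fun x : Set.Ioo (0:ℝ) (TT m) × ℝ => (x.1.1 + (p - x.1.1) * c01 x.2, x.1.1)) (by fun_prop)
    fun x => ⟨tri_seg hp.1 hp.2 x.1.2.1 x.1.2.2 (c01_nonneg _) (c01_le _), x.1.2⟩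

lemma w_eq (h : Adm m μ) (hz : IsSol m μ z) {p q : ℝ} (hp : p ∈ Set.Ioo 0 (TT m)) (hq : q ∈ Set.Ioo 0 (TT m)) :
    (p - q) * z p q = 1 / 4 * ∫ q' in q..p, JJ μ z p q' := by
  have hg := cont_gg h hz.cont
  have e1 : ∀ β ∈ Set.uIcc (0:ℝ) 1, (p - q) ^ 2 * (∫ α in (0:ℝ)..1,
      max (α - β) 0 * gg μ z (q + (p - q) * α) (q + (p - q) * β)) = JJ μ z p (q + (p - q) * β) := by
    intro β hβ
    rw [Set.uIcc_of_le zero_le_one] at hβ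
    have hb := tri_seg hp.1 hp.2 hq.1 hq.2 hβ.1 hβ.2
    have hc : ContinuousOn (fun α => max (α - β) 0 * gg μ z (q + (p - q) * α) (q + (p - q) * β)) (Set.Icc 0 1) :=
      ContinuousOn.mul (by fun_prop) (hg.comp (f := fun α : ℝ => (q + (p - q) * α, q + (p - q) * β)) (by fun_prop)
        fun α hα => ⟨tri_seg hp.1 hp.2 hq.1 hq.2 hα.1 hα.2, hb⟩)
    have s1 := intervalIntegral.integral_add_adjacent_intervals (μ := volume) (a := 0) (b := β) (c := 1)
      (f := fun α => max (α - β) 0 * gg μ z (q + (p - q) * α) (q + (p - q) * β))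
      ((hc.mono (by rw [Set.uIcc_of_le hβ.1]; exact Set.Icc_subset_Icc le_rfl hβ.2)).intervalIntegrable)
      ((hc.mono (by rw [Set.uIcc_of_le hβ.2]; exact Set.Icc_subset_Icc hβ.1 le_rfl)).intervalIntegrable)
    have s2 : (∫ α in (0:ℝ)..β, max (α - β) 0 * gg μ z (q + (p - q) * α) (q + (p - q) * β)) = 0 := by
      rw [intervalIntegral.integral_congr (g := fun _ => (0:ℝ)) ?_]
      · simp
      · intro α hα
        rw [Set.uIcc_of_le hβ.1] at hα
        beta_reduce
        rw [max_eq_right (by linarith [hα.2]), zero_mul]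
    have s3 : (∫ α in β..(1:ℝ), max (α - β) 0 * gg μ z (q + (p - q) * α) (q + (p - q) * β)) =
        ∫ α in β..(1:ℝ), (α - β) * gg μ z (q + (p - q) * α) (q + (p - q) * β) := by
      refine intervalIntegral.integral_congr fun α hα => ?_
      rw [Set.uIcc_of_le hβ.2] at hα
      rw [max_eq_left (by linarith [hα.1])]
    rw [s2, zero_add, s3] at s1
    rw [← s1]
    have := intervalIntegral.smul_integral_comp_add_mul
      (fun p' => (p' - (q + (p - q) * β)) * gg μ z p' (q + (p - q) * β)) (p - q) q (a := β) (b := 1)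
    simp only [mul_one, add_sub_cancel, smul_eq_mul] at this
    unfold JJ
    rw [← this, pow_two, mul_assoc, ← intervalIntegral.integral_const_mul (p - q)]
    congr 1; refine intervalIntegral.integral_congr fun α _ => ?_
    ring
  rw [hz.eq p q hp.1 hp.2 hq.1 hq.2]
  have := intervalIntegral.smul_integral_comp_add_mul (fun q' => JJ μ z p q') (p - q) q (a := 0) (b := 1)
  simp only [mul_zero, add_zero, mul_one, add_sub_cancel, smul_eq_mul] at this
  rw [← this, ← intervalIntegral.integral_congr e1, intervalIntegral.integral_const_mul]
  ring

lemma w_has_q (h : Adm m μ) (hz : IsSol m μ z) {p q : ℝ} (hp : p ∈ Set.Ioo 0 (TT m)) (hq : q ∈ Set.Ioo 0 (TT m)) :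
    HasDerivAt (fun q => (p - q) * z p q) (-(1 / 4) * JJ μ z p q) q := by
  have hc := JJ_cont h hz hp
  have h1 := (intervalIntegral.integral_hasDerivAt_left
    (hc.mono fun x hx => uIcc_Ioo hq hp hx).intervalIntegrable
    (hc.stronglyMeasurableAtFilter isOpen_Ioo q hq) (hc.continuousAt (isOpen_Ioo.mem_nhds hq))).const_mul (1 / 4)
  have h2 : (fun q => (p - q) * z p q) =ᶠ[𝓝 q] fun q => 1 / 4 * ∫ q' in q..p, JJ μ z p q' := by
    filter_upwards [isOpen_Ioo.mem_nhds hq] with q' hq' using w_eq h hz hp hq'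
  refine (h1.congr_of_eventuallyEq h2).congr_deriv (by ring)

lemma w_has_p (h : Adm m μ) (hz : IsSol m μ z) {p q : ℝ} (hp : p ∈ Set.Ioo 0 (TT m)) (hq : q ∈ Set.Ioo 0 (TT m)) :
    HasDerivAt (fun p => (p - q) * z p q) (1 / 4 * ∫ q' in q..p, (p - q') * gg μ z p q') p := by
  have h1 := (w_has_q h hz hq hp).neg
  have e : (fun p => (p - q) * z p q) = -(fun p => (q - p) * z q p) := by
    funext p; simp only [Pi.neg_apply]; rw [hz.symm q p]; ring
  rw [e]
  refine h1.congr_deriv ?_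
  unfold JJ
  rw [intervalIntegral.integral_symm q p, ← intervalIntegral.integral_neg, neg_mul, neg_neg]
  congr 1
  refine intervalIntegral.integral_congr fun x _ => ?_
  rw [gg_symm hz x p]; ring

lemma PS_smooth (hm : 1 ≤ m) (h : Adm m μ) (hμ : Sym m μ) (hz : IsSol m μ z) :
    CDOn (fun x : ℝℝ => PS μ z x.1 x.2) (Set.Ioo 0 (TT m) ×ˢ Set.Ioo 0 (TT m)) := by
  unfold PS
  exact ((contDiff_fst.sub contDiff_snd).div_const 2).contDiffOn.mul ((AA_smooth h _).add (z_smooth hm h hμ hz))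

lemma PS_has_q (h : Adm m μ) (hz : IsSol m μ z) {p q : ℝ} (hp : p ∈ Set.Ioo 0 (TT m)) (hq : q ∈ Set.Ioo 0 (TT m)) :
    HasDerivAt (fun q => PS μ z p q) (fq μ p q - 1 / 8 * JJ μ z p q) q := by
  have := (f_has_q h hp.1 hq.1).add ((w_has_q h hz hp hq).const_mul (1 / 2))
  refine (this.congr_of_eventuallyEq (Eventually.of_forall fun q => ?_)).congr_deriv (by ring)
  simp only [PS, Pi.add_apply]; ring

def C1 (m : ℕ) : ℝ := 3 + RR m

lemma f_abs (h : Adm m μ) {p q : ℝ} (hq : 0 < q) (hqp : q ≤ p) : |(p - q) / 2 * AA μ p q| ≤ MM μ p q := by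
  have hp := hq.trans_le hqp
  have hN := NN_pos h hp hq
  have hM := MM_pos h hp hq
  rw [abs_of_nonneg (mul_nonneg (by linarith) (AA_pos h hp hq).le)]
  have h1 := DD_NN h hp hq
  have h2 : (√3 * ((p - q) / 2) * NN μ p q) ^ 2 ≤ 1 := by
    have h3 : √3 ^ 2 = 3 := sq_sqrt (by norm_num)
    rw [← h1, mul_pow, mul_pow, h3]; unfold DD
    have : 0 ≤ MM μ p q ^ 4 * NN μ p q ^ 2 := by positivity
    nlinarith
  have h4 := (sq_le_one_iff_abs_le_one _).1 h2
  have h5 := (le_abs_self _).trans h4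
  unfold AA
  nlinarith [mul_le_mul_of_nonneg_left h5 hM.le]

theorem PS_wave (hm : 1 ≤ m) (h : Adm m μ) (hμ : Sym m μ) (hz : IsSol m μ z) :
    WaveSol (TT m) (C1 m) (fun x => PS μ z x.1 x.2) where
  smooth := (PS_smooth hm h hμ hz).mono fun x hx => ⟨⟨hx.1.trans hx.2.1, hx.2.2⟩, ⟨hx.1, hx.2.1.trans hx.2.2⟩⟩
  eq := by
    rintro ⟨p, q⟩ ⟨h1, h2, h3⟩
    simp only at h1 h2 h3 ⊢
    have hq : q ∈ Set.Ioo 0 (TT m) := ⟨h1, by linarith⟩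
    have hp : p ∈ Set.Ioo 0 (TT m) := ⟨by linarith, h3⟩
    have e : (fun p => DQ 1 (fun x => PS μ z x.1 x.2) (p, q)) =ᶠ[𝓝 p] fun p => fq μ p q - 1 / 8 * JJ μ z p q := by
      filter_upwards [isOpen_Ioo.mem_nhds hp] with p' hp'
      simp only [DQ, iteratedDeriv_one]
      exact (PS_has_q h hz hp' hq).deriv
    unfold DP
    simp only
    rw [e.deriv_eq, ((f_has_p h hp.1 hq.1).fun_sub ((JJ_has_p h hz hp hq).const_mul (1 / 8))).deriv]
    have hd : p - q ≠ 0 := by linarith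
    unfold gg PS
    field_simp
    ring
  bd := by
    rintro ⟨p, q⟩ ⟨h1, h2, h3⟩
    simp only at h1 h2 h3 ⊢
    have hp1 : p ≤ 1 := by linarith [TT_le m]
    have hp0 : 0 < p := by linarith
    have a1 := f_abs h h1 h2.le
    have a2 := MM_hi h h1 h2.le
    have a3 : p ^ m ≤ p := by simpa using pow_le_pow_of_le_one hp0.le hp1 hm
    have a4 := hz.bd p q h1 h2.le h3
    have a5 : p ^ (3 * m - 2) ≤ p := by simpa using pow_le_pow_of_le_one hp0.le hp1 (show 1 ≤ 3 * m - 2 by omega)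
    have a6 : |(p - q) / 2 * z p q| ≤ RR m * p := by
      rw [abs_mul, abs_of_nonneg (by linarith : 0 ≤ (p - q) / 2)]
      have a7 : |z p q| ≤ RR m * p := a4.trans (mul_le_mul_of_nonneg_left a5 (RR_pos m).le)
      calc _ ≤ 1 * |z p q| := mul_le_mul_of_nonneg_right (by linarith) (abs_nonneg _)
        _ ≤ _ := by linarith
    have a8 := abs_add_le ((p - q) / 2 * AA μ p q) ((p - q) / 2 * z p q)
    rw [← mul_add] at a8
    unfold PS C1
    linarith
end

end

lemma rpw {q : ℝ} (hq : 0 < q) (a : ℝ) (j : ℕ) : q ^ (a - j) = q ^ a * (q⁻¹) ^ j := by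
  rw [rpow_sub hq, rpow_natCast, inv_pow, div_eq_mul_inv]

lemma ext_bd {F : ℝ → ℝ} {b a C ε : ℝ} (hF : ContinuousOn F (Set.Ioc 0 b)) (hε : 0 < ε)
    (h : ∀ s, 0 < s → s < ε → |F s| ≤ C * s ^ a) : ∃ C', ∀ s, 0 < s → s ≤ b → |F s| ≤ C' * s ^ a := by
  have hc : ContinuousOn (fun s => F s * s ^ (-a)) (Set.Icc ε b) :=
    (hF.mono fun s hs => ⟨hε.trans_le hs.1, hs.2⟩).mul
      (continuousOn_id.rpow_const fun s hs => Or.inl (hε.trans_le hs.1).ne')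
  obtain ⟨K, hK⟩ := isCompact_Icc.exists_bound_of_continuousOn hc
  refine ⟨max C K, fun s h0 h1 => ?_⟩
  have hp := rpow_pos_of_pos h0 a
  rcases lt_or_ge s ε with h2 | h2
  · exact (h s h0 h2).trans (mul_le_mul_of_nonneg_right (le_max_left _ _) hp.le)
  · have := hK s ⟨h2, h1⟩
    rw [Real.norm_eq_abs, abs_mul, rpow_neg h0.le, abs_inv, abs_of_pos hp] at this
    calc |F s| = |F s| * (s ^ a)⁻¹ * s ^ a := by field_simp
      _ ≤ K * s ^ a := mul_le_mul_of_nonneg_right this hp.le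
      _ ≤ _ := mul_le_mul_of_nonneg_right (le_max_right _ _) hp.le

def P0 (m : ℕ) : ℝ := min (TT m / 2) (1 / (30 * C1 m ^ 2))
lemma C1_ge (m : ℕ) : 3 ≤ C1 m := by have := RR_pos m; unfold C1; linarith
lemma P0_pos (m : ℕ) : 0 < P0 m := by
  have := C1_ge m; have := TT_pos m
  exact lt_min (by linarith) (by positivity)
lemma P0_lt (m : ℕ) : P0 m < TT m := (min_le_left _ _).trans_lt (by linarith [TT_pos m])
lemma P0_le (m : ℕ) : P0 m ≤ 1 / 4 := (P0_lt m).le.trans (TT_le m)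
lemma P0_small (m : ℕ) : 320 * C1 m ^ 4 * P0 m ^ 2 ≤ 1 / 2 := by
  have h := C1_ge m
  have h1 : P0 m ^ 2 ≤ (1 / (30 * C1 m ^ 2)) ^ 2 := pow_le_pow_left₀ (P0_pos m).le (min_le_right _ _) 2
  calc _ ≤ 320 * C1 m ^ 4 * (1 / (30 * C1 m ^ 2)) ^ 2 := by gcongr
    _ = 320 / 900 := by field_simp; norm_num
    _ ≤ _ := by norm_num

def Qn (P n : ℝ) (h : ℝ → ℝ) : Prop :=
  ∀ j : ℕ, ∃ C, ∀ q, 0 < q → 2 * q ≤ P → |iteratedDeriv j h q| ≤ C * (1 + q ^ n * (q⁻¹) ^ j)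

lemma keyL {m : ℕ} {n : ℝ} (hn : 1 ≤ n) {ψ ψ' : ℝℝ → ℝ} (hψ : WaveSol (TT m) (C1 m) ψ) (hψ' : WaveSol (TT m) (C1 m) ψ')
    (hh : Qn (P0 m) n (fun q => ψ (P0 m, q))) {δ : ℝ → ℝ} (hδ : Sym n δ)
    (hcor : ∀ j : ℕ, ∃ C ε, 0 < ε ∧ ∀ s, 0 < s → s < ε →
      |iteratedDeriv j (fun q => (ψ' (2 * s, q) - ψ (2 * s, q)) - (δ (2 * s) + δ q) / 2) s| ≤ C * s ^ (n + 1 - j)) :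
    Qn (P0 m) (n + 1) (fun q => (ψ' (P0 m, q) - ψ (P0 m, q)) - 1 / 2 * δ q) := by
  have sΔ : CDOn (fun x => ψ' x - ψ x) (Om (TT m)) := hψ'.smooth.sub hψ.smooth
  have hPT := P0_lt m
  have hP1 := P0_le m
  have hmem : ∀ q, 0 < q → 2 * q ≤ P0 m → (2 * q, q) ∈ Om (TT m) := fun q h0 h1 =>
    ⟨h0, by simp only; linarith, by simp only; linarith⟩
  have hmem' : ∀ q, 0 < q → 2 * q ≤ P0 m → (P0 m, q) ∈ Om (TT m) := fun q h0 h1 =>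
    ⟨h0, by simp only; linarith, hPT⟩
  have sδ : ∀ q, 0 < q → ∀ j : ℕ, ContDiffAt ℝ j δ q := fun q h0 j =>
    (hδ.smooth.contDiffAt (isOpen_Ioi.mem_nhds h0)).of_le (by exact_mod_cast le_top)
  have cD : ∀ j, ContinuousOn (fun q => DQ j (fun x => ψ' x - ψ x) (2 * q, q)) (Set.Ioc 0 (P0 m / 2)) := fun j =>
    (DQ_smooth (Om_open _) sΔ j).continuousOn.comp (f := fun q : ℝ => (2 * q, q)) (by fun_prop)
      fun q hq => hmem q hq.1 (by linarith [hq.2])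
  have cδ : ∀ j, ContinuousOn (iteratedDeriv j δ) (Set.Ioi 0) := fun j =>
    (iter_smooth isOpen_Ioi hδ.smooth j).continuousOn
  have hdl : ∀ j : ℕ, ∃ C, ∀ q, 0 < q → 2 * q ≤ P0 m → |1 / 2 * iteratedDeriv j δ q| ≤ C * (q ^ n * (q⁻¹) ^ j) := by
    intro j
    obtain ⟨C, hC⟩ := hδ.bd j
    refine ⟨C, fun q h0 h1 => ?_⟩
    have := hC q h0 (by linarith)
    rw [rpw h0] at this
    rw [abs_mul, abs_of_pos (by norm_num : (0:ℝ) < 1 / 2)]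
    linarith [abs_nonneg (iteratedDeriv j δ q)]
  have hK := claimC hPT (by linarith) hn (P0_pos m) (by linarith [C1_ge m]) (P0_small m) hψ hψ'
    (fun j => hh j) (fun j q => 1 / 2 * iteratedDeriv j δ q) hdl ?_ ?_
  · intro j
    obtain ⟨C, hC⟩ := hK j
    refine ⟨C, fun q h0 h1 => ?_⟩
    have := hC q h0 h1
    have e : iteratedDeriv j (fun q => (ψ' (P0 m, q) - ψ (P0 m, q)) - 1 / 2 * δ q) q =
        DQ j (fun x => ψ' x - ψ x) (P0 m, q) - 1 / 2 * iteratedDeriv j δ q := by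
      rw [iteratedDeriv_fun_sub (slice_cd (Om_open _) sΔ (hmem' q h0 h1) j) (contDiffAt_const.mul (sδ q h0 j)),
        iteratedDeriv_const_mul_field]
      rfl
    rw [e]; exact this
  · obtain ⟨C, ε, hε, hC⟩ := hcor 0
    obtain ⟨Cd, hCd⟩ := hδ.bd 0
    simp only [iteratedDeriv_zero, Nat.cast_zero, sub_zero] at hC hCd
    have key := ext_bd (F := fun q => ψ' (2 * q, q) - ψ (2 * q, q)) (b := P0 m / 2) (a := n) (C := |C| + |Cd| * 2 ^ n + |Cd|) (ε := min ε (1 / 2))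
      (by simpa using cD 0) (lt_min hε (by norm_num)) ?_
    · obtain ⟨K, hK⟩ := key
      exact ⟨K, fun q h0 h1 => hK q h0 (by linarith)⟩
    · intro s h0 h1
      have a1 := hC s h0 (h1.trans_le (min_le_left _ _))
      have hs1 : s < 1 / 2 := h1.trans_le (min_le_right _ _)
      have a2 := hCd (2 * s) (by linarith) (by linarith)
      have a3 := hCd s h0 (by linarith)
      have hsn := rpow_pos_of_pos h0 n
      have e2 : (2 * s) ^ n = 2 ^ n * s ^ n := Real.mul_rpow (by norm_num) h0.le
      have e1 : C * s ^ (n + 1) ≤ |C| * s ^ n := by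
        rw [rpow_add h0, rpow_one, ← mul_assoc]
        have : C * s ^ n ≤ |C| * s ^ n := mul_le_mul_of_nonneg_right (le_abs_self C) hsn.le
        have : 0 ≤ |C| * s ^ n := by positivity
        nlinarith
      have e3 : Cd * s ^ n ≤ |Cd| * s ^ n := mul_le_mul_of_nonneg_right (le_abs_self _) hsn.le
      have e4 : Cd * (2 ^ n * s ^ n) ≤ |Cd| * (2 ^ n * s ^ n) := mul_le_mul_of_nonneg_right (le_abs_self _) (by positivity)
      rw [e2] at a2
      rw [abs_le] at a1 a2 a3 ⊢
      have e5 : 0 ≤ |Cd| * (2 ^ n * s ^ n) := by positivity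
      have e6 : 0 ≤ |Cd| * s ^ n := by positivity
      constructor <;> nlinarith
  · intro j
    obtain ⟨C, ε, hε, hC⟩ := hcor (j + 1)
    have key := ext_bd (F := fun q => DQ (j + 1) (fun x => ψ' x - ψ x) (2 * q, q) - 1 / 2 * iteratedDeriv (j + 1) δ q)
      (b := P0 m / 2) (a := n - j) (C := C) (ε := min ε (P0 m / 2))
      ((cD (j + 1)).sub (continuousOn_const.mul ((cδ (j + 1)).mono fun q hq => hq.1))) (lt_min hε (by linarith [P0_pos m])) ?_
    · obtain ⟨K, hK⟩ := key
      refine ⟨K, fun q h0 h1 => ?_⟩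
      rw [← rpw h0]; exact hK q h0 (by linarith)
    · intro s h0 h1
      have a1 := hC s h0 (h1.trans_le (min_le_left _ _))
      have h2 := h1.trans_le (min_le_right _ _)
      have e : iteratedDeriv (j + 1) (fun q => (ψ' (2 * s, q) - ψ (2 * s, q)) - (δ (2 * s) + δ q) / 2) s =
          DQ (j + 1) (fun x => ψ' x - ψ x) (2 * s, s) - 1 / 2 * iteratedDeriv (j + 1) δ s := by
        rw [iteratedDeriv_fun_sub (slice_cd (Om_open _) sΔ (hmem s h0 (by linarith)) (j + 1))
          ((contDiffAt_const.add (sδ s h0 (j + 1))).div_const 2)]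
        have : (fun q => (δ (2 * s) + δ q) / 2) = fun q => δ (2 * s) / 2 + 1 / 2 * δ q := by funext q; ring
        rw [this, iteratedDeriv_const_add (by omega), iteratedDeriv_const_mul_field]
        rfl
      rw [e] at a1
      refine a1.trans_eq ?_
      congr 2; push_cast; ring

def hF (m : ℕ) (μ : ℝ → ℝ) (z : ℝ → ℝ → ℝ) (q : ℝ) : ℝ := PS μ z (P0 m) q

theorem key_step {m : ℕ} (hm : 1 ≤ m) {n : ℝ} (hn : m < n) {μ δ : ℝ → ℝ} (hA : Adm m μ) (hμ : Sym m μ)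
    (hA' : Adm m (fun t => μ t + δ t)) (hμ' : Sym m (fun t => μ t + δ t))
    (hδ : Sym n δ) {z z' : ℝ → ℝ → ℝ} (hz : IsSol m μ z) (hz' : IsSol m (fun t => μ t + δ t) z')
    (hh : Qn (P0 m) n (hF m μ z)) :
    Qn (P0 m) (n + 1) (fun q => hF m (fun t => μ t + δ t) z' q - hF m μ z q - 1 / 2 * δ q) := by
  have hm1 : (1:ℝ) ≤ m := by exact_mod_cast hm
  refine keyL (by linarith) (PS_wave hm hA hμ hz) (PS_wave hm hA' hμ' hz') hh hδ fun j => ?_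
  obtain ⟨C, ε, hε, hC⟩ := corner hm hn hA hμ hδ hz hz' j
  refine ⟨C, min ε (TT m / 2), lt_min hε (by linarith [TT_pos m]), fun s h0 h1 => ?_⟩
  have h2 := (hC s h0 (h1.trans_le (min_le_left _ _))).2
  have h3 := h1.trans_le (min_le_right _ _)
  have hx : (2 * s, s) ∈ Set.Ioo 0 (TT m) ×ˢ Set.Ioo 0 (TT m) := ⟨⟨by simp only; linarith, by simp only; linarith⟩, ⟨h0, by simp only; linarith⟩⟩
  have hO : IsOpen (Set.Ioo 0 (TT m) ×ˢ Set.Ioo 0 (TT m)) := isOpen_Ioo.prod isOpen_Ioo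
  have s1 : ContDiffAt ℝ j (fun q => PS μ z (2 * s) q) s := slice_cd hO (PS_smooth hm hA hμ hz) hx j
  have s2 : ContDiffAt ℝ j (fun q => PS (fun t => μ t + δ t) z' (2 * s) q) s := slice_cd hO (PS_smooth hm hA' hμ' hz') hx j
  have s3 : ContDiffAt ℝ j μ s := (hA.smooth.contDiffAt (isOpen_Ioi.mem_nhds h0)).of_le (by exact_mod_cast le_top)
  have s4 : ContDiffAt ℝ j δ s := (hδ.smooth.contDiffAt (isOpen_Ioi.mem_nhds h0)).of_le (by exact_mod_cast le_top)
  have s5 : ContDiffAt ℝ j (fun q => MM μ (2 * s) q) s := (contDiffAt_const.add s3).div_const 2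
  have s6 : ContDiffAt ℝ j (fun q => MM (fun t => μ t + δ t) (2 * s) q) s :=
    (contDiffAt_const.add (s3.add s4)).div_const 2
  rw [← iteratedDeriv_fun_sub (s2.sub s6) (s1.sub s5)] at h2
  convert h2 using 3
  funext q
  simp only [MM]; ring

lemma sym_pow (m : ℕ) : Sym m (fun t => t ^ m) where
  smooth := (contDiff_id.pow m).contDiffOn
  bd := fun j => by
    refine ⟨(m.descFactorial j : ℝ), fun t h0 h1 => ?_⟩
    rw [iteratedDeriv_pow, rpw h0, rpow_natCast]
    rw [abs_mul, abs_of_nonneg (by positivity), abs_of_nonneg (by positivity)]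
    rcases le_or_gt j m with h | h
    · rw [pow_sub₀ t h0.ne' h, inv_pow]
    · rw [Nat.descFactorial_of_lt h]; simp

lemma adm_pow (m : ℕ) : Adm m (fun t => t ^ m) where
  smooth := (contDiff_id.pow m).contDiffOn
  b0 := fun t h => by simp; positivity
  b1 := fun t h => by
    rcases m with _ | m
    · simp
    · simp only [deriv_pow_field]; rw [abs_of_nonneg (by positivity)]
      push_cast
      have : 0 ≤ t ^ (m + 1) := by positivity
      calc _ = ((m:ℝ) + 1) * t ^ (m + 1) := by ring
        _ ≤ _ := by nlinarith
  b2 := fun t h => by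
    rw [show deriv (fun t : ℝ => t ^ m) = fun t => (m:ℝ) * t ^ (m - 1) by funext s; simp]
    rcases m with _ | _ | m
    · simp
    · simp; positivity
    · simp only [Nat.add_sub_cancel, deriv_const_mul_field', deriv_pow_field]
      rw [abs_of_nonneg (by positivity)]
      push_cast
      have h1 : 0 ≤ t ^ (m + 2) := by positivity
      have e : t ^ 2 * (((m:ℝ) + 1 + 1) * (((m:ℝ) + 1) * t ^ m)) = ((m:ℝ) + 2) * (m + 1) * t ^ (m + 2) := by
        ring
      rw [e]
      refine mul_le_mul_of_nonneg_right ?_ h1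
      have : (0:ℝ) ≤ m := by positivity
      nlinarith

theorem key_base {m : ℕ} (hm : 1 ≤ m) {z : ℝ → ℝ → ℝ} (hz : IsSol m (fun t => t ^ m) z) :
    Qn (P0 m) (m + 1) (hF m (fun t => t ^ m) z) := by
  have hm1 : (1:ℝ) ≤ m := by exact_mod_cast hm
  have hw0 : WaveSol (TT m) (C1 m) (fun _ => 0) :=
    ⟨contDiffOn_const, fun x _ => by simp [DP, DQ], fun x hx => by
      have := C1_ge m
      have : 0 < x.1 := hx.1.trans hx.2.1
      simp; positivity⟩
  have h0 : Qn (P0 m) m (fun q => (fun _ : ℝℝ => (0:ℝ)) (P0 m, q)) := fun j => ⟨0, fun q _ _ => by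
    simp⟩
  have key := keyL hm1 hw0 (PS_wave hm (adm_pow m) (sym_pow m) hz) h0 (sym_pow m) fun j => ?_
  · intro j
    obtain ⟨C, hC⟩ := key j
    refine ⟨|C| + m.descFactorial j, fun q q0 q1 => ?_⟩
    have a1 := hC q q0 q1
    have s1 : ContDiffAt ℝ j (fun q => PS (fun t => t ^ m) z (P0 m) q) q :=
      slice_cd (Om_open _) (PS_wave hm (adm_pow m) (sym_pow m) hz).smooth (x := (P0 m, q))
        ⟨q0, by simp only; linarith, P0_lt m⟩ j
    have e : iteratedDeriv j (fun q => PS (fun t => t ^ m) z (P0 m) q - 0 - 1 / 2 * q ^ m) q =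
        iteratedDeriv j (hF m (fun t => t ^ m) z) q - 1 / 2 * (m.descFactorial j * q ^ (m - j)) := by
      simp only [sub_zero]
      rw [iteratedDeriv_fun_sub s1 (by fun_prop), iteratedDeriv_const_mul_field]
      congr 2
      rw [iteratedDeriv_pow]
    rw [e] at a1
    have hq1 : q ≤ 1 := by linarith [P0_le m]
    have b1 : q ^ (m - j) ≤ 1 := pow_le_one₀ q0.le hq1
    have b2 : 0 ≤ q ^ (m - j) := by positivity
    have b3 : 0 ≤ q ^ ((m:ℝ) + 1) * q⁻¹ ^ j := by positivity
    have b4 : (0:ℝ) ≤ m.descFactorial j := by positivity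
    have b5 : C * (1 + q ^ ((m:ℝ) + 1) * q⁻¹ ^ j) ≤ |C| * (1 + q ^ ((m:ℝ) + 1) * q⁻¹ ^ j) :=
      mul_le_mul_of_nonneg_right (le_abs_self C) (by positivity)
    have b6 := mul_le_mul_of_nonneg_left b1 b4
    have b7 := mul_nonneg b4 b2
    have b8 := mul_nonneg b4 b3
    rw [abs_le] at a1 ⊢
    constructor <;> nlinarith
  · have hz0 : IsSol m (fun t : ℝ => t ^ m + (fun _ => (0:ℝ)) t) z := by simpa using hz
    obtain ⟨C, ε, hε, hC⟩ := corner hm (n := (m:ℝ) + 1) (by linarith) (adm_pow m) (sym_pow m) (sym_zero _) hz hz0 j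
    refine ⟨C, ε, hε, fun s h0 h1 => ?_⟩
    have := (hC s h0 h1).1
    simpa [MM] using this

lemma lim0 {g g' : ℝ → ℝ} {a C s : ℝ} (hs : 0 < s) (hg : ∀ t ∈ Set.Ioo 0 a, HasDerivAt g (g' t) t)
    (hb : ∀ t ∈ Set.Ioo 0 a, |g' t| ≤ C * t ^ (s - 1)) : ∃ c, ∀ t ∈ Set.Ioo 0 a, |g t - c| ≤ C / s * t ^ s := by
  have hr : ∀ t ∈ Set.Ioo 0 a, HasDerivAt (fun t : ℝ => C / s * t ^ s) (C * t ^ (s - 1)) t := fun t ht => by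
    have := (Real.hasDerivAt_rpow_const (p := s) (Or.inl ht.1.ne')).const_mul (C / s)
    refine this.congr_deriv (by field_simp)
  have hu : MonotoneOn (fun t => g t + C / s * t ^ s) (Set.Ioo 0 a) := by
    refine monotoneOn_of_hasDerivWithinAt_nonneg (f' := fun t => g' t + C * t ^ (s - 1)) (convex_Ioo 0 a)
      (fun t ht => ((hg t ht).add (hr t ht)).continuousAt.continuousWithinAt) ?_ ?_
    · intro t ht; rw [interior_Ioo] at ht; exact ((hg t ht).add (hr t ht)).hasDerivWithinAt
    · intro t ht; rw [interior_Ioo] at ht; linarith [(abs_le.1 (hb t ht)).1]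
  have hv : AntitoneOn (fun t => g t - C / s * t ^ s) (Set.Ioo 0 a) := by
    refine antitoneOn_of_hasDerivWithinAt_nonpos (f' := fun t => g' t - C * t ^ (s - 1)) (convex_Ioo 0 a)
      (fun t ht => ((hg t ht).sub (hr t ht)).continuousAt.continuousWithinAt) ?_ ?_
    · intro t ht; rw [interior_Ioo] at ht; exact ((hg t ht).sub (hr t ht)).hasDerivWithinAt
    · intro t ht; rw [interior_Ioo] at ht; linarith [(abs_le.1 (hb t ht)).2]
  have hpos : ∀ t ∈ Set.Ioo 0 a, 0 ≤ C / s * t ^ s := fun t ht => by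
    have h1 := (abs_nonneg _).trans (hb t ht)
    have h2 : 0 ≤ C := by
      by_contra h; push Not at h
      exact absurd h1 (not_le.2 (mul_neg_of_neg_of_pos h (rpow_pos_of_pos ht.1 _)))
    have := rpow_pos_of_pos ht.1 s
    positivity
  have hvu : ∀ t ∈ Set.Ioo 0 a, ∀ t' ∈ Set.Ioo 0 a, g t - C / s * t ^ s ≤ g t' + C / s * t' ^ s := by
    intro t ht t' ht'
    rcases le_total t' t with h | h
    · have := hv ht' ht h; have := hpos t' ht'; simp only at *; linarith
    · have := hu ht ht' h; have := hpos t ht; simp only at *; linarith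
  refine ⟨sInf ((fun t => g t + C / s * t ^ s) '' Set.Ioo 0 a), fun t ht => ?_⟩
  have h1 : sInf ((fun t => g t + C / s * t ^ s) '' Set.Ioo 0 a) ≤ g t + C / s * t ^ s :=
    csInf_le ⟨g t - C / s * t ^ s, by rintro _ ⟨t', ht', rfl⟩; exact hvu t ht t' ht'⟩ ⟨t, ht, rfl⟩
  have h2 : g t - C / s * t ^ s ≤ sInf ((fun t => g t + C / s * t ^ s) '' Set.Ioo 0 a) :=
    le_csInf ⟨_, t, ht, rfl⟩ (by rintro _ ⟨t', ht', rfl⟩; exact hvu t ht t' ht')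
  rw [abs_le]; constructor <;> linarith

lemma cdA {f : ℝ → ℝ} {O : Set ℝ} (hO : IsOpen O) (hf : CDOn f O) {t : ℝ} (ht : t ∈ O) (j : ℕ) :
    ContDiffAt ℝ j f t := (hf.contDiffAt (hO.mem_nhds ht)).of_le (by exact_mod_cast le_top)

lemma decomp {a : ℝ} (ha1 : a ≤ 1) (N : ℕ) : ∀ h : ℝ → ℝ, CDOn h (Set.Ioo 0 a) →
    (∀ j : ℕ, ∃ C, ∀ t ∈ Set.Ioo 0 a, |iteratedDeriv j h t| ≤ C * (1 + t ^ ((N:ℝ) - 1 / 2) * (t⁻¹) ^ j)) →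
    ∃ p : ℝ → ℝ, ContDiff ℝ (⊤ : ℕ∞) p ∧
      ∀ j : ℕ, ∃ C, ∀ t ∈ Set.Ioo 0 a, |iteratedDeriv j (fun t => h t - p t) t| ≤ C * (t ^ ((N:ℝ) - 1 / 2) * (t⁻¹) ^ j) := by
  induction N with
  | zero =>
    intro h sh hb
    refine ⟨fun _ => 0, contDiff_const, fun j => ?_⟩
    obtain ⟨C, hC⟩ := hb j
    refine ⟨|C| * 2, fun t ht => ?_⟩
    simp only [sub_zero]
    have h1 : 1 ≤ t ^ (((0:ℕ):ℝ) - 1 / 2) * (t⁻¹) ^ j := by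
      refine one_le_mul_of_one_le_of_one_le ?_ (one_le_pow₀ ((one_le_inv₀ ht.1).2 (ht.2.le.trans ha1)))
      exact Real.one_le_rpow_of_pos_of_le_one_of_nonpos ht.1 (ht.2.le.trans ha1) (by norm_num)
    calc _ ≤ _ := hC t ht
      _ ≤ |C| * (1 + t ^ (((0:ℕ):ℝ) - 1 / 2) * (t⁻¹) ^ j) := mul_le_mul_of_nonneg_right (le_abs_self C) (by linarith)
      _ ≤ _ := by rw [mul_assoc]; exact mul_le_mul_of_nonneg_left (by linarith) (abs_nonneg _)
  | succ N ih =>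
    intro h sh hb
    have ew : ∀ t ∈ Set.Ioo 0 a, ∀ j : ℕ, t ^ (((N + 1 : ℕ) : ℝ) - 1 / 2) * (t⁻¹) ^ (j + 1) = t ^ ((N:ℝ) - 1 / 2) * (t⁻¹) ^ j := by
      intro t ht j
      rw [← rpw ht.1, ← rpw ht.1]; congr 1; push_cast; ring
    obtain ⟨p, sp, hp⟩ := ih (deriv h) (sh.deriv_of_isOpen isOpen_Ioo (by simp)) (fun j => by
      obtain ⟨C, hC⟩ := hb (j + 1)
      refine ⟨C, fun t ht => ?_⟩
      rw [← iteratedDeriv_succ', ← ew t ht j]; exact hC t ht)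
    have hP : ∀ t, HasDerivAt (fun t => ∫ s in (0:ℝ)..t, p s) (p t) t := fun t =>
      intervalIntegral.integral_hasDerivAt_right (sp.continuous.intervalIntegrable _ _)
        (sp.continuous.stronglyMeasurableAtFilter _ _) sp.continuous.continuousAt
    have sP : ContDiff ℝ (⊤ : ℕ∞) (fun t => ∫ s in (0:ℝ)..t, p s) := by
      rw [contDiff_infty_iff_deriv]
      refine ⟨fun t => (hP t).differentiableAt, ?_⟩
      rw [show deriv (fun t => ∫ s in (0:ℝ)..t, p s) = p from funext fun t => (hP t).deriv]; exact sp
    have hd : ∀ t ∈ Set.Ioo 0 a, HasDerivAt (fun t => h t - ∫ s in (0:ℝ)..t, p s) (deriv h t - p t) t := fun t ht =>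
      ((cdA isOpen_Ioo sh ht 1).differentiableAt (by simp)).hasDerivAt.sub (hP t)
    obtain ⟨C0, hC0⟩ := hp 0
    have hN : (0:ℝ) < ((N + 1 : ℕ) : ℝ) - 1 / 2 := by push_cast; have : (0:ℝ) ≤ N := by positivity
                                                      linarith
    obtain ⟨c, hc⟩ := lim0 (C := C0) hN hd (fun t ht => by
      have := hC0 t ht
      simp only [iteratedDeriv_zero, pow_zero, mul_one] at this
      refine this.trans_eq ?_
      congr 2; push_cast; ring)
    refine ⟨fun t => (∫ s in (0:ℝ)..t, p s) + c, sP.add contDiff_const, fun j => ?_⟩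
    rcases j with _ | j
    · refine ⟨C0 / (((N + 1 : ℕ) : ℝ) - 1 / 2), fun t ht => ?_⟩
      have := hc t ht
      simp only [iteratedDeriv_zero, pow_zero, mul_one]
      rw [← sub_sub]; exact this
    · obtain ⟨C, hC⟩ := hp j
      refine ⟨C, fun t ht => ?_⟩
      rw [ew t ht j, iteratedDeriv_succ']
      have : deriv (fun t => h t - ((∫ s in (0:ℝ)..t, p s) + c)) =ᶠ[𝓝 t] fun t => deriv h t - p t := by
        filter_upwards [isOpen_Ioo.mem_nhds ht] with s hs
        have := (hd s hs).sub_const c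
        rw [← this.deriv]; congr 1; funext u; ring
      rw [this.iteratedDeriv_eq]
      exact hC t ht

def chi (s : ℝ) : ℝ := Real.smoothTransition (2 - s)
lemma chi_smooth : ContDiff ℝ (⊤ : ℕ∞) chi :=
  (Real.smoothTransition.contDiff (n := (⊤ : ℕ∞))).comp (contDiff_const.sub contDiff_id)
lemma chi_one {s : ℝ} (h : s ≤ 1) : chi s = 1 := Real.smoothTransition.one_of_one_le (by linarith)
lemma chi_zero {s : ℝ} (h : 2 ≤ s) : chi s = 0 := Real.smoothTransition.zero_of_nonpos (by linarith)

lemma chi_bd (i : ℕ) : ∃ X, 0 ≤ X ∧ ∀ s ∈ Set.Icc (0:ℝ) 2, |iteratedDeriv i chi s| ≤ X := by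
  obtain ⟨X, hX⟩ := isCompact_Icc.exists_bound_of_continuousOn
    ((chi_smooth.continuous_iteratedDeriv i (by exact_mod_cast le_top)).continuousOn (s := Set.Icc (0:ℝ) 2))
  exact ⟨X, (norm_nonneg _).trans (hX 0 ⟨le_rfl, by norm_num⟩), fun s hs => hX s hs⟩

lemma cutoff {f : ℝ → ℝ} {a n b ε : ℝ} (ha : 0 < a) (hf : CDOn f (Set.Ioo 0 a))
    (hb : ∀ j : ℕ, ∃ C, ∀ t ∈ Set.Ioo 0 a, |iteratedDeriv j f t| ≤ C * (t ^ n * (t⁻¹) ^ j)) (hbn : b < n) (hε : 0 < ε) (J : ℕ) :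
    ∃ (δ : ℝ → ℝ) (τ : ℝ), 0 < τ ∧ τ < a ∧ (∀ t, 0 < t → t ≤ τ → δ t = f t) ∧ (∀ t, ε ≤ t → δ t = 0) ∧ Sym n δ ∧
      ∀ j ≤ J, ∀ t, 0 < t → |iteratedDeriv j δ t| ≤ ε * (t ^ b * (t⁻¹) ^ j) := by
  choose Cf hCf using hb
  choose X hX0 hX using chi_bd
  let B : ℕ → ℝ := fun j => ∑ i ∈ Finset.range (j + 1), (j.choose i : ℝ) * (2 ^ i * X i) * |Cf (j - i)|
  have hB0 : ∀ j, 0 ≤ B j := fun j => Finset.sum_nonneg fun i _ => by have := hX0 i; positivity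
  let BS : ℝ := ∑ j ∈ Finset.range (J + 1), B j
  have hBS : ∀ j ≤ J, B j ≤ BS := fun j hj =>
    Finset.single_le_sum (f := B) (fun i _ => hB0 i) (Finset.mem_range.2 (by omega))
  have hBS0 : 0 ≤ BS := Finset.sum_nonneg fun i _ => hB0 i
  have hlim : Tendsto (fun τ : ℝ => BS * (2 * τ) ^ (n - b)) (𝓝[>] 0) (𝓝 (BS * 0)) := by
    refine Tendsto.const_mul _ ?_
    have h1 : Continuous fun τ : ℝ => (2 * τ) ^ (n - b) :=
      (continuous_const.mul continuous_id).rpow_const fun τ => Or.inr (by linarith)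
    have := h1.tendsto 0
    rw [mul_zero, Real.zero_rpow (by linarith)] at this
    exact this.mono_left nhdsWithin_le_nhds
  rw [mul_zero] at hlim
  obtain ⟨τ, ⟨h1, h2⟩, h3⟩ := ((((hlim.eventually (gt_mem_nhds hε)).and
    (mem_nhdsWithin_of_mem_nhds (gt_mem_nhds (show (0:ℝ) < min a ε / 2 by positivity)))).and self_mem_nhdsWithin)).exists
  have hτ : 0 < τ := h3
  have hτa : 2 * τ < a := by have := min_le_left a ε; linarith
  have hτε : 2 * τ < ε := by have := min_le_right a ε; linarith
  let δ : ℝ → ℝ := fun t => if t < a then chi (t / τ) * f t else 0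
  have e1 : ∀ t, 2 * τ ≤ t → δ t = 0 := fun t ht => by
    simp only [δ]; split_ifs
    · rw [chi_zero (by rw [le_div_iff₀ hτ]; exact ht), zero_mul]
    · rfl
  have z1 : ∀ t, 2 * τ < t → ∀ᶠ s in 𝓝 t, δ s = 0 := fun t ht => by
    filter_upwards [lt_mem_nhds ht] with s hs using e1 s hs.le
  have z2 : ∀ t, t < a → ∀ᶠ s in 𝓝 t, δ s = chi (s / τ) * f s := fun t ht => by
    filter_upwards [gt_mem_nhds ht] with s hs
    simp only [δ, if_pos hs]
  have sc : ContDiff ℝ (⊤ : ℕ∞) (fun t : ℝ => chi (t / τ)) := chi_smooth.comp (contDiff_id.div_const τ)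
  have sδ : CDOn δ (Set.Ioi 0) := by
    intro t ht
    refine ContDiffAt.contDiffWithinAt ?_
    rcases lt_or_ge t a with h | h
    · exact (sc.contDiffAt.mul (hf.contDiffAt (isOpen_Ioo.mem_nhds ⟨ht, h⟩))).congr_of_eventuallyEq (z2 t h)
    · exact contDiffAt_const.congr_of_eventuallyEq (z1 t (by linarith))
  have hiter : ∀ i t, iteratedDeriv i (fun t : ℝ => chi (t / τ)) t = (τ⁻¹) ^ i * iteratedDeriv i chi (t / τ) := by
    intro i t
    have := iteratedDeriv_comp_const_mul (n := i) (f := chi) (h := chi_smooth.of_le (by exact_mod_cast le_top)) τ⁻¹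
    have e : (fun t : ℝ => chi (t / τ)) = fun t => chi (τ⁻¹ * t) := by funext t; rw [div_eq_inv_mul]
    rw [e, this, div_eq_inv_mul]
  have bd : ∀ j t, 0 < t → |iteratedDeriv j δ t| ≤ B j * (t ^ n * (t⁻¹) ^ j) := by
    intro j t ht
    have htn := rpow_pos_of_pos ht n
    rcases lt_or_ge (2 * τ) t with h | h
    · rw [EventuallyEq.iteratedDeriv_eq j (show δ =ᶠ[𝓝 t] fun _ => 0 from z1 t h)]
      have := hB0 j
      simp; positivity
    · have hta : t < a := by linarith
      rw [EventuallyEq.iteratedDeriv_eq j (show δ =ᶠ[𝓝 t] (fun s => chi (s / τ)) * f from z2 t hta),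
        iteratedDeriv_mul (sc.contDiffAt.of_le (by exact_mod_cast le_top)) (cdA isOpen_Ioo hf ⟨ht, hta⟩ j)]
      rw [Finset.sum_mul]
      refine (Finset.abs_sum_le_sum_abs _ _).trans (Finset.sum_le_sum fun i hi => ?_)
      have hij : i ≤ j := Nat.lt_succ_iff.1 (Finset.mem_range.1 hi)
      rw [abs_mul, abs_mul, hiter, abs_mul, abs_of_nonneg (by positivity : (0:ℝ) ≤ (j.choose i : ℝ)),
        abs_of_nonneg (by positivity : 0 ≤ (τ⁻¹) ^ i)]
      have b1 := hX i (t / τ) ⟨by positivity, by rw [div_le_iff₀ hτ]; linarith⟩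
      have b2 := hCf (j - i) t ⟨ht, hta⟩
      have b3 : Cf (j - i) * (t ^ n * (t⁻¹) ^ (j - i)) ≤ |Cf (j - i)| * (t ^ n * (t⁻¹) ^ (j - i)) :=
        mul_le_mul_of_nonneg_right (le_abs_self _) (by positivity)
      have b4 : (τ⁻¹) ^ i ≤ 2 ^ i * (t⁻¹) ^ i := by
        rw [← mul_pow]
        refine pow_le_pow_left₀ (by positivity) ?_ i
        rw [← div_eq_mul_inv, inv_eq_one_div, div_le_div_iff₀ hτ ht]; linarith
      have b5 : (t⁻¹) ^ j = (t⁻¹) ^ i * (t⁻¹) ^ (j - i) := by rw [← pow_add]; congr 1; omega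
      have hx := hX0 i
      calc (j.choose i : ℝ) * ((τ⁻¹) ^ i * |iteratedDeriv i chi (t / τ)|) * |iteratedDeriv (j - i) f t|
          ≤ (j.choose i : ℝ) * ((2 ^ i * (t⁻¹) ^ i) * X i) * (|Cf (j - i)| * (t ^ n * (t⁻¹) ^ (j - i))) := by
            gcongr; exact b2.trans b3
        _ = _ := by rw [b5]; ring
  refine ⟨δ, τ, hτ, by linarith, fun t h0 h1 => ?_, fun t ht => e1 t (by linarith), ⟨sδ, fun j => ⟨B j, fun t h0 _ => ?_⟩⟩,
    fun j hj t ht => ?_⟩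
  · simp only [δ, if_pos (by linarith : t < a)]
    rw [chi_one (by rw [div_le_iff₀ hτ]; linarith), one_mul]
  · rw [rpw h0]; exact bd j t h0
  · rcases lt_or_ge (2 * τ) t with h | h
    · rw [EventuallyEq.iteratedDeriv_eq j (show δ =ᶠ[𝓝 t] fun _ => 0 from z1 t h)]
      simp; positivity
    · have c1 : t ^ n = t ^ (n - b) * t ^ b := by rw [← rpow_add ht]; congr 1; ring
      have c2 : t ^ (n - b) ≤ (2 * τ) ^ (n - b) := rpow_le_rpow ht.le h (by linarith)
      have c3 : 0 ≤ t ^ b * (t⁻¹) ^ j := by positivity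
      calc _ ≤ B j * (t ^ n * (t⁻¹) ^ j) := bd j t ht
        _ ≤ BS * (t ^ n * (t⁻¹) ^ j) := mul_le_mul_of_nonneg_right (hBS j hj) (by positivity)
        _ = (BS * t ^ (n - b)) * (t ^ b * (t⁻¹) ^ j) := by rw [c1]; ring
        _ ≤ ε * (t ^ b * (t⁻¹) ^ j) := mul_le_mul_of_nonneg_right
            ((mul_le_mul_of_nonneg_left c2 hBS0).trans h1.le) c3

lemma half_sum (k K : ℕ) : ∑ i ∈ Finset.Ico k K, (1 / 2 : ℝ) ^ i ≤ 2 := by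
  calc _ ≤ ∑ i ∈ Finset.range K, (1 / 2 : ℝ) ^ i :=
        Finset.sum_le_sum_of_subset_of_nonneg (fun i hi => by simp at hi ⊢; exact hi.2) (fun _ _ _ => by positivity)
    _ ≤ _ := sum_geometric_two_le K

lemma as_sum {E : ℕ → ℝ → ℝ} {b ε : ℝ} (hε : 0 ≤ ε) (h0 : ∀ (i : ℕ) t, 1 / ((i : ℝ) + 1) ≤ t → E i t = 0)
    (hb : ∀ i, ∀ j ≤ i + 2, ∀ t, 0 < t → |iteratedDeriv j (E i) t| ≤ ε * (1 / 2) ^ i * (t ^ (b + i) * (t⁻¹) ^ j))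
    (hS : ∀ i : ℕ, Sym (b + i) (E i)) :
    ∃ F : ℝ → ℝ, (∀ k : ℕ, Sym (b + k) (fun t => F t - ∑ i ∈ Finset.range k, E i t)) ∧
      ∀ b' ≤ b, ∀ j ≤ 2, ∀ t, 0 < t → |iteratedDeriv j F t| ≤ 2 * ε * (t ^ b' * (t⁻¹) ^ j) := by
  let F : ℝ → ℝ := fun t => ∑ i ∈ Finset.range ⌈1 / t⌉₊, E i t
  have hF : ∀ K : ℕ, ∀ t : ℝ, 0 < t → 1 / t < K → F t = ∑ i ∈ Finset.range K, E i t := by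
    intro K t ht hK
    refine Finset.sum_subset (fun i hi => ?_) (fun i _ hi => ?_)
    · simp only [Finset.mem_range] at hi ⊢; exact hi.trans_le (Nat.ceil_le.2 hK.le)
    · simp only [Finset.mem_range, not_lt] at hi
      apply h0
      have h1 : 1 / t ≤ i := (Nat.le_ceil _).trans (by exact_mod_cast hi)
      rw [div_le_iff₀ ht] at h1
      rw [div_le_iff₀ (by positivity)]; nlinarith
  have sE : ∀ i t, 0 < t → ∀ j : ℕ, ContDiffAt ℝ j (E i) t := fun i t ht j => cdA isOpen_Ioi (hS i).smooth ht j
  have nb : ∀ k K : ℕ, k ≤ K → ∀ t : ℝ, 0 < t → 1 / t < K → (fun t : ℝ => F t - ∑ i ∈ Finset.range k, E i t) =ᶠ[𝓝 t]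
      fun t : ℝ => ∑ i ∈ Finset.Ico k K, E i t := by
    intro k K hk t ht hK
    have h1 : ∀ᶠ s in 𝓝 t, 0 < s := lt_mem_nhds ht
    have h2 : ∀ᶠ s : ℝ in 𝓝 t, 1 / s < K :=
      ((continuousAt_const.div continuousAt_id ht.ne').eventually (gt_mem_nhds hK))
    filter_upwards [h1, h2] with s hs hs'
    rw [hF K s hs hs', Finset.sum_Ico_eq_sub _ hk]
  have it : ∀ k K : ℕ, k ≤ K → ∀ t : ℝ, 0 < t → 1 / t < K → ∀ j, iteratedDeriv j (fun t => F t - ∑ i ∈ Finset.range k, E i t) t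
      = ∑ i ∈ Finset.Ico k K, iteratedDeriv j (E i) t := by
    intro k K hk t ht hK j
    rw [(nb k K hk t ht hK).iteratedDeriv_eq, iteratedDeriv_fun_sum fun i _ => sE i t ht j]
  refine ⟨F, fun k => ⟨fun t ht => ?_, fun j => ?_⟩, fun b' hb' j hj t ht => ?_⟩
  · obtain ⟨K, hK⟩ := exists_nat_gt (1 / t)
    have h := nb k (max k K) (le_max_left _ _) t ht (hK.trans_le (by exact_mod_cast le_max_right _ _))
    refine (ContDiffAt.congr_of_eventuallyEq ?_ h).contDiffWithinAt
    exact ContDiffAt.sum fun i _ => (hS i).smooth.contDiffAt (Ioi_mem_nhds ht)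
  · choose C hC using fun i => (hS i).bd j
    refine ⟨∑ i ∈ Finset.range j, |C i| + ε * 2, fun t ht ht1 => ?_⟩
    obtain ⟨K, hK⟩ := exists_nat_gt (1 / t)
    rw [it k (max k K) (le_max_left _ _) t ht (hK.trans_le (by exact_mod_cast le_max_right _ _))]
    have hp : (0:ℝ) ≤ t ^ (b + k - j) := by positivity
    calc _ ≤ ∑ i ∈ Finset.Ico k (max k K), |iteratedDeriv j (E i) t| := Finset.abs_sum_le_sum_abs _ _
      _ ≤ ∑ i ∈ Finset.Ico k (max k K), ((if i < j then |C i| else 0) + ε * (1 / 2) ^ i) * t ^ (b + k - j) := by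
          refine Finset.sum_le_sum fun i hi => ?_
          have hki : (k:ℝ) ≤ i := by exact_mod_cast (Finset.mem_Ico.1 hi).1
          have hpw : t ^ (b + i - j) ≤ t ^ (b + k - j) := rpow_le_rpow_of_exponent_ge ht ht1 (by linarith)
          have hp2 : (0:ℝ) ≤ t ^ (b + i - j) := by positivity
          split_ifs with hij
          · calc _ ≤ C i * t ^ (b + i - j) := hC i t ht ht1
              _ ≤ |C i| * t ^ (b + i - j) := mul_le_mul_of_nonneg_right (le_abs_self _) hp2
              _ ≤ (|C i| + ε * (1 / 2) ^ i) * t ^ (b + k - j) := by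
                  have : 0 ≤ ε * (1 / 2 : ℝ) ^ i := by positivity
                  gcongr; linarith
          · have := hb i j (by omega) t ht
            rw [← rpw ht] at this
            rw [zero_add]
            exact this.trans (mul_le_mul_of_nonneg_left hpw (by positivity))
      _ ≤ _ := by
          rw [← Finset.sum_mul, Finset.sum_add_distrib, ← Finset.mul_sum]
          refine mul_le_mul_of_nonneg_right (add_le_add ?_ (mul_le_mul_of_nonneg_left (half_sum _ _) hε)) hp
          rw [← Finset.sum_filter]
          refine Finset.sum_le_sum_of_subset_of_nonneg (fun i hi => ?_) (fun _ _ _ => abs_nonneg _)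
          simp only [Finset.mem_filter] at hi; simpa using hi.2
  · obtain ⟨K, hK⟩ := exists_nat_gt (1 / t)
    have h := it 0 K (Nat.zero_le _) t ht hK j
    simp only [Finset.range_zero, Finset.sum_empty, sub_zero] at h
    rw [h]
    rcases le_or_gt t 1 with h1 | h1
    · calc _ ≤ ∑ i ∈ Finset.Ico 0 K, |iteratedDeriv j (E i) t| := Finset.abs_sum_le_sum_abs _ _
        _ ≤ ∑ i ∈ Finset.Ico 0 K, ε * (1 / 2) ^ i * (t ^ b' * (t⁻¹) ^ j) := by
            refine Finset.sum_le_sum fun i _ => (hb i j (by omega) t ht).trans ?_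
            have : t ^ (b + i) ≤ t ^ b' := rpow_le_rpow_of_exponent_ge ht h1 (by linarith [Nat.cast_nonneg (α := ℝ) i])
            gcongr
        _ ≤ _ := by
            rw [← Finset.sum_mul, ← Finset.mul_sum, mul_comm 2 ε]
            have := half_sum 0 K
            gcongr
    · have hz : ∀ i, iteratedDeriv j (E i) t = 0 := fun i => by
        have : E i =ᶠ[𝓝 t] fun _ => 0 := by
          filter_upwards [lt_mem_nhds h1] with s hs
          refine h0 i s (le_trans ?_ hs.le)
          rw [div_le_one (by positivity)]; simp
        rw [this.iteratedDeriv_eq]; simp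
      simp only [hz, Finset.sum_const_zero, abs_zero]; positivity

lemma adm_of_small {m : ℕ} {D : ℝ → ℝ} (hD : CDOn D (Set.Ioi 0))
    (hb : ∀ j ≤ 2, ∀ t, 0 < t → |iteratedDeriv j D t| ≤ 1 / 4 * (t ^ (m:ℝ) * (t⁻¹) ^ j)) : Adm m (fun t => t ^ m + D t) := by
  have hp := adm_pow m
  have e1 : ∀ t, 0 < t → deriv (fun t => t ^ m + D t) t = deriv (fun t => t ^ m) t + deriv D t := fun t ht =>
    deriv_fun_add (by fun_prop) ((cdA isOpen_Ioi hD ht 1).differentiableAt (by simp))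
  have e2 : ∀ t, 0 < t → deriv (deriv (fun t => t ^ m + D t)) t = deriv (deriv (fun t : ℝ => t ^ m)) t + deriv (deriv D) t := by
    intro t ht
    have : deriv (fun t => t ^ m + D t) =ᶠ[𝓝 t] fun t => deriv (fun t => t ^ m) t + deriv D t := by
      filter_upwards [lt_mem_nhds ht] with s hs using e1 s hs
    rw [this.deriv_eq]
    have h2 := iter_smooth isOpen_Ioi hD 1
    have h3 := iter_smooth isOpen_Ioi hp.smooth 1
    rw [iteratedDeriv_one] at h2 h3
    exact deriv_fun_add ((cdA isOpen_Ioi h3 ht 1).differentiableAt (by simp)) ((cdA isOpen_Ioi h2 ht 1).differentiableAt (by simp))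
  have pw : ∀ t : ℝ, deriv (fun t => t ^ m) t = m * t ^ (m - 1) := fun t => by simp
  have b0 := fun t ht => hb 0 (by norm_num) t ht
  have b1 := fun t ht => hb 1 (by norm_num) t ht
  have b2 := fun t ht => hb 2 (by norm_num) t ht
  simp only [iteratedDeriv_zero, pow_zero, mul_one, rpow_natCast, iteratedDeriv_one, pow_one] at b0 b1
  simp only [rpow_natCast, iteratedDeriv_succ, iteratedDeriv_zero] at b2
  refine ⟨hp.smooth.add hD, fun t ht => ?_, fun t ht => ?_, fun t ht => ?_⟩
  · simp only [add_sub_cancel_left]; linarith [b0 t ht]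
  · rw [e1 t ht]
    have h1 : t * |deriv (fun t : ℝ => t ^ m) t| ≤ m * t ^ m := by
      rw [pw, abs_of_nonneg (by positivity)]
      rcases m with _ | m
      · simp
      · simp only [Nat.add_sub_cancel, pow_succ]; apply le_of_eq; ring
    have h2 : t * |deriv D t| ≤ 1 / 4 * t ^ m := by
      calc _ ≤ t * (1 / 4 * (t ^ m * t⁻¹)) := mul_le_mul_of_nonneg_left (b1 t ht) ht.le
        _ = _ := by field_simp
    calc _ ≤ t * (|deriv (fun t : ℝ => t ^ m) t| + |deriv D t|) := mul_le_mul_of_nonneg_left (abs_add_le _ _) ht.le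
      _ ≤ _ := by rw [mul_add]; nlinarith [pow_pos ht m]
  · rw [e2 t ht]
    have h1 : t ^ 2 * |deriv (deriv (fun t : ℝ => t ^ m)) t| ≤ (m:ℝ) ^ 2 * t ^ m := by
      rw [show deriv (fun t : ℝ => t ^ m) = fun t : ℝ => (m:ℝ) * t ^ (m - 1) from funext pw, deriv_const_mul_field, deriv_pow_field,
        abs_of_nonneg (by positivity)]
      rcases m with _ | _ | m
      · simp
      · simp; positivity
      · simp only [Nat.add_sub_cancel]; push_cast
        have : (0:ℝ) < t ^ m := by positivity
        have e : t ^ (m + 1 + 1) = t ^ m * t ^ 2 := by ring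
        rw [e]
        have : 0 < t ^ 2 * t ^ m := by positivity
        have hm0 : (0:ℝ) ≤ m := by positivity
        nlinarith [mul_nonneg hm0 this.le]
    have h2 : t ^ 2 * |deriv (deriv D) t| ≤ 1 / 4 * t ^ m := by
      calc _ ≤ t ^ 2 * (1 / 4 * (t ^ m * (t⁻¹) ^ 2)) := mul_le_mul_of_nonneg_left (b2 t ht) (by positivity)
        _ = _ := by field_simp
    calc _ ≤ t ^ 2 * (|deriv (deriv (fun t : ℝ => t ^ m)) t| + |deriv (deriv D) t|) :=
          mul_le_mul_of_nonneg_left (abs_add_le _ _) (by positivity)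
      _ ≤ _ := by rw [mul_add]; nlinarith [pow_pos ht m]

lemma Sym.mono {n n' : ℝ} {f : ℝ → ℝ} (h : Sym n f) (hn : n' ≤ n) : Sym n' f where
  smooth := h.smooth
  bd j := by
    obtain ⟨C, hC⟩ := h.bd j
    refine ⟨|C|, fun t ht h1 => (hC t ht h1).trans ?_⟩
    have h2 : t ^ (n - j) ≤ t ^ (n' - j) := rpow_le_rpow_of_exponent_ge ht h1 (by linarith)
    have h3 : 0 ≤ t ^ (n - j) := by positivity
    nlinarith [le_abs_self C, abs_nonneg C]

lemma Sym.add {n : ℝ} {f g : ℝ → ℝ} (h : Sym n f) (h' : Sym n g) : Sym n (fun t => f t + g t) where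
  smooth := h.smooth.add h'.smooth
  bd j := by
    obtain ⟨C, hC⟩ := h.bd j
    obtain ⟨C', hC'⟩ := h'.bd j
    refine ⟨C + C', fun t ht h1 => ?_⟩
    rw [iteratedDeriv_fun_add (cdA isOpen_Ioi h.smooth ht j) (cdA isOpen_Ioi h'.smooth ht j), add_mul]
    exact (abs_add_le _ _).trans (add_le_add (hC t ht h1) (hC' t ht h1))

lemma Qn.mono {P n n' : ℝ} {f : ℝ → ℝ} (hP : P ≤ 1) (h : Qn P n f) (hn : n' ≤ n) : Qn P n' f := fun j => by
  obtain ⟨C, hC⟩ := h j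
  refine ⟨|C|, fun q h0 h1 => (hC q h0 h1).trans ?_⟩
  have h2 : q ^ n ≤ q ^ n' := rpow_le_rpow_of_exponent_ge h0 (by linarith) hn
  have h3 : q ^ n * (q⁻¹) ^ j ≤ q ^ n' * (q⁻¹) ^ j := by gcongr
  have h4 : 0 ≤ q ^ n * (q⁻¹) ^ j := by positivity
  nlinarith [le_abs_self C, abs_nonneg C]

lemma Qn.add {P n a : ℝ} (ha : P < 2 * a) {f g : ℝ → ℝ} (h : Qn P n f) (h' : Qn P n g) (sf : CDOn f (Set.Ioo 0 a))
    (sg : CDOn g (Set.Ioo 0 a)) : Qn P n (fun t => f t + g t) := fun j => by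
  obtain ⟨C, hC⟩ := h j
  obtain ⟨C', hC'⟩ := h' j
  refine ⟨C + C', fun t ht h1 => ?_⟩
  have hm : t ∈ Set.Ioo 0 a := ⟨ht, by linarith⟩
  rw [iteratedDeriv_fun_add (cdA isOpen_Ioo sf hm j) (cdA isOpen_Ioo sg hm j), add_mul]
  exact (abs_add_le _ _).trans (add_le_add (hC t ht h1) (hC' t ht h1))

lemma Qn_half {P n : ℝ} (hP : P ≤ 1) {δ : ℝ → ℝ} (h : Sym n δ) : Qn P n (fun t => 1 / 2 * δ t) := fun j => by
  obtain ⟨C, hC⟩ := h.bd j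
  refine ⟨|C|, fun q h0 h1 => ?_⟩
  rw [iteratedDeriv_const_mul_field, abs_mul, abs_of_pos (by norm_num : (0:ℝ) < 1 / 2)]
  have := hC q h0 (by linarith)
  rw [rpw h0] at this
  have h4 : 0 ≤ q ^ n * (q⁻¹) ^ j := by positivity
  nlinarith [le_abs_self C, abs_nonneg C]

lemma Qn_of_smooth {P n a τ : ℝ} (ha : P < 2 * a) (hτ : 0 < τ) {f p : ℝ → ℝ} (sf : CDOn f (Set.Ioo 0 a))
    (sp : ContDiff ℝ (⊤ : ℕ∞) p) (hfp : ∀ t, 0 < t → t ≤ τ → f t = p t) : Qn P n f := fun j => by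
  have c1 : ContinuousOn (iteratedDeriv j f) (Set.Ioc 0 (P / 2)) :=
    (iter_smooth isOpen_Ioo sf j).continuousOn.mono fun t ht => ⟨ht.1, by linarith [ht.2]⟩
  obtain ⟨X, hX⟩ := isCompact_Icc.exists_bound_of_continuousOn
    ((sp.continuous_iteratedDeriv j (by exact_mod_cast le_top)).continuousOn (s := Set.Icc 0 τ))
  obtain ⟨C, hC⟩ := ext_bd (a := 0) (C := X) c1 hτ (fun s h0 h1 => by
    have : f =ᶠ[𝓝 s] p := by
      filter_upwards [Ioo_mem_nhds h0 h1] with u hu using hfp u hu.1 hu.2.le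
    rw [this.iteratedDeriv_eq, rpow_zero, mul_one]
    exact hX s ⟨h0.le, h1.le⟩)
  refine ⟨C, fun q h0 h1 => ?_⟩
  have h2 := hC q h0 (by linarith)
  rw [rpow_zero, mul_one] at h2
  have h4 : 0 ≤ q ^ n * (q⁻¹) ^ j := by positivity
  have := (abs_nonneg _).trans h2
  nlinarith

lemma hF_smooth {m : ℕ} (hm : 1 ≤ m) {μ : ℝ → ℝ} {z : ℝ → ℝ → ℝ} (hA : Adm m μ) (hμ : Sym m μ) (hz : IsSol m μ z) :
    CDOn (hF m μ z) (Set.Ioo 0 (TT m)) :=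
  (PS_smooth hm hA hμ hz).comp (f := fun q : ℝ => (P0 m, q)) (by fun_prop) fun q hq => ⟨⟨P0_pos m, P0_lt m⟩, hq⟩

structure Inv (m k : ℕ) (D : ℝ → ℝ) : Prop where
  sym : Sym m D
  bd : ∀ j ≤ 2, ∀ t, 0 < t → |iteratedDeriv j D t| ≤ 1 / 4 * (1 - (1 / 2) ^ k) * (t ^ (m:ℝ) * (t⁻¹) ^ j)
  Q : ∀ z, IsSol m (fun t => t ^ m + D t) z → Qn (P0 m) (m + 1 / 2 + k) (hF m (fun t => t ^ m + D t) z)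

lemma Inv.adm {m k : ℕ} {D : ℝ → ℝ} (h : Inv m k D) : Adm m (fun t => t ^ m + D t) :=
  adm_of_small h.sym.smooth fun j hj t ht => (h.bd j hj t ht).trans <| by
    have : (0:ℝ) ≤ (1 / 2) ^ k := by positivity
    gcongr; linarith

lemma inv_step {m : ℕ} (hm : 1 ≤ m) (k : ℕ) {D : ℝ → ℝ} (h : Inv m k D) : ∃ δ : ℝ → ℝ,
    (∀ t, 1 / ((k:ℝ) + 1) ≤ t → δ t = 0) ∧
    (∀ j ≤ k + 2, ∀ t, 0 < t → |iteratedDeriv j δ t| ≤ 1 / 8 * (1 / 2) ^ k * (t ^ ((m:ℝ) + 1 / 4 + k) * (t⁻¹) ^ j)) ∧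
    Sym ((m:ℝ) + 1 / 4 + k) δ ∧ Inv m (k + 1) (fun t => D t + δ t) := by
  have hP := P0_pos m
  have hPl := P0_lt m
  have hP1 := P0_le m
  have hTT := TT_pos m
  obtain ⟨z, hz⟩ := exists_sol h.adm hm
  have sμ : Sym m (fun t => t ^ m + D t) := (sym_pow m).add h.sym
  have sh := hF_smooth hm h.adm sμ hz
  have hQ := h.Q z hz
  obtain ⟨p, sp, hp⟩ := decomp (a := P0 m / 2) (by linarith) (m + 1 + k) (hF m (fun t => t ^ m + D t) z)
    (sh.mono fun t ht => ⟨ht.1, by linarith [ht.2]⟩) (fun j => by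
      obtain ⟨C, hC⟩ := hQ j
      refine ⟨C, fun t ht => ?_⟩
      rw [show ((m + 1 + k : ℕ) : ℝ) - 1 / 2 = m + 1 / 2 + k by push_cast; ring]
      exact hC t ht.1 (by linarith [ht.2]))
  rw [show ((m + 1 + k : ℕ) : ℝ) - 1 / 2 = m + 1 / 2 + k by push_cast; ring] at hp
  have se : CDOn (fun t => hF m (fun t => t ^ m + D t) z t - p t) (Set.Ioo 0 (P0 m / 2)) :=
    (sh.mono fun t ht => ⟨ht.1, by linarith [ht.2]⟩).sub sp.contDiffOn
  have hε : (0:ℝ) < min (1 / ((k:ℝ) + 1)) (1 / 8 * (1 / 2) ^ k) := lt_min (by positivity) (by positivity)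
  obtain ⟨δ, τ, hτ, hτa, hδe, hδ0, hδS, hδb⟩ := cutoff (a := P0 m / 2) (n := m + 1 / 2 + k) (b := (m:ℝ) + 1 / 4 + k) (by linarith)
    (f := fun t => (-2) * (hF m (fun t => t ^ m + D t) z t - p t)) (contDiffOn_const.mul se)
    (fun j => by
      obtain ⟨C, hC⟩ := hp j
      refine ⟨2 * C, fun t ht => ?_⟩
      rw [iteratedDeriv_const_mul_field, abs_mul]
      norm_num
      rw [mul_assoc]
      have := hC t ht
      norm_num at this ⊢
      exact this) (by linarith) hε (k + 2)
  have hδb' : ∀ j ≤ k + 2, ∀ t, 0 < t → |iteratedDeriv j δ t| ≤ 1 / 8 * (1 / 2) ^ k * (t ^ ((m:ℝ) + 1 / 4 + k) * (t⁻¹) ^ j) :=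
    fun j hj t ht => (hδb j hj t ht).trans <| by
      gcongr; exact min_le_right _ _
  have hδ0' : ∀ t, 1 / ((k:ℝ) + 1) ≤ t → δ t = 0 := fun t ht => hδ0 t ((min_le_left _ _).trans ht)
  have hk0 : (0:ℝ) ≤ k := by positivity
  have hS' : Sym m (fun t => D t + δ t) := h.sym.add (hδS.mono (by linarith))
  have hbd : ∀ j ≤ 2, ∀ t, 0 < t → |iteratedDeriv j (fun t => D t + δ t) t| ≤
      1 / 4 * (1 - (1 / 2) ^ (k + 1)) * (t ^ (m:ℝ) * (t⁻¹) ^ j) := by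
    intro j hj t ht
    rw [iteratedDeriv_fun_add (cdA isOpen_Ioi h.sym.smooth ht j) (cdA isOpen_Ioi hδS.smooth ht j)]
    have h2 : |iteratedDeriv j δ t| ≤ 1 / 8 * (1 / 2) ^ k * (t ^ (m:ℝ) * (t⁻¹) ^ j) := by
      rcases le_or_gt t 1 with h1 | h1
      · refine (hδb' j (by omega) t ht).trans ?_
        have : t ^ ((m:ℝ) + 1 / 4 + k) ≤ t ^ (m:ℝ) := rpow_le_rpow_of_exponent_ge ht h1 (by linarith)
        gcongr
      · have : δ =ᶠ[𝓝 t] fun _ => 0 := by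
          filter_upwards [lt_mem_nhds h1] with s hs
          refine hδ0' s (le_trans ?_ hs.le)
          rw [div_le_one (by positivity)]; simp
        rw [this.iteratedDeriv_eq, iteratedDeriv_fun_const_zero, abs_zero]; positivity
    refine (abs_add_le _ _).trans ((add_le_add (h.bd j hj t ht) h2).trans_eq ?_)
    rw [pow_succ]; ring
  refine ⟨δ, hδ0', hδb', hδS.mono (by linarith), hS', hbd, fun z' hz' => ?_⟩
  have hfe : (fun t => t ^ m + (D t + δ t)) = fun t => (t ^ m + D t) + δ t := by funext t; ring
  have hA' : Adm m (fun t => t ^ m + (D t + δ t)) := adm_of_small hS'.smooth fun j hj t ht => (hbd j hj t ht).trans <| by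
    have : (0:ℝ) ≤ (1 / 2) ^ (k + 1) := by positivity
    gcongr; linarith
  have sμ' : Sym m (fun t => t ^ m + (D t + δ t)) := (sym_pow m).add hS'
  rw [hfe] at hz' hA' sμ' ⊢
  have sh' := hF_smooth hm hA' sμ' hz'
  have ks := key_step hm (n := m + 1 / 2 + k) (by linarith) h.adm sμ hA' sμ' hδS hz hz' hQ
  have sδ : CDOn (fun t => 1 / 2 * δ t) (Set.Ioo 0 (TT m)) :=
    contDiffOn_const.mul (hδS.smooth.mono fun t ht => ht.1)
  have q2 : Qn (P0 m) (m + 1 / 2 + k + 1) (fun q => hF m (fun t => t ^ m + D t) z q + 1 / 2 * δ q) :=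
    Qn_of_smooth (a := TT m) (by linarith) hτ (sh.add sδ) sp fun t h0 h1 => by rw [hδe t h0 h1]; ring
  have := Qn.add (a := TT m) (by linarith) ks q2 ((sh'.sub sh).sub sδ) (sh.add sδ)
  rw [show (m:ℝ) + 1 / 2 + ((k + 1 : ℕ) : ℝ) = m + 1 / 2 + k + 1 by push_cast; ring]
  convert this using 2
  ring

theorem exists_mu {m : ℕ} (hm : 1 ≤ m) : ∃ μ : ℝ → ℝ, Adm m μ ∧ Sym m μ ∧ Sym ((m:ℝ) + 1 / 4) (fun t => μ t - t ^ m) ∧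
    ∃ z, IsSol m μ z ∧ ∀ j : ℕ, ∃ C, ∀ q, 0 < q → 2 * q ≤ P0 m → |iteratedDeriv j (hF m μ z) q| ≤ C := by
  have hP := P0_pos m
  have hPl := P0_lt m
  have hP1 := P0_le m
  have hTT := TT_pos m
  have h0 : Inv m 0 (fun _ => 0) := ⟨sym_zero _, fun j _ t _ => by simp, fun z hz => by
    simp only [add_zero] at hz ⊢
    exact (key_base hm hz).mono (by linarith) (by push_cast; linarith)⟩
  choose! δ d1 d2 d3 d4 using fun (k : ℕ) (D : ℝ → ℝ) => inv_step hm k (D := D)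
  let S : ∀ k : ℕ, {D // Inv m k D} := fun k => Nat.rec ⟨fun _ => 0, h0⟩ (fun k D => ⟨fun t => D.1 t + δ k D.1 t, d4 k D.1 D.2⟩) k
  let E : ℕ → ℝ → ℝ := fun k => δ k (S k).1
  have hS : ∀ k t, (S k).1 t = ∑ i ∈ Finset.range k, E i t := by
    intro k t
    induction k with
    | zero => rfl
    | succ k ih => rw [Finset.sum_range_succ, ← ih]
  obtain ⟨F, F1, F2⟩ := as_sum (E := E) (b := (m:ℝ) + 1 / 4) (ε := 1 / 8) (by norm_num) (fun i => d1 i _ (S i).2)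
    (fun i => d2 i _ (S i).2) (fun i => d3 i _ (S i).2)
  have F0 := F1 0
  simp only [Finset.range_zero, Finset.sum_empty, sub_zero, Nat.cast_zero, add_zero] at F0
  have hA : Adm m (fun t => t ^ m + F t) := adm_of_small F0.smooth fun j hj t ht =>
    (F2 m (by linarith) j hj t ht).trans_eq (by ring)
  have sμ : Sym m (fun t => t ^ m + F t) := (sym_pow m).add (F0.mono (by linarith))
  obtain ⟨z, hz⟩ := exists_sol hA hm
  refine ⟨fun t => t ^ m + F t, hA, sμ, by simpa using F0, z, hz, fun j => ?_⟩
  have hQ : Qn (P0 m) ((m:ℝ) + 1 / 4 + j) (hF m (fun t => t ^ m + F t) z) := by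
    have hk := (S j).2
    have sk := F1 j
    simp only [← hS] at sk
    obtain ⟨zk, hzk⟩ := exists_sol hk.adm hm
    have sμk : Sym m (fun t => t ^ m + (S j).1 t) := (sym_pow m).add hk.sym
    have hfe : (fun t => t ^ m + F t) = fun t => (t ^ m + (S j).1 t) + (F t - (S j).1 t) := by funext t; ring
    rw [hfe] at hz hA sμ ⊢
    have hq := (hk.Q zk hzk).mono (n' := (m:ℝ) + 1 / 4 + j) (by linarith) (by linarith)
    have ks := key_step hm (n := (m:ℝ) + 1 / 4 + j) (by have : (0:ℝ) ≤ j := by positivity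
                                                        linarith) hk.adm sμk hA sμ sk hzk hz hq
    have ks' := ks.mono (n' := (m:ℝ) + 1 / 4 + j) (by linarith) (by linarith)
    have sh := hF_smooth hm hk.adm sμk hzk
    have sh' := hF_smooth hm hA sμ hz
    have sδ : CDOn (fun t => 1 / 2 * (F t - (S j).1 t)) (Set.Ioo 0 (TT m)) :=
      contDiffOn_const.mul (sk.smooth.mono fun t ht => ht.1)
    have a1 := Qn.add (a := TT m) (by linarith) hq (Qn_half (by linarith) sk) sh sδ
    have := Qn.add (a := TT m) (by linarith) ks' a1 ((sh'.sub sh).sub sδ) (sh.add sδ)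
    convert this using 2
    ring
  obtain ⟨C, hC⟩ := hQ j
  refine ⟨|C| * 2, fun q h0 h1 => (hC q h0 h1).trans ?_⟩
  rw [← rpw h0, show (m:ℝ) + 1 / 4 + j - j = m + 1 / 4 by ring]
  have h3 : q ^ ((m:ℝ) + 1 / 4) ≤ 1 := rpow_le_one h0.le (by linarith) (by positivity)
  have h4 : 0 ≤ q ^ ((m:ℝ) + 1 / 4) := by positivity
  nlinarith [le_abs_self C, abs_nonneg C]

lemma fam_smooth {O : Set ℝ} (hO : IsOpen O) {f : ℕ → ℝ → ℝ} (h : ∀ j, ∀ q ∈ O, HasDerivAt (f j) (f (j + 1) q) q) :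
    CDOn (f 0) O := by
  rw [contDiffOn_infty]
  intro n
  suffices H : ∀ j, ContDiffOn ℝ n (f j) O from H 0
  induction n with
  | zero => exact fun j => contDiffOn_zero.2 fun q hq => (h j q hq).continuousAt.continuousWithinAt
  | succ n ih =>
    intro j
    push_cast
    rw [contDiffOn_succ_iff_deriv_of_isOpen hO]
    exact ⟨fun q hq => (h j q hq).differentiableAt.differentiableWithinAt, by simp,
      (ih (j + 1)).congr fun q hq => (h j q hq).deriv⟩

lemma borel (a : ℕ → ℝ) : ∃ F : ℝ → ℝ, CDOn F (Set.Ioi 0) ∧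
    ∀ j, Tendsto (iteratedDeriv j F) (𝓝[>] 0) (𝓝 (a j)) := by
  have key : ∀ k : ℕ, ∃ (δ : ℝ → ℝ) (τ : ℝ), 0 < τ ∧ τ < 1 ∧ (∀ t, 0 < t → t ≤ τ → δ t = a k / k.factorial * t ^ k) ∧
      (∀ t, min (1 / ((k:ℝ) + 1)) ((1 / 2) ^ k) ≤ t → δ t = 0) ∧ Sym k δ ∧
      ∀ j ≤ k + 2, ∀ t, 0 < t → |iteratedDeriv j δ t| ≤ min (1 / ((k:ℝ) + 1)) ((1 / 2) ^ k) * (t ^ (-(1 / 4) + (k:ℝ)) * (t⁻¹) ^ j) := by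
    intro k
    refine cutoff one_pos (by fun_prop) (fun j => ?_) (by linarith) (lt_min (by positivity) (by positivity)) (k + 2)
    obtain ⟨C, hC⟩ := (sym_pow k).bd j
    refine ⟨|a k / k.factorial| * C, fun t ht => ?_⟩
    rw [iteratedDeriv_const_mul_field, abs_mul, ← rpw ht.1, mul_assoc]
    exact mul_le_mul_of_nonneg_left (hC t ht.1 ht.2.le) (abs_nonneg _)
  choose E τ hτ _ hE1 hE2 hE3 hE4 using key
  obtain ⟨F, F1, -⟩ := as_sum (E := E) (b := -(1 / 4)) (ε := 1) zero_le_one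
    (fun i t ht => hE2 i t ((min_le_left _ _).trans ht))
    (fun i j hj t ht => (hE4 i j hj t ht).trans (by rw [one_mul]; gcongr; exact min_le_right _ _))
    (fun i => (hE3 i).mono (by linarith))
  have F0 := (F1 0).smooth
  simp only [Finset.range_zero, Finset.sum_empty, sub_zero] at F0
  refine ⟨F, F0, fun j => ?_⟩
  obtain ⟨C, hC⟩ := (F1 (j + 1)).bd j
  have hsum : ∀ᶠ t in 𝓝[>] (0:ℝ), ∑ i ∈ Finset.range (j + 1), iteratedDeriv j (E i) t = a j := by
    have : ∀ᶠ t in 𝓝[>] (0:ℝ), ∀ i ∈ Finset.range (j + 1), t < τ i := by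
      rw [Filter.eventually_all_finset]
      exact fun i _ => nhdsWithin_le_nhds (gt_mem_nhds (hτ i))
    filter_upwards [this, self_mem_nhdsWithin] with t ht h0
    have e : ∀ i ∈ Finset.range (j + 1), iteratedDeriv j (E i) t = if i = j then a j else 0 := by
      intro i hi
      have : E i =ᶠ[𝓝 t] fun t => a i / i.factorial * t ^ i := by
        filter_upwards [Ioo_mem_nhds h0 (ht i hi)] with s hs using hE1 i s hs.1 hs.2.le
      rw [this.iteratedDeriv_eq, iteratedDeriv_const_mul_field, iteratedDeriv_pow]
      split_ifs with hij
      · subst hij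
        rw [Nat.descFactorial_self, Nat.sub_self, pow_zero, mul_one]
        field_simp
      · have : i < j := by simp at hi; omega
        rw [Nat.descFactorial_of_lt this]; simp
    rw [Finset.sum_congr rfl e]; simp
  have h2 : Tendsto (fun t => iteratedDeriv j F t - a j) (𝓝[>] 0) (𝓝 0) := by
    have h3 : Tendsto (fun t : ℝ => C * t ^ (3 / 4 : ℝ)) (𝓝[>] 0) (𝓝 0) := by
      have : ContinuousAt (fun t : ℝ => C * t ^ (3 / 4 : ℝ)) 0 :=
        continuousAt_const.mul (Real.continuousAt_rpow_const _ _ (Or.inr (by norm_num)))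
      have := this.tendsto.mono_left (nhdsWithin_le_nhds (s := Set.Ioi 0))
      simpa using this
    refine squeeze_zero_norm' ?_ h3
    filter_upwards [hsum, self_mem_nhdsWithin, nhdsWithin_le_nhds (gt_mem_nhds one_pos)] with t ht h0 h1
    have h0' : (0:ℝ) < t := h0
    have := hC t h0 h1.le
    rw [iteratedDeriv_fun_sub (cdA isOpen_Ioi F0 h0 j)
      (ContDiffAt.sum fun i _ => cdA isOpen_Ioi (hE3 i).smooth h0 j),
      iteratedDeriv_fun_sum fun i _ => cdA isOpen_Ioi (hE3 i).smooth h0 j, ht] at this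
    rw [Real.norm_eq_abs]
    refine this.trans_eq ?_
    congr 2; push_cast; ring
  simpa using h2.add_const (a j)

lemma hasDeriv_ne {f g : ℝ → ℝ} {x a b : ℝ} (ha : a < x) (hb : x < b)
    (fd : ∀ y ∈ Set.Ioo a b, y ≠ x → HasDerivAt f (g y) y) (hf : ContinuousAt f x)
    (hg : ContinuousAt g x) : HasDerivAt f (g x) x := by
  have A : HasDerivWithinAt f (g x) (Set.Ici x) x := by
    refine hasDerivWithinAt_Ici_of_tendsto_deriv (s := Set.Ioo x b) (fun y hy =>
      (fd y ⟨ha.trans hy.1, hy.2⟩ hy.1.ne').differentiableAt.differentiableWithinAt)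
      hf.continuousWithinAt (Ioo_mem_nhdsGT hb) ?_
    refine Tendsto.congr' ?_ (tendsto_inf_left hg)
    filter_upwards [Ioo_mem_nhdsGT hb] with y hy using (fd y ⟨ha.trans hy.1, hy.2⟩ hy.1.ne').deriv.symm
  have B : HasDerivWithinAt f (g x) (Set.Iic x) x := by
    refine hasDerivWithinAt_Iic_of_tendsto_deriv (s := Set.Ioo a x) (fun y hy =>
      (fd y ⟨hy.1, hy.2.trans hb⟩ hy.2.ne).differentiableAt.differentiableWithinAt)
      hf.continuousWithinAt (Ioo_mem_nhdsLT ha) ?_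
    refine Tendsto.congr' ?_ (tendsto_inf_left hg)
    filter_upwards [Ioo_mem_nhdsLT ha] with y hy using (fd y ⟨hy.1, hy.2.trans hb⟩ hy.2.ne).deriv.symm
  simpa using B.union A

theorem extend {h : ℝ → ℝ} {A T : ℝ} (hA : 0 < A) (hAT : A ≤ T) (sh : CDOn h (Set.Ioo 0 T))
    (hb : ∀ j : ℕ, ∃ C, ∀ q ∈ Set.Ioo 0 A, |iteratedDeriv j h q| ≤ C) :
    ∃ H : ℝ → ℝ, CDOn H (Set.Iio T) ∧ ∀ q ∈ Set.Ioo 0 T, H q = h q := by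
  have lim : ∀ j : ℕ, ∃ c, Tendsto (iteratedDeriv j h) (𝓝[>] 0) (𝓝 c) := by
    intro j
    obtain ⟨C, hC⟩ := hb (j + 1)
    obtain ⟨c, hc⟩ := lim0 (g := iteratedDeriv j h) (C := C) (s := 1) one_pos
      (fun t ht => iter_hasDeriv isOpen_Ioo sh j ⟨ht.1, ht.2.trans_le hAT⟩) (fun t ht => by simpa using hC t ht)
    refine ⟨c, ?_⟩
    have h3 : Tendsto (fun t : ℝ => C * t) (𝓝[>] 0) (𝓝 0) := by
      have : Tendsto (fun t : ℝ => C * t) (𝓝 0) (𝓝 (C * 0)) := (continuous_const.mul continuous_id).tendsto 0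
      rw [mul_zero] at this
      exact this.mono_left nhdsWithin_le_nhds
    have h4 : Tendsto (fun t => iteratedDeriv j h t - c) (𝓝[>] 0) (𝓝 0) := by
      refine squeeze_zero_norm' ?_ h3
      filter_upwards [Ioo_mem_nhdsGT hA] with t ht
      simpa using hc t ht
    simpa using h4.add_const c
  choose a ha using lim
  obtain ⟨F, sF, hF⟩ := borel fun j => (-1) ^ j * a j
  let f : ℕ → ℝ → ℝ := fun j q => if 0 < q then iteratedDeriv j h q else if q < 0 then (-1) ^ j * iteratedDeriv j F (-q) else a j
  have fpos : ∀ j, ∀ q, 0 < q → f j q = iteratedDeriv j h q := fun j q hq => if_pos hq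
  have fneg : ∀ j, ∀ q, q < 0 → f j q = (-1) ^ j * iteratedDeriv j F (-q) := fun j q hq => by
    simp only [f, if_neg hq.not_gt, if_pos hq]
  have f0 : ∀ j, f j 0 = a j := fun j => by simp [f]
  have hd : ∀ j, ∀ q, q ≠ 0 → q < T → HasDerivAt (f j) (f (j + 1) q) q := by
    intro j q hq hT
    rcases lt_or_gt_of_ne hq with h0 | h0
    · have e : f j =ᶠ[𝓝 q] fun q => (-1) ^ j * iteratedDeriv j F (-q) := by
        filter_upwards [gt_mem_nhds h0] with s hs using fneg j s hs
      refine HasDerivAt.congr_of_eventuallyEq ?_ e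
      rw [fneg _ _ h0]
      have := ((iter_hasDeriv isOpen_Ioi sF j (t := -q) (by simpa using h0)).comp q (hasDerivAt_neg q)).const_mul ((-1) ^ j)
      refine HasDerivAt.congr_deriv this ?_
      rw [pow_succ]; ring
    · have e : f j =ᶠ[𝓝 q] iteratedDeriv j h := by
        filter_upwards [lt_mem_nhds h0] with s hs using fpos j s hs
      refine HasDerivAt.congr_of_eventuallyEq ?_ e
      rw [fpos _ _ h0]
      exact iter_hasDeriv isOpen_Ioo sh j ⟨h0, hT⟩
  have hc : ∀ j, ContinuousAt (f j) 0 := by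
    intro j
    rw [continuousAt_iff_punctured_nhds, ← Set.Iio_union_Ioi, nhdsWithin_union, f0]
    refine Tendsto.sup ?_ ?_
    · have h1 : Tendsto (fun q : ℝ => -q) (𝓝[<] 0) (𝓝[>] 0) := by
        have := tendsto_neg_nhdsLT (a := (0:ℝ)); simpa using this
      have h2 := ((hF j).comp h1).const_mul ((-1) ^ j)
      rw [← mul_assoc, ← mul_pow, neg_one_mul, neg_neg, one_pow, one_mul] at h2
      refine h2.congr' ?_
      filter_upwards [self_mem_nhdsWithin] with q hq using (fneg j q hq).symm
    · refine (ha j).congr' ?_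
      filter_upwards [self_mem_nhdsWithin] with q hq using (fpos j q hq).symm
  refine ⟨f 0, fam_smooth isOpen_Iio fun j q hq => ?_, fun q hq => by rw [fpos 0 q hq.1, iteratedDeriv_zero]⟩
  rcases eq_or_ne q 0 with rfl | h0
  · exact hasDeriv_ne (a := -1) (b := T) (by norm_num) (hA.trans_le hAT) (fun y hy h0 => hd j y h0 hy.2) (hc j) (hc (j + 1))
  · exact hd j q h0 hq

lemma CIc {E : Type} [NormedAddCommGroup E] [NormedSpace ℝ E] {U : Set (ℝℝ)} {O : Set ((ℝℝ) × ℝ)}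
    (h : ∀ x ∈ U, ∀ σ ∈ Set.Icc (0:ℝ) 1, (x, σ) ∈ O) {F : (ℝℝ) × ℝ → E} (hF : ContinuousOn F O) :
    ContinuousOn (fun x => ∫ σ in (0:ℝ)..1, F (x, σ)) U := by
  rw [continuousOn_iff_continuous_domRestrict]
  have hc : Continuous (fun y : U × ℝ => F (y.1.1, (Set.projIcc (0:ℝ) 1 zero_le_one y.2).1)) :=
    hF.comp_continuous (by fun_prop) fun y => h _ y.1.2 _ (Set.projIcc (0:ℝ) 1 zero_le_one y.2).2
  have := continuous_parametric_intervalIntegral_of_continuous' (μ := volume)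
    (f := fun (x : U) σ => F (x.1, (Set.projIcc (0:ℝ) 1 zero_le_one σ).1)) hc 0 1
  refine this.congr fun x => intervalIntegral.integral_congr fun σ hσ => ?_
  rw [Set.uIcc_of_le zero_le_one] at hσ
  simp only [Set.projIcc_of_mem zero_le_one hσ]

lemma CI {U : Set (ℝℝ)} (hU : IsOpen U) {O : Set ((ℝℝ) × ℝ)} (hO : IsOpen O)
    (h : ∀ x ∈ U, ∀ σ ∈ Set.Icc (0:ℝ) 1, (x, σ) ∈ O) (n : ℕ) :
    ∀ (E : Type) [NormedAddCommGroup E] [NormedSpace ℝ E], ∀ {F : (ℝℝ) × ℝ → E} (_ : ContDiffOn ℝ n F O),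
    ContDiffOn ℝ n (fun x => ∫ σ in (0:ℝ)..1, F (x, σ)) U := by
  induction n with
  | zero =>
    intro E _ _ F hF
    exact contDiffOn_zero.2 (CIc h hF.continuousOn)
  | succ n ih =>
    intro E _ _ F hF
    have h01 : Set.uIoc (0:ℝ) 1 ⊆ Set.Icc 0 1 := by
      rw [Set.uIoc_of_le zero_le_one]; exact Set.Ioc_subset_Icc_self
    have hF' : ContDiffOn ℝ n (fun y => (fderiv ℝ F y).comp (ContinuousLinearMap.inl ℝ (ℝℝ) ℝ)) O :=
      (hF.fderiv_of_isOpen hO (by norm_cast)).clm_comp contDiffOn_const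
    have sl : ∀ x ∈ U, ContinuousOn (fun σ : ℝ => F (x, σ)) (Set.Icc 0 1) := fun x hx =>
      hF.continuousOn.comp (by fun_prop) fun σ hσ => h x hx σ hσ
    have sl' : ∀ x ∈ U, ContinuousOn (fun σ : ℝ => (fderiv ℝ F (x, σ)).comp (ContinuousLinearMap.inl ℝ (ℝℝ) ℝ)) (Set.Icc 0 1) :=
      fun x hx => hF'.continuousOn.comp (f := fun σ : ℝ => (x, σ)) (by fun_prop) fun σ hσ => h x hx σ hσ
    have key : ∀ x ∈ U, HasFDerivAt (fun x => ∫ σ in (0:ℝ)..1, F (x, σ))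
        (∫ σ in (0:ℝ)..1, (fderiv ℝ F (x, σ)).comp (ContinuousLinearMap.inl ℝ (ℝℝ) ℝ)) x := by
      intro x hx
      obtain ⟨ε, hε, hb⟩ := Metric.nhds_basis_closedBall.mem_iff.1 (hU.mem_nhds hx)
      obtain ⟨C, hC⟩ := ((isCompact_closedBall x ε).prod (isCompact_Icc (a := (0:ℝ)) (b := 1))).exists_bound_of_continuousOn
        (hF'.continuousOn.mono fun y hy => h y.1 (hb hy.1) y.2 hy.2)
      refine intervalIntegral.hasFDerivAt_integral_of_dominated_of_fderiv_le (F := fun x σ => F (x, σ))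
        (F' := fun x σ => (fderiv ℝ F (x, σ)).comp (ContinuousLinearMap.inl ℝ (ℝℝ) ℝ)) (bound := fun _ => C)
        (Metric.closedBall_mem_nhds x hε) ?_ ?_ ?_ ?_ intervalIntegrable_const ?_
      · filter_upwards [hU.mem_nhds hx] with y hy
        exact ((sl y hy).mono h01).aestronglyMeasurable measurableSet_uIoc
      · exact ContinuousOn.intervalIntegrable (by rw [Set.uIcc_of_le zero_le_one]; exact sl x hx)
      · exact ((sl' x hx).mono h01).aestronglyMeasurable measurableSet_uIoc
      · exact Eventually.of_forall fun σ hσ y hy => hC (y, σ) ⟨hy, h01 hσ⟩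
      · refine Eventually.of_forall fun σ hσ y hy => ?_
        have h1 : HasFDerivAt F (fderiv ℝ F (y, σ)) (y, σ) :=
          ((hF.contDiffAt (hO.mem_nhds (h y (hb hy) σ (h01 hσ)))).differentiableAt (by simp)).hasFDerivAt
        exact h1.comp y (hasFDerivAt_prodMk_left y σ)
    push_cast
    rw [contDiffOn_succ_iff_fderiv_of_isOpen hU]
    exact ⟨fun x hx => (key x hx).differentiableAt.differentiableWithinAt, by simp,
      (ih _ hF').congr fun x hx => (key x hx).fderiv⟩

lemma PP {O : Set (ℝℝ)} (hO : IsOpen O) {f f1 f2 : ℝℝ → ℝ} {n : ℕ} (s1 : ContDiffOn ℝ n f1 O)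
    (s2 : ContDiffOn ℝ n f2 O) (h1 : ∀ x ∈ O, HasDerivAt (fun p => f (p, x.2)) (f1 x) x.1)
    (h2 : ∀ x ∈ O, HasDerivAt (fun q => f (x.1, q)) (f2 x) x.2) : ContDiffOn ℝ (n + 1 : ℕ) f O := by
  let T : ℝ →L[ℝ] (ℝ →L[ℝ] ℝ) := ContinuousLinearMap.toSpanSingletonCLE.toContinuousLinearMap
  have c1 : ∀ {g : ℝℝ → ℝ}, ContDiffOn ℝ n g O → ContDiffOn ℝ n (fun x => ContinuousLinearMap.toSpanSingleton ℝ (g x)) O :=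
    fun hg => T.contDiff.comp_contDiffOn hg
  have key : ∀ x ∈ O, HasFDerivAt f ((ContinuousLinearMap.toSpanSingleton ℝ (f1 x)).coprod (ContinuousLinearMap.toSpanSingleton ℝ (f2 x))) x := by
    intro x hx
    exact (hasStrictFDerivAt_uncurry_coprod (f := fun p q => f (p, q)) (u := x)
      (f₁ := fun p q => ContinuousLinearMap.toSpanSingleton ℝ (f1 (p, q)))
      (f₂ := fun p q => ContinuousLinearMap.toSpanSingleton ℝ (f2 (p, q)))
      (by filter_upwards [hO.mem_nhds hx] with y hy using (h1 y hy).hasFDerivAt)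
      (by filter_upwards [hO.mem_nhds hx] with y hy using (h2 y hy).hasFDerivAt)
      ((c1 s1).continuousOn.continuousAt (hO.mem_nhds hx))
      ((c1 s2).continuousOn.continuousAt (hO.mem_nhds hx))).hasFDerivAt
  push_cast
  rw [contDiffOn_succ_iff_fderiv_of_isOpen hO]
  refine ⟨fun x hx => (key x hx).differentiableAt.differentiableWithinAt, by simp, ?_⟩
  refine ContDiffOn.congr (f := fun x => (ContinuousLinearMap.toSpanSingleton ℝ (f1 x)).comp (ContinuousLinearMap.fst ℝ ℝ ℝ)
    + (ContinuousLinearMap.toSpanSingleton ℝ (f2 x)).comp (ContinuousLinearMap.snd ℝ ℝ ℝ)) ?_ fun x hx => ?_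
  · exact ((c1 s1).clm_comp contDiffOn_const).add ((c1 s2).clm_comp contDiffOn_const)
  · rw [(key x hx).fderiv]; ext <;> simp

lemma PI {a b c d a0 : ℝ} (h0 : a0 ∈ Set.Ioo a b) {F : ℝℝ → ℝ} {n : ℕ}
    (hF : ContDiffOn ℝ n F (Set.Ioo a b ×ˢ Set.Ioo c d)) :
    ContDiffOn ℝ n (fun x => ∫ s in a0..x.1, F (s, x.2)) (Set.Ioo a b ×ˢ Set.Ioo c d) := by
  have e : (fun x : ℝℝ => ∫ s in a0..x.1, F (s, x.2)) = fun x => (x.1 - a0) * ∫ σ in (0:ℝ)..1, F (a0 + (x.1 - a0) * σ, x.2) := by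
    funext x
    have := intervalIntegral.mul_integral_comp_add_mul (x.1 - a0) a0 (f := fun s => F (s, x.2)) (a := 0) (b := 1)
    rw [this]; simp
  rw [e]
  refine ContDiffOn.mul (by fun_prop) ?_
  have ho : Continuous fun y : (ℝℝ) × ℝ => (a0 + (y.1.1 - a0) * y.2, y.1.2) := by fun_prop
  refine CI (isOpen_Ioo.prod isOpen_Ioo) (O := (fun y : (ℝℝ) × ℝ => (a0 + (y.1.1 - a0) * y.2, y.1.2)) ⁻¹' (Set.Ioo a b ×ˢ Set.Ioo c d))
    ((isOpen_Ioo.prod isOpen_Ioo).preimage ho) (fun x hx σ hσ => ⟨?_, hx.2⟩) n ℝ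
    (hF.comp (f := fun y : (ℝℝ) × ℝ => (a0 + (y.1.1 - a0) * y.2, y.1.2)) (by fun_prop) fun y hy => hy)
  obtain ⟨⟨h1, h2⟩, -⟩ := hx
  have e : a0 + (x.1 - a0) * σ = (1 - σ) * a0 + σ * x.1 := by ring
  exact (convex_Ioo a b) h0 ⟨h1, h2⟩ (sub_nonneg.2 hσ.2) hσ.1 (by ring) |> fun h => by
    simpa [smul_eq_mul, ← e] using h

lemma FT {a b x0 x : ℝ} (h0 : x0 ∈ Set.Ioo a b) (hx : x ∈ Set.Ioo a b) {f : ℝ → ℝ} (hf : ContinuousOn f (Set.Ioo a b)) :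
    HasDerivAt (fun y => ∫ s in x0..y, f s) (f x) x :=
  intervalIntegral.integral_hasDerivAt_right
    (hf.mono (Set.ordConnected_Ioo.uIcc_subset h0 hx)).intervalIntegrable
    (hf.stronglyMeasurableAtFilter isOpen_Ioo x hx) (hf.continuousAt (Ioo_mem_nhds hx.1 hx.2))

lemma DI {a b c d a0 c0 : ℝ} (h0 : a0 ∈ Set.Ioo a b) (h1 : c0 ∈ Set.Ioo c d) {F : ℝℝ → ℝ} {n : ℕ}
    (hF : ContDiffOn ℝ n F (Set.Ioo a b ×ˢ Set.Ioo c d)) :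
    ContDiffOn ℝ (n + 1 : ℕ) (fun x => ∫ q in c0..x.2, ∫ s in a0..x.1, F (s, q)) (Set.Ioo a b ×ˢ Set.Ioo c d) := by
  have g2 := PI h0 hF
  have sw : ContDiffOn ℝ n (fun y : ℝℝ => F (y.2, y.1)) (Set.Ioo c d ×ˢ Set.Ioo a b) :=
    hF.comp (f := fun y : ℝℝ => (y.2, y.1)) (by fun_prop) fun y hy => ⟨hy.2, hy.1⟩
  have g1' := PI h1 sw
  have g1 : ContDiffOn ℝ n (fun x : ℝℝ => ∫ q in c0..x.2, F (x.1, q)) (Set.Ioo a b ×ˢ Set.Ioo c d) :=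
    g1'.comp (f := fun y : ℝℝ => (y.2, y.1)) (by fun_prop) fun y hy => ⟨hy.2, hy.1⟩
  refine PP (isOpen_Ioo.prod isOpen_Ioo) g1 g2 (fun x hx => ?_) fun x hx => ?_
  · refine HasDerivAt.congr_of_eventuallyEq (f := fun p => ∫ s in a0..p, ∫ q in c0..x.2, F (s, q)) ?_ ?_
    · exact FT h0 hx.1 (f := fun s => ∫ q in c0..x.2, F (s, q))
        (g1.continuousOn.comp (f := fun s : ℝ => (s, x.2)) (by fun_prop) fun s hs => ⟨hs, hx.2⟩)
    · filter_upwards [Ioo_mem_nhds hx.1.1 hx.1.2] with p hp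
      refine intervalIntegral_intervalIntegral_swap (F := fun q s => F (s, q)) ?_
      have : ContinuousOn (Function.uncurry fun q s => F (s, q)) (Set.uIcc c0 x.2 ×ˢ Set.uIcc a0 p) :=
        sw.continuousOn.mono (Set.prod_mono (Set.ordConnected_Ioo.uIcc_subset h1 hx.2) (Set.ordConnected_Ioo.uIcc_subset h0 hp))
      have h3 := this.integrableOn_compact (μ := volume) (isCompact_uIcc.prod isCompact_uIcc)
      exact h3.mono_set (Set.prod_mono Set.uIoc_subset_uIcc Set.uIoc_subset_uIcc)
  · exact FT h1 hx.2 (f := fun q => ∫ s in a0..x.1, F (s, q))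
      (g2.continuousOn.comp (f := fun q : ℝ => (x.1, q)) (by fun_prop) fun q hq => ⟨hx.1, hq⟩)

lemma goursat {P δ Λ a0 : ℝ} (hP : 0 ≤ P) (hδ : 0 ≤ δ) (ha0 : a0 ∈ Set.Icc 0 P) {G : ℝℝ → ℝ}
    (hG : ContinuousOn G (Set.Icc 0 P ×ˢ Set.Icc (-δ) 0)) {F : (ℝℝ) × ℝ → ℝ} (hF : Continuous F) (hΛ : 0 ≤ Λ)
    (hL : ∀ x y y', |F (x, y) - F (x, y')| ≤ Λ * |y - y'|) (small : δ * (P * Λ) ≤ 1 / 2) :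
    ∃ ψ : ℝℝ → ℝ, Continuous ψ ∧ ∀ p ∈ Set.Icc 0 P, ∀ q ∈ Set.Icc (-δ) 0,
      ψ (p, q) = G (p, q) + ∫ t in (0:ℝ)..q, ∫ s in a0..p, F ((s, t), ψ (s, t)) := by
  have hδ' : -δ ≤ 0 := by linarith
  let pr : ℝℝ → Set.Icc 0 P × Set.Icc (-δ) 0 := fun x => (Set.projIcc 0 P hP x.1, Set.projIcc (-δ) 0 hδ' x.2)
  have hpr : Continuous pr := by fun_prop
  let H : C(Set.Icc 0 P × Set.Icc (-δ) 0, ℝ) → ℝ → ℝ → ℝ := fun ψ t s => F ((s, t), ψ (pr (s, t)))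
  have hH : ∀ ψ, Continuous fun y : ℝℝ => H ψ y.1 y.2 := fun ψ => by
    have := ψ.continuous
    exact hF.comp (by fun_prop)
  have hI : ∀ ψ, Continuous fun y : ℝℝ => ∫ s in a0..y.1, H ψ y.2 s := fun ψ =>
    intervalIntegral.continuous_parametric_intervalIntegral_of_continuous (f := fun y : ℝℝ => H ψ y.2)
      ((hH ψ).comp (f := fun z : (ℝℝ) × ℝ => (z.1.2, z.2)) (by fun_prop)) continuous_fst
  have hJ : ∀ ψ, Continuous fun y : ℝℝ => ∫ t in (0:ℝ)..y.2, ∫ s in a0..y.1, H ψ t s := fun ψ =>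
    intervalIntegral.continuous_parametric_intervalIntegral_of_continuous (f := fun (y : ℝℝ) t => ∫ s in a0..y.1, H ψ t s)
      ((hI ψ).comp (f := fun z : (ℝℝ) × ℝ => (z.1.1, z.2)) (by fun_prop)) continuous_snd
  let T : C(Set.Icc 0 P × Set.Icc (-δ) 0, ℝ) → C(Set.Icc 0 P × Set.Icc (-δ) 0, ℝ) := fun ψ =>
    ⟨fun x => G (x.1, x.2) + ∫ t in (0:ℝ)..x.2, ∫ s in a0..x.1, H ψ t s, by
      refine Continuous.add ?_ ((hJ ψ).comp (f := fun x : Set.Icc 0 P × Set.Icc (-δ) 0 => ((x.1:ℝ), (x.2:ℝ))) (by fun_prop))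
      exact hG.comp_continuous (by fun_prop) fun x => ⟨x.1.2, x.2.2⟩⟩
  have hT : ContractingWith (1 / 2) T := by
    refine ⟨by norm_num, LipschitzWith.of_dist_le_mul fun ψ ψ' => ?_⟩
    rw [ContinuousMap.dist_le (by positivity)]
    rintro ⟨⟨p, hp⟩, ⟨q, hq⟩⟩
    have e : T ψ (⟨p, hp⟩, ⟨q, hq⟩) - T ψ' (⟨p, hp⟩, ⟨q, hq⟩)
        = ∫ t in (0:ℝ)..q, ∫ s in a0..p, (H ψ t s - H ψ' t s) := by
      have ii : ∀ ψ t, IntervalIntegrable (H ψ t) volume a0 p := fun ψ t =>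
        ((hH ψ).comp (f := fun s : ℝ => (t, s)) (by fun_prop)).intervalIntegrable _ _
      have jj : ∀ ψ, IntervalIntegrable (fun t => ∫ s in a0..p, H ψ t s) volume 0 q := fun ψ =>
        ((hI ψ).comp (f := fun t : ℝ => (p, t)) (by fun_prop)).intervalIntegrable _ _
      simp_rw [fun t => intervalIntegral.integral_sub (ii ψ t) (ii ψ' t)]
      rw [intervalIntegral.integral_sub (jj ψ) (jj ψ')]
      simp [T]
    rw [Real.dist_eq, e]
    have b1 : ∀ t s, ‖H ψ t s - H ψ' t s‖ ≤ Λ * dist ψ ψ' := fun t s => by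
      refine (hL _ _ _).trans (mul_le_mul_of_nonneg_left ?_ hΛ)
      rw [← Real.dist_eq]; exact ContinuousMap.dist_apply_le_dist _
    have hpa : |p - a0| ≤ P := abs_le.2 ⟨by linarith [hp.1, ha0.2], by linarith [hp.2, ha0.1]⟩
    have b2 : ∀ t, ‖∫ s in a0..p, (H ψ t s - H ψ' t s)‖ ≤ Λ * dist ψ ψ' * P := fun t =>
      (intervalIntegral.norm_integral_le_of_norm_le_const fun s _ => b1 t s).trans
        (mul_le_mul_of_nonneg_left hpa (mul_nonneg hΛ dist_nonneg))
    have b3 := intervalIntegral.norm_integral_le_of_norm_le_const (a := 0) (b := q) fun t _ => b2 t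
    rw [Real.norm_eq_abs, sub_zero, abs_of_nonpos hq.2] at b3
    have h0 := dist_nonneg (x := ψ) (y := ψ')
    have : Λ * dist ψ ψ' * P * -q ≤ Λ * dist ψ ψ' * P * δ := mul_le_mul_of_nonneg_left (by linarith [hq.1]) (by positivity)
    have h1 := mul_le_mul_of_nonneg_right small h0
    refine b3.trans (this.trans ?_)
    simp only [NNReal.coe_div, NNReal.coe_one, NNReal.coe_ofNat]
    linarith
  obtain ⟨ψ, hψ⟩ : ∃ ψ, T ψ = ψ := ⟨_, hT.fixedPoint_isFixedPt⟩
  refine ⟨fun x => ψ (pr x), by fun_prop, fun p hp q hq => ?_⟩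
  have : pr (p, q) = (⟨p, hp⟩, ⟨q, hq⟩) := by
    simp only [pr, Set.projIcc_of_mem hP hp, Set.projIcc_of_mem hδ' hq]
  dsimp only
  rw [this]
  conv_lhs => rw [← hψ]
  rfl

def Ft (K : ℝ) (x : (ℝℝ) × ℝ) : ℝ := 4 * (x.1.1 - x.1.2) * (max (-K) (min (x.2 / (x.1.1 - x.1.2)) K)) ^ 5

lemma clip_le {K u : ℝ} (hK : 0 ≤ K) : |max (-K) (min u K)| ≤ K :=
  abs_le.2 ⟨le_max_left _ _, max_le (by linarith) (min_le_right _ _)⟩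

lemma Ft_le {K : ℝ} (hK : 0 ≤ K) (x : (ℝℝ) × ℝ) : |Ft K x| ≤ 4 * |x.1.1 - x.1.2| * K ^ 5 := by
  unfold Ft
  rw [abs_mul, abs_mul, abs_pow, abs_of_nonneg (by norm_num : (0:ℝ) ≤ 4)]
  gcongr
  exact clip_le hK

lemma Ft_eq {K : ℝ} {p q y : ℝ} (h : q < p) (hy : |y| ≤ K * (p - q)) : Ft K ((p, q), y) = 4 * y ^ 5 * ((p - q)⁻¹) ^ 4 := by
  have hd : 0 < p - q := sub_pos.2 h
  have h1 : |y / (p - q)| ≤ K := by rw [abs_div, abs_of_pos hd, div_le_iff₀ hd]; exact hy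
  unfold Ft
  rw [min_eq_left (abs_le.1 h1).2, max_eq_right (abs_le.1 h1).1]
  dsimp only
  field_simp

lemma Ft_cont {K : ℝ} (hK : 0 ≤ K) : Continuous (Ft K) := by
  rw [continuous_iff_continuousAt]
  intro x
  by_cases hd : x.1.1 - x.1.2 = 0
  · have h0 : Ft K x = 0 := by simp [Ft, hd]
    unfold ContinuousAt
    rw [h0]
    refine squeeze_zero_norm (fun y => Ft_le hK y) ?_
    have : ContinuousAt (fun y : (ℝℝ) × ℝ => 4 * |y.1.1 - y.1.2| * K ^ 5) x := by fun_prop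
    have h2 := this.tendsto
    simpa [hd] using h2
  · unfold Ft
    have : ContinuousAt (fun y : (ℝℝ) × ℝ => y.2 / (y.1.1 - y.1.2)) x :=
      ContinuousAt.div (by fun_prop) (by fun_prop) hd
    fun_prop

lemma Ft_lip {K : ℝ} (hK : 0 ≤ K) (x : ℝℝ) (y y' : ℝ) : |Ft K (x, y) - Ft K (x, y')| ≤ 20 * K ^ 4 * |y - y'| := by
  by_cases hd : x.1 - x.2 = 0
  · simp only [Ft, hd]; simp; positivity
  unfold Ft
  dsimp only
  set d := x.1 - x.2
  have h1 := pow5_lip (clip_le hK (u := y / d)) (clip_le hK (u := y' / d))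
  have h2 : |max (-K) (min (y / d) K) - max (-K) (min (y' / d) K)| ≤ |y / d - y' / d| := by
    refine (abs_max_sub_max_le_max _ _ _ _).trans ?_
    rw [sub_self, abs_zero]
    refine max_le (abs_nonneg _) ((abs_min_sub_min_le_max _ _ _ _).trans ?_)
    rw [sub_self, abs_zero]
    exact max_le le_rfl (abs_nonneg _)
  rw [← mul_sub, abs_mul, abs_mul, abs_of_nonneg (by norm_num : (0:ℝ) ≤ 4)]
  have h3 : |y / d - y' / d| = |y - y'| / |d| := by rw [← sub_div, abs_div]
  rw [h3] at h2
  have hd' := abs_pos.2 hd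
  calc _ ≤ 4 * |d| * (5 * K ^ 4 * (|y - y'| / |d|)) := by
        refine mul_le_mul_of_nonneg_left (h1.trans ?_) (by positivity)
        exact mul_le_mul_of_nonneg_left h2 (by positivity)
    _ = _ := by field_simp; ring

lemma outer_bd {T p0 C1 : ℝ} (hpT : p0 < T) (hp1 : p0 ≤ 1) (hC1 : 0 ≤ C1) {ψ : ℝℝ → ℝ} (hψ : WaveSol T C1 ψ)
    (hh : ∀ j, ∃ C, ∀ q, 0 < q → 2 * q ≤ p0 → |DQ j ψ (p0, q)| ≤ C) :
    (∃ L, 0 ≤ L ∧ ∀ x ∈ Rg p0, |DQ 1 ψ x| ≤ L) ∧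
    ∀ P1, 0 < P1 → P1 ≤ p0 → ∀ j : ℕ, ∃ C, ∀ q, 0 < q → 2 * q ≤ P1 → |DQ j ψ (P1, q)| ≤ C := by
  have A : ∀ (n : ℝ) (_ : 1 ≤ n) (J : ℕ), Bd (Rg p0) (pcw n) J ψ := by
    intro n hn J
    refine claimA hpT hp1 hn hC1 hψ (fun j => ?_) J
    obtain ⟨C, hC⟩ := hh j
    refine ⟨|C|, fun q h1 h2 => ((hC q h1 h2).trans (le_abs_self C)).trans ?_⟩
    have : 0 ≤ q ^ n * (q⁻¹) ^ j := by positivity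
    nlinarith [abs_nonneg C]
  constructor
  · obtain ⟨C, h0, hC⟩ := A 1 le_rfl 1 1 le_rfl
    refine ⟨C * 2, by positivity, fun x hx => (hC x hx).trans_eq ?_⟩
    obtain ⟨h1, h2, h3⟩ := hx
    have : 0 < x.1 := by linarith
    unfold pcw cw
    rw [rpow_one]; field_simp; norm_num
  · intro P1 hP h1 j
    obtain ⟨C, h0, hC⟩ := A (j + 1) (by linarith [(Nat.cast_nonneg j : (0:ℝ) ≤ j)]) j j le_rfl
    refine ⟨C * (P1 * ((P1⁻¹) ^ j + P1⁻¹ * 1)), fun q hq hqP => (hC (P1, q) ⟨hq, hqP, h1⟩).trans ?_⟩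
    unfold pcw cw
    dsimp only
    gcongr
    rw [rpow_add hq, rpow_one, rpow_natCast, mul_right_comm, ← mul_pow, mul_inv_cancel₀ hq.ne', one_pow, one_mul]
    linarith

lemma bdry {T p0 C1 L : ℝ} (hpT : p0 < T) {ψ : ℝℝ → ℝ} (hψ : WaveSol T C1 ψ) (hC1 : 0 ≤ C1)
    (hL : ∀ x ∈ Rg p0, |DQ 1 ψ x| ≤ L) (hL0 : 0 ≤ L) : ∃ b : ℝ → ℝ, ContinuousOn b (Set.Ico 0 p0) ∧
      (∀ p ∈ Set.Ico 0 p0, |b p| ≤ C1 * p) ∧ ∀ p q, p < p0 → 0 < q → 2 * q < p → |ψ (p, q) - b p| ≤ L * q := by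
  have ex : ∀ p : ℝ, ∃ c, p < p0 → ∀ q ∈ Set.Ioo 0 (p / 2), |ψ (p, q) - c| ≤ L * q := by
    intro p
    by_cases hp : p < p0
    · obtain ⟨c, hc⟩ := lim0 (g := fun q => ψ (p, q)) (g' := fun q => DQ 1 ψ (p, q)) (a := p / 2) (C := L) (s := 1) one_pos
        (fun q hq => by
          have hx : ((p, q) : ℝℝ) ∈ Om T := ⟨hq.1, by dsimp only; linarith [hq.1, hq.2], hp.trans hpT⟩
          have := has_q (Om_open T) hψ.smooth hx
          rwa [← DQ_one_eq (Om_open T) hψ.smooth hx] at this)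
        (fun q hq => by
          have := hL (p, q) ⟨hq.1, by dsimp only; linarith [hq.2], hp.le⟩
          simpa using this)
      exact ⟨c, fun _ q hq => by simpa using hc q hq⟩
    · exact ⟨0, fun h => absurd h hp⟩
  choose b0 hb0 using ex
  let b : ℝ → ℝ := fun p => if p = 0 then 0 else b0 p
  have hb : ∀ p q, p < p0 → 0 < q → 2 * q < p → |ψ (p, q) - b p| ≤ L * q := fun p q h1 h2 h3 => by
    have : p ≠ 0 := by linarith
    simp only [b, if_neg this]
    exact hb0 p h1 q ⟨h2, by linarith⟩
  have hb1 : ∀ p ∈ Set.Ico 0 p0, |b p| ≤ C1 * p := by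
    rintro p ⟨h1, h2⟩
    rcases h1.eq_or_lt with rfl | h1
    · simp [b]
    refine le_of_forall_pos_le_add fun ε hε => ?_
    set q := min (p / 4) (ε / (L + 1)) with hq
    have hq0 : 0 < q := lt_min (by linarith) (by positivity)
    have hq1 : q ≤ p / 4 := min_le_left _ _
    have hq2 : q * (L + 1) ≤ ε := (le_div_iff₀ (by linarith)).1 (min_le_right _ _)
    have h3 := hb p q h2 hq0 (by linarith)
    have h4 := hψ.bd (p, q) ⟨hq0, by dsimp only; linarith, h2.trans hpT⟩
    dsimp only at h4
    have := abs_sub_abs_le_abs_sub (b p) (ψ (p, q))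
    rw [abs_sub_comm] at this
    linarith
  refine ⟨b, ?_, hb1, hb⟩
  rintro p ⟨h1, h2⟩
  rcases h1.eq_or_lt with rfl | h1
  · have h0 : b 0 = 0 := by simp [b]
    unfold ContinuousWithinAt
    rw [h0]
    refine squeeze_zero_norm' (a := fun p => C1 * p) ?_ ?_
    · filter_upwards [self_mem_nhdsWithin] with p hp using hb1 p hp
    · have : Tendsto (fun p : ℝ => C1 * p) (𝓝 0) (𝓝 (C1 * 0)) := (continuous_const.mul continuous_id).tendsto 0
      rw [mul_zero] at this
      exact this.mono_left nhdsWithin_le_nhds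
  · refine ContinuousAt.continuousWithinAt ?_
    refine continuousAt_of_locally_uniform_approx_of_continuousAt fun u hu => ?_
    obtain ⟨ε, hε, hu⟩ := Metric.mem_uniformity_dist.1 hu
    set q := min (p / 8) (ε / 2 / (L + 1)) with hq
    have hq0 : 0 < q := lt_min (by linarith) (by positivity)
    have hq1 : q ≤ p / 8 := min_le_left _ _
    have hq2 : q * (L + 1) ≤ ε / 2 := (le_div_iff₀ (by linarith)).1 (min_le_right _ _)
    refine ⟨Set.Ioo (p / 2) p0, Ioo_mem_nhds (by linarith) h2, fun p => ψ (p, q), ?_, fun y hy => ?_⟩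
    · have hx : ((p, q) : ℝℝ) ∈ Om T := ⟨hq0, by dsimp only; linarith, h2.trans hpT⟩
      exact (has_p (Om_open T) hψ.smooth hx).continuousAt
    · refine hu ?_
      rw [Real.dist_eq, abs_sub_comm]
      have := hb y q hy.2 hq0 (by linarith [hy.1])
      linarith

def Ux (P δ : ℝ) : Set (ℝℝ) := {x | 0 < x.1 ∧ x.1 < P ∧ -δ < x.2 ∧ x.2 < x.1}
def FW (Ψ : ℝℝ → ℝ) (x : ℝℝ) : ℝ := 4 * Ψ x ^ 5 * ((x.1 - x.2)⁻¹) ^ 4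

lemma FW_cd {Ψ : ℝℝ → ℝ} {R : Set (ℝℝ)} (hR : ∀ x ∈ R, x.2 < x.1) {n : ℕ} (h : ContDiffOn ℝ n Ψ R) :
    ContDiffOn ℝ n (FW Ψ) R := by
  have : ContDiffOn ℝ n (fun x : ℝℝ => (x.1 - x.2)⁻¹) R :=
    ContDiffOn.inv (by fun_prop) fun x hx => (sub_pos.2 (hR x hx)).ne'
  exact (contDiffOn_const.mul (h.pow 5)).mul (this.pow 4)

lemma Ux_open (P δ : ℝ) : IsOpen (Ux P δ) :=
  (isOpen_lt continuous_const continuous_fst).inter ((isOpen_lt continuous_fst continuous_const).inter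
    ((isOpen_lt continuous_const continuous_snd).inter (isOpen_lt continuous_snd continuous_fst)))

lemma boot {P δ P1 : ℝ} (hδ : 0 < δ) (hP1 : P / 2 ≤ P1) (hP1' : P1 < P) {Ψ : ℝℝ → ℝ} (hc : ContinuousOn Ψ (Ux P δ))
    (hs : CDOn Ψ (Om P)) (hpde : ∀ x ∈ Om P, DP (DQ 1 Ψ) x = FW Ψ x) {H : ℝ → ℝ}
    (hH : CDOn H (Set.Iio P1))
    (hrep : ∀ p ∈ Set.Ioo 0 P, ∀ q, -δ < q → q < p → q < P1 → q ≠ 0 →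
      HasDerivAt (fun q => Ψ (p, q)) (deriv H q + ∫ s in P1..p, FW Ψ (s, q)) q) :
    CDOn Ψ (Ux P δ) ∧ ∀ x ∈ Ux P δ, DP (DQ 1 Ψ) x = FW Ψ x := by
  suffices key : ∀ x ∈ Ux P δ, CDAt Ψ x ∧ DP (DQ 1 Ψ) x = FW Ψ x from
    ⟨fun x hx => (key x hx).1.contDiffWithinAt, fun x hx => (key x hx).2⟩
  rintro ⟨a, c⟩ ⟨x1, x2, x3, x4⟩
  dsimp only at x1 x2 x3 x4
  rcases lt_or_ge 0 c with hc0 | hc0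
  · have : ((a, c) : ℝℝ) ∈ Om P := ⟨hc0, x4, x2⟩
    exact ⟨hs.contDiffAt ((Om_open P).mem_nhds this), hpde _ this⟩
  have dH : CDOn (deriv H) (Set.Iio P1) := by simpa using iter_smooth isOpen_Iio hH 1
  have hHd : ∀ q < P1, HasDerivAt H (deriv H q) q := fun q hq => by simpa using iter_hasDeriv isOpen_Iio hH 0 hq
  set R : Set (ℝℝ) := Set.Ioo (a / 2) P ×ˢ Set.Ioo (-δ) (a / 2) with hR
  have RO : IsOpen R := isOpen_Ioo.prod isOpen_Ioo
  have RU : R ⊆ Ux P δ := fun x hx => ⟨by linarith [hx.1.1], hx.1.2, hx.2.1, by linarith [hx.1.1, hx.2.2]⟩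
  have xR : ((a, c) : ℝℝ) ∈ R := ⟨⟨by dsimp only; linarith, x2⟩, ⟨x3, by dsimp only; linarith⟩⟩
  have hI1 : P1 ∈ Set.Ioo (a / 2) P := ⟨by linarith, hP1'⟩
  have hq1 : a / 4 ∈ Set.Ioo (-δ) (a / 2) := ⟨by linarith, by linarith⟩
  have g0 : ContDiffOn ℝ (0 : ℕ) (fun x => ∫ s in P1..x.1, FW Ψ (s, x.2)) R :=
    PI hI1 (FW_cd (fun x hx => (RU hx).2.2.2) (contDiffOn_zero.2 (hc.mono RU)))
  have ci : ∀ p ∈ Set.Ioo (a / 2) P, ContinuousOn (fun q => ∫ s in P1..p, FW Ψ (s, q)) (Set.Ioo (-δ) (a / 2)) :=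
    fun p hp => g0.continuousOn.comp (f := fun q : ℝ => (p, q)) (by fun_prop) fun q hq => ⟨hp, hq⟩
  have cH : ContinuousOn (deriv H) (Set.Ioo (-δ) (a / 2)) := dH.continuousOn.mono fun q hq => by
    have := hq.2; simp only [Set.mem_Iio]; linarith
  have hder : ∀ p ∈ Set.Ioo (a / 2) P, ∀ q ∈ Set.Ioo (-δ) (a / 2),
      HasDerivAt (fun q => Ψ (p, q)) (deriv H q + ∫ s in P1..p, FW Ψ (s, q)) q := by
    intro p hp q hq
    have h1 : ∀ q ∈ Set.Ioo (-δ) (a / 2), q ≠ 0 → HasDerivAt (fun q => Ψ (p, q)) (deriv H q + ∫ s in P1..p, FW Ψ (s, q)) q :=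
      fun q hq h0 => hrep p ⟨by linarith [hp.1], hp.2⟩ q hq.1 (by linarith [hp.1, hq.2]) (by linarith [hq.2]) h0
    rcases eq_or_ne q 0 with rfl | h0
    · refine hasDeriv_ne (g := fun q => deriv H q + ∫ s in P1..p, FW Ψ (s, q)) hq.1 hq.2 h1 ?_ ?_
      · exact (hc.comp (f := fun q : ℝ => (p, q)) (by fun_prop) (fun q hq => RU ⟨hp, hq⟩)).continuousAt (Ioo_mem_nhds hq.1 hq.2)
      · exact (cH.add (ci p hp)).continuousAt (Ioo_mem_nhds hq.1 hq.2)
    · exact h1 q hq h0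
  have rep : ∀ x ∈ R, Ψ x = Ψ (x.1, a / 4) + (H x.2 - H (a / 4)) + ∫ q in (a / 4)..x.2, ∫ s in P1..x.1, FW Ψ (s, q) := by
    rintro ⟨p, q⟩ ⟨hp, hq⟩
    have sub := Set.ordConnected_Ioo.uIcc_subset hq1 hq
    have i1 := (cH.mono sub).intervalIntegrable (μ := volume)
    have i2 := ((ci p hp).mono sub).intervalIntegrable (μ := volume)
    have e1 := intervalIntegral.integral_eq_sub_of_hasDerivAt (fun t ht => hder p hp t (sub ht)) (i1.add i2)
    have e2 := intervalIntegral.integral_eq_sub_of_hasDerivAt (fun t ht => hHd t (by have := (sub ht).2; linarith)) i1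
    rw [intervalIntegral.integral_add i1 i2, e2] at e1
    dsimp only
    linarith
  have sm : ∀ n : ℕ, ContDiffOn ℝ n Ψ R := by
    intro n
    induction n with
    | zero => exact contDiffOn_zero.2 (hc.mono RU)
    | succ n ih =>
      refine ContDiffOn.congr ?_ rep
      refine ContDiffOn.add (ContDiffOn.add ?_ ?_) (DI hI1 hq1 (FW_cd (fun x hx => (RU hx).2.2.2) ih))
      · refine ContDiffOn.comp (hs.of_le (by exact_mod_cast le_top)) (f := fun x : ℝℝ => (x.1, a / 4)) (by fun_prop) fun x hx => ?_
        exact ⟨by dsimp only; linarith, by dsimp only; linarith [hx.1.1], hx.1.2⟩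
      · refine ContDiffOn.sub (ContDiffOn.comp (hH.of_le (by exact_mod_cast le_top)) (f := fun x : ℝℝ => x.2) (by fun_prop) fun x hx => ?_) contDiffOn_const
        have := hx.2.2; simp only [Set.mem_Iio]; linarith
  refine ⟨(contDiffOn_infty.2 sm).contDiffAt (RO.mem_nhds xR), ?_⟩
  have e : (fun p => DQ 1 Ψ (p, c)) =ᶠ[𝓝 a] fun p => deriv H c + ∫ s in P1..p, FW Ψ (s, c) := by
    filter_upwards [Ioo_mem_nhds xR.1.1 xR.1.2] with p hp
    simp only [DQ, iteratedDeriv_one]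
    exact (hder p hp c xR.2).deriv
  have := (FT hI1 xR.1 (f := fun s => FW Ψ (s, c))
    ((FW_cd (n := 0) (fun x hx => (RU hx).2.2.2) (contDiffOn_zero.2 (hc.mono RU))).continuousOn.comp
      (f := fun s : ℝ => (s, c)) (by fun_prop) fun s hs => ⟨hs, xR.2⟩)).const_add (deriv H c)
  exact (this.congr_of_eventuallyEq e).deriv

theorem extension {T p0 C1 : ℝ} (hp0 : 0 < p0) (hpT : p0 < T) (hp1 : p0 ≤ 1 / 4) (hC1 : 0 ≤ C1) {ψ0 : ℝℝ → ℝ}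
    (hψ : WaveSol T C1 ψ0) (hh : ∀ j, ∃ C, ∀ q, 0 < q → 2 * q ≤ p0 → |DQ j ψ0 (p0, q)| ≤ C) :
    ∃ P δ : ℝ, ∃ Ψ : ℝℝ → ℝ, 0 < P ∧ P ≤ p0 ∧ 0 < δ ∧ (∀ x ∈ Om P, Ψ x = ψ0 x) ∧
      CDOn Ψ (Ux P δ) ∧ ∀ x ∈ Ux P δ, DP (DQ 1 Ψ) x = FW Ψ x := by
  obtain ⟨⟨L, hL0, hL⟩, hB⟩ := outer_bd hpT (by linarith) hC1 hψ hh
  obtain ⟨b, bc, bb, bL⟩ := bdry hpT hψ hC1 hL hL0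
  set K := C1 + L + 2 with hK
  have K2 : 2 ≤ K := by linarith
  set P := min (p0 / 2) (1 / (4 * K ^ 5)) with hP
  have P0' : 0 < P := lt_min (by linarith) (by positivity)
  have Pp : P ≤ p0 / 2 := min_le_left _ _
  have PK : P * (4 * K ^ 5) ≤ 1 := (le_div_iff₀ (by positivity)).1 (min_le_right _ _)
  have OmS : Om P ⊆ Om T := fun x hx => ⟨hx.1, hx.2.1, by linarith [hx.2.2]⟩
  have so := hψ.smooth
  obtain ⟨H, sH, hH⟩ := extend (h := fun q => ψ0 (P / 2, q)) (A := P / 2 / 2) (T := P / 2) (by linarith) (by linarith)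
    (so.comp (f := fun q : ℝ => (P / 2, q)) (by fun_prop) fun q hq => ⟨hq.1, hq.2, by dsimp only; linarith⟩)
    (fun j => by
      obtain ⟨C, hC⟩ := hB (P / 2) (by linarith) (by linarith) j
      exact ⟨C, fun q hq => hC q hq.1 (by linarith [hq.2])⟩)
  have dH : CDOn (deriv H) (Set.Iio (P / 2)) := by simpa using iter_smooth isOpen_Iio sH 1
  have hHd : ∀ q < P / 2, HasDerivAt H (deriv H q) q := fun q hq => by simpa using iter_hasDeriv isOpen_Iio sH 0 hq
  have dHq : ∀ q, 0 < q → q < P / 2 → deriv H q = DQ 1 ψ0 (P / 2, q) := fun q h1 h2 => by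
    have : H =ᶠ[𝓝 q] fun q => ψ0 (P / 2, q) := by filter_upwards [Ioo_mem_nhds h1 h2] with s hs using hH s hs
    rw [this.deriv_eq]; simp [DQ]
  have c0 : ContinuousAt (deriv H) 0 := dH.continuousOn.continuousAt (Iio_mem_nhds (by linarith))
  have H0 : |deriv H 0| ≤ L := by
    refine le_of_tendsto (c0.abs.tendsto.mono_left (nhdsWithin_le_nhds (s := Set.Ioi 0))) ?_
    filter_upwards [Ioo_mem_nhdsGT (show (0:ℝ) < P / 4 by linarith)] with q hq
    rw [dHq q hq.1 (by linarith [hq.2])]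
    exact hL _ ⟨hq.1, by dsimp only; linarith [hq.2], by dsimp only; linarith⟩
  obtain ⟨ε, hε, hHε⟩ := Metric.eventually_nhds_iff.1 (c0.abs.eventually (gt_mem_nhds (show |deriv H 0| < L + 1 by linarith)))
  set δ := min (ε / 2) (1 / 8) with hδ
  have δ0 : 0 < δ := lt_min (by linarith) (by norm_num)
  have δε : δ ≤ ε / 2 := min_le_left _ _
  have δ8 : δ ≤ 1 / 8 := min_le_right _ _
  have HL : ∀ q ∈ Set.Icc (-δ) 0, |H q - H 0| ≤ (L + 1) * -q := by
    rintro q ⟨h1, h2⟩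
    have := mvt (f := H) (f' := deriv H) (B := L + 1) h2 (fun s _ h => hHd s (by linarith)) fun s h3 h4 =>
      (hHε (y := s) (by rw [Real.dist_eq, sub_zero, abs_of_nonpos h4]; linarith)).le
    rw [abs_sub_comm]; simpa using this
  have cH : ContinuousOn H (Set.Iio (P / 2)) := sH.continuousOn
  obtain ⟨ψ, cψ, eψ⟩ := goursat (P := P) (δ := δ) (Λ := 20 * K ^ 4) (a0 := P / 2) (G := fun x => b x.1 + (H x.2 - H 0)) (F := Ft K)
    P0'.le δ0.le ⟨by linarith, by linarith⟩
    (ContinuousOn.add (bc.comp continuousOn_fst fun x hx => ⟨hx.1.1, by linarith [hx.1.2]⟩)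
      ((cH.comp continuousOn_snd fun x hx => by have := hx.2.2; simp only [Set.mem_Iio]; linarith).sub continuousOn_const))
    (Ft_cont (by linarith)) (by positivity) (fun x y y' => Ft_lip (by linarith) x y y')
    (by
      have h1 : P * (20 * K ^ 4) * K ≤ 5 := by nlinarith
      have h2 : P * (20 * K ^ 4) ≤ 5 / 2 := by nlinarith [show 0 ≤ P * (20 * K ^ 4) by positivity]
      nlinarith [show 0 ≤ P * (20 * K ^ 4) by positivity])
  have ψK : ∀ p ∈ Set.Icc 0 P, ∀ q ∈ Set.Icc (-δ) 0, |ψ (p, q)| ≤ K * (p - q) := by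
    intro p hp q hq
    rw [eψ p hp q hq]
    have i1 : ∀ t ∈ Set.uIoc 0 q, ‖∫ s in (P / 2)..p, Ft K ((s, t), ψ (s, t))‖ ≤ 4 * K ^ 5 * P := by
      intro t ht
      have ht' := Set.uIoc_subset_uIcc ht
      rw [Set.uIcc_of_ge hq.2] at ht'
      have hpa : |p - P / 2| ≤ P := abs_le.2 ⟨by linarith [hp.1], by linarith [hp.2]⟩
      refine (intervalIntegral.norm_integral_le_of_norm_le_const (C := 4 * K ^ 5) fun s hs => ?_).trans
        (mul_le_mul_of_nonneg_left hpa (by positivity))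
      have hs' := (Set.ordConnected_Icc (a := 0) (b := P)).uIcc_subset ⟨by linarith, by linarith⟩ hp (Set.uIoc_subset_uIcc hs)
      refine (Ft_le (by linarith) _).trans ?_
      have : |s - t| ≤ 1 := abs_le.2 ⟨by linarith [hs'.1, ht'.2], by linarith [hs'.2, ht'.1, hq.1]⟩
      nlinarith [show 0 ≤ K ^ 5 by positivity]
    have i2 := intervalIntegral.norm_integral_le_of_norm_le_const i1
    rw [Real.norm_eq_abs, sub_zero, abs_of_nonpos hq.2] at i2
    have i3 := bb p ⟨hp.1, by linarith [hp.2]⟩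
    have i4 := HL q hq
    have i5 := abs_add_le (b p + (H q - H 0)) (∫ t in (0:ℝ)..q, ∫ s in (P / 2)..p, Ft K ((s, t), ψ (s, t)))
    have i6 := abs_add_le (b p) (H q - H 0)
    dsimp only at i5 ⊢
    nlinarith [hp.1, hq.2]
  let Ψ : ℝℝ → ℝ := fun x => if 0 < x.2 then ψ0 x else ψ x
  have Ψp : ∀ x : ℝℝ, 0 < x.2 → Ψ x = ψ0 x := fun x hx => if_pos hx
  have Ψn : ∀ x : ℝℝ, x.2 ≤ 0 → Ψ x = ψ x := fun x hx => if_neg hx.not_gt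
  have ψb : ∀ p ∈ Set.Icc 0 P, ψ (p, 0) = b p := fun p hp => by
    rw [eψ p hp 0 ⟨by linarith, le_rfl⟩]; simp
  have hs : CDOn Ψ (Om P) := (so.mono OmS).congr fun x hx => Ψp x hx.1
  have hpde : ∀ x ∈ Om P, DP (DQ 1 Ψ) x = FW Ψ x := fun x hx => by
    rw [DP_congr (Om_open P) (DQ_congr (Om_open P) (fun x hx => Ψp x hx.1) 1) x hx, hψ.eq x (OmS hx), FW, Ψp x hx.1]
  refine ⟨P, δ, Ψ, P0', by linarith, δ0, fun x hx => Ψp x hx.1, boot (P1 := P / 2) δ0 le_rfl (by linarith) ?_ hs hpde sH ?_⟩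
  · rintro ⟨p, q⟩ ⟨x1, x2, x3, x4⟩
    dsimp only at x1 x2 x3 x4
    refine ContinuousAt.continuousWithinAt ?_
    rcases lt_trichotomy q 0 with h0 | rfl | h0
    · refine (cψ.continuousAt (x := (p, q))).congr ?_
      filter_upwards [continuousAt_snd.eventually (gt_mem_nhds h0)] with y hy using (Ψn y (le_of_lt hy)).symm
    · have t1 : Tendsto (fun y : ℝℝ => ψ (y.1, min y.2 0)) (𝓝 (p, 0)) (𝓝 (Ψ (p, 0))) := by
        have : Continuous fun y : ℝℝ => ψ (y.1, min y.2 0) := by fun_prop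
        have := this.tendsto (p, 0)
        simpa [Ψn (p, 0) le_rfl] using this
      have t2 : Tendsto (fun y : ℝℝ => Ψ y - ψ (y.1, min y.2 0)) (𝓝 (p, 0)) (𝓝 0) := by
        refine squeeze_zero_norm' (a := fun y : ℝℝ => L * |y.2|) ?_ ?_
        · filter_upwards [continuousAt_fst.eventually (Ioo_mem_nhds (show p / 2 < p by linarith) x2),
            continuousAt_snd.eventually (gt_mem_nhds (show 0 < p / 4 by linarith))] with y h1 h2
          rcases le_or_gt y.2 0 with h3 | h3
          · rw [Ψn y h3, min_eq_left h3]; simp; positivity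
          · rw [Ψp y h3, min_eq_right h3.le, ψb y.1 ⟨by linarith [h1.1], h1.2.le⟩, abs_of_pos h3]
            exact bL y.1 y.2 (by linarith [h1.2]) h3 (by linarith [h1.1])
        · have : Continuous fun y : ℝℝ => L * |y.2| := by fun_prop
          simpa using this.tendsto (p, 0)
      have := t1.add t2
      simpa [ContinuousAt] using this
    · have hx : ((p, q) : ℝℝ) ∈ Om P := ⟨h0, x4, x2⟩
      exact hs.continuousOn.continuousAt ((Om_open P).mem_nhds hx)
  · intro p hp q h1 h2 h3 h4
    have hP2 : P / 2 ∈ Set.Ioo 0 P := ⟨by linarith, by linarith⟩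
    rcases lt_or_gt_of_ne h4 with h0 | h0
    · have hpI : p ∈ Set.Icc 0 P := ⟨hp.1.le, hp.2.le⟩
      have e : (fun q => Ψ (p, q)) =ᶠ[𝓝 q] fun q => b p + (H q - H 0) + ∫ t in (0:ℝ)..q, ∫ s in (P / 2)..p, Ft K ((s, t), ψ (s, t)) := by
        filter_upwards [Ioo_mem_nhds h1 h0] with t ht
        rw [Ψn _ ht.2.le, eψ p hpI t ⟨ht.1.le, ht.2.le⟩]
      refine HasDerivAt.congr_of_eventuallyEq ?_ e
      have cI : Continuous fun t => ∫ s in (P / 2)..p, Ft K ((s, t), ψ (s, t)) :=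
        continuous_parametric_intervalIntegral_of_continuous' (f := fun t s => Ft K ((s, t), ψ (s, t)))
          ((Ft_cont (by linarith)).comp (f := fun z : ℝℝ => ((z.2, z.1), ψ (z.2, z.1))) (by fun_prop)) _ _
      have d2 := FT (a := -1) (b := 1) (x0 := 0) (x := q) ⟨by norm_num, by norm_num⟩ ⟨by linarith, by linarith⟩ cI.continuousOn
      refine ((((hHd q h3).sub_const (H 0)).const_add (b p)).add d2).congr_deriv ?_
      congr 1
      refine intervalIntegral.integral_congr fun s hs => ?_
      have hs' := (Set.ordConnected_Ioo (a := 0) (b := P)).uIcc_subset hP2 hp hs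
      rw [Ft_eq (by linarith [hs'.1]) (ψK s ⟨hs'.1.le, hs'.2.le⟩ q ⟨h1.le, h0.le⟩), FW, Ψn _ h0.le]
    · have e : (fun q => Ψ (p, q)) =ᶠ[𝓝 q] fun q => ψ0 (p, q) := by
        filter_upwards [lt_mem_nhds h0] with t ht using Ψp _ ht
      refine HasDerivAt.congr_of_eventuallyEq ?_ e
      have hx : ((p, q) : ℝℝ) ∈ Om T := OmS ⟨h0, h2, hp.2⟩
      refine (has_q (Om_open T) so hx).congr_deriv ?_
      rw [← DQ_one_eq (Om_open T) so hx, dHq q h0 h3]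
      have mem : ∀ s ∈ Set.uIcc (P / 2) p, ((s, q) : ℝℝ) ∈ Om P := fun s hs => by
        have hs' := (Set.ordConnected_Ioo (a := q) (b := P)).uIcc_subset ⟨h3, by linarith⟩ ⟨h2, hp.2⟩ hs
        exact ⟨h0, hs'.1, hs'.2⟩
      have := intervalIntegral.integral_eq_sub_of_hasDerivAt (f := fun s => DQ 1 ψ0 (s, q)) (f' := fun s => FW Ψ (s, q)) (a := P / 2) (b := p)
        (fun s hs => by
          have hd := has_p (Om_open T) (DQ_smooth (Om_open T) so 1) (OmS (mem s hs))
          rw [← DP_eq (Om_open T) (DQ_smooth (Om_open T) so 1) (OmS (mem s hs)), hψ.eq _ (OmS (mem s hs))] at hd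
          dsimp only [FW]
          rwa [Ψp _ h0])
        (ContinuousOn.intervalIntegrable ((FW_cd (n := 0) (fun x hx => hx.2.1) (hs.of_le (by simp))).continuousOn.comp
          (f := fun s : ℝ => (s, q)) (by fun_prop) mem))
      rw [this]; ring

section

lemma rad_fd {G : ℝℝ → ℝ} {L : ℝℝ →L[ℝ] ℝ} {t κ : ℝ} {x : E3} (hG : HasFDerivAt G L (t, ‖x‖)) (hL : L (0, 1) = κ * ‖x‖) :
    HasFDerivAt (fun y : ℝ × E3 => G (y.1, ‖y.2‖))
      (L (1, 0) • ContinuousLinearMap.fst ℝ ℝ E3 + κ • (innerSL ℝ x).comp (ContinuousLinearMap.snd ℝ ℝ E3)) (t, x) := by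
  have eL : ∀ a b : ℝ, L (a, b) = a * L (1, 0) + b * L (0, 1) := fun a b => by
    rw [← smul_eq_mul, ← smul_eq_mul, ← map_smul, ← map_smul, ← map_add]; simp
  by_cases hx : x = 0
  · subst hx
    rw [hasFDerivAt_iff_isLittleO] at hG ⊢
    have hc : Tendsto (fun y : ℝ × E3 => (y.1, ‖y.2‖)) (𝓝 (t, (0 : E3))) (𝓝 (t, ‖(0 : E3)‖)) :=
      Continuous.tendsto (by fun_prop : Continuous fun y : ℝ × E3 => (y.1, ‖y.2‖)) (t, (0 : E3))
    refine ((hG.comp_tendsto hc).congr_left fun y => ?_).trans_isBigO (Asymptotics.IsBigO.of_bound 1 (Eventually.of_forall fun y => ?_))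
    · have : L ((y.1, ‖y.2‖) - (t, ‖(0 : E3)‖)) = (y.1 - t) * L (1, 0) := by
        simp only [Prod.mk_sub_mk]
        rw [eL, hL]; simp
      simp only [Function.comp_apply, this]
      simp; ring
    · simp [Prod.norm_def]
  · have h0 : ‖x‖ ≠ 0 := norm_ne_zero_iff.2 hx
    have hn := (hasStrictFDerivAt_norm_sq x).hasFDerivAt.sqrt (by positivity)
    simp only [sqrt_sq (norm_nonneg _)] at hn
    have h2 := hG.comp (t, x) ((hasFDerivAt_fst (𝕜 := ℝ) (p := (t, x))).prodMk (hn.comp (t, x) (hasFDerivAt_snd (p := (t, x)))))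
    refine h2.congr_fderiv ?_
    ext v
    · simp
    · simp
      rw [eL, hL]; field_simp; simp

lemma rad1 {f : ℝ → ℝ} {κ : ℝ} {x : E3} (h : HasDerivAt f (κ * ‖x‖) ‖x‖) : HasFDerivAt (fun y : E3 => f ‖y‖) (κ • innerSL ℝ x) x := by
  have h1 : HasFDerivAt (fun y : ℝℝ => f y.2) _ ((0:ℝ), ‖x‖) := h.hasFDerivAt.comp ((0:ℝ), ‖x‖) hasFDerivAt_snd
  refine ((rad_fd (κ := κ) h1 (by simp)).comp x (hasFDerivAt_prodMk_right 0 x)).congr_fderiv ?_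
  ext v; simp

lemma lap_rad {f κ : ℝ → ℝ} {κ2 : ℝ} {x : E3} (hf : ∀ᶠ r in 𝓝 ‖x‖, HasDerivAt f (κ r * r) r)
    (hκ : HasDerivAt κ (κ2 * ‖x‖) ‖x‖) : lap (fun y => f ‖y‖) x = 3 * κ ‖x‖ + κ2 * ‖x‖ ^ 2 := by
  have e : ∀ i : Fin 3, fderiv ℝ (fun y => fderiv ℝ (fun y : E3 => f ‖y‖) y (EuclideanSpace.single i 1)) x (EuclideanSpace.single i 1)
      = κ ‖x‖ + κ2 * x i ^ 2 := by
    intro i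
    have ev : (fun y => fderiv ℝ (fun y : E3 => f ‖y‖) y (EuclideanSpace.single i 1)) =ᶠ[𝓝 x] fun y => κ ‖y‖ * y i := by
      filter_upwards [(continuous_norm.tendsto x).eventually hf] with y hy
      rw [(rad1 hy).fderiv]; simp [EuclideanSpace.inner_single_right]
    have hd : HasFDerivAt (fun y : E3 => κ ‖y‖ * y i) _ x := (rad1 hκ).mul (EuclideanSpace.proj (𝕜 := ℝ) i : E3 →L[ℝ] ℝ).hasFDerivAt
    rw [ev.fderiv_eq, hd.fderiv]
    simp [EuclideanSpace.inner_single_right]; ring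
  unfold lap
  rw [Finset.sum_congr rfl fun i _ => e i, EuclideanSpace.norm_sq_eq]
  simp [Finset.sum_add_distrib, ← Finset.mul_sum]

def KK (g : ℝℝ → ℝ) (x : ℝℝ) : ℝ := ∫ σ in (0:ℝ)..1, DQ 2 g (x.1, σ * x.2)

section
variable {U : Set (ℝℝ)} (hU : IsOpen U) (hs : ∀ x ∈ U, ∀ s, |s| ≤ |x.2| → (x.1, s) ∈ U)
include hU hs

lemma KK_spec {g : ℝℝ → ℝ} (hg : CDOn g U) (he : ∀ t r, g (t, -r) = g (t, r)) :
    CDOn (KK g) U ∧ (∀ t r, KK g (t, -r) = KK g (t, r)) ∧ ∀ x ∈ U, fderiv ℝ g x (0, 1) = KK g x * x.2 := by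
  have hσ : ∀ x ∈ U, ∀ σ ∈ Set.Icc (0:ℝ) 1, (x.1, σ * x.2) ∈ U := fun x hx σ hσ => hs x hx _ (by
    rw [abs_mul, abs_of_nonneg hσ.1]; exact mul_le_of_le_one_left (abs_nonneg _) hσ.2)
  refine ⟨contDiffOn_infty.2 fun n => ?_, fun t r => ?_, fun x hx => ?_⟩
  · have hc : Continuous fun y : (ℝℝ) × ℝ => (y.1.1, y.2 * y.1.2) := by fun_prop
    refine CI hU (hU.preimage hc) hσ n ℝ (F := fun y => DQ 2 g (y.1.1, y.2 * y.1.2)) ?_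
    exact ((DQ_smooth hU hg 2).of_le (by exact_mod_cast le_top)).comp (by fun_prop) fun y hy => hy
  · have : ∀ t s, DQ 2 g (t, -s) = DQ 2 g (t, s) := fun t s => by
      have := iteratedDeriv_comp_neg 2 (fun q => g (t, q)) s
      simp only [he] at this
      simp only [DQ]; rw [this]; simp
    simp only [KK, mul_neg, this]
  · have h0 : DQ 1 g (x.1, 0) = 0 := by
      have := deriv_comp_neg (fun q => g (x.1, q)) 0
      simp only [he, neg_zero] at this
      simp only [DQ, iteratedDeriv_one]; linarith
    have hd : ∀ σ ∈ Set.uIcc (0:ℝ) 1, HasDerivAt (fun σ => DQ 1 g (x.1, σ * x.2)) (DQ 2 g (x.1, σ * x.2) * x.2) σ := fun σ h => by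
      rw [Set.uIcc_of_le zero_le_one] at h
      have h1 := has_q hU (DQ_smooth hU hg 1) (hσ x hx σ h)
      rw [← DQ_one_eq hU (DQ_smooth hU hg 1) (hσ x hx σ h), ← DQ_succ] at h1
      exact h1.comp σ (by simpa using (hasDerivAt_id σ).mul_const x.2)
    have hi : IntervalIntegrable (fun σ => DQ 2 g (x.1, σ * x.2) * x.2) volume 0 1 := by
      refine (ContinuousOn.mul ?_ continuousOn_const).intervalIntegrable
      rw [Set.uIcc_of_le zero_le_one]
      exact (DQ_smooth hU hg 2).continuousOn.comp (f := fun σ : ℝ => (x.1, σ * x.2)) (by fun_prop) (hσ x hx)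
    have := intervalIntegral.integral_eq_sub_of_hasDerivAt hd hi
    rw [intervalIntegral.integral_mul_const] at this
    simp only [one_mul, zero_mul, h0, sub_zero] at this
    rw [KK, this, DQ_one_eq hU hg hx]

lemma even_cd (n : ℕ) : ∀ {g : ℝℝ → ℝ}, CDOn g U → (∀ t r, g (t, -r) = g (t, r)) →
    ContDiffOn ℝ n (fun y : ℝ × E3 => g (y.1, ‖y.2‖)) {y | (y.1, ‖y.2‖) ∈ U} := by
  have hc : Continuous fun y : ℝ × E3 => (y.1, ‖y.2‖) := by fun_prop
  induction n with
  | zero => exact fun hg _ => contDiffOn_zero.2 (hg.continuousOn.comp hc.continuousOn fun y hy => hy)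
  | succ n ih =>
    intro g hg he
    obtain ⟨k1, k2, k3⟩ := KK_spec hU hs hg he
    have key : ∀ y : ℝ × E3, (y.1, ‖y.2‖) ∈ U → HasFDerivAt (fun y : ℝ × E3 => g (y.1, ‖y.2‖))
        (DP g (y.1, ‖y.2‖) • ContinuousLinearMap.fst ℝ ℝ E3 +
          KK g (y.1, ‖y.2‖) • (innerSL ℝ y.2).comp (ContinuousLinearMap.snd ℝ ℝ E3)) y := fun y hy => by
      rw [DP_eq hU hg hy]
      exact rad_fd (((hg.contDiffAt (hU.mem_nhds hy)).differentiableAt (by simp)).hasFDerivAt) (k3 _ hy)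
    push_cast
    rw [contDiffOn_succ_iff_fderiv_of_isOpen (show IsOpen {y : ℝ × E3 | (y.1, ‖y.2‖) ∈ U} from hU.preimage hc)]
    refine ⟨fun y hy => (key y hy).differentiableAt.differentiableWithinAt, by simp, ContDiffOn.congr ?_ fun y hy => (key y hy).fderiv⟩
    refine ((ih (DP_smooth hU hg) fun t r => by simp only [DP, he]).smul contDiffOn_const).add ((ih k1 k2).smul ?_)
    exact ((((innerSL ℝ (E := E3)).contDiff).comp contDiff_snd).clm_comp contDiff_const).contDiffOn
end

end

def Uu (P : ℝ) : Set (ℝℝ) := {x | |x.2| < x.1 ∧ x.1 + |x.2| < P}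
def Vv (P δ : ℝ) : Set (ℝℝ) := {x | 0 < x.2 ∧ (x.1 + x.2, x.1 - x.2) ∈ Ux P δ}
def GG (g Ψ : ℝℝ → ℝ) (x : ℝℝ) : ℝ := if |x.2| < x.1 then g x else Ψ (x.1 + x.2, x.1 - x.2) / x.2

lemma Uu_open (P : ℝ) : IsOpen (Uu P) :=
  (isOpen_lt (f := fun x : ℝℝ => |x.2|) (g := fun x => x.1) (by fun_prop) (by fun_prop)).inter
    (isOpen_lt (f := fun x : ℝℝ => x.1 + |x.2|) (g := fun _ => P) (by fun_prop) (by fun_prop))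
lemma Vv_open (P δ : ℝ) : IsOpen (Vv P δ) :=
  (isOpen_lt continuous_const continuous_snd).inter ((Ux_open P δ).preimage (f := fun x : ℝℝ => (x.1 + x.2, x.1 - x.2)) (by fun_prop))
lemma Uu_star (P : ℝ) : ∀ x ∈ Uu P, ∀ s, |s| ≤ |x.2| → (x.1, s) ∈ Uu P :=
  fun x hx s h => ⟨h.trans_lt hx.1, by have := hx.2; dsimp only; linarith⟩

lemma slice_p {Ω : Set (ℝℝ)} (hΩ : IsOpen Ω) {x : ℝℝ} (hx : x ∈ Ω) : ∀ᶠ p in 𝓝 x.1, (p, x.2) ∈ Ω := by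
  have hc : ContinuousAt (fun p : ℝ => (p, x.2)) x.1 := by fun_prop
  exact hc.eventually (show ∀ᶠ y in 𝓝 (x.1, x.2), y ∈ Ω from hΩ.mem_nhds hx)

lemma null_has {P δ t r : ℝ} {F : ℝℝ → ℝ} (hF : CDOn F (Ux P δ)) (h : (t, r) ∈ Vv P δ) :
    HasDerivAt (fun s => F (s + r, s - r)) (DP F (t + r, t - r) + DQ 1 F (t + r, t - r)) t ∧
    HasDerivAt (fun s => F (t + s, t - s)) (DP F (t + r, t - r) - DQ 1 F (t + r, t - r)) r := by
  have h1 : HasFDerivAt F (fderiv ℝ F (t + r, t - r)) (t + r, t - r) :=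
    ((hF.contDiffAt ((Ux_open P δ).mem_nhds h.2)).differentiableAt (by simp)).hasFDerivAt
  rw [DP_eq (Ux_open P δ) hF h.2, DQ_one_eq (Ux_open P δ) hF h.2]
  constructor
  · refine (h1.comp_hasDerivAt t (((hasDerivAt_id t).add_const r).prodMk ((hasDerivAt_id t).sub_const r))).congr_deriv ?_
    rw [← map_add]; simp
  · refine (h1.comp_hasDerivAt r (((hasDerivAt_id r).const_add t).prodMk ((hasDerivAt_id r).const_sub t))).congr_deriv ?_
    rw [← map_sub]; simp

theorem build {P δ : ℝ} (hδ : 0 < δ) {Ψ g : ℝℝ → ℝ} (hg : CDOn g (Uu P)) (he : ∀ t r, g (t, -r) = g (t, r))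
    (hΨ : CDOn Ψ (Ux P δ)) (hw : ∀ x ∈ Ux P δ, DP (DQ 1 Ψ) x = FW Ψ x)
    (ha : ∀ t r, 0 < r → r < t → t + r < P → Ψ (t + r, t - r) = r * g (t, r)) :
    CDOn (fun y : ℝ × E3 => GG g Ψ (y.1, ‖y.2‖)) {p | 0 < p.1 + ‖p.2‖ ∧ p.1 + ‖p.2‖ < P ∧ -δ < p.1 - ‖p.2‖} ∧
    ∀ (t : ℝ) (x : E3), 0 < t + ‖x‖ → t + ‖x‖ < P → -δ < t - ‖x‖ →
      deriv (fun s => deriv (fun r => GG g Ψ (r, ‖x‖)) s) t = lap (fun y => GG g Ψ (t, ‖y‖)) x + GG g Ψ (t, ‖x‖) ^ 5 := by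
  have gU : ∀ x ∈ Uu P, GG g Ψ x = g x := fun x hx => if_pos hx.1
  have gV : ∀ x ∈ Vv P δ, GG g Ψ x = Ψ (x.1 + x.2, x.1 - x.2) / x.2 := fun x hx => by
    unfold GG
    split_ifs with h
    · rw [abs_of_pos hx.1] at h
      rw [ha _ _ hx.1 h hx.2.2.1]; field_simp [hx.1.ne']
    · rfl
  have UO := Ux_open P δ
  have mV : ∀ (t : ℝ) (x : E3), x ≠ 0 → 0 < t + ‖x‖ → t + ‖x‖ < P → -δ < t - ‖x‖ → (t, ‖x‖) ∈ Vv P δ := fun t x hx h1 h2 h3 => by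
    have := norm_pos_iff.2 hx
    exact ⟨this, h1, h2, h3, by dsimp only; linarith⟩
  have mU : ∀ t : ℝ, 0 < t + ‖(0 : E3)‖ → t + ‖(0 : E3)‖ < P → (t, ‖(0 : E3)‖) ∈ Uu P := fun t h1 h2 => by
    simp only [norm_zero, add_zero] at h1 h2 ⊢
    exact ⟨by simpa using h1, by simpa using h2⟩
  have hc : Continuous fun y : ℝ × E3 => (y.1, ‖y.2‖) := by fun_prop
  refine ⟨?_, ?_⟩
  · rintro ⟨t, x⟩ ⟨h1, h2, h3⟩
    dsimp only at h1 h2 h3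
    refine ContDiffAt.contDiffWithinAt ?_
    by_cases hx : x = 0
    · subst hx
      have h := contDiffOn_infty.2 fun n => even_cd (Uu_open P) (Uu_star P) n hg he
      have hn : {y : ℝ × E3 | (y.1, ‖y.2‖) ∈ Uu P} ∈ 𝓝 (t, (0 : E3)) := ((Uu_open P).preimage hc).mem_nhds (mU t h1 h2)
      refine (h.contDiffAt hn).congr_of_eventuallyEq ?_
      filter_upwards [hn] with y hy using gU _ hy
    · have hv := mV t x hx h1 h2 h3
      have h4 : CDAt (GG g Ψ) (t, ‖x‖) := by
        have : CDAt (fun x : ℝℝ => Ψ (x.1 + x.2, x.1 - x.2) / x.2) (t, ‖x‖) :=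
          ((hΨ.contDiffAt (UO.mem_nhds hv.2)).comp (t, ‖x‖) (f := fun x : ℝℝ => (x.1 + x.2, x.1 - x.2)) (by fun_prop)).div contDiffAt_snd hv.1.ne'
        refine this.congr_of_eventuallyEq ?_
        filter_upwards [(Vv_open P δ).mem_nhds hv] with y hy using gV y hy
      exact h4.comp (t, x) (contDiffAt_fst.prodMk ((contDiffAt_norm ℝ hx).comp (t, x) contDiffAt_snd))
  have pne : ∀ (t : ℝ) (x : E3), x ≠ 0 → 0 < t + ‖x‖ → t + ‖x‖ < P → -δ < t - ‖x‖ →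
      deriv (fun s => deriv (fun r => GG g Ψ (r, ‖x‖)) s) t = lap (fun y => GG g Ψ (t, ‖y‖)) x + GG g Ψ (t, ‖x‖) ^ 5 := by
    intro t x hx h1 h2 h3
    have hv := mV t x hx h1 h2 h3
    have hr := hv.1
    dsimp only at hr
    set r := ‖x‖ with hrd
    have sa := DP_smooth UO hΨ
    have sb := DQ_smooth UO hΨ 1
    have dt : ∀ s, (s, r) ∈ Vv P δ → HasDerivAt (fun s => GG g Ψ (s, r)) ((DP Ψ (s + r, s - r) + DQ 1 Ψ (s + r, s - r)) / r) s := fun s hs => by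
      refine ((null_has hΨ hs).1.div_const r).congr_of_eventuallyEq ?_
      filter_upwards [slice_p (Vv_open P δ) hs] with y hy using gV _ hy
    have e1 : deriv (fun s => deriv (fun r' => GG g Ψ (r', r)) s) t = (DP (DP Ψ) (t + r, t - r) + DQ 1 (DP Ψ) (t + r, t - r) +
        (DP (DQ 1 Ψ) (t + r, t - r) + DQ 1 (DQ 1 Ψ) (t + r, t - r))) / r := by
      have ev : (fun s => deriv (fun r' => GG g Ψ (r', r)) s) =ᶠ[𝓝 t] fun s => (DP Ψ (s + r, s - r) + DQ 1 Ψ (s + r, s - r)) / r := by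
        filter_upwards [slice_p (Vv_open P δ) hv] with s hs using (dt s hs).deriv
      rw [ev.deriv_eq]
      exact (((null_has sa hv).1.add (null_has sb hv).1).div_const r).deriv
    have dr : ∀ s, (t, s) ∈ Vv P δ → HasDerivAt (fun s => GG g Ψ (t, s))
        (((DP Ψ (t + s, t - s) - DQ 1 Ψ (t + s, t - s)) / s ^ 2 - Ψ (t + s, t - s) / s ^ 3) * s) s := fun s hs => by
      have h0 : s ≠ 0 := hs.1.ne'
      refine (((null_has hΨ hs).2.div (hasDerivAt_id s) h0).congr_of_eventuallyEq ?_).congr_deriv (by simp; field_simp)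
      filter_upwards [slice_q (Vv_open P δ) hs] with y hy using gV _ hy
    have hκ := (((null_has sa hv).2.sub (null_has sb hv).2).div (hasDerivAt_pow 2 r) (by positivity)).sub
      ((null_has hΨ hv).2.div (hasDerivAt_pow 3 r) (by positivity))
    rw [lap_rad (f := fun s => GG g Ψ (t, s)) (slice_q (Vv_open P δ) hv |>.mono fun s hs => dr s hs) (hκ.congr_deriv (div_mul_cancel₀ _ hr.ne').symm),
      e1, gV _ hv, (comm1 UO hΨ hv.2).symm.trans (hw _ hv.2), hw _ hv.2]
    dsimp only [FW]
    rw [← hrd, show t + r - (t - r) = 2 * r by ring]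
    simp
    field_simp
    ring
  intro t x h1 h2 h3
  by_cases hx : x = 0
  swap
  · exact pne t x hx h1 h2 h3
  subst hx
  obtain ⟨k1, k2, k3⟩ := KK_spec (Uu_open P) (Uu_star P) hg he
  obtain ⟨l1, l2, l3⟩ := KK_spec (Uu_open P) (Uu_star P) k1 k2
  have inn : ∀ x : E3, (t, ‖x‖) ∈ Uu P → deriv (fun s => deriv (fun r => GG g Ψ (r, ‖x‖)) s) t = DP (DP g) (t, ‖x‖) ∧
      lap (fun y => GG g Ψ (t, ‖y‖)) x = 3 * KK g (t, ‖x‖) + KK (KK g) (t, ‖x‖) * ‖x‖ ^ 2 := by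
    intro x hx
    constructor
    · unfold DP
      refine EventuallyEq.deriv_eq ?_
      filter_upwards [slice_p (Uu_open P) hx] with s hs
      refine EventuallyEq.deriv_eq ?_
      filter_upwards [slice_p (Uu_open P) hs] with s' hs' using gU _ hs'
    · have hq := has_q (Uu_open P) k1 hx
      rw [l3 _ hx] at hq
      refine lap_rad (f := fun s => GG g Ψ (t, s)) (κ := fun s => KK g (t, s)) ?_ hq
      filter_upwards [slice_q (Uu_open P) hx] with s hs
      rw [← k3 _ hs]
      refine (has_q (Uu_open P) hg hs).congr_of_eventuallyEq ?_
      filter_upwards [slice_q (Uu_open P) hs] with s' hs' using gU _ hs'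
  have h0 := mU t h1 h2
  rw [(inn 0 h0).1, (inn 0 h0).2, gU _ h0]
  have cs : ∀ {f : ℝℝ → ℝ}, CDOn f (Uu P) → Tendsto (fun s => f (t, s)) (𝓝[>] ‖(0 : E3)‖) (𝓝 (f (t, ‖(0 : E3)‖))) := fun hf =>
    ((has_q (Uu_open P) hf h0).continuousAt.tendsto).mono_left nhdsWithin_le_nhds
  have ti : Tendsto (fun s : ℝ => s) (𝓝[>] ‖(0 : E3)‖) (𝓝 ‖(0 : E3)‖) := tendsto_id.mono_left nhdsWithin_le_nhds
  refine tendsto_nhds_unique_of_eventuallyEq (cs (DP_smooth (Uu_open P) (DP_smooth (Uu_open P) hg)))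
    ((((cs k1).const_mul 3).add ((cs l1).mul (ti.pow 2))).add ((cs hg).pow 5)) ?_
  filter_upwards [self_mem_nhdsWithin, (slice_q (Uu_open P) h0).filter_mono nhdsWithin_le_nhds] with s hs1 hs2
  rw [norm_zero] at hs1
  have hs1 : 0 < s := hs1
  have en : ‖EuclideanSpace.single (0 : Fin 3) s‖ = s := by simp [abs_of_pos hs1]
  have hs3 := hs2
  rw [← en] at hs3
  have h4 := hs2.1
  have h5 := hs2.2
  rw [norm_zero] at h3
  simp only [abs_of_pos hs1] at h4 h5
  have := pne t (EuclideanSpace.single 0 s) (fun h => by rw [h, norm_zero] at en; linarith) (by rw [en]; linarith) (by rw [en]; linarith)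
    (by rw [en]; linarith)
  rw [(inn _ hs3).1, (inn _ hs3).2, gU _ hs3, en] at this
  exact this

section

lemma ker_int {b D α β : ℝ} (hb : 0 < b) (hD : 0 ≤ D) (hβ : 0 ≤ β) :
    IntervalIntegrable (fun x => α + β * (b / (b + x) ^ 2)) volume 0 D ∧ ∫ x in (0:ℝ)..D, (α + β * (b / (b + x) ^ 2)) ≤ α * D + β := by
  have pos : ∀ x ∈ Set.uIcc 0 D, 0 < b + x := fun x hx => by rw [Set.uIcc_of_le hD] at hx; linarith [hx.1]
  have hi : IntervalIntegrable (fun x => α + β * (b / (b + x) ^ 2)) volume 0 D :=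
    ContinuousOn.intervalIntegrable (continuousOn_const.add (continuousOn_const.mul (continuousOn_const.div (by fun_prop) fun x hx => (pow_pos (pos x hx) 2).ne')))
  refine ⟨hi, ?_⟩
  rw [intervalIntegral.integral_eq_sub_of_hasDerivAt (f := fun x => α * x - β * (b / (b + x))) (fun x hx => ?_) hi]
  · have h1 : 0 ≤ b / (b + D) := by positivity
    simp [hb.ne']; nlinarith
  · have h := pos x hx
    refine (((hasDerivAt_id x).const_mul α).sub (((hasDerivAt_const x b).div ((hasDerivAt_id x).const_add b) h.ne').const_mul β)).congr_deriv ?_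
    simp; field_simp; ring

lemma ker_bd {b D C : ℝ} (hb : 0 < b) (hD : 0 ≤ D) (hC : 0 ≤ C) {f : ℝ → ℝ} (hf : ∀ x ∈ Set.Ioc 0 D, |f x| ≤ C * (5 + b / (b + x) ^ 2)) :
    |∫ x in (0:ℝ)..D, f x| ≤ C * (5 * D + 1) := by
  obtain ⟨h1, h2⟩ := ker_int (α := C * 5) hb hD hC
  have := intervalIntegral.norm_integral_le_of_norm_le (f := f) hD (Eventually.of_forall fun x hx => (hf x hx).trans_eq (by ring)) h1
  rw [Real.norm_eq_abs] at this
  linarith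

variable {m : ℕ} {μ : ℝ → ℝ} {z : ℝ → ℝ → ℝ}

lemma gg_bd (h : Adm m μ) (hm : 1 ≤ m) (hz : IsSol m μ z) {p q : ℝ} (hq : 0 < q) (hqp : q ≤ p) (hp : p < TT m) :
    |(p - q) * gg μ z p q| ≤ (Ce m + CL m) * (1 + q ^ (2 * m) / ((q ^ (2 * m)) ^ 2 + (p - q) ^ 2)) := by
  have hp0 := hq.trans_le hqp
  have hp1 : p ≤ 1 := by linarith [TT_le m]
  have hR := RR_pos m
  have hz1 : |z p q| ≤ 1 := by
    have h1 : p ^ (3 * m - 2) ≤ p := pow_le_of_le_one hp0.le hp1 (by omega)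
    have h2 : TT m ≤ 1 / RR m := (min_le_right _ _).trans (min_le_right _ _)
    rw [le_div_iff₀ hR] at h2
    nlinarith [hz.bd p q hq hqp hp]
  have hA := AA_pos h hp0 hq
  have hU := UU_pos (m := m) hq hqp
  have e1 := e_le h hm hq hqp hp1
  have e2 : |(AA μ p q + z p q) ^ 5 - AA μ p q ^ 5| ≤ CL m * UU m p q := by
    refine (pow5_lip (B := AA μ p q + 1) ?_ ?_).trans ?_
    · exact (abs_add_le _ _).trans (by rw [abs_of_pos hA]; linarith)
    · rw [abs_of_pos hA]; linarith
    · rw [add_sub_cancel_left]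
      exact (mul_le_of_le_one_right (by positivity) hz1).trans (L_le h hm hq hqp hp1)
  have e3 : Ce m * p ^ (3 * m - 2) * UU m p q ≤ Ce m * UU m p q :=
    mul_le_mul_of_nonneg_right (mul_le_of_le_one_right (Ce_pos m).le (pow_le_one₀ hp0.le hp1)) hU.le
  have e4 : |gg μ z p q| ≤ (Ce m + CL m) * UU m p q := (abs_sub _ _).trans (by linarith)
  have hd : 0 ≤ p - q := by linarith
  rw [abs_mul, abs_of_nonneg hd]
  refine (mul_le_mul_of_nonneg_left e4 hd).trans ?_
  rw [mul_left_comm]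
  refine mul_le_mul_of_nonneg_left ?_ (add_pos (Ce_pos m) (CL_pos m)).le
  have ha : 0 < q ^ (2 * m) := by positivity
  unfold UU
  set a := q ^ (2 * m)
  have hS : 0 < a ^ 2 + (p - q) ^ 2 := by positivity
  set N := √(a ^ 2 + (p - q) ^ 2) with hN
  have hN0 : 0 < N := sqrt_pos.2 hS
  have hdN : (p - q) * N⁻¹ ≤ 1 := by
    rw [← div_eq_mul_inv, div_le_one hN0]; exact le_sqrt_of_sq_le (by nlinarith)
  have e5 : (p - q) * p⁻¹ ≤ 1 := by rw [← div_eq_mul_inv, div_le_one hp0]; linarith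
  have e6 : a / (a ^ 2 + (p - q) ^ 2) = a * N⁻¹ ^ 2 := by rw [inv_pow, hN, sq_sqrt hS.le]; rfl
  rw [e6]
  have : 0 ≤ a * N⁻¹ ^ 2 := by positivity
  nlinarith

lemma w_bd (h : Adm m μ) (hm : 1 ≤ m) (hz : IsSol m μ z) : ∃ C, ∀ p q, 0 < q → q ≤ p → p < TT m →
    |JJ μ z p q| ≤ C ∧ |∫ q' in q..p, (p - q') * gg μ z p q'| ≤ C := by
  set K := Ce m + CL m with hK
  have hK0 : 0 < K := add_pos (Ce_pos m) (CL_pos m)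
  have k16 : (1:ℝ) ≤ 16 ^ m := one_le_pow₀ (by norm_num)
  refine ⟨K * (2 * 16 ^ m) * (5 * 1 + 1), fun p q hq hqp hp => ?_⟩
  have hp0 := hq.trans_le hqp
  have hp1 : p ≤ 1 := by linarith [TT_le m]
  have fin : ∀ {f : ℝ → ℝ} {b : ℝ}, 0 < b → (∀ x ∈ Set.Ioc 0 (p - q), |f x| ≤ K * (2 * 16 ^ m) * (5 + b / (b + x) ^ 2)) →
      |∫ x in (0:ℝ)..(p - q), f x| ≤ K * (2 * 16 ^ m) * (5 * 1 + 1) := fun hb hf =>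
    (ker_bd hb (by linarith) (by positivity) hf).trans (by gcongr; linarith)
  have two : ∀ b x : ℝ, 0 < b → 0 ≤ x → b / (b ^ 2 + x ^ 2) ≤ 2 * (b / (b + x) ^ 2) := fun b x hb hx => by
    rw [← mul_div_assoc, div_le_div_iff₀ (by positivity) (by positivity)]
    nlinarith [mul_nonneg hb.le (sq_nonneg (b - x))]
  constructor
  · have e : JJ μ z p q = ∫ x in (0:ℝ)..(p - q), x * gg μ z (x + q) q := by
      have := intervalIntegral.integral_comp_add_right (a := 0) (b := p - q) (fun p' => (p' - q) * gg μ z p' q) q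
      simp only [add_sub_cancel_right, zero_add, sub_add_cancel] at this
      exact this.symm
    rw [e]
    refine fin (b := q ^ (2 * m)) (by positivity) fun x hx => ?_
    have h1 := gg_bd h hm hz hq (by linarith [hx.1] : q ≤ x + q) (by linarith [hx.2])
    rw [add_sub_cancel_right] at h1
    have h2 := two (q ^ (2 * m)) x (by positivity) hx.1.le
    have h3 : 0 ≤ q ^ (2 * m) / (q ^ (2 * m) + x) ^ 2 := by positivity
    refine h1.trans ?_
    rw [mul_assoc]
    refine mul_le_mul_of_nonneg_left ?_ hK0.le
    nlinarith
  · have e : ∫ q' in q..p, (p - q') * gg μ z p q' = ∫ x in (0:ℝ)..(p - q), x * gg μ z p (p - x) := by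
      have := intervalIntegral.integral_comp_sub_left (a := 0) (b := p - q) (fun q' => (p - q') * gg μ z p q') p
      simpa using this.symm
    rw [e]
    refine fin (b := p ^ (2 * m)) (by positivity) fun x hx => ?_
    have hx0 : 0 < p - x := by linarith [hx.2]
    have h1 := gg_bd h hm hz hx0 (by linarith [hx.1] : p - x ≤ p) hp
    rw [sub_sub_cancel] at h1
    have h3 : 0 ≤ p ^ (2 * m) / (p ^ (2 * m) + x) ^ 2 := by positivity
    have hle : (p - x) ^ (2 * m) ≤ p ^ (2 * m) := pow_le_pow_left₀ hx0.le (by linarith [hx.1]) _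
    refine h1.trans ?_
    rw [mul_assoc]
    refine mul_le_mul_of_nonneg_left ?_ hK0.le
    rcases le_or_gt p (2 * (p - x)) with hc | hc
    · have h2 := two (p ^ (2 * m)) x (by positivity) hx.1.le
      have h4 : p ^ (2 * m) ≤ 4 ^ m * (p - x) ^ (2 * m) := by
        have := pow_le_pow_left₀ hp0.le hc (2 * m)
        rwa [mul_pow, pow_mul 2, show (2:ℝ) ^ 2 = 4 by norm_num] at this
      have h5 : (p - x) ^ (2 * m) / (((p - x) ^ (2 * m)) ^ 2 + x ^ 2) ≤ 16 ^ m * (p ^ (2 * m) / ((p ^ (2 * m)) ^ 2 + x ^ 2)) := by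
        have hp2 : 0 < p ^ (2 * m) := by positivity
        have hq2 : 0 < (p - x) ^ (2 * m) := by positivity
        have hx1 := hx.1
        rw [← mul_div_assoc, div_le_div_iff₀ (by positivity) (by positivity)]
        have h6 : (p ^ (2 * m)) ^ 2 ≤ 16 ^ m * ((p - x) ^ (2 * m)) ^ 2 := by
          have := pow_le_pow_left₀ hp2.le h4 2
          rwa [mul_pow, show ((4:ℝ) ^ m) ^ 2 = 16 ^ m by rw [← pow_mul, mul_comm, pow_mul]; norm_num] at this
        have h7 : (p ^ (2 * m)) ^ 2 + x ^ 2 ≤ 16 ^ m * (((p - x) ^ (2 * m)) ^ 2 + x ^ 2) := by nlinarith [sq_nonneg x]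
        calc _ ≤ p ^ (2 * m) * (16 ^ m * (((p - x) ^ (2 * m)) ^ 2 + x ^ 2)) := by gcongr
          _ = _ := by ring
      nlinarith
    · have h4 : (p - x) ^ (2 * m) / (((p - x) ^ (2 * m)) ^ 2 + x ^ 2) ≤ 4 := by
        have hx1 := hx.1
        rw [div_le_iff₀ (by positivity)]
        have : p ^ (2 * m) ≤ p ^ 2 := pow_le_pow_of_le_one hp0.le hp1 (by omega)
        nlinarith [sq_nonneg ((p - x) ^ (2 * m))]
      nlinarith

lemma z_bd (hm : 1 ≤ m) (h : Adm m μ) (hμ : Sym m μ) (hz : IsSol m μ z) : ∃ C, 0 ≤ C ∧ ∀ t r, 0 < r → r < t → t + r < TT m →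
    ∃ L : ℝℝ →L[ℝ] ℝ, HasFDerivAt (fun x : ℝℝ => z x.1 x.2) L (t + r, t - r) ∧ |r * L (1, 0)| ≤ C ∧ |r * L (0, 1)| ≤ C := by
  obtain ⟨C, hC⟩ := w_bd h hm hz
  have hR := RR_pos m
  refine ⟨|C| + RR m, by positivity, fun t r h0 h1 h2 => ?_⟩
  have hp : t + r ∈ Set.Ioo 0 (TT m) := ⟨by linarith, h2⟩
  have hq : t - r ∈ Set.Ioo 0 (TT m) := ⟨by linarith, by linarith⟩
  have hx : (t + r, t - r) ∈ Set.Ioo 0 (TT m) ×ˢ Set.Ioo 0 (TT m) := ⟨hp, hq⟩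
  have hO : IsOpen (Set.Ioo 0 (TT m) ×ˢ Set.Ioo 0 (TT m)) := isOpen_Ioo.prod isOpen_Ioo
  have zs := z_smooth hm h hμ hz
  obtain ⟨c1, c2⟩ := hC (t + r) (t - r) hq.1 (by linarith) h2
  have zb : |z (t + r) (t - r)| ≤ RR m := (hz.bd _ _ hq.1 (by linarith) h2).trans
    (mul_le_of_le_one_right hR.le (pow_le_one₀ hp.1.le (by linarith [TT_le m])))
  refine ⟨_, ((zs.contDiffAt (hO.mem_nhds hx)).differentiableAt (by simp)).hasFDerivAt, ?_, ?_⟩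
  · have e := (((hasDerivAt_id (t + r)).sub_const (t - r)).mul (has_p hO zs hx)).unique (w_has_p h hz hp hq)
    simp only [id, one_mul] at e
    rw [show r * _ = (1 / 4 * (∫ q' in (t - r)..(t + r), (t + r - q') * gg μ z (t + r) q') - z (t + r) (t - r)) / 2 by rw [← e]; ring,
      abs_div, abs_of_pos (by norm_num : (0:ℝ) < 2), div_le_iff₀ (by norm_num)]
    refine (abs_sub _ _).trans ?_
    rw [abs_mul, abs_of_pos (by norm_num : (0:ℝ) < 1 / 4)]
    linarith [le_abs_self C, abs_nonneg C]
  · have e := (((hasDerivAt_id (t - r)).const_sub (t + r)).mul (has_q hO zs hx)).unique (w_has_q h hz hp hq)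
    simp only [id] at e
    rw [show r * _ = (-(1 / 4) * JJ μ z (t + r) (t - r) - -z (t + r) (t - r)) / 2 by rw [← e]; ring,
      abs_div, abs_of_pos (by norm_num : (0:ℝ) < 2), div_le_iff₀ (by norm_num)]
    refine (abs_sub _ _).trans ?_
    rw [abs_mul, abs_neg, abs_neg, abs_of_pos (by norm_num : (0:ℝ) < 1 / 4)]
    linarith [le_abs_self C, abs_nonneg C]

end

section

def Nf (M R : ℝ) : ℝ := (√(M ^ 4 + 3 * R ^ 2))⁻¹
def Bf (M R : ℝ) : ℝ := √3 * M * Nf M R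

lemma Nf_spec {M : ℝ} (R : ℝ) (hM : 0 < M) : 0 < Nf M R ∧ (M ^ 4 + 3 * R ^ 2) * Nf M R ^ 2 = 1 := by
  have h : 0 < M ^ 4 + 3 * R ^ 2 := by positivity
  refine ⟨inv_pos.2 (sqrt_pos.2 h), ?_⟩
  rw [Nf, inv_pow, sq_sqrt h.le, mul_inv_cancel₀ h.ne']

lemma Nf_has {M R : ℝ → ℝ} {M' R' s : ℝ} (h1 : HasDerivAt M M' s) (h2 : HasDerivAt R R' s) (h0 : 0 < M s) :
    HasDerivAt (fun s => Nf (M s) (R s)) (-(Nf (M s) (R s) ^ 3 * (2 * M s ^ 3 * M' + 3 * R s * R'))) s :=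
  (NN_has ((h1.pow 4).add ((h2.pow 2).const_mul 3)) (by simp only [Pi.add_apply, Pi.pow_apply]; positivity)).congr_deriv
    (by simp [Nf]; ring)

lemma Bf_has {M R : ℝ → ℝ} {M' R' s : ℝ} (h1 : HasDerivAt M M' s) (h2 : HasDerivAt R R' s) (h0 : 0 < M s) :
    HasDerivAt (fun s => Bf (M s) (R s)) (√3 * Nf (M s) (R s) ^ 3 * M' * (3 * R s ^ 2 - M s ^ 4) - 3 * √3 * M s * R s * R' * Nf (M s) (R s) ^ 3) s :=
  ((h1.const_mul √3).mul (Nf_has h1 h2 h0)).congr_deriv (by linear_combination (-(√3 * M' * Nf (M s) (R s))) * (Nf_spec (R s) h0).2)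

lemma Bf_t {M r : ℝ} (M' : ℝ) (hM : 0 < M) (hr : 0 < r) : |r * (√3 * Nf M r ^ 3 * M' * (3 * r ^ 2 - M ^ 4))| ≤ |M'| := by
  obtain ⟨hN, h⟩ := Nf_spec r hM
  have s3 : √3 ^ 2 = 3 := sq_sqrt (by norm_num)
  have a1 : |√3 * r * Nf M r| ≤ 1 := by
    rw [← sq_le_one_iff_abs_le_one, mul_pow, mul_pow, s3]
    nlinarith [mul_pos (pow_pos hM 4) (pow_pos hN 2)]
  have a2 : |(3 * r ^ 2 - M ^ 4) * Nf M r ^ 2| ≤ 1 :=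
    abs_le.2 ⟨by nlinarith [mul_pos (pow_pos hr 2) (pow_pos hN 2)], by nlinarith [mul_pos (pow_pos hM 4) (pow_pos hN 2)]⟩
  rw [show r * (√3 * Nf M r ^ 3 * M' * (3 * r ^ 2 - M ^ 4)) = (√3 * r * Nf M r) * ((3 * r ^ 2 - M ^ 4) * Nf M r ^ 2) * M' by ring, abs_mul, abs_mul]
  exact mul_le_of_le_one_left (abs_nonneg _) (mul_le_one₀ a1 (abs_nonneg _) a2)

lemma Bf_r {a M r : ℝ} (ha : 0 < a) (hM : 3 / 8 * a ≤ M) (hr : 0 < r) :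
    |3 * √3 * M * r ^ 2 * Nf M r ^ 3 - 3 * √3 * a * r ^ 2 * Nf a r ^ 3| ≤ 150 / (a ^ 2 + r) * |M - a| := by
  have s3 : √3 ^ 2 = 3 := sq_sqrt (by norm_num)
  have s0 : 0 < √3 := by positivity
  have hd : ∀ x ∈ Set.Ici (3 / 8 * a), HasDerivWithinAt (fun x => 3 * √3 * x * r ^ 2 * Nf x r ^ 3)
      (√3 * (3 * r ^ 2 * Nf x r ^ 2) * (Nf x r * (1 - 6 * (x ^ 4 * Nf x r ^ 2)))) (Set.Ici (3 / 8 * a)) x := fun x hx => by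
    have hx0 : 0 < x := lt_of_lt_of_le (by positivity) hx
    refine (((((hasDerivAt_id x).const_mul (3 * √3)).mul_const (r ^ 2)).mul
      ((Nf_has (hasDerivAt_id x) (hasDerivAt_const x r) hx0).pow 3)).congr_deriv ?_).hasDerivWithinAt
    simp; ring
  refine Convex.norm_image_sub_le_of_norm_hasDerivWithin_le hd (fun x hx => ?_) (convex_Ici _) (by simp; linarith) hM
  have hx : 3 / 8 * a ≤ x := hx
  have hx0 : 0 < x := lt_of_lt_of_le (by positivity) hx
  obtain ⟨hN, h⟩ := Nf_spec r hx0
  have b1 := mul_pos (pow_pos hx0 4) (pow_pos hN 2)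
  have b2 := mul_pos (pow_pos hr 2) (pow_pos hN 2)
  have b3 : Nf x r * (a ^ 2 + r) ≤ 15 := by
    refine abs_le_of_sq_le_sq' ?_ (by norm_num) |>.2
    have : (3 / 8 * a) ^ 4 ≤ x ^ 4 := by gcongr
    have h4 : (a ^ 2 + r) ^ 2 ≤ 225 * (x ^ 4 + 3 * r ^ 2) := by nlinarith [sq_nonneg (a ^ 2 - r), sq_nonneg r, pow_pos ha 4]
    nlinarith [mul_le_mul_of_nonneg_right h4 (pow_pos hN 2).le]
  have b4 : |1 - 6 * (x ^ 4 * Nf x r ^ 2)| ≤ 5 := abs_le.2 ⟨by nlinarith, by nlinarith⟩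
  have b5 : Nf x r ≤ 15 / (a ^ 2 + r) := by rwa [le_div_iff₀ (by positivity)]
  rw [Real.norm_eq_abs, abs_mul, abs_mul √3, abs_mul (Nf x r), abs_of_pos s0, abs_of_pos hN, abs_of_pos (by positivity : 0 < 3 * r ^ 2 * Nf x r ^ 2)]
  calc _ ≤ 2 * 1 * (15 / (a ^ 2 + r) * 5) := by
        gcongr
        · nlinarith
        · nlinarith
    _ = _ := by ring

variable {m : ℕ} {μ : ℝ → ℝ} {z : ℝ → ℝ → ℝ}

lemma AA_Bf (s R : ℝ) : AA μ (s + R) (s - R) = Bf (MM μ (s + R) (s - R)) R := by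
  simp only [AA, NN, DD, Bf, Nf]
  rw [show 3 / 4 * (s + R - (s - R)) ^ 2 = 3 * R ^ 2 by ring]

lemma M_bd (hs : Sym ((m:ℝ) + 1 / 4) (fun t => μ t - t ^ m)) : ∃ C, 0 ≤ C ∧ ∀ t r, 0 ≤ r → r < t → t + r ≤ 1 →
    |MM μ (t + r) (t - r) - t ^ m| ≤ C * t ^ m * t ^ (1 / 4 : ℝ) + m * r := by
  obtain ⟨C, hC⟩ := hs.bd 0
  refine ⟨|C| * 2 ^ ((m:ℝ) + 1 / 4), by positivity, fun t r h0 h1 h2 => ?_⟩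
  have ht : 0 < t := by linarith
  have key : ∀ s, 0 < s → s ≤ 2 * t → s ≤ 1 → |s - t| ≤ r → |μ s - t ^ m| ≤ |C| * 2 ^ ((m:ℝ) + 1 / 4) * t ^ m * t ^ (1 / 4 : ℝ) + m * r := by
    intro s k0 k1 k2 k3
    have a1 := hC s k0 k2
    simp only [iteratedDeriv_zero, Nat.cast_zero, sub_zero] at a1
    have a2 : C * s ^ ((m:ℝ) + 1 / 4) ≤ |C| * 2 ^ ((m:ℝ) + 1 / 4) * t ^ m * t ^ (1 / 4 : ℝ) := by
      rw [mul_assoc _ (t ^ m), ← rpow_natCast t, ← rpow_add ht, mul_assoc, ← Real.mul_rpow (by norm_num) ht.le]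
      gcongr; exact le_abs_self C
    have a3 : |s ^ m - t ^ m| ≤ m * r := by
      refine (abs_pow_sub_pow_le _ _ _).trans ?_
      have : max |s| |t| ^ (m - 1) ≤ 1 := pow_le_one₀ (by positivity) (by rw [abs_of_pos k0, abs_of_pos ht]; exact max_le k2 (by linarith))
      calc _ ≤ r * m * 1 := by gcongr
        _ = _ := by ring
    rw [show μ s - t ^ m = (μ s - s ^ m) + (s ^ m - t ^ m) by ring]
    exact (abs_add_le _ _).trans (by linarith)
  have e1 := abs_le.1 (key (t + r) (by linarith) (by linarith) h2 (by rw [abs_of_nonneg] <;> linarith))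
  have e2 := abs_le.1 (key (t - r) (by linarith) (by linarith) (by linarith) (by rw [abs_of_nonpos] <;> linarith))
  unfold MM
  exact abs_le.2 ⟨by linarith [e1.1, e2.1], by linarith [e1.2, e2.2]⟩

set_option maxHeartbeats 1000000 in
lemma E_bd (hm : 1 ≤ m) (h : Adm m μ) (hμ : Sym m μ) (hs : Sym ((m:ℝ) + 1 / 4) (fun t => μ t - t ^ m)) (hz : IsSol m μ z) :
    ∃ C, 0 ≤ C ∧ ∀ t r, 0 < r → r < t → t + r < TT m → ∃ a c,
      HasDerivAt (fun s => AA μ (s + r) (s - r) + z (s + r) (s - r) - Bf (s ^ m) r) a t ∧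
      HasDerivAt (fun s => AA μ (t + s) (t - s) + z (t + s) (t - s) - Bf (t ^ m) s) c r ∧
      r ^ 2 * (a ^ 2 + c ^ 2) ≤ C * (1 + (t ^ (1 / 4 : ℝ)) ^ 2 * ((t ^ m) ^ 2 / ((t ^ m) ^ 2 + r) ^ 2)) := by
  obtain ⟨C, hC, hzb⟩ := z_bd hm h hμ hz
  obtain ⟨C', hC', hMb⟩ := M_bd hs
  set K := 2 * (m:ℝ) + 1 + 2 * C + 150 * m with hK
  refine ⟨3 * K ^ 2 + 2 * (150 * C') ^ 2, by positivity, fun t r h0 h1 h2 => ?_⟩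
  have ht : 0 < t := by linarith
  have hp1 : t + r ≤ 1 := by linarith [TT_le m]
  have hp : 0 < t + r := by linarith
  have hq : 0 < t - r := by linarith
  obtain ⟨L, hL, l1, l2⟩ := hzb t r h0 h1 h2
  have hM := MM_pos h hp hq
  have hM2 : 3 / 8 * t ^ m ≤ MM μ (t + r) (t - r) := by
    have e1 := h.lo hp
    have e2 := h.lo hq
    have : t ^ m ≤ (t + r) ^ m := by gcongr; linarith
    have : 0 < (t - r) ^ m := by positivity
    unfold MM; linarith
  have ha : 0 < t ^ m := by positivity
  have dμ : ∀ q, 0 < q → q ≤ t + r → |deriv μ q| ≤ m + 1 := fun q k1 k2 => by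
    have := p_deriv_le h hm k1 k2
    have e : (t + r) ^ m ≤ t + r := pow_le_of_le_one hp.le hp1 (by omega)
    exact le_of_mul_le_mul_left (this.trans (by nlinarith [(Nat.cast_nonneg m : (0:ℝ) ≤ m)])) hp
  have d1 := dμ _ hp le_rfl
  have d2 := dμ _ hq (by linarith)
  have P1 : HasDerivAt (fun s => s + r) 1 t := (hasDerivAt_id t).add_const r
  have P2 : HasDerivAt (fun s => s - r) 1 t := (hasDerivAt_id t).sub_const r
  have Q1 : HasDerivAt (fun s => t + s) 1 r := (hasDerivAt_id r).const_add t
  have Q2 : HasDerivAt (fun s => t - s) (-1) r := (hasDerivAt_id r).const_sub t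
  have D1 : HasDerivAt (fun s => MM μ (s + r) (s - r)) _ t :=
    (((h.hasDeriv hp).comp t P1).add ((h.hasDeriv hq).comp t P2)).div_const 2
  have D2 : HasDerivAt (fun s => MM μ (t + s) (t - s)) _ r :=
    (((h.hasDeriv hp).comp r Q1).add ((h.hasDeriv hq).comp r Q2)).div_const 2
  have B1 := (((Bf_has D1 (hasDerivAt_const t r) hM).add (hL.comp_hasDerivAt t (P1.prodMk P2))).sub
    (Bf_has (hasDerivAt_pow m t) (hasDerivAt_const t r) ha))
  have B2 := (((Bf_has D2 (hasDerivAt_id r) hM).add (hL.comp_hasDerivAt r (Q1.prodMk Q2))).sub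
    (Bf_has (hasDerivAt_const r (t ^ m)) (hasDerivAt_id r) ha))
  simp only [AA_Bf]
  refine ⟨_, _, B1, B2, ?_⟩
  have b1 := Bf_t ((deriv μ (t + r) * 1 + deriv μ (t - r) * 1) / 2) hM h0
  have b2 := Bf_t ((deriv μ (t + r) * 1 + deriv μ (t - r) * -1) / 2) hM h0
  have b3 := Bf_t ((m:ℝ) * t ^ (m - 1)) ha h0
  have b4 := Bf_r ha hM2 h0
  have b5 := hMb t r h0.le h1 hp1
  have c1 : |(deriv μ (t + r) * 1 + deriv μ (t - r) * 1) / 2| ≤ m + 1 := by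
    rw [abs_le] at d1 d2 ⊢; constructor <;> linarith [d1.1, d1.2, d2.1, d2.2]
  have c2 : |(deriv μ (t + r) * 1 + deriv μ (t - r) * -1) / 2| ≤ m + 1 := by
    rw [abs_le] at d1 d2 ⊢; constructor <;> linarith [d1.1, d1.2, d2.1, d2.2]
  have c3 : |(m:ℝ) * t ^ (m - 1)| ≤ m := by
    rw [abs_of_nonneg (by positivity)]
    exact mul_le_of_le_one_right (by positivity) (pow_le_one₀ ht.le (by linarith))
  have f1 : L (1, 1) = L (1, 0) + L (0, 1) := by rw [← map_add]; simp
  have f2 : L (1, -1) = L (1, 0) - L (0, 1) := by rw [← map_sub]; simp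
  set v := t ^ (1 / 4 : ℝ)
  set a := t ^ m
  set w := a / (a ^ 2 + r) with hw
  have hv : 0 ≤ v := by positivity
  have hw0 : 0 < w := by positivity
  have c4 : 150 / (a ^ 2 + r) * |MM μ (t + r) (t - r) - a| ≤ 150 * C' * (v * w) + 150 * m := by
    refine (mul_le_mul_of_nonneg_left b5 (by positivity)).trans ?_
    have : r / (a ^ 2 + r) ≤ 1 := by rw [div_le_one (by positivity)]; nlinarith
    calc _ = 150 * C' * (v * w) + 150 * m * (r / (a ^ 2 + r)) := by rw [hw]; ring
      _ ≤ _ := by nlinarith [(Nat.cast_nonneg m : (0:ℝ) ≤ m)]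
  rw [show a ^ 2 / (a ^ 2 + r) ^ 2 = w ^ 2 by rw [hw, div_pow]]
  have g1 := abs_le.1 (b1.trans c1)
  have g2 := abs_le.1 (b2.trans c2)
  have g3 := abs_le.1 (b3.trans c3)
  have g4 := abs_le.1 (b4.trans c4)
  rw [abs_le] at l1 l2
  have sq : ∀ {x y u : ℝ}, |r * x| ≤ K → |r * y| ≤ K + u → r ^ 2 * (x ^ 2 + y ^ 2) ≤ 3 * K ^ 2 + 2 * u ^ 2 := fun {x y u} k1 k2 => by
    have := sq_le_sq.2 (k1.trans (le_abs_self _))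
    have := sq_le_sq.2 (k2.trans (le_abs_self _))
    nlinarith [sq_nonneg (K - u)]
  have hm0 : (0:ℝ) ≤ m := Nat.cast_nonneg m
  refine (sq (u := 150 * C' * (v * w)) ?_ ?_).trans ?_
  · simp only [f1]
    rw [abs_le]; constructor <;> linarith [g1.1, g1.2, g3.1, g3.2, l1.1, l1.2, l2.1, l2.2]
  · simp only [f2, id]
    rw [abs_le]; constructor <;> linarith [g2.1, g2.2, g4.1, g4.2, l1.1, l1.2, l2.1, l2.2]
  · have := mul_nonneg (sq_nonneg K) (mul_nonneg (sq_nonneg v) (sq_nonneg w))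
    nlinarith [sq_nonneg (150 * C')]

lemma int_bd : ∃ V, 0 ≤ V ∧ ∀ {t α β b : ℝ} {F : E3 → ℝ}, 0 < t → 0 < b → 0 ≤ α → 0 ≤ β → (∀ x, 0 ≤ F x) →
    (∀ x, x ≠ 0 → ‖x‖ < t → ‖x‖ ^ 2 * F x ≤ α + β * (b / (b + ‖x‖) ^ 2)) → ∫ x in {x : E3 | ‖x‖ < t}, F x ≤ V * (α * t + β) := by
  refine ⟨3 * (volume : Measure E3).real (Metric.ball 0 1), by positivity, fun {t α β b F} ht hb hα hβ h0 hF => ?_⟩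
  set k : ℝ → ℝ := fun x => α + β * (b / (b + x) ^ 2)
  set f : ℝ → ℝ := (Set.Ioc 0 t).indicator (fun x => k x / x ^ 2)
  obtain ⟨i1, i2⟩ := ker_int (α := α) hb ht.le hβ
  have e : ∀ y ∈ Set.Ioi (0:ℝ), y ^ (Module.finrank ℝ E3 - 1) • f y = (Set.Ioc 0 t).indicator k y := fun y hy => by
    have hy : y ≠ 0 := ne_of_gt hy
    simp only [finrank_euclideanSpace, Fintype.card_fin, f, Set.indicator, smul_eq_mul]
    split_ifs
    · norm_num; field_simp
    · simp
  have hi : IntegrableOn ((Set.Ioc 0 t).indicator k) (Set.Ioi 0) :=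
    ((integrable_indicator_iff measurableSet_Ioc).2 ((intervalIntegrable_iff_integrableOn_Ioc_of_le ht.le).1 i1)).integrableOn
  have hI : Integrable (fun x : E3 => f ‖x‖) := (integrable_fun_norm_addHaar volume).2 (hi.congr_fun (fun y hy => (e y hy).symm) measurableSet_Ioi)
  have hS : MeasurableSet {x : E3 | ‖x‖ < t} := measurableSet_lt measurable_norm measurable_const
  rw [← integral_indicator hS]
  refine (integral_mono_of_nonneg (Eventually.of_forall fun x => Set.indicator_nonneg (fun y _ => h0 y) x) hI ?_).trans ?_
  · filter_upwards [compl_mem_ae_iff.2 (measure_singleton (0 : E3))] with x hx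
    have hx : x ≠ 0 := hx
    have hn := norm_pos_iff.2 hx
    by_cases hxt : ‖x‖ < t
    · rw [Set.indicator_of_mem (by exact hxt)]
      simp only [f]
      rw [Set.indicator_of_mem (show ‖x‖ ∈ Set.Ioc 0 t from ⟨hn, hxt.le⟩), le_div_iff₀ (by positivity), mul_comm]
      exact hF x hx hxt
    · rw [Set.indicator_of_notMem (by exact hxt)]
      exact Set.indicator_nonneg (fun y hy => by have := hy.1; simp only [k]; positivity) _
  · rw [integral_fun_norm_addHaar, setIntegral_congr_fun measurableSet_Ioi e, setIntegral_indicator measurableSet_Ioc,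
      Set.inter_eq_right.2 Set.Ioc_subset_Ioi_self, ← intervalIntegral.integral_of_le ht.le]
    simp only [finrank_euclideanSpace, Fintype.card_fin, nsmul_eq_mul, smul_eq_mul, ← mul_assoc]
    exact mul_le_mul_of_nonneg_left i2 (by positivity)

end

lemma Bf_scale {a : ℝ} (c R : ℝ) (ha : 0 < a) : Bf (a * c) (a ^ 2 * R) = a⁻¹ * Bf c R := by
  unfold Bf Nf
  rw [show (a * c) ^ 4 + 3 * (a ^ 2 * R) ^ 2 = (a ^ 2) ^ 2 * (c ^ 4 + 3 * R ^ 2) by ring, sqrt_mul (by positivity), sqrt_sq (by positivity), mul_inv]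
  field_simp

lemma W_eq (y : E3) : W y = Bf 1 ‖y‖ := by
  rw [W, Bf, Nf, rpow_neg (by positivity), ← sqrt_eq_rpow]; simp

lemma rp {t : ℝ} (ht : 0 < t) (m : ℕ) : t ^ (((m + m : ℕ) : ℝ) / 2) = t ^ m ∧ t ^ ((m + m : ℕ) : ℝ) = (t ^ m) ^ 2 := by
  rw [rpow_natCast, ← rpow_natCast t m]
  exact ⟨by congr 1; push_cast; ring, by rw [rpow_natCast]; ring⟩

lemma S_eq {s : ℝ} (hs : 0 < s) (m : ℕ) (x : E3) : singleSoliton ((m + m : ℕ) : ℝ) s x = Bf (s ^ m) ‖x‖ := by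
  have ha : 0 < s ^ m := by positivity
  have := Bf_scale (a := s ^ m) 1 (((s ^ m) ^ 2)⁻¹ * ‖x‖) ha
  rw [mul_one, mul_inv_cancel_left₀ (by positivity)] at this
  rw [singleSoliton, W_eq, neg_div, rpow_neg hs.le, rpow_neg hs.le, (rp hs m).1, (rp hs m).2, norm_smul, this, Real.norm_of_nonneg (by positivity)]
end SW

open SW Topology

/-- Smooth single-soliton singularity formation at quantised rates: for every even
integer `ν ≥ 2` there is a solution of `∂_t²φ = Δφ + φ⁵`, smooth on a full
neighbourhood `{0 < t + |x| < T, t - |x| > -δ}` of the punctured light cone (in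
particular smooth up to and across `{|x| = t}`), such that
(i) `t^{ν/2} φ(t, t^ν y) → W(y)` as `t → 0⁺` for every `y`, and
(ii) the localized energy distance to `S(t,x) = t^{-ν/2} W(t^{-ν}x)` vanishes as
`t → 0⁺`. -/
theorem stmt19 (ν : ℕ) (hν : 2 ≤ ν) (hev : Even ν) :
    ∃ T δ : ℝ, 0 < T ∧ 0 < δ ∧
    ∃ φ : ℝ → E3 → ℝ,
      ContDiffOn ℝ (⊤ : ℕ∞) (fun p : ℝ × E3 => φ p.1 p.2)
        {p : ℝ × E3 | 0 < p.1 + ‖p.2‖ ∧ p.1 + ‖p.2‖ < T ∧ -δ < p.1 - ‖p.2‖} ∧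
      (∀ (t : ℝ) (x : E3), 0 < t + ‖x‖ → t + ‖x‖ < T → -δ < t - ‖x‖ →
        deriv (fun s => deriv (fun r => φ r x) s) t
          = lap (fun y => φ t y) x + φ t x ^ 5) ∧
      (∀ y : E3,
        Tendsto (fun t : ℝ => t ^ ((ν : ℝ) / 2) * φ t (t ^ (ν : ℝ) • y))
          (nhdsWithin 0 (Set.Ioi 0)) (nhds (W y))) ∧
      Tendsto (fun t : ℝ =>
          ∫ x in {x : E3 | ‖x‖ < t},
            ((deriv (fun s => φ s x - singleSoliton (ν : ℝ) s x) t) ^ 2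
              + ‖gradient (fun y => φ t y - singleSoliton (ν : ℝ) t y) x‖ ^ 2))
        (nhdsWithin 0 (Set.Ioi 0)) (nhds 0) := by
  obtain ⟨m, rfl⟩ := hev
  have hm : 1 ≤ m := by omega
  obtain ⟨μ, hA, hμ, hs, z, hz, hb⟩ := exists_mu hm
  obtain ⟨P, δ, Ψ, hP, hPp, hδ, hΨ0, hΨ, hw⟩ := extension (P0_pos m) (P0_lt m) (P0_le m) (by linarith [C1_ge m]) (PS_wave hm hA hμ hz) hb
  have hPT : P ≤ TT m := hPp.trans (P0_lt m).le
  have hP1 : P ≤ 1 := by linarith [TT_le m]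
  set g : ℝ × ℝ → ℝ := fun x => AA μ (x.1 + x.2) (x.1 - x.2) + z (x.1 + x.2) (x.1 - x.2) with hgd
  have hg : ContDiffOn ℝ (⊤ : ℕ∞) g (Uu P) :=
    ((AA_smooth hA (TT m)).add (z_smooth hm hA hμ hz)).comp (f := fun x : ℝ × ℝ => (x.1 + x.2, x.1 - x.2)) (by fun_prop) fun x hx => by
      have h1 := hx.1
      have h2 := hx.2
      have h3 := abs_le.1 (le_refl |x.2|)
      exact ⟨⟨by dsimp only; linarith, by dsimp only; linarith⟩, by dsimp only; linarith, by dsimp only; linarith⟩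
  have he : ∀ t r, g (t, -r) = g (t, r) := fun t r => by
    simp only [hgd, sub_neg_eq_add, ← sub_eq_add_neg]; rw [AA_symm, hz.symm]
  obtain ⟨r1, r2⟩ := build hδ hg he hΨ hw fun t r h1 h2 h3 => by
    rw [hΨ0 _ ⟨by dsimp only; linarith, by dsimp only; linarith, h3⟩]
    simp only [PS, hgd]; ring
  refine ⟨P, δ, hP, hδ, fun t x => GG g Ψ (t, ‖x‖), r1, r2, fun y => ?_, ?_⟩
  · obtain ⟨C, hC, hM⟩ := M_bd hs
    have t0 : Tendsto (fun t : ℝ => t) (𝓝[>] 0) (𝓝 0) := tendsto_id.mono_left nhdsWithin_le_nhds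
    have tm : Tendsto (fun t : ℝ => t ^ m) (𝓝[>] 0) (𝓝 0) := by simpa [zero_pow (by omega : m ≠ 0)] using t0.pow m
    have tq : Tendsto (fun t : ℝ => t ^ (1 / 4 : ℝ)) (𝓝[>] 0) (𝓝 0) := by
      simpa using t0.rpow_const (p := (1 / 4 : ℝ)) (Or.inr (by norm_num))
    have ev : ∀ᶠ t : ℝ in 𝓝[>] 0, 0 < t ∧ (t ^ m) ^ 2 * ‖y‖ < t ∧ t + (t ^ m) ^ 2 * ‖y‖ < P := by
      have h1 : ∀ᶠ t : ℝ in 𝓝[>] 0, t * ‖y‖ < 1 := (t0.mul_const ‖y‖).eventually_lt_const (by simp)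
      filter_upwards [self_mem_nhdsWithin, h1, t0.eventually_lt_const (half_pos hP)] with t k0 k1 k2
      have k0 : 0 < t := k0
      have : t ^ m ≤ t := pow_le_of_le_one k0.le (by linarith) (by omega)
      have : (t ^ m) ^ 2 * ‖y‖ ≤ t ^ 2 * ‖y‖ := by gcongr
      have : t ^ 2 * ‖y‖ < t := by nlinarith
      exact ⟨k0, by linarith, by linarith⟩
    have T1 : Tendsto (fun t : ℝ => MM μ (t + (t ^ m) ^ 2 * ‖y‖) (t - (t ^ m) ^ 2 * ‖y‖) / t ^ m) (𝓝[>] 0) (𝓝 1) := by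
      rw [tendsto_iff_norm_sub_tendsto_zero]
      refine squeeze_zero' (g := fun t => C * t ^ (1 / 4 : ℝ) + m * (t ^ m * ‖y‖)) (Eventually.of_forall fun t => norm_nonneg _) ?_
        (by simpa using (tq.const_mul C).add ((tm.mul_const ‖y‖).const_mul (m:ℝ)))
      filter_upwards [ev] with t ⟨k0, k1, k2⟩
      have ha : 0 < t ^ m := by positivity
      rw [div_sub_one ha.ne', norm_div, Real.norm_eq_abs, Real.norm_of_nonneg ha.le, div_le_iff₀ ha]
      exact (hM t _ (by positivity) k1 (by linarith)).trans_eq (by ring)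
    have T2 : Tendsto (fun t : ℝ => t ^ m * z (t + (t ^ m) ^ 2 * ‖y‖) (t - (t ^ m) ^ 2 * ‖y‖)) (𝓝[>] 0) (𝓝 0) := by
      refine squeeze_zero_norm' (a := fun t => t ^ m * RR m) ?_ (by simpa using tm.mul_const (RR m))
      filter_upwards [ev] with t ⟨k0, k1, k2⟩
      have hr : 0 ≤ (t ^ m) ^ 2 * ‖y‖ := by positivity
      rw [norm_mul, Real.norm_of_nonneg (by positivity)]
      exact mul_le_mul_of_nonneg_left ((hz.bd _ _ (by linarith) (by linarith) (by linarith)).trans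
        (mul_le_of_le_one_right (RR_pos m).le (pow_le_one₀ (by linarith) (by linarith)))) (by positivity)
    have T3 := ((Bf_has (hasDerivAt_id (1:ℝ)) (hasDerivAt_const 1 ‖y‖) one_pos).continuousAt.tendsto.comp T1).add T2
    rw [add_zero, id, ← W_eq] at T3
    refine T3.congr' ?_
    filter_upwards [ev] with t ⟨k0, k1, k2⟩
    have ha : 0 < t ^ m := by positivity
    rw [(rp k0 m).1, (rp k0 m).2, norm_smul, Real.norm_of_nonneg (by positivity), GG, if_pos (by rwa [abs_of_nonneg (by positivity)])]
    simp only [hgd, AA_Bf, Function.comp_apply, id]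
    have := Bf_scale (MM μ (t + (t ^ m) ^ 2 * ‖y‖) (t - (t ^ m) ^ 2 * ‖y‖) / t ^ m) ‖y‖ ha
    rw [mul_div_cancel₀ _ ha.ne'] at this
    rw [this, mul_add, mul_inv_cancel_left₀ ha.ne']
  · obtain ⟨C, hC, hE⟩ := E_bd hm hA hμ hs hz
    obtain ⟨V, hV, hI⟩ := int_bd
    have t0 : Tendsto (fun t : ℝ => t) (𝓝[>] 0) (𝓝 0) := tendsto_id.mono_left nhdsWithin_le_nhds
    have tq : Tendsto (fun t : ℝ => t ^ (1 / 4 : ℝ)) (𝓝[>] 0) (𝓝 0) := by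
      simpa using t0.rpow_const (p := (1 / 4 : ℝ)) (Or.inr (by norm_num))
    refine squeeze_zero' (g := fun t => V * (C * t + C * (t ^ (1 / 4 : ℝ)) ^ 2)) (Eventually.of_forall fun t => integral_nonneg fun x => by positivity) ?_
      (by simpa using ((t0.const_mul C).add ((tq.pow 2).const_mul C)).const_mul V)
    filter_upwards [self_mem_nhdsWithin, t0.eventually_lt_const (half_pos hP)] with t k0 k1
    have k0 : 0 < t := k0
    refine hI (b := (t ^ m) ^ 2) k0 (by positivity) hC (by positivity) (fun x => by positivity) fun x hx hxt => ?_
    have hn := norm_pos_iff.2 hx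
    obtain ⟨a, c, ha, hc, hle⟩ := hE t ‖x‖ hn hxt (by linarith)
    have e1 : deriv (fun s => GG g Ψ (s, ‖x‖) - singleSoliton ((m + m : ℕ) : ℝ) s x) t = a := by
      refine (ha.congr_of_eventuallyEq ?_).deriv
      filter_upwards [lt_mem_nhds hxt] with s hs
      rw [S_eq (hn.trans hs), GG, if_pos (by rwa [abs_of_pos hn])]
    have e2 : ‖gradient (fun y => GG g Ψ (t, ‖y‖) - singleSoliton ((m + m : ℕ) : ℝ) t y) x‖ = |c| := by
      have h1 := rad1 (κ := c / ‖x‖) (x := x) (hc.congr_deriv (div_mul_cancel₀ _ hn.ne').symm)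
      have h2 : HasFDerivAt (fun y => GG g Ψ (t, ‖y‖) - singleSoliton ((m + m : ℕ) : ℝ) t y) _ x := h1.congr_of_eventuallyEq (by
        filter_upwards [continuous_norm.continuousAt.eventually_lt_const hxt] with y hy
        rw [S_eq k0, GG, if_pos (by rwa [abs_of_nonneg (norm_nonneg y)])])
      rw [gradient, LinearIsometryEquiv.norm_map, h2.fderiv, norm_smul, innerSL_apply_norm, Real.norm_eq_abs, abs_div, abs_of_pos hn, div_mul_cancel₀ _ hn.ne']
    simp only [e1, e2, sq_abs]
    exact hle.trans_eq (by ring)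
end
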